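/- For every prime p, every positive integer e, and q = p^e, the p-adic valuation of the nonzero rational number h(GL_5(F_q)) equals e·(q − 1)(10q⁴ + 7q³ − 2q² − 15q − 10), where F_q denotes the finite field with q elements. -/

import Mathlib

/-- The set of pairs (χ, d) where χ is the character of an irreducible (simple) complex
representation of `G` and `d` is its degree. Distinct irreducible characters correspond to
distinct isomorphism classes, so this set is in bijection with `Irr(G)`. -/
noncomputable def irrCharDegSet (G : Type) [Group G] : Set ((G → ℂ) × ℕ) :=
  {p | ∃ V : FDRep ℂ G, CategoryTheory.Simple V ∧ p.1 = V.character ∧ p.2 = Module.finrank ℂ V}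

/-- `h(G)`: the product of the sizes of all conjugacy classes of `G` divided by the
product of the degrees of all irreducible complex characters of `G`. -/
noncomputable def groupH (G : Type) [Group G] : ℚ :=
  (∏ᶠ c : ConjClasses G, (c.carrier.ncard : ℚ)) / (∏ᶠ p ∈ irrCharDegSet G, (p.2 : ℚ))

section IsoClasses

open Module

variable {k : Type} [Field k]

/-- Pairs `(k^n, x)` up to linear isomorphism. -/
def endSetoid (k : Type) [Field k] : Setoid (Σ n : ℕ, End k (Fin n → k)) where
  r a b := ∃ e : (Fin a.1 → k) ≃ₗ[k] (Fin b.1 → k), ∀ v, e (a.2 v) = b.2 (e v)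
  iseqv := by
    refine ⟨fun a => ⟨LinearEquiv.refl k _, fun v => rfl⟩, ?_, ?_⟩
    · rintro a b ⟨e, he⟩
      exact ⟨e.symm, fun v => by rw [e.symm_apply_eq, he, e.apply_symm_apply]⟩
    · rintro a b c ⟨e, he⟩ ⟨f, hf⟩
      exact ⟨e.trans f, fun v => by simp [he, hf]⟩

/-- Isomorphism classes of finite-dimensional spaces with an endomorphism. -/
def EndClass (k : Type) [Field k] : Type := Quotient (endSetoid k)

variable {V W Q U : Type} [AddCommGroup V] [Module k V] [AddCommGroup W] [Module k W]
  [AddCommGroup Q] [Module k Q] [AddCommGroup U] [Module k U]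

/-- The class of an endomorphism. -/
noncomputable def cls [Module.Finite k V] (x : End k V) : EndClass k :=
  Quotient.mk (endSetoid k) ⟨finrank k V, (finBasis k V).equivFun.conj x⟩

theorem cls_eq_iff [Module.Finite k V] [Module.Finite k W] {x : End k V} {y : End k W} :
    cls x = cls y ↔ ∃ e : V ≃ₗ[k] W, ∀ v, e (x v) = y (e v) := by
  constructor
  · intro h
    obtain ⟨e, he⟩ := Quotient.exact h
    refine ⟨((finBasis k V).equivFun.trans e).trans (finBasis k W).equivFun.symm, fun v => ?_⟩
    have h1 := he ((finBasis k V).equivFun v)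
    simp only [LinearEquiv.conj_apply_apply, LinearEquiv.symm_apply_apply] at h1
    simp only [LinearEquiv.trans_apply, h1, LinearEquiv.symm_apply_apply]
  · rintro ⟨e, he⟩
    refine Quotient.sound ⟨((finBasis k V).equivFun.symm.trans e).trans
      (finBasis k W).equivFun, fun v => ?_⟩
    simp [LinearEquiv.conj_apply_apply, he]

theorem cls_congr [Module.Finite k V] [Module.Finite k W] {x : End k V} {y : End k W}
    (e : V ≃ₗ[k] W) (h : ∀ v, e (x v) = y (e v)) : cls x = cls y :=
  cls_eq_iff.2 ⟨e, h⟩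

theorem cls_conj [Module.Finite k V] [Module.Finite k W] (x : End k V) (e : V ≃ₗ[k] W) :
    cls (e.conj x) = cls x :=
  (cls_congr e fun v => by simp [LinearEquiv.conj_apply_apply]).symm

namespace EndClass

/-- A representative of an isomorphism class. -/
noncomputable def rep (ν : EndClass k) : Σ n : ℕ, End k (Fin n → k) :=
  Quotient.out ν

theorem cls_rep (ν : EndClass k) : cls ν.rep.2 = ν := by
  conv_rhs => rw [← Quotient.out_eq ν]
  refine Quotient.sound ⟨(finBasis k (Fin ν.rep.1 → k)).equivFun.symm, fun v => ?_⟩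
  change (finBasis k (Fin ν.rep.1 → k)).equivFun.symm
    ((finBasis k (Fin ν.rep.1 → k)).equivFun (ν.rep.2 _)) = ν.rep.2 _
  rw [LinearEquiv.symm_apply_apply]
  rfl

theorem exists_rep [Module.Finite k V] (x : End k V) :
    ∃ e : V ≃ₗ[k] (Fin (cls x).rep.1 → k), ∀ v, e (x v) = (cls x).rep.2 (e v) :=
  cls_eq_iff.1 (cls_rep (cls x)).symm

/-- The dimension of the underlying space. -/
noncomputable def dim (ν : EndClass k) : ℕ := ν.rep.1

/-- The determinant of the endomorphism. -/
noncomputable def det (ν : EndClass k) : k := LinearMap.det ν.rep.2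

end EndClass

@[simp] theorem dim_cls [Module.Finite k V] (x : End k V) : (cls x).dim = finrank k V := by
  obtain ⟨e, -⟩ := EndClass.exists_rep x
  rw [e.finrank_eq, finrank_fin_fun]
  rfl

@[simp] theorem det_cls [Module.Finite k V] (x : End k V) :
    (cls x).det = LinearMap.det x := by
  obtain ⟨e, he⟩ := EndClass.exists_rep x
  have : (cls x).rep.2 = e.conj x := by
    refine LinearMap.ext fun v => ?_
    rw [LinearEquiv.conj_apply_apply, he, e.apply_symm_apply]
  rw [EndClass.det, this]
  exact LinearMap.det_conj x e

/-- The block upper triangular endomorphism. -/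
def blk (a : End k W) (c : Q →ₗ[k] W) (y : End k Q) : End k (W × Q) :=
  (a ∘ₗ LinearMap.fst k W Q + c ∘ₗ LinearMap.snd k W Q).prod (y ∘ₗ LinearMap.snd k W Q)

@[simp] theorem blk_apply (a : End k W) (c : Q →ₗ[k] W) (y : End k Q) (v : W × Q) :
    blk a c y v = (a v.1 + c v.2, y v.2) := rfl

open Classical in
/-- Class of the restriction to an invariant subspace. -/
noncomputable def subCls [Module.Finite k V] (x : End k V) (S : Submodule k V) : EndClass k :=
  if h : S ≤ S.comap x then cls (x.restrict h) else cls (0 : End k (Fin 0 → k))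

open Classical in
/-- Class of the endomorphism induced on the quotient by an invariant subspace. -/
noncomputable def quoCls [Module.Finite k V] (x : End k V) (S : Submodule k V) : EndClass k :=
  if h : S ≤ S.comap x then cls (S.mapQ S x h) else cls (0 : End k (Fin 0 → k))

theorem subCls_eq [Module.Finite k V] [Module.Finite k W] {x : End k V} {S : Submodule k V}
    (y : End k W) (i : W →ₗ[k] V) (hi : Function.Injective i) (hr : LinearMap.range i = S)
    (h : ∀ w, i (y w) = x (i w)) : subCls x S = cls y := by
  have hS : S ≤ S.comap x := by
    rw [← hr]
    rintro _ ⟨w, rfl⟩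
    exact ⟨y w, h w⟩
  rw [subCls, dif_pos hS]
  refine (cls_congr ((LinearEquiv.ofInjective i hi).trans (LinearEquiv.ofEq _ _ hr)) ?_).symm
  intro w
  apply Subtype.ext
  simp [h]

theorem quoCls_eq [Module.Finite k V] [Module.Finite k W] {x : End k V} {S : Submodule k V}
    (y : End k W) (p : V →ₗ[k] W) (hp : Function.Surjective p) (hr : LinearMap.ker p = S)
    (h : ∀ v, p (x v) = y (p v)) : quoCls x S = cls y := by
  have hS : S ≤ S.comap x := by
    rw [← hr]
    intro v hv
    simp only [Submodule.mem_comap, LinearMap.mem_ker] at hv ⊢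
    rw [h, hv, map_zero]
  rw [quoCls, dif_pos hS]
  refine cls_congr ((Submodule.quotEquivOfEq _ _ hr.symm).trans (p.quotKerEquivOfSurjective hp)) ?_
  intro w
  obtain ⟨v, rfl⟩ := Submodule.Quotient.mk_surjective _ w
  simp [h]

theorem le_comap_map_iff {x : End k V} {y : End k W} (e : V ≃ₗ[k] W)
    (h : ∀ v, e (x v) = y (e v)) (S : Submodule k V) :
    S.map (e : V →ₗ[k] W) ≤ (S.map (e : V →ₗ[k] W)).comap y ↔ S ≤ S.comap x := by
  rw [Submodule.map_le_iff_le_comap]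
  refine forall_congr' fun v => forall_congr' fun _ => ?_
  simp only [Submodule.mem_comap, LinearEquiv.coe_coe, ← h]
  constructor
  · rintro ⟨w, hw, h2⟩
    rwa [← e.injective h2]
  · intro h2
    exact ⟨_, h2, rfl⟩

theorem subCls_map [Module.Finite k V] [Module.Finite k W] {x : End k V} {y : End k W}
    (e : V ≃ₗ[k] W) (h : ∀ v, e (x v) = y (e v)) (S : Submodule k V) :
    subCls y (S.map (e : V →ₗ[k] W)) = subCls x S := by
  by_cases hS : S ≤ S.comap x
  · rw [subCls_eq (x := y) (x.restrict hS) (e.toLinearMap ∘ₗ S.subtype)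
      (e.injective.comp S.injective_subtype) (by rw [LinearMap.range_comp, S.range_subtype])
      (fun w => by simp [h]), subCls, dif_pos hS]
  · rw [subCls, subCls, dif_neg hS, dif_neg (by rwa [le_comap_map_iff e h])]

theorem quoCls_map [Module.Finite k V] [Module.Finite k W] {x : End k V} {y : End k W}
    (e : V ≃ₗ[k] W) (h : ∀ v, e (x v) = y (e v)) (S : Submodule k V) :
    quoCls y (S.map (e : V →ₗ[k] W)) = quoCls x S := by
  by_cases hS : S ≤ S.comap x
  · rw [quoCls_eq (x := y) (S.mapQ S x hS) (S.mkQ ∘ₗ e.symm.toLinearMap)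
      (S.mkQ_surjective.comp e.symm.surjective)
      (by rw [LinearMap.ker_comp, S.ker_mkQ]; exact (Submodule.map_equiv_eq_comap_symm e S).symm)
      (fun w => by
        have : e.symm (y w) = x (e.symm w) := by
          rw [e.symm_apply_eq, h, e.apply_symm_apply]
        simp [this]), quoCls, dif_pos hS]
  · rw [quoCls, quoCls, dif_neg hS, dif_neg (by rwa [le_comap_map_iff e h])]

theorem subCls_bot [Module.Finite k V] (x : End k V) :
    subCls x ⊥ = cls (0 : End k (Fin 0 → k)) :=
  subCls_eq _ 0 (fun _ _ _ => Subsingleton.elim _ _) LinearMap.range_zero (by simp)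

theorem quoCls_bot [Module.Finite k V] (x : End k V) : quoCls x ⊥ = cls x :=
  quoCls_eq _ LinearMap.id Function.surjective_id LinearMap.ker_id (by simp)

theorem subCls_blk [Module.Finite k W] [Module.Finite k Q] (a : End k W) (c : Q →ₗ[k] W)
    (y : End k Q) : subCls (blk a c y) (LinearMap.range (LinearMap.inl k W Q)) = cls a :=
  subCls_eq _ (LinearMap.inl k W Q) LinearMap.inl_injective rfl (by simp)

theorem quoCls_blk [Module.Finite k W] [Module.Finite k Q] (a : End k W) (c : Q →ₗ[k] W)
    (y : End k Q) : quoCls (blk a c y) (LinearMap.range (LinearMap.inl k W Q)) = cls y :=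
  quoCls_eq _ (LinearMap.snd k W Q) LinearMap.snd_surjective (LinearMap.ker_snd ..) (by simp)

theorem det_blk [Module.Finite k W] [Module.Finite k Q] (a : End k W) (c : Q →ₗ[k] W)
    (y : End k Q) : LinearMap.det (blk a c y) = LinearMap.det a * LinearMap.det y := by
  set S := LinearMap.range (LinearMap.inl k W Q)
  have hS : S ≤ S.comap (blk a c y) := by
    rintro _ ⟨w, rfl⟩
    exact ⟨a w, by simp⟩
  rw [LinearMap.det_eq_det_mul_det S _ hS]
  have h1 := congrArg EndClass.det (subCls_blk a c y)
  have h2 := congrArg EndClass.det (quoCls_blk a c y)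
  rw [subCls, dif_pos hS, det_cls, det_cls] at h1
  rw [quoCls, dif_pos hS, det_cls, det_cls] at h2
  rw [h1, h2]

theorem cls_blk_congr {W' Q' : Type} [AddCommGroup W'] [Module k W'] [AddCommGroup Q']
    [Module k Q'] [Module.Finite k W] [Module.Finite k Q] [Module.Finite k W']
    [Module.Finite k Q'] (a : End k W) (c : Q →ₗ[k] W) (y : End k Q) (e : W ≃ₗ[k] W')
    (f : Q ≃ₗ[k] Q') :
    cls (blk (e.conj a) (f.arrowCongr e c) (f.conj y)) = cls (blk a c y) :=
  (cls_congr (e.prodCongr f) fun v => by simp [LinearEquiv.conj_apply_apply,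
    LinearEquiv.arrowCongr_apply]).symm

theorem cls_blk_of_subsingleton_left [Module.Finite k W] [Module.Finite k Q] [Subsingleton W]
    (a : End k W) (c : Q →ₗ[k] W) (y : End k Q) : cls (blk a c y) = cls y :=
  cls_congr (LinearEquiv.ofBijective (LinearMap.snd k W Q)
    ⟨fun _ _ h => Prod.ext (Subsingleton.elim _ _) h, LinearMap.snd_surjective⟩) (fun _ => rfl)

theorem cls_blk_of_subsingleton_right [Module.Finite k W] [Module.Finite k Q] [Subsingleton Q]
    (a : End k W) (c : Q →ₗ[k] W) (y : End k Q) : cls (blk a c y) = cls a :=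
  (cls_congr (y := blk a c y) (LinearEquiv.ofBijective (LinearMap.inl k W Q)
    ⟨LinearMap.inl_injective, fun v => ⟨v.1, Prod.ext rfl (Subsingleton.elim _ _)⟩⟩)
    (fun w => Prod.ext (show a w = a w + c 0 by simp) (Subsingleton.elim _ _))).symm

end IsoClasses

section PairSums

open Module

variable {k : Type} [Field k]
variable {V W Q U : Type} [AddCommGroup V] [Module k V] [AddCommGroup W] [Module k W]
  [AddCommGroup Q] [Module k Q] [AddCommGroup U] [Module k U]

instance finite_linearMap [Finite V] [Finite W] : Finite (V →ₗ[k] W) :=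
  DFunLike.finite _

instance finite_linearEquiv [Finite V] [Finite W] : Finite (V ≃ₗ[k] W) :=
  DFunLike.finite _

instance finite_submoduleQuotient [Finite V] (S : Submodule k V) : Finite (V ⧸ S) :=
  Finite.of_surjective _ S.mkQ_surjective

noncomputable instance fintypeLinearMap [Finite V] [Finite W] : Fintype (V →ₗ[k] W) :=
  Fintype.ofFinite _

noncomputable instance fintypeLinearEquiv [Finite V] [Finite W] : Fintype (V ≃ₗ[k] W) :=
  Fintype.ofFinite _

noncomputable instance fintypeSubmodule [Finite V] : Fintype (Submodule k V) :=
  Fintype.ofFinite _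

variable {I A B R : Type} [AddCommGroup I] [Module k I] [AddCommGroup A] [Module k A]
  [AddCommGroup B] [Module k B] [AddCommGroup R] [Module k R]

/-- The subspace `I × A` of `I × A × B × R`. -/
def stdLeft (k I A B R : Type) [Field k] [AddCommGroup I] [Module k I] [AddCommGroup A]
    [Module k A] [AddCommGroup B] [Module k B] [AddCommGroup R] [Module k R] :
    Submodule k (I × A × B × R) :=
  (⊤ : Submodule k I).prod ((⊤ : Submodule k A).prod ⊥)

/-- The subspace `I × B` of `I × A × B × R`. -/
def stdRight (k I A B R : Type) [Field k] [AddCommGroup I] [Module k I] [AddCommGroup A]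
    [Module k A] [AddCommGroup B] [Module k B] [AddCommGroup R] [Module k R] :
    Submodule k (I × A × B × R) :=
  (⊤ : Submodule k I).prod ((⊥ : Submodule k A).prod ((⊤ : Submodule k B).prod ⊥))

theorem mem_stdLeft {v : I × A × B × R} : v ∈ stdLeft k I A B R ↔ v.2.2 = 0 := by
  simp [stdLeft, Submodule.mem_prod]

theorem mem_stdRight {v : I × A × B × R} :
    v ∈ stdRight k I A B R ↔ v.2.1 = 0 ∧ v.2.2.2 = 0 := by
  simp [stdRight, Submodule.mem_prod]

theorem exists_compl_le [Module.Finite k V] {S T : Submodule k V} (h : S ≤ T) :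
    ∃ C : Submodule k V, S ⊔ C = T ∧ finrank k S + finrank k C = finrank k T := by
  obtain ⟨D, hD⟩ := exists_isCompl S
  have h1 : S ⊔ D ⊓ T = T := by
    rw [← sup_inf_assoc_of_le D h, hD.sup_eq_top, top_inf_eq]
  refine ⟨D ⊓ T, h1, ?_⟩
  have h2 := Submodule.finrank_sup_add_finrank_inf_eq S (D ⊓ T)
  rw [h1, ← inf_assoc, hD.inf_eq_bot, bot_inf_eq, finrank_bot] at h2
  omega

/-- A pair of subspaces is determined by dimensions up to linear isomorphism. -/
theorem exists_adapted_equiv [Module.Finite k V] [Module.Finite k I] [Module.Finite k A]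
    [Module.Finite k B] [Module.Finite k R] {S T : Submodule k V}
    (hV : finrank k V = finrank k I + finrank k A + finrank k B + finrank k R)
    (hS : finrank k S = finrank k I + finrank k A) (hT : finrank k T = finrank k I + finrank k B)
    (hST : finrank k (S ⊓ T : Submodule k V) = finrank k I) :
    ∃ e : (I × A × B × R) ≃ₗ[k] V, (stdLeft k I A B R).map (e : _ →ₗ[k] V) = S ∧
      (stdRight k I A B R).map (e : _ →ₗ[k] V) = T := by
  obtain ⟨A', hA1, hA2⟩ := exists_compl_le (inf_le_left : S ⊓ T ≤ S)
  obtain ⟨B', hB1, hB2⟩ := exists_compl_le (inf_le_right : S ⊓ T ≤ T)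
  obtain ⟨R', hR1, hR2⟩ := exists_compl_le (le_top : S ⊔ T ≤ ⊤)
  have h1 := Submodule.finrank_sup_add_finrank_inf_eq S T
  rw [finrank_top] at hR2
  have eI : I ≃ₗ[k] (S ⊓ T : Submodule k V) := LinearEquiv.ofFinrankEq _ _ (by omega)
  have eA : A ≃ₗ[k] A' := LinearEquiv.ofFinrankEq _ _ (by omega)
  have eB : B ≃ₗ[k] B' := LinearEquiv.ofFinrankEq _ _ (by omega)
  have eR : R ≃ₗ[k] R' := LinearEquiv.ofFinrankEq _ _ (by omega)
  let f : (I × A × B × R) →ₗ[k] V := ((S ⊓ T).subtype ∘ₗ eI.toLinearMap).coprod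
    ((A'.subtype ∘ₗ eA.toLinearMap).coprod
      ((B'.subtype ∘ₗ eB.toLinearMap).coprod (R'.subtype ∘ₗ eR.toLinearMap)))
  have hf : ∀ v : I × A × B × R, f v = eI v.1 + (eA v.2.1 + (eB v.2.2.1 + eR v.2.2.2)) :=
    fun v => rfl
  have key1 : ∀ s ∈ S, ∃ i a, f (i, a, 0, 0) = s := by
    intro s hs
    rw [← hA1] at hs
    obtain ⟨u, hu, w, hw, rfl⟩ := Submodule.mem_sup.1 hs
    exact ⟨eI.symm ⟨u, hu⟩, eA.symm ⟨w, hw⟩, by simp [hf]⟩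
  have key2 : ∀ s ∈ T, ∃ i b, f (i, 0, b, 0) = s := by
    intro s hs
    rw [← hB1] at hs
    obtain ⟨u, hu, w, hw, rfl⟩ := Submodule.mem_sup.1 hs
    exact ⟨eI.symm ⟨u, hu⟩, eB.symm ⟨w, hw⟩, by simp [hf]⟩
  have hsurj : Function.Surjective f := by
    intro v
    have hv : v ∈ (S ⊔ T) ⊔ R' := hR1 ▸ Submodule.mem_top
    obtain ⟨u, hu, r, hr, rfl⟩ := Submodule.mem_sup.1 hv
    obtain ⟨s, hs, t, ht, rfl⟩ := Submodule.mem_sup.1 hu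
    obtain ⟨i, a, rfl⟩ := key1 s hs
    obtain ⟨i', b, rfl⟩ := key2 t ht
    refine ⟨(i, a, 0, 0) + (i', 0, b, 0) + (0, 0, 0, eR.symm ⟨r, hr⟩), ?_⟩
    rw [map_add, map_add]
    simp [hf]
  have hinj : Function.Injective f :=
    (LinearMap.injective_iff_surjective_of_finrank_eq_finrank
      (by simp only [finrank_prod]; omega)).2 hsurj
  refine ⟨LinearEquiv.ofBijective f ⟨hinj, hsurj⟩, le_antisymm ?_ ?_, le_antisymm ?_ ?_⟩
  · rintro _ ⟨⟨i, a, b, r⟩, hv, rfl⟩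
    have hv' : (b, r) = 0 := mem_stdLeft.1 hv
    rw [Prod.mk_eq_zero] at hv'
    obtain ⟨rfl, rfl⟩ := hv'
    change f (i, a, 0, 0) ∈ S
    simp only [hf, map_zero, ZeroMemClass.coe_zero, add_zero]
    refine S.add_mem (eI i).2.1 ?_
    rw [← hA1]
    exact Submodule.mem_sup_right (eA a).2
  · intro s hs
    obtain ⟨i, a, rfl⟩ := key1 s hs
    exact ⟨_, mem_stdLeft.2 rfl, rfl⟩
  · rintro _ ⟨⟨i, a, b, r⟩, hv, rfl⟩
    obtain ⟨h1, h2⟩ := mem_stdRight.1 hv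
    simp only at h1 h2
    subst h1 h2
    change f (i, 0, b, 0) ∈ T
    simp only [hf, map_zero, ZeroMemClass.coe_zero, add_zero, zero_add]
    refine T.add_mem (eI i).2.2 ?_
    rw [← hB1]
    exact Submodule.mem_sup_right (eB b).2
  · intro s hs
    obtain ⟨i, b, rfl⟩ := key2 s hs
    exact ⟨_, mem_stdRight.2 ⟨rfl, rfl⟩, rfl⟩

theorem finrank_stdLeft [Module.Finite k I] [Module.Finite k A]
    [Module.Finite k B] [Module.Finite k R] :
    finrank k (stdLeft k I A B R) = finrank k I + finrank k A := by
  have : stdLeft k I A B R = LinearMap.range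
      (LinearMap.prodMap LinearMap.id (LinearMap.inl k A (B × R)) : I × A →ₗ[k] I × A × B × R) := by
    ext ⟨i, a, b, r⟩
    rw [mem_stdLeft]
    simp [eq_comm]
  rw [this, LinearMap.finrank_range_of_inj, finrank_prod]
  rintro ⟨i, a⟩ ⟨i', a'⟩ h
  simpa using h

theorem finrank_stdRight [Module.Finite k I] [Module.Finite k A]
    [Module.Finite k B] [Module.Finite k R] :
    finrank k (stdRight k I A B R) = finrank k I + finrank k B := by
  have : stdRight k I A B R = LinearMap.range
      (LinearMap.prodMap LinearMap.id (LinearMap.inr k A (B × R) ∘ₗ LinearMap.inl k B R) :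
        I × B →ₗ[k] I × A × B × R) := by
    ext ⟨i, a, b, r⟩
    rw [mem_stdRight]
    simp [eq_comm]
  rw [this, LinearMap.finrank_range_of_inj, finrank_prod]
  rintro ⟨i, a⟩ ⟨i', a'⟩ h
  simpa using h

theorem finrank_stdLeft_inf_stdRight [Module.Finite k I] [Module.Finite k A]
    [Module.Finite k B] [Module.Finite k R] :
    finrank k (stdLeft k I A B R ⊓ stdRight k I A B R : Submodule k (I × A × B × R)) =
      finrank k I := by
  have : stdLeft k I A B R ⊓ stdRight k I A B R = LinearMap.range
      (LinearMap.inl k I (A × B × R)) := by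
    ext ⟨i, a, b, r⟩
    rw [Submodule.mem_inf, mem_stdLeft, mem_stdRight]
    simp only [Prod.mk_eq_zero, LinearMap.mem_range, LinearMap.inl_apply, Prod.mk.injEq,
      exists_eq_left, eq_comm (a := (0 : A × B × R))]
    tauto
  rw [this, LinearMap.finrank_range_of_inj LinearMap.inl_injective]

/-- Both standard subspaces are invariant. -/
def StdInv (x : End k (I × A × B × R)) : Prop :=
  stdLeft k I A B R ≤ (stdLeft k I A B R).comap x ∧
    stdRight k I A B R ≤ (stdRight k I A B R).comap x

/-- The endomorphism with given blocks preserving both standard subspaces. -/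
def stdBlk (p : (End k I × End k A × End k B × End k R) ×
    ((A × B × R →ₗ[k] I) × (R →ₗ[k] A) × (R →ₗ[k] B))) : End k (I × A × B × R) :=
  blk p.1.1 p.2.1 (blk p.1.2.1 (p.2.2.1 ∘ₗ LinearMap.snd k B R)
    (blk p.1.2.2.1 p.2.2.2 p.1.2.2.2))

theorem stdBlk_apply (p : (End k I × End k A × End k B × End k R) ×
    ((A × B × R →ₗ[k] I) × (R →ₗ[k] A) × (R →ₗ[k] B))) (v : I × A × B × R) :
    stdBlk p v = (p.1.1 v.1 + p.2.1 v.2, p.1.2.1 v.2.1 + p.2.2.1 v.2.2.2,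
      p.1.2.2.1 v.2.2.1 + p.2.2.2 v.2.2.2, p.1.2.2.2 v.2.2.2) := rfl

theorem stdInv_stdBlk (p : (End k I × End k A × End k B × End k R) ×
    ((A × B × R →ₗ[k] I) × (R →ₗ[k] A) × (R →ₗ[k] B))) : StdInv (stdBlk p) := by
  constructor
  · intro v hv
    rw [mem_stdLeft] at hv
    rw [Submodule.mem_comap, mem_stdLeft, stdBlk_apply]
    simp [hv]
  · intro v hv
    rw [mem_stdRight] at hv
    rw [Submodule.mem_comap, mem_stdRight, stdBlk_apply]
    simp [hv.1, hv.2]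

theorem stdBlk_injective : Function.Injective (stdBlk (k := k) (I := I) (A := A) (B := B)
    (R := R)) := by
  rintro ⟨⟨xI, xA, xB, xR⟩, cI, cA, cB⟩ ⟨⟨yI, yA, yB, yR⟩, dI, dA, dB⟩ h
  have h' := fun v => LinearMap.congr_fun h v
  simp only [stdBlk_apply, Prod.mk.injEq] at h'
  have e1 : xI = yI := LinearMap.ext fun v => by simpa using (h' (v, 0)).1
  have e2 : cI = dI := LinearMap.ext fun v => by simpa using (h' (0, v)).1
  have e3 : xA = yA := LinearMap.ext fun v => by simpa using (h' (0, v, 0)).2.1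
  have e4 : cA = dA := LinearMap.ext fun v => by simpa using (h' (0, 0, 0, v)).2.1
  have e5 : xB = yB := LinearMap.ext fun v => by simpa using (h' (0, 0, v, 0)).2.2.1
  have e6 : cB = dB := LinearMap.ext fun v => by simpa using (h' (0, 0, 0, v)).2.2.1
  have e7 : xR = yR := LinearMap.ext fun v => by simpa using (h' (0, 0, 0, v)).2.2.2
  rw [e1, e2, e3, e4, e5, e6, e7]

theorem exists_stdBlk {x : End k (I × A × B × R)} (hx : StdInv x) : ∃ p, stdBlk p = x := by
  obtain ⟨h1, h2⟩ := hx
  let iA : A →ₗ[k] I × A × B × R := LinearMap.inr _ _ _ ∘ₗ LinearMap.inl _ _ _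
  let iB : B →ₗ[k] I × A × B × R := LinearMap.inr _ _ _ ∘ₗ LinearMap.inr _ _ _ ∘ₗ
    LinearMap.inl _ _ _
  let iR : R →ₗ[k] I × A × B × R := LinearMap.inr _ _ _ ∘ₗ LinearMap.inr _ _ _ ∘ₗ
    LinearMap.inr _ _ _
  let pA : I × A × B × R →ₗ[k] A := LinearMap.fst _ _ _ ∘ₗ LinearMap.snd _ _ _
  let pB : I × A × B × R →ₗ[k] B := LinearMap.fst _ _ _ ∘ₗ LinearMap.snd _ _ _ ∘ₗ
    LinearMap.snd _ _ _
  let pR : I × A × B × R →ₗ[k] R := LinearMap.snd _ _ _ ∘ₗ LinearMap.snd _ _ _ ∘ₗ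
    LinearMap.snd _ _ _
  refine ⟨⟨⟨LinearMap.fst _ _ _ ∘ₗ x ∘ₗ LinearMap.inl _ _ _, pA ∘ₗ x ∘ₗ iA,
    pB ∘ₗ x ∘ₗ iB, pR ∘ₗ x ∘ₗ iR⟩, LinearMap.fst _ _ _ ∘ₗ x ∘ₗ LinearMap.inr _ _ _,
    pA ∘ₗ x ∘ₗ iR, pB ∘ₗ x ∘ₗ iR⟩, ?_⟩
  refine LinearMap.ext fun v => ?_
  obtain ⟨i, a, b, r⟩ := v
  have hi1 := mem_stdLeft.1 (h1 (mem_stdLeft.2 (rfl : ((i, 0, 0, 0) : I × A × B × R).2.2 = 0)))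
  have hi2 := mem_stdRight.1 (h2 (mem_stdRight.2
    (⟨rfl, rfl⟩ : ((i, 0, 0, 0) : I × A × B × R).2.1 = 0 ∧ _)))
  have ha := mem_stdLeft.1 (h1 (mem_stdLeft.2 (rfl : ((0, a, 0, 0) : I × A × B × R).2.2 = 0)))
  have hb := mem_stdRight.1 (h2 (mem_stdRight.2
    (⟨rfl, rfl⟩ : ((0, 0, b, 0) : I × A × B × R).2.1 = 0 ∧ _)))
  have hv : ((i, a, b, r) : I × A × B × R) = (i, 0, 0, 0) + (0, a, 0, 0) + (0, 0, b, 0) +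
    (0, 0, 0, r) := by simp
  have hv2 : ((a, b, r) : A × B × R) = (a, 0, 0) + (0, b, 0) + (0, 0, r) := by simp
  rw [Prod.ext_iff] at hi1 ha
  rw [stdBlk_apply]
  simp only [LinearMap.comp_apply, LinearMap.fst_apply, LinearMap.snd_apply, LinearMap.inl_apply,
    LinearMap.inr_apply, pA, pB, pR, iA, iB, iR]
  rw [hv]
  simp only [map_add]
  simp only [Prod.fst_zero, Prod.snd_zero] at hi1 ha
  have e1 : x (0, a, b, r) = x (0, a, 0, 0) + x (0, 0, b, 0) + x (0, 0, 0, r) := by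
    rw [← map_add, ← map_add]; simp
  refine Prod.ext ?_ (Prod.ext ?_ (Prod.ext ?_ ?_))
  · simp only [e1, Prod.fst_add, add_assoc]
    rfl
  · simp only [Prod.snd_add, Prod.fst_add, hi2.1, hb.1, zero_add, add_zero]
    rfl
  · simp [hi1.1, ha.1]
  · simp [hi1.2, ha.2, hb.2]

theorem blk_bijective_iff [Finite W] [Finite Q] (a : End k W) (c : Q →ₗ[k] W) (y : End k Q) :
    Function.Bijective (blk a c y) ↔ Function.Bijective a ∧ Function.Bijective y := by
  have key : ∀ {X : Type} [AddCommGroup X] [Module k X] [Finite X] (x : End k X),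
      Function.Bijective x ↔ LinearMap.det x ≠ 0 := by
    intro X _ _ _ x
    have := Fintype.ofFinite X
    rw [← isUnit_iff_ne_zero, ← LinearMap.isUnit_iff_isUnit_det, Module.End.isUnit_iff]
  rw [key, key, key, det_blk, mul_ne_zero_iff]

end PairSums

section PairSums2

open Module

variable {k : Type} [Field k]
variable {V : Type} [AddCommGroup V] [Module k V] [Finite V]
variable {I A B R : Type} [AddCommGroup I] [Module k I] [AddCommGroup A] [Module k A]
  [AddCommGroup B] [Module k B] [AddCommGroup R] [Module k R] [Finite I] [Finite A] [Finite B]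
  [Finite R]

/-- The stabiliser of the pair of standard subspaces. -/
def StdStab (k I A B R : Type) [Field k] [AddCommGroup I] [Module k I] [AddCommGroup A]
    [Module k A] [AddCommGroup B] [Module k B] [AddCommGroup R] [Module k R] : Type :=
  {g : (I × A × B × R) ≃ₗ[k] (I × A × B × R) //
    (stdLeft k I A B R).map (g : _ →ₗ[k] (I × A × B × R)) = stdLeft k I A B R ∧
    (stdRight k I A B R).map (g : _ →ₗ[k] (I × A × B × R)) = stdRight k I A B R}

theorem map_equiv_eq_of_le_comap {S : Submodule k V} (g : V ≃ₗ[k] V)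
    (h : S ≤ S.comap (g : V →ₗ[k] V)) : S.map (g : V →ₗ[k] V) = S :=
  Submodule.eq_of_le_of_finrank_eq (Submodule.map_le_iff_le_comap.2 h)
    (LinearEquiv.finrank_map_eq g S)

theorem card_stdStab :
    Nat.card (StdStab k I A B R) =
      Nat.card (I ≃ₗ[k] I) * (Nat.card (A ≃ₗ[k] A) * (Nat.card (B ≃ₗ[k] B) *
        Nat.card (R ≃ₗ[k] R))) * (Nat.card (A × B × R →ₗ[k] I) * (Nat.card (R →ₗ[k] A) *
          Nat.card (R →ₗ[k] B))) := by
  rw [← Nat.card_prod, ← Nat.card_prod, ← Nat.card_prod, ← Nat.card_prod, ← Nat.card_prod,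
    ← Nat.card_prod]
  symm
  let t : ((I ≃ₗ[k] I) × (A ≃ₗ[k] A) × (B ≃ₗ[k] B) × (R ≃ₗ[k] R)) ×
    ((A × B × R →ₗ[k] I) × (R →ₗ[k] A) × (R →ₗ[k] B)) →
    (End k I × End k A × End k B × End k R) ×
    ((A × B × R →ₗ[k] I) × (R →ₗ[k] A) × (R →ₗ[k] B)) :=
    fun p => ((p.1.1.toLinearMap, p.1.2.1.toLinearMap, p.1.2.2.1.toLinearMap,
      p.1.2.2.2.toLinearMap), p.2)
  have ht : ∀ p, Function.Bijective (stdBlk (t p)) := fun p =>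
    (blk_bijective_iff _ _ _).2 ⟨p.1.1.bijective, (blk_bijective_iff _ _ _).2
      ⟨p.1.2.1.bijective, (blk_bijective_iff _ _ _).2
      ⟨p.1.2.2.1.bijective, p.1.2.2.2.bijective⟩⟩⟩
  let φ : ((I ≃ₗ[k] I) × (A ≃ₗ[k] A) × (B ≃ₗ[k] B) × (R ≃ₗ[k] R)) ×
    ((A × B × R →ₗ[k] I) × (R →ₗ[k] A) × (R →ₗ[k] B)) → StdStab k I A B R := fun p =>
    ⟨LinearEquiv.ofBijective (stdBlk (t p)) (ht p),
      map_equiv_eq_of_le_comap _ (stdInv_stdBlk (t p)).1,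
      map_equiv_eq_of_le_comap _ (stdInv_stdBlk (t p)).2⟩
  refine Nat.card_eq_of_bijective φ ⟨?_, ?_⟩
  · intro p p' h
    have h1 : stdBlk (t p) = stdBlk (t p') := by
      have h2 := congrArg (fun g : StdStab k I A B R => g.1.toLinearMap) h
      exact h2
    have h3 := stdBlk_injective h1
    obtain ⟨⟨a, b, c, d⟩, e⟩ := p
    obtain ⟨⟨a', b', c', d'⟩, e'⟩ := p'
    simp only [t, Prod.mk.injEq, LinearEquiv.toLinearMap_inj] at h3
    obtain ⟨⟨rfl, rfl, rfl, rfl⟩, rfl⟩ := h3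
    rfl
  · rintro ⟨g, hg1, hg2⟩
    obtain ⟨p, hp⟩ := exists_stdBlk (x := g.toLinearMap)
      ⟨Submodule.map_le_iff_le_comap.1 hg1.le, Submodule.map_le_iff_le_comap.1 hg2.le⟩
    have hb : Function.Bijective (stdBlk p) := by
      rw [hp]
      exact g.bijective
    have h1 := (blk_bijective_iff _ _ _).1 hb
    have h2 := (blk_bijective_iff _ _ _).1 h1.2
    have h3 := (blk_bijective_iff _ _ _).1 h2.2
    refine ⟨⟨⟨LinearEquiv.ofBijective _ h1.1, LinearEquiv.ofBijective _ h2.1,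
      LinearEquiv.ofBijective _ h3.1, LinearEquiv.ofBijective _ h3.2⟩, p.2⟩, ?_⟩
    apply Subtype.ext
    apply LinearEquiv.toLinearMap_injective
    exact hp

/-- `S` and `T` have dimensions `dim I + dim A` and `dim I + dim B` and meet in dimension
`dim I`. -/
def PairDim (k I A B : Type) [Field k] [AddCommGroup I] [Module k I] [AddCommGroup A]
    [Module k A] [AddCommGroup B] [Module k B] {V : Type} [AddCommGroup V] [Module k V]
    (S T : Submodule k V) : Prop :=
  finrank k S = finrank k I + finrank k A ∧ finrank k T = finrank k I + finrank k B ∧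
    finrank k (S ⊓ T : Submodule k V) = finrank k I

open Classical in
theorem sum_equiv_eq_sum_pairs
    (hV : finrank k V = finrank k I + finrank k A + finrank k B + finrank k R)
    (F : Submodule k V → Submodule k V → ℂ) :
    ∑ e : (I × A × B × R) ≃ₗ[k] V, F ((stdLeft k I A B R).map (e : _ →ₗ[k] V))
        ((stdRight k I A B R).map (e : _ →ₗ[k] V)) =
      Nat.card (StdStab k I A B R) * ∑ S : Submodule k V, ∑ T : Submodule k V,
        if PairDim k I A B S T then F S T else 0 := by
  let φ : ((I × A × B × R) ≃ₗ[k] V) → Submodule k V × Submodule k V := fun e =>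
    ((stdLeft k I A B R).map (e : _ →ₗ[k] V), (stdRight k I A B R).map (e : _ →ₗ[k] V))
  have h1 : ∑ e : (I × A × B × R) ≃ₗ[k] V, F (φ e).1 (φ e).2 =
      ∑ st : Submodule k V × Submodule k V, ∑ e ∈ Finset.univ.filter fun e => φ e = st,
        F (φ e).1 (φ e).2 := (Finset.sum_fiberwise Finset.univ φ _).symm
  change ∑ e : (I × A × B × R) ≃ₗ[k] V, F (φ e).1 (φ e).2 = _
  rw [h1, Fintype.sum_prod_type, Finset.mul_sum]
  refine Finset.sum_congr rfl fun S _ => ?_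
  rw [Finset.mul_sum]
  refine Finset.sum_congr rfl fun T _ => ?_
  rw [Finset.sum_congr rfl (g := fun _ => F S T) (fun e he => by
    rw [(Finset.mem_filter.1 he).2]), Finset.sum_const, nsmul_eq_mul]
  have hmeet : ∀ e : (I × A × B × R) ≃ₗ[k] V,
      (stdLeft k I A B R).map (e : _ →ₗ[k] V) ⊓ (stdRight k I A B R).map (e : _ →ₗ[k] V) =
      (stdLeft k I A B R ⊓ stdRight k I A B R).map (e : _ →ₗ[k] V) := fun e =>
    (Submodule.map_inf _ e.injective).symm
  split_ifs with hP
  · obtain ⟨e0, h1, h2⟩ := exists_adapted_equiv (R := R) hV hP.1 hP.2.1 hP.2.2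
    congr 1
    rw [Nat.cast_inj, ← Fintype.card_subtype, ← Nat.card_eq_fintype_card]
    refine Nat.card_congr ⟨fun e => ⟨e.1.trans e0.symm, ?_⟩, fun g => ⟨g.1.trans e0, ?_⟩, ?_, ?_⟩
    · have he := e.2
      simp only [φ, Prod.mk.injEq] at he
      constructor
      · rw [LinearEquiv.coe_trans, Submodule.map_comp, he.1, ← h1, ← Submodule.map_comp,
          ← LinearEquiv.coe_trans]
        simp
      · rw [LinearEquiv.coe_trans, Submodule.map_comp, he.2, ← h2, ← Submodule.map_comp,
          ← LinearEquiv.coe_trans]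
        simp
    · simp only [φ, LinearEquiv.coe_trans, Submodule.map_comp, Prod.mk.injEq]
      rw [g.2.1, g.2.2]
      exact ⟨h1, h2⟩
    · intro e
      apply Subtype.ext
      ext v
      simp
    · intro g
      apply Subtype.ext
      refine LinearEquiv.ext fun v => ?_
      simp
  · rw [Finset.filter_eq_empty_iff.2]
    · simp
    · intro e _ he
      apply hP
      simp only [φ, Prod.mk.injEq] at he
      rw [← he.1, ← he.2]
      refine ⟨?_, ?_, ?_⟩
      · rw [LinearEquiv.finrank_map_eq, finrank_stdLeft]
      · rw [LinearEquiv.finrank_map_eq, finrank_stdRight]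
      · rw [hmeet, LinearEquiv.finrank_map_eq, finrank_stdLeft_inf_stdRight]

open Classical in
/-- Sum over all endomorphisms and all pairs of invariant subspaces in a given relative
position. -/
theorem sum_end_pairs
    (hV : finrank k V = finrank k I + finrank k A + finrank k B + finrank k R)
    (G : EndClass k → EndClass k → EndClass k → EndClass k → ℂ) :
    (Nat.card (StdStab k I A B R) : ℂ) * ∑ x : End k V, ∑ S : Submodule k V,
        ∑ T : Submodule k V, (if PairDim k I A B S T then
          (if S ≤ S.comap x ∧ T ≤ T.comap x then
            G (subCls x S) (quoCls x S) (subCls x T) (quoCls x T) else 0) else 0) =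
      Nat.card (V ≃ₗ[k] V) * ∑ p : (End k I × End k A × End k B × End k R) ×
          ((A × B × R →ₗ[k] I) × (R →ₗ[k] A) × (R →ₗ[k] B)),
        G (cls (blk p.1.1 (p.2.1 ∘ₗ LinearMap.inl k A (B × R)) p.1.2.1))
          (cls (blk p.1.2.2.1 p.2.2.2 p.1.2.2.2))
          (cls (blk p.1.1 (p.2.1 ∘ₗ LinearMap.inr k A (B × R) ∘ₗ LinearMap.inl k B R) p.1.2.2.1))
          (cls (blk p.1.2.1 p.2.2.1 p.1.2.2.2)) := by
  have hswap : ∑ x : End k V, ∑ S : Submodule k V,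
        ∑ T : Submodule k V, (if PairDim k I A B S T then
          (if S ≤ S.comap x ∧ T ≤ T.comap x then
            G (subCls x S) (quoCls x S) (subCls x T) (quoCls x T) else 0) else 0) =
      ∑ S : Submodule k V, ∑ T : Submodule k V, (if PairDim k I A B S T then
        ∑ x : End k V, (if S ≤ S.comap x ∧ T ≤ T.comap x then
            G (subCls x S) (quoCls x S) (subCls x T) (quoCls x T) else 0) else 0) := by
    rw [Finset.sum_comm]
    refine Finset.sum_congr rfl fun S _ => ?_
    rw [Finset.sum_comm]
    refine Finset.sum_congr rfl fun T _ => ?_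
    split_ifs
    · rfl
    · simp
  rw [hswap, ← sum_equiv_eq_sum_pairs (R := R) hV]
  have hconst : ∀ e : (I × A × B × R) ≃ₗ[k] V,
      (∑ x : End k V, (if (stdLeft k I A B R).map (e : _ →ₗ[k] V) ≤
          ((stdLeft k I A B R).map (e : _ →ₗ[k] V)).comap x ∧
          (stdRight k I A B R).map (e : _ →ₗ[k] V) ≤
          ((stdRight k I A B R).map (e : _ →ₗ[k] V)).comap x then
        G (subCls x ((stdLeft k I A B R).map (e : _ →ₗ[k] V)))
          (quoCls x ((stdLeft k I A B R).map (e : _ →ₗ[k] V)))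
          (subCls x ((stdRight k I A B R).map (e : _ →ₗ[k] V)))
          (quoCls x ((stdRight k I A B R).map (e : _ →ₗ[k] V))) else 0)) =
      ∑ x : End k (I × A × B × R), (if StdInv x then
        G (subCls x (stdLeft k I A B R)) (quoCls x (stdLeft k I A B R))
          (subCls x (stdRight k I A B R)) (quoCls x (stdRight k I A B R)) else 0) := by
    intro e
    symm
    refine Fintype.sum_equiv e.conj.toEquiv _ _ fun x => ?_
    have hx : ∀ v, e (x v) = (e.conj x) (e v) := fun v => by
      simp [LinearEquiv.conj_apply_apply]
    change _ = if _ ≤ Submodule.comap (e.conj x) _ ∧ _ ≤ Submodule.comap (e.conj x) _ then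
      G (subCls (e.conj x) _) (quoCls (e.conj x) _) (subCls (e.conj x) _)
        (quoCls (e.conj x) _) else 0
    refine if_congr ?_ ?_ rfl
    · rw [le_comap_map_iff e hx, le_comap_map_iff e hx]
      rfl
    · rw [subCls_map e hx, quoCls_map e hx, subCls_map e hx, quoCls_map e hx]
  rw [Finset.sum_congr rfl fun e _ => hconst e, Finset.sum_const, nsmul_eq_mul]
  have e0 : (I × A × B × R) ≃ₗ[k] V := LinearEquiv.ofFinrankEq _ _ (by
    simp only [finrank_prod, hV]; ring)
  have hcard : (Finset.univ : Finset ((I × A × B × R) ≃ₗ[k] V)).card = Nat.card (V ≃ₗ[k] V) := by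
    rw [Finset.card_univ, ← Nat.card_eq_fintype_card]
    exact Nat.card_congr ⟨fun e => e0.symm.trans e, fun e => e0.trans e,
      fun e => by ext v; simp, fun e => by ext v; simp⟩
  rw [hcard]
  congr 1
  rw [← Finset.sum_filter]
  symm
  refine Finset.sum_bij (fun p _ => stdBlk p) ?_ ?_ ?_ ?_
  · intro p _
    exact Finset.mem_filter.2 ⟨Finset.mem_univ _, stdInv_stdBlk p⟩
  · intro p _ p' _ h
    exact stdBlk_injective h
  · intro x hx
    obtain ⟨p, hp⟩ := exists_stdBlk (Finset.mem_filter.1 hx).2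
    exact ⟨p, Finset.mem_univ _, hp⟩
  · intro p _
    congr 1
    · symm
      refine subCls_eq _ (LinearMap.prodMap LinearMap.id (LinearMap.inl k A (B × R)))
        (fun u v h => by simpa [Prod.ext_iff] using h) ?_ ?_
      · ext ⟨i, a, b, r⟩
        rw [mem_stdLeft]
        simp [eq_comm]
      · intro w
        rw [stdBlk_apply]
        simp
        rfl
    · symm
      refine quoCls_eq _ (LinearMap.snd k A (B × R) ∘ₗ LinearMap.snd k I (A × B × R))
        (fun r => ⟨(0, 0, r), rfl⟩) ?_ ?_
      · ext ⟨i, a, b, r⟩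
        rw [mem_stdLeft]
        simp
      · intro w
        rw [LinearMap.comp_apply, stdBlk_apply]
        simp
    · symm
      refine subCls_eq _ (LinearMap.prodMap LinearMap.id
        (LinearMap.inr k A (B × R) ∘ₗ LinearMap.inl k B R))
        (fun u v h => by simpa [Prod.ext_iff] using h) ?_ ?_
      · ext ⟨i, a, b, r⟩
        rw [mem_stdRight]
        simp [eq_comm]
      · intro w
        rw [stdBlk_apply]
        simp
    · symm
      refine quoCls_eq _ (LinearMap.prodMap LinearMap.id (LinearMap.snd k B R) ∘ₗ
        LinearMap.snd k I (A × B × R))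
        (by rintro ⟨a, r⟩; exact ⟨(0, a, 0, r), rfl⟩) ?_ ?_
      · ext ⟨i, a, b, r⟩
        rw [mem_stdRight]
        simp
      · intro w
        rw [LinearMap.comp_apply, stdBlk_apply]
        simp

end PairSums2

section Operators

open Module
open scoped ComplexConjugate

variable {k : Type} [Field k] [Finite k]
variable {V W Q U : Type} [AddCommGroup V] [Module k V] [AddCommGroup W] [Module k W]
  [AddCommGroup Q] [Module k Q] [Finite V] [Finite W] [Finite Q]

/-- The order of `GL_n(k)`. -/
noncomputable def glCard (k : Type) [Field k] (n : ℕ) : ℕ :=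
  Nat.card ((Fin n → k) ≃ₗ[k] (Fin n → k))

theorem glCard_ne_zero (n : ℕ) : (glCard k n : ℂ) ≠ 0 := by
  rw [Nat.cast_ne_zero]
  have : Nonempty ((Fin n → k) ≃ₗ[k] (Fin n → k)) := ⟨LinearEquiv.refl _ _⟩
  exact Nat.card_pos.ne'

theorem card_linearEquiv {n : ℕ} (h : finrank k V = n) : Nat.card (V ≃ₗ[k] V) = glCard k n := by
  have e : V ≃ₗ[k] (Fin n → k) := LinearEquiv.ofFinrankEq _ _ (by rw [h, finrank_fin_fun])
  exact Nat.card_congr ⟨fun g => (e.symm.trans g).trans e, fun g => (e.trans g).trans e.symm,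
    fun g => by ext; simp, fun g => LinearEquiv.ext fun v => by simp⟩

theorem card_linearMap : Nat.card (V →ₗ[k] W) = Nat.card k ^ (finrank k V * finrank k W) := by
  rw [Module.natCard_eq_pow_finrank (K := k), finrank_linearMap]

theorem card_linearMap_ne_zero : (Nat.card (V →ₗ[k] W) : ℂ) ≠ 0 := by
  rw [Nat.cast_ne_zero]
  exact Nat.card_pos.ne'

theorem card_stdStab_ne_zero {I A B R : Type} [AddCommGroup I] [Module k I] [AddCommGroup A]
    [Module k A] [AddCommGroup B] [Module k B] [AddCommGroup R] [Module k R] [Finite I] [Finite A]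
    [Finite B] [Finite R] : (Nat.card (StdStab k I A B R) : ℂ) ≠ 0 := by
  rw [Nat.cast_ne_zero]
  have : Finite (StdStab k I A B R) := Subtype.finite
  have : Nonempty (StdStab k I A B R) := ⟨⟨LinearEquiv.refl _ _, by simp, by simp⟩⟩
  exact Nat.card_pos.ne'

theorem sum_end_eq (f : EndClass k → ℂ) (h : finrank k V = finrank k W) :
    ∑ x : End k V, f (cls x) = ∑ x : End k W, f (cls x) := by
  have e : V ≃ₗ[k] W := LinearEquiv.ofFinrankEq _ _ h
  exact Fintype.sum_equiv e.conj.toEquiv _ _ fun x => by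
    change _ = f (cls (e.conj x))
    rw [cls_conj]

/-- The standard hermitian form on class functions in dimension `n`. -/
noncomputable def ip (n : ℕ) (f g : EndClass k → ℂ) : ℂ :=
  (glCard k n : ℂ)⁻¹ * ∑ x : End k (Fin n → k), f (cls x) * conj (g (cls x))

/-- The average over the unipotent radical. -/
noncomputable def jac (h : EndClass k → ℂ) (α ν : EndClass k) : ℂ :=
  (Nat.card ((Fin ν.rep.1 → k) →ₗ[k] (Fin α.rep.1 → k)) : ℂ)⁻¹ *
    ∑ c : (Fin ν.rep.1 → k) →ₗ[k] (Fin α.rep.1 → k), h (cls (blk α.rep.2 c ν.rep.2))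

theorem jac_cls (h : EndClass k → ℂ) (a : End k W) (y : End k Q) :
    jac h (cls a) (cls y) =
      (Nat.card (Q →ₗ[k] W) : ℂ)⁻¹ * ∑ c : Q →ₗ[k] W, h (cls (blk a c y)) := by
  obtain ⟨e, he⟩ := EndClass.exists_rep a
  obtain ⟨f, hf⟩ := EndClass.exists_rep y
  have ha : (cls a).rep.2 = e.conj a := LinearMap.ext fun v => by
    rw [LinearEquiv.conj_apply_apply, he, e.apply_symm_apply]
  have hy : (cls y).rep.2 = f.conj y := LinearMap.ext fun v => by
    rw [LinearEquiv.conj_apply_apply, hf, f.apply_symm_apply]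
  rw [jac, ha, hy]
  congr 1
  · rw [Nat.card_congr (f.arrowCongr e).toEquiv]
  · symm
    refine Fintype.sum_equiv (f.arrowCongr e).toEquiv _ _ fun c => ?_
    change _ = h (cls (blk _ (f.arrowCongr e c) _))
    rw [cls_blk_congr]

theorem sum_blk_eq_jac (h : EndClass k → ℂ) (a : End k W) (y : End k Q) :
    ∑ c : Q →ₗ[k] W, h (cls (blk a c y)) =
      (Nat.card (Q →ₗ[k] W) : ℂ) * jac h (cls a) (cls y) := by
  rw [jac_cls, mul_inv_cancel_left₀ card_linearMap_ne_zero]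

open Classical in
/-- Hall product of a function of two classes, with `m`-dimensional subobject. -/
noncomputable def hmul (m : ℕ) (F : EndClass k → EndClass k → ℂ) (ν : EndClass k) : ℂ :=
  ∑ S : Submodule k (Fin ν.rep.1 → k),
    if S ≤ S.comap ν.rep.2 ∧ finrank k S = m then F (subCls ν.rep.2 S) (quoCls ν.rep.2 S) else 0

open Classical in
theorem hmul_cls (m : ℕ) (F : EndClass k → EndClass k → ℂ) (x : End k V) :
    hmul m F (cls x) = ∑ S : Submodule k V,
      if S ≤ S.comap x ∧ finrank k S = m then F (subCls x S) (quoCls x S) else 0 := by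
  obtain ⟨e, he⟩ := EndClass.exists_rep x
  rw [hmul]
  symm
  refine Fintype.sum_equiv (Submodule.orderIsoMapComap e).toEquiv _ _ fun S => ?_
  have hE : (Submodule.orderIsoMapComap e).toEquiv S =
      S.map (e : V →ₗ[k] (Fin (cls x).rep.1 → k)) := rfl
  rw [hE]
  refine if_congr ?_ ?_ rfl
  · rw [le_comap_map_iff e he, LinearEquiv.finrank_map_eq]
  · rw [subCls_map e he, quoCls_map e he]

theorem hmul_eq_zero_of_lt {m : ℕ} (F : EndClass k → EndClass k → ℂ) (x : End k V)
    (h : finrank k V < m) : hmul m F (cls x) = 0 := by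
  classical
  rw [hmul_cls]
  refine Finset.sum_eq_zero fun S _ => if_neg ?_
  rintro ⟨-, h2⟩
  have := S.finrank_le
  omega

theorem hmul_zero (h : EndClass k → ℂ) (ν : EndClass k) : hmul 0 (fun _ ν => h ν) ν = h ν := by
  classical
  rw [← ν.cls_rep, hmul_cls, Finset.sum_eq_single ⊥]
  · rw [if_pos ⟨bot_le, finrank_bot _ _⟩, quoCls_bot]
  · intro S _ hS
    rw [if_neg]
    rintro ⟨-, h2⟩
    exact hS (Submodule.finrank_eq_zero.1 h2)
  · simp

/-- Contribution of pairs of subspaces with given relative position. -/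
noncomputable def pairTerm (j a b r : ℕ) (F F' : EndClass k → EndClass k → ℂ) : ℂ :=
  (Nat.card (StdStab k (Fin j → k) (Fin a → k) (Fin b → k) (Fin r → k)) : ℂ)⁻¹ *
    ∑ p : (End k (Fin j → k) × End k (Fin a → k) × End k (Fin b → k) × End k (Fin r → k)) ×
      (((Fin a → k) × (Fin b → k) × (Fin r → k) →ₗ[k] (Fin j → k)) ×
        ((Fin r → k) →ₗ[k] (Fin a → k)) × ((Fin r → k) →ₗ[k] (Fin b → k))),
      F (cls (blk p.1.1 (p.2.1 ∘ₗ LinearMap.inl k _ _) p.1.2.1))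
        (cls (blk p.1.2.2.1 p.2.2.2 p.1.2.2.2)) *
      conj (F' (cls (blk p.1.1 (p.2.1 ∘ₗ LinearMap.inr k _ _ ∘ₗ LinearMap.inl k _ _) p.1.2.2.1))
        (cls (blk p.1.2.1 p.2.2.1 p.1.2.2.2)))

theorem ip_hmul_hmul (n m l : ℕ) (F F' : EndClass k → EndClass k → ℂ) :
    ip n (hmul m F) (hmul l F') = ∑ j ∈ Finset.range (min m l + 1),
      if m + l ≤ n + j then pairTerm j (m - j) (l - j) (n + j - (m + l)) F F' else 0 := by
  classical
  have h1 : ∀ x : End k (Fin n → k), hmul m F (cls x) * conj (hmul l F' (cls x)) =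
      ∑ j ∈ Finset.range (min m l + 1), ∑ S : Submodule k (Fin n → k),
        ∑ T : Submodule k (Fin n → k),
        (if PairDim k (Fin j → k) (Fin (m - j) → k) (Fin (l - j) → k) S T then
          (if S ≤ S.comap x ∧ T ≤ T.comap x then
            F (subCls x S) (quoCls x S) * conj (F' (subCls x T) (quoCls x T)) else 0) else 0) := by
    intro x
    rw [hmul_cls, hmul_cls, map_sum, Finset.sum_mul_sum, Finset.sum_comm' (t' := Finset.univ)
      (s' := fun _ => Finset.range (min m l + 1)) (by simp)]
    refine Finset.sum_congr rfl fun S _ => ?_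
    rw [Finset.sum_comm' (t' := Finset.univ)
      (s' := fun _ => Finset.range (min m l + 1)) (by simp)]
    refine Finset.sum_congr rfl fun T _ => ?_
    by_cases hS : S ≤ S.comap x ∧ finrank k S = m
    swap
    · rw [if_neg hS, zero_mul]
      symm
      refine Finset.sum_eq_zero fun j hj => ?_
      rw [Finset.mem_range] at hj
      split_ifs with hP hi
      · refine absurd ⟨hi.1, ?_⟩ hS
        have := hP.1
        simp only [finrank_fin_fun] at this
        omega
      · rfl
      · rfl
    by_cases hT : T ≤ T.comap x ∧ finrank k T = l
    swap
    · rw [if_neg hT, map_zero, mul_zero]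
      symm
      refine Finset.sum_eq_zero fun j hj => ?_
      rw [Finset.mem_range] at hj
      split_ifs with hP hi
      · refine absurd ⟨hi.2, ?_⟩ hT
        have := hP.2.1
        simp only [finrank_fin_fun] at this
        omega
      · rfl
      · rfl
    rw [if_pos hS, if_pos hT]
    have hl : finrank k (S ⊓ T : Submodule k (Fin n → k)) ≤ min m l := by
      rw [← hS.2, ← hT.2]
      exact le_min (Submodule.finrank_mono inf_le_left) (Submodule.finrank_mono inf_le_right)
    rw [Finset.sum_eq_single (finrank k (S ⊓ T : Submodule k (Fin n → k)))]
    · have hl1 := hl.trans (min_le_left m l)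
      have hl2 := hl.trans (min_le_right m l)
      rw [if_pos, if_pos ⟨hS.1, hT.1⟩]
      simp only [PairDim, finrank_fin_fun]
      refine ⟨?_, ?_, trivial⟩
      · rw [hS.2]
        omega
      · rw [hT.2]
        omega
    · intro j _ hj
      rw [if_neg]
      rintro ⟨-, -, h3⟩
      rw [finrank_fin_fun] at h3
      exact hj h3.symm
    · intro h
      rw [Finset.mem_range] at h
      omega
  rw [ip, Finset.sum_congr rfl fun x _ => h1 x, Finset.sum_comm, Finset.mul_sum]
  refine Finset.sum_congr rfl fun j hj => ?_
  rw [Finset.mem_range] at hj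
  split_ifs with hn
  · have h2 := sum_end_pairs (k := k) (V := Fin n → k) (I := Fin j → k) (A := Fin (m - j) → k)
      (B := Fin (l - j) → k) (R := Fin (n + j - (m + l)) → k)
      (by simp only [finrank_fin_fun]; omega) (fun a b c d => F a b * conj (F' c d))
    rw [pairTerm, inv_mul_eq_iff_eq_mul₀ (glCard_ne_zero n), ← mul_assoc, mul_comm _ (_)⁻¹,
      mul_assoc, eq_inv_mul_iff_mul_eq₀ card_stdStab_ne_zero]
    exact h2
  · rw [Finset.sum_eq_zero, mul_zero]
    refine fun x _ => Finset.sum_eq_zero fun S _ => Finset.sum_eq_zero fun T _ => if_neg ?_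
    rintro ⟨h2, h3, h4⟩
    have h5 := Submodule.finrank_sup_add_finrank_inf_eq S T
    have h6 := (S ⊔ T).finrank_le
    simp only [finrank_fin_fun] at h2 h3 h4 h6
    omega

/-- Adjunction between the Hall product and the average over the unipotent radical. -/
theorem ip_hmul (m d : ℕ) (F : EndClass k → EndClass k → ℂ) (h : EndClass k → ℂ) :
    ip (m + d) (hmul m F) h = (glCard k m : ℂ)⁻¹ * (glCard k d : ℂ)⁻¹ *
      ∑ a : End k (Fin m → k), ∑ y : End k (Fin d → k),
        F (cls a) (cls y) * conj (jac h (cls a) (cls y)) := by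
  have h1 : h = hmul 0 fun _ ν => h ν := funext fun ν => (hmul_zero h ν).symm
  conv_lhs => rw [h1]
  rw [ip_hmul_hmul, Nat.min_zero, zero_add, Finset.sum_range_one, if_pos (by omega)]
  simp only [Nat.sub_zero, Nat.add_zero, Nat.add_sub_cancel_left]
  rw [pairTerm]
  have hs : ∀ {X Y : Type} [AddCommGroup X] [Module k X] [Finite X] [AddCommGroup Y] [Module k Y]
      [Finite Y] [Subsingleton Y] (u : (X →ₗ[k] Y) → ℂ), ∑ c : X →ₗ[k] Y, u c = u 0 := by
    intro X Y _ _ _ _ _ _ _ u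
    rw [Fintype.sum_eq_single 0]
    intro c hc
    exact absurd (LinearMap.ext fun v => Subsingleton.elim _ _) hc
  simp only [Fintype.sum_prod_type]
  rw [hs]
  have h2 : ∀ xA : End k (Fin m → k), ∑ xB : End k (Fin 0 → k), ∑ xR : End k (Fin d → k),
      ∑ cI : (Fin m → k) × (Fin 0 → k) × (Fin d → k) →ₗ[k] (Fin 0 → k),
      ∑ cA : (Fin d → k) →ₗ[k] (Fin m → k), ∑ cB : (Fin d → k) →ₗ[k] (Fin 0 → k),
      F (cls (blk 0 (cI ∘ₗ LinearMap.inl k _ _) xA)) (cls (blk xB cB xR)) *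
        conj (h (cls (blk xA cA xR))) =
      (Nat.card ((Fin d → k) →ₗ[k] (Fin m → k)) : ℂ) * ∑ y : End k (Fin d → k),
        F (cls xA) (cls y) * conj (jac h (cls xA) (cls y)) := by
    intro xA
    rw [hs, Finset.mul_sum]
    refine Finset.sum_congr rfl fun xR _ => ?_
    rw [hs]
    simp only [hs, cls_blk_of_subsingleton_left]
    rw [← Finset.mul_sum, ← map_sum, sum_blk_eq_jac, map_mul, Complex.conj_natCast]
    ring
  rw [Finset.sum_congr rfl fun xA _ => h2 xA, ← Finset.mul_sum, ← mul_assoc]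
  congr 1
  rw [card_stdStab]
  have hs' : ∀ {X : Type} [AddCommGroup X] [Module k X],
      Nat.card (X →ₗ[k] (Fin 0 → k)) = 1 := by
    intro X _ _
    have : Unique (X →ₗ[k] (Fin 0 → k)) :=
      ⟨⟨0⟩, fun c => LinearMap.ext fun v => Subsingleton.elim _ _⟩
    exact Nat.card_unique
  have hs'' : Nat.card ((Fin 0 → k) ≃ₗ[k] (Fin 0 → k)) = 1 := by
    have : Unique ((Fin 0 → k) ≃ₗ[k] (Fin 0 → k)) :=
      ⟨⟨LinearEquiv.refl _ _⟩, fun c => LinearEquiv.ext fun v => Subsingleton.elim _ _⟩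
    exact Nat.card_unique
  rw [hs', hs', hs'']
  have := card_linearMap_ne_zero (k := k) (V := Fin d → k) (W := Fin m → k)
  have h3 := glCard_ne_zero (k := k) m
  have h4 := glCard_ne_zero (k := k) d
  change (↑(1 * (glCard k m * (1 * glCard k d)) * _) : ℂ)⁻¹ * _ = _
  push_cast
  field_simp

end Operators

section Mackey

open Module
open scoped ComplexConjugate

variable {k : Type} [Field k] [Finite k]

theorem ip_conj (n : ℕ) (f g : EndClass k → ℂ) : conj (ip n f g) = ip n g f := by
  simp only [ip, map_mul, map_sum, map_inv₀, Complex.conj_natCast, Complex.conj_conj]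
  congr 1
  exact Finset.sum_congr rfl fun x _ => mul_comm _ _

theorem ip_congr {n : ℕ} {f f' g g' : EndClass k → ℂ} (hf : ∀ ν, ν.dim = n → f ν = f' ν)
    (hg : ∀ ν, ν.dim = n → g ν = g' ν) : ip n f g = ip n f' g' := by
  rw [ip, ip]
  congr 1
  refine Finset.sum_congr rfl fun x _ => ?_
  rw [hf _ (by simp), hg _ (by simp)]

theorem ip_add_left (n : ℕ) (f f' g : EndClass k → ℂ) :
    ip n (f + f') g = ip n f g + ip n f' g := by
  simp only [ip, Pi.add_apply, add_mul, Finset.sum_add_distrib, mul_add]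

theorem ip_add_right (n : ℕ) (f g g' : EndClass k → ℂ) :
    ip n f (g + g') = ip n f g + ip n f g' := by
  simp only [ip, Pi.add_apply, map_add, mul_add, Finset.sum_add_distrib]

theorem ip_smul_left (n : ℕ) (c : ℂ) (f g : EndClass k → ℂ) :
    ip n (c • f) g = c * ip n f g := by
  simp only [ip, Pi.smul_apply, smul_eq_mul, Finset.mul_sum]
  exact Finset.sum_congr rfl fun x _ => by ring

theorem ip_smul_right (n : ℕ) (c : ℂ) (f g : EndClass k → ℂ) :
    ip n f (c • g) = conj c * ip n f g := by
  simp only [ip, Pi.smul_apply, smul_eq_mul, Finset.mul_sum, map_mul]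
  exact Finset.sum_congr rfl fun x _ => by ring

theorem ip_zero_left (n : ℕ) (g : EndClass k → ℂ) : ip n 0 g = 0 := by
  simp [ip]

theorem ip_zero_right (n : ℕ) (g : EndClass k → ℂ) : ip n g 0 = 0 := by
  simp [ip]

theorem ip_sub_left (n : ℕ) (f f' g : EndClass k → ℂ) :
    ip n (f - f') g = ip n f g - ip n f' g := by
  simp only [ip, Pi.sub_apply, sub_mul, Finset.sum_sub_distrib, mul_sub]

theorem ip_sub_right (n : ℕ) (f g g' : EndClass k → ℂ) :
    ip n f (g - g') = ip n f g - ip n f g' := by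
  simp only [ip, Pi.sub_apply, map_sub, mul_sub, Finset.sum_sub_distrib]

theorem ip_sum_left {ι : Type*} (s : Finset ι) (n : ℕ) (f : ι → EndClass k → ℂ)
    (g : EndClass k → ℂ) : ip n (∑ i ∈ s, f i) g = ∑ i ∈ s, ip n (f i) g := by
  classical
  induction s using Finset.induction_on with
  | empty => simp [ip_zero_left]
  | insert a s ha ih => rw [Finset.sum_insert ha, Finset.sum_insert ha, ip_add_left, ih]

theorem ip_sum_right {ι : Type*} (s : Finset ι) (n : ℕ) (f : ι → EndClass k → ℂ)
    (g : EndClass k → ℂ) : ip n g (∑ i ∈ s, f i) = ∑ i ∈ s, ip n g (f i) := by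
  classical
  induction s using Finset.induction_on with
  | empty => simp [ip_zero_right]
  | insert a s ha ih => rw [Finset.sum_insert ha, Finset.sum_insert ha, ip_add_right, ih]

theorem EndClass.exists_fin {n : ℕ} {ν : EndClass k} (h : ν.dim = n) :
    ∃ x : End k (Fin n → k), cls x = ν := by
  subst h
  exact ⟨ν.rep.2, ν.cls_rep⟩

theorem eq_zero_of_ip_self {n : ℕ} {f : EndClass k → ℂ} (h : ip n f f = 0) {ν : EndClass k}
    (hν : ν.dim = n) : f ν = 0 := by
  rw [ip, mul_eq_zero] at h
  have h := h.resolve_left (inv_ne_zero (glCard_ne_zero n))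
  obtain ⟨x, rfl⟩ := EndClass.exists_fin hν
  simp only [Complex.mul_conj] at h
  rw [← Complex.ofReal_sum, Complex.ofReal_eq_zero,
    Finset.sum_eq_zero_iff_of_nonneg (fun _ _ => Complex.normSq_nonneg _)] at h
  exact Complex.normSq_eq_zero.1 (h x (Finset.mem_univ _))

theorem eq_of_ip_right {n : ℕ} {f g : EndClass k → ℂ} (h : ∀ u, ip n u f = ip n u g)
    {ν : EndClass k} (hν : ν.dim = n) : f ν = g ν := by
  have := eq_zero_of_ip_self (f := f - g) (by rw [ip_sub_right, h, sub_self]) hν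
  rwa [Pi.sub_apply, sub_eq_zero] at this

/-- Parabolic induction with the character `θ ∘ det` of `GL_m`. -/
noncomputable def hA (θ : MulChar k ℂ) (m : ℕ) (f : EndClass k → ℂ) : EndClass k → ℂ :=
  hmul m fun α ν => θ α.det * f ν

/-- The adjoint of `hA`. -/
noncomputable def hB (θ : MulChar k ℂ) (m : ℕ) (h : EndClass k → ℂ) : EndClass k → ℂ := fun ν =>
  (glCard k m : ℂ)⁻¹ * ∑ a : End k (Fin m → k), conj (θ (LinearMap.det a)) * jac h (cls a) ν

theorem ip_hA (θ : MulChar k ℂ) (m d : ℕ) (f g : EndClass k → ℂ) :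
    ip (m + d) (hA θ m f) g = ip d f (hB θ m g) := by
  rw [hA, ip_hmul, ip]
  simp only [hB, map_mul, map_inv₀, Complex.conj_natCast, map_sum, Complex.conj_conj, det_cls,
    Finset.mul_sum]
  rw [Finset.sum_comm]
  refine Finset.sum_congr rfl fun y _ => Finset.sum_congr rfl fun a _ => ?_
  ring

/-- The multiplicity of `θ' ∘ det` in `θ ∘ det`. -/
noncomputable def detIp (θ θ' : MulChar k ℂ) (j : ℕ) : ℂ :=
  (glCard k j : ℂ)⁻¹ * ∑ x : End k (Fin j → k),
    θ (LinearMap.det x) * conj (θ' (LinearMap.det x))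

theorem pairTerm_det (θ θ' : MulChar k ℂ) (j a b r : ℕ) (f g : EndClass k → ℂ) :
    pairTerm j a b r (fun α ν => θ α.det * f ν) (fun α ν => θ' α.det * g ν) =
      detIp θ θ' j * ip r (hB θ' b f) (hB θ a g) := by
  simp only [pairTerm, det_cls, det_blk, Fintype.sum_prod_type, map_mul]
  have h1 : ∀ (xI : End k (Fin j → k)) (xA : End k (Fin a → k)) (xB : End k (Fin b → k))
      (xR : End k (Fin r → k)),
      ∑ _cI : (Fin a → k) × (Fin b → k) × (Fin r → k) →ₗ[k] (Fin j → k),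
      ∑ cA : (Fin r → k) →ₗ[k] (Fin a → k), ∑ cB : (Fin r → k) →ₗ[k] (Fin b → k),
        (θ (LinearMap.det xI) * θ (LinearMap.det xA)) * f (cls (blk xB cB xR)) *
          ((conj (θ' (LinearMap.det xI)) * conj (θ' (LinearMap.det xB))) *
            conj (g (cls (blk xA cA xR)))) =
      (Nat.card ((Fin a → k) × (Fin b → k) × (Fin r → k) →ₗ[k] (Fin j → k)) : ℂ) *
        (Nat.card ((Fin r → k) →ₗ[k] (Fin a → k)) : ℂ) *
        (Nat.card ((Fin r → k) →ₗ[k] (Fin b → k)) : ℂ) *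
        ((θ (LinearMap.det xI) * conj (θ' (LinearMap.det xI))) *
          ((conj (θ' (LinearMap.det xB)) * jac f (cls xB) (cls xR)) *
          conj (conj (θ (LinearMap.det xA)) * jac g (cls xA) (cls xR)))) := by
    intro xI xA xB xR
    rw [Finset.sum_const, Finset.card_univ, ← Nat.card_eq_fintype_card, nsmul_eq_mul]
    simp only [map_mul, Complex.conj_conj]
    have e1 := sum_blk_eq_jac f xB xR
    have e2 := congrArg conj (sum_blk_eq_jac g xA xR)
    rw [map_sum, map_mul, Complex.conj_natCast] at e2
    calc _ = (Nat.card ((Fin a → k) × (Fin b → k) × (Fin r → k) →ₗ[k] (Fin j → k)) : ℂ) *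
        ((θ (LinearMap.det xI) * conj (θ' (LinearMap.det xI))) *
          ((conj (θ' (LinearMap.det xB)) *
            ∑ cB : (Fin r → k) →ₗ[k] (Fin b → k), f (cls (blk xB cB xR))) *
          (θ (LinearMap.det xA) *
            ∑ cA : (Fin r → k) →ₗ[k] (Fin a → k), conj (g (cls (blk xA cA xR)))))) := by
          congr 1
          simp only [Finset.mul_sum, Finset.sum_mul]
          refine Finset.sum_congr rfl fun _ _ => ?_
          refine Finset.sum_congr rfl fun _ _ => ?_
          ring
      _ = _ := by
          rw [e1, e2]
          ring
  simp only [h1]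
  rw [detIp, ip, card_stdStab]
  have h2 := glCard_ne_zero (k := k) j
  have h3 := glCard_ne_zero (k := k) a
  have h4 := glCard_ne_zero (k := k) b
  have h5 := glCard_ne_zero (k := k) r
  have h6 := card_linearMap_ne_zero (k := k) (V := Fin r → k) (W := Fin a → k)
  have h7 := card_linearMap_ne_zero (k := k) (V := Fin r → k) (W := Fin b → k)
  have h8 := card_linearMap_ne_zero (k := k)
    (V := (Fin a → k) × (Fin b → k) × (Fin r → k)) (W := Fin j → k)
  simp only [hB, map_mul, map_inv₀, Complex.conj_natCast, map_sum]
  have h9 : ∀ xR : End k (Fin r → k),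
      ((glCard k b : ℂ)⁻¹ * ∑ xB : End k (Fin b → k),
        conj (θ' (LinearMap.det xB)) * jac f (cls xB) (cls xR)) *
      ((glCard k a : ℂ)⁻¹ * ∑ xA : End k (Fin a → k),
        conj (conj (θ (LinearMap.det xA))) * conj (jac g (cls xA) (cls xR))) =
      (glCard k b : ℂ)⁻¹ * (glCard k a : ℂ)⁻¹ * ∑ xA : End k (Fin a → k),
        ∑ xB : End k (Fin b → k), (conj (θ' (LinearMap.det xB)) * jac f (cls xB) (cls xR)) *
          (conj (conj (θ (LinearMap.det xA))) * conj (jac g (cls xA) (cls xR))) := by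
    intro xR
    rw [mul_mul_mul_comm, mul_comm (∑ xB : End k (Fin b → k), _), Finset.sum_mul_sum]
    congr 1
    refine Finset.sum_congr rfl fun _ _ => Finset.sum_congr rfl fun _ _ => mul_comm _ _
  simp only [h9]
  rw [← Finset.mul_sum]
  have h10 : ∀ (C : ℂ) (u : End k (Fin j → k) → ℂ)
      (w : End k (Fin a → k) → End k (Fin b → k) → End k (Fin r → k) → ℂ),
      ∑ xI, ∑ xA, ∑ xB, ∑ xR, C * (u xI * w xA xB xR) =
      C * ((∑ xI, u xI) * ∑ xR, ∑ xA, ∑ xB, w xA xB xR) := by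
    intro C u w
    have : ∑ xR, ∑ xA, ∑ xB, w xA xB xR = ∑ xA, ∑ xB, ∑ xR, w xA xB xR := by
      rw [Finset.sum_comm]
      refine Finset.sum_congr rfl fun xA _ => ?_
      rw [Finset.sum_comm]
    rw [this, Finset.sum_mul]
    simp only [Finset.mul_sum]
  rw [h10]
  change (↑(glCard k j * (glCard k a * (glCard k b * glCard k r)) * _) : ℂ)⁻¹ * _ = _
  push_cast
  generalize (∑ xI : End k (Fin j → k), _ : ℂ) = X
  generalize (∑ xI : End k (Fin r → k), _ : ℂ) = Y
  field_simp

end Mackey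

section Commutation

open Module
open scoped ComplexConjugate

variable {k : Type} [Field k] [Finite k]

theorem hmul_add (m : ℕ) (F G : EndClass k → EndClass k → ℂ) :
    hmul m (F + G) = hmul m F + hmul m G := by
  funext ν
  simp only [hmul, Pi.add_apply, ← Finset.sum_add_distrib]
  refine Finset.sum_congr rfl fun S _ => ?_
  split_ifs <;> simp

theorem hmul_smul (m : ℕ) (c : ℂ) (F : EndClass k → EndClass k → ℂ) :
    hmul m (c • F) = c • hmul m F := by
  funext ν
  simp only [hmul, Pi.smul_apply, Finset.smul_sum]
  refine Finset.sum_congr rfl fun S _ => ?_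
  split_ifs <;> simp

theorem hA_add (θ : MulChar k ℂ) (m : ℕ) (f g : EndClass k → ℂ) :
    hA θ m (f + g) = hA θ m f + hA θ m g := by
  rw [hA, hA, hA, ← hmul_add]
  congr 1
  funext α ν
  simp [mul_add]

theorem hA_smul (θ : MulChar k ℂ) (m : ℕ) (c : ℂ) (f : EndClass k → ℂ) :
    hA θ m (c • f) = c • hA θ m f := by
  rw [hA, hA, ← hmul_smul]
  congr 1
  funext α ν
  simp only [Pi.smul_apply, smul_eq_mul]
  ring

/-- `hA` as a linear map. -/
noncomputable def hAL (θ : MulChar k ℂ) (m : ℕ) : (EndClass k → ℂ) →ₗ[ℂ] (EndClass k → ℂ) where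
  toFun := hA θ m
  map_add' := hA_add θ m
  map_smul' := hA_smul θ m

/-- `hB` as a linear map. -/
noncomputable def hBL (θ : MulChar k ℂ) (m : ℕ) : (EndClass k → ℂ) →ₗ[ℂ] (EndClass k → ℂ) where
  toFun := hB θ m
  map_add' f g := by
    funext ν
    simp only [hB, jac, Pi.add_apply, Finset.sum_add_distrib, mul_add]
  map_smul' c f := by
    funext ν
    simp only [hB, jac, Pi.smul_apply, smul_eq_mul, RingHom.id_apply, Finset.mul_sum]
    refine Finset.sum_congr rfl fun a _ => Finset.sum_congr rfl fun b _ => ?_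
    ring

@[simp] theorem hAL_apply (θ : MulChar k ℂ) (m : ℕ) (f : EndClass k → ℂ) :
    hAL θ m f = hA θ m f := rfl

@[simp] theorem hBL_apply (θ : MulChar k ℂ) (m : ℕ) (f : EndClass k → ℂ) :
    hBL θ m f = hB θ m f := rfl

theorem hA_zero_right (θ : MulChar k ℂ) (m : ℕ) : hA θ m (0 : EndClass k → ℂ) = 0 :=
  map_zero (hAL θ m)

theorem hB_zero_right (θ : MulChar k ℂ) (m : ℕ) : hB θ m (0 : EndClass k → ℂ) = 0 :=
  map_zero (hBL θ m)

theorem hA_eq_zero_of_lt (θ : MulChar k ℂ) {m : ℕ} (f : EndClass k → ℂ) {ν : EndClass k}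
    (h : ν.dim < m) : hA θ m f ν = 0 := by
  rw [← ν.cls_rep] at h ⊢
  exact hmul_eq_zero_of_lt _ _ (by simpa using h)

theorem hA_zero_left (θ : MulChar k ℂ) (f : EndClass k → ℂ) : hA θ 0 f = f := by
  classical
  funext ν
  rw [← ν.cls_rep, hA, hmul_cls, Finset.sum_eq_single ⊥]
  · rw [if_pos ⟨bot_le, finrank_bot _ _⟩, quoCls_bot, subCls_bot, det_cls,
      LinearMap.det_eq_one_of_subsingleton, map_one, one_mul]
  · intro S _ hS
    rw [if_neg]
    rintro ⟨-, h2⟩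
    exact hS (Submodule.finrank_eq_zero.1 h2)
  · simp

theorem ip_hA_right (θ : MulChar k ℂ) (m d : ℕ) (f g : EndClass k → ℂ) :
    ip (m + d) g (hA θ m f) = ip d (hB θ m g) f := by
  rw [← ip_conj, ip_hA, ip_conj]

theorem hB_zero_left (θ : MulChar k ℂ) (f : EndClass k → ℂ) : hB θ 0 f = f := by
  funext ν
  refine eq_of_ip_right (n := ν.dim) (fun u => ?_) rfl
  rw [← ip_hA, hA_zero_left, zero_add]

theorem detIp_eq (θ θ' : MulChar k ℂ) (j : ℕ) : detIp θ θ' j = (glCard k j : ℂ)⁻¹ *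
    ∑ x : End k (Fin j → k), (θ * θ'⁻¹) (LinearMap.det x) := by
  rw [detIp]
  congr 1
  refine Finset.sum_congr rfl fun x _ => ?_
  rw [MulChar.mul_apply, ← MulChar.star_apply' θ']
  rfl

theorem card_isUnit_det (V : Type) [AddCommGroup V] [Module k V] [Finite V] :
    Nat.card {x : End k V // IsUnit (LinearMap.det x)} = Nat.card (V ≃ₗ[k] V) := by
  refine Nat.card_congr (Equiv.ofBijective
    (fun e : V ≃ₗ[k] V => (⟨e.toLinearMap, LinearEquiv.isUnit_det' e⟩ :
      {x : End k V // IsUnit (LinearMap.det x)})) ⟨?_, ?_⟩).symm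
  · intro e e' h
    exact LinearEquiv.toLinearMap_injective (Subtype.ext_iff.1 h)
  · rintro ⟨x, hx⟩
    rw [LinearMap.isUnit_iff_isUnit_det _ |>.symm, Module.End.isUnit_iff] at hx
    exact ⟨LinearEquiv.ofBijective x hx, Subtype.ext (LinearMap.ext fun v => rfl)⟩

theorem detIp_self (θ : MulChar k ℂ) (j : ℕ) : detIp θ θ j = 1 := by
  classical
  rw [detIp_eq, mul_inv_cancel, inv_mul_eq_one₀ (glCard_ne_zero j)]
  have h : ∀ x : End k (Fin j → k), (1 : MulChar k ℂ) (LinearMap.det x) =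
      if IsUnit (LinearMap.det x) then 1 else 0 := by
    intro x
    split_ifs with h
    · rw [MulChar.one_apply h]
    · rw [MulChar.map_nonunit _ h]
  simp only [h]
  rw [Finset.sum_boole, glCard, ← card_isUnit_det, Nat.card_eq_fintype_card, Fintype.card_subtype]

theorem detIp_of_ne {θ θ' : MulChar k ℂ} (h : θ ≠ θ') {j : ℕ} (hj : j ≠ 0) :
    detIp θ θ' j = 0 := by
  rw [detIp_eq]
  have h1 : θ * θ'⁻¹ ≠ 1 := fun h' => h (mul_inv_eq_one.1 h')
  obtain ⟨u, hu⟩ := MulChar.ne_one_iff.1 h1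
  set ψ := θ * θ'⁻¹
  obtain ⟨i, rfl⟩ := Nat.exists_eq_succ_of_ne_zero hj
  let D : Matrix (Fin (i + 1)) (Fin (i + 1)) k := Matrix.diagonal (Fin.cons (u : k) fun _ => 1)
  have hD : D.det = u := by
    rw [Matrix.det_diagonal, Fin.prod_univ_succ]
    simp
  have hD' : IsUnit (Matrix.toLin' D) := by
    rw [LinearMap.isUnit_iff_isUnit_det, LinearMap.det_toLin', hD]
    exact u.isUnit
  have h2 : ∑ x : End k (Fin (i + 1) → k), ψ (LinearMap.det x) =
      ψ u * ∑ x : End k (Fin (i + 1) → k), ψ (LinearMap.det x) := by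
    rw [Finset.mul_sum]
    symm
    refine Fintype.sum_bijective (fun x => Matrix.toLin' D * x) ?_ _ _ fun x => ?_
    · exact hD'.unit.mulLeft_bijective
    · rw [map_mul, LinearMap.det_toLin', hD, map_mul]
  have h3 : (1 - ψ u) * ∑ x : End k (Fin (i + 1) → k), ψ (LinearMap.det x) = 0 := by
    rw [sub_mul, one_mul, ← h2, sub_self]
  rw [mul_eq_zero] at h3
  rw [h3.resolve_left (sub_ne_zero.2 (Ne.symm hu)), mul_zero]

theorem detIp_zero (θ θ' : MulChar k ℂ) : detIp θ θ' 0 = 1 := by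
  rw [← detIp_self (k := k) 1 0, detIp, detIp]
  congr 1
  refine Finset.sum_congr rfl fun x _ => ?_
  rw [LinearMap.det_eq_one_of_subsingleton]
  simp

theorem ip_hA_hA (θ θ' : MulChar k ℂ) (n m l : ℕ) (f g : EndClass k → ℂ) :
    ip n (hA θ m f) (hA θ' l g) = ∑ j ∈ Finset.range (min m l + 1),
      if m + l ≤ n + j then detIp θ θ' j *
        ip (n + j - (m + l)) (hB θ' (l - j) f) (hB θ (m - j) g) else 0 := by
  rw [hA, hA, ip_hmul_hmul]
  simp only [pairTerm_det]

theorem hB_hA (θ θ' : MulChar k ℂ) (m l : ℕ) (g : EndClass k → ℂ) :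
    hB θ m (hA θ' l g) = ∑ j ∈ Finset.range (min m l + 1),
      conj (detIp θ θ' j) • hA θ' (l - j) (hB θ (m - j) g) := by
  funext ν
  refine eq_of_ip_right (n := ν.dim) (fun u => ?_) rfl
  rw [← ip_hA, ip_hA_hA, ip_sum_right]
  refine Finset.sum_congr rfl fun j hj => ?_
  rw [Finset.mem_range] at hj
  have hl : j ≤ l := by omega
  rw [ip_smul_right, Complex.conj_conj]
  split_ifs with h
  · rw [← ip_hA_right]
    congr 2
    omega
  · rw [ip_congr (g' := 0) (fun _ _ => rfl), ip_zero_right, mul_zero]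
    intro μ hμ
    exact hA_eq_zero_of_lt _ _ (by omega)

theorem hB_hA_self (θ : MulChar k ℂ) (m l : ℕ) (g : EndClass k → ℂ) :
    hB θ m (hA θ l g) = ∑ j ∈ Finset.range (min m l + 1), hA θ (l - j) (hB θ (m - j) g) := by
  rw [hB_hA]
  simp only [detIp_self, map_one, one_smul]

theorem hB_hA_of_ne {θ θ' : MulChar k ℂ} (h : θ ≠ θ') (m l : ℕ) (g : EndClass k → ℂ) :
    hB θ m (hA θ' l g) = hA θ' l (hB θ m g) := by
  rw [hB_hA, Finset.sum_range_succ', Finset.sum_eq_zero, zero_add, detIp_zero, map_one, one_smul]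
  · rfl
  · intro j _
    rw [detIp_of_ne h (Nat.succ_ne_zero j), map_zero, zero_smul]

theorem ip_hA_hA_self (θ : MulChar k ℂ) (k' d : ℕ) (f g : EndClass k → ℂ) :
    ip (k' + d) (hA θ k' f) (hA θ k' g) = ∑ j ∈ Finset.range (k' + 1),
      if k' ≤ d + j then ip (d + j - k') (hB θ (k' - j) f) (hB θ (k' - j) g) else 0 := by
  rw [ip_hA_hA, Nat.min_self]
  refine Finset.sum_congr rfl fun j hj => ?_
  rw [detIp_self, one_mul]
  congr 1
  · simp only [eq_iff_iff]
    omega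
  · congr 1
    omega

theorem ip_hA_hA_self' (θ : MulChar k ℂ) (m d : ℕ) (f g : EndClass k → ℂ) :
    ip (m + d) (hA θ m f) (hA θ m g) = ∑ i ∈ Finset.range (m + 1),
      if i ≤ d then ip (d - i) (hB θ i f) (hB θ i g) else 0 := by
  rw [ip_hA_hA_self, ← Finset.sum_range_reflect]
  refine Finset.sum_congr rfl fun j hj => ?_
  rw [Finset.mem_range] at hj
  have h1 : m - (m + 1 - 1 - j) = j := by omega
  rw [h1]
  refine if_congr (by omega) ?_ rfl
  congr 1
  omega

theorem hB_hA_self' (θ : MulChar k ℂ) (m : ℕ) (g : EndClass k → ℂ) :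
    hB θ m (hA θ m g) = ∑ i ∈ Finset.range (m + 1), hA θ i (hB θ i g) := by
  rw [hB_hA_self, Nat.min_self, ← Finset.sum_range_reflect]
  refine Finset.sum_congr rfl fun j hj => ?_
  rw [Finset.mem_range] at hj
  have h1 : m - (m + 1 - 1 - j) = j := by omega
  rw [h1]

theorem ip_hA_right_eq_ite (θ : MulChar k ℂ) (m n : ℕ) (f g : EndClass k → ℂ) :
    ip n g (hA θ m f) = if m ≤ n then ip (n - m) (hB θ m g) f else 0 := by
  split_ifs with h
  · rw [← ip_hA_right]
    congr 1
    omega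
  · rw [ip_congr (g' := 0) (fun _ _ => rfl), ip_zero_right]
    intro ν hν
    exact hA_eq_zero_of_lt _ _ (by omega)

section

variable {θ θ' : MulChar k ℂ} (hθ : θ ≠ θ')
include hθ

theorem ip_hA_hA_hA_hA (a b d : ℕ) (f g : EndClass k → ℂ) :
    ip (a + (b + d)) (hA θ a (hA θ' b f)) (hA θ a (hA θ' b g)) =
      ∑ i ∈ Finset.range (a + 1), ∑ j ∈ Finset.range (b + 1),
        if i + j ≤ d then ip (d - (i + j)) (hB θ' j (hB θ i f)) (hB θ' j (hB θ i g)) else 0 := by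
  rw [ip_hA_hA_self']
  refine Finset.sum_congr rfl fun i _ => ?_
  rw [hB_hA_of_ne hθ, hB_hA_of_ne hθ]
  by_cases hi : i ≤ d
  · rw [if_pos (by omega), Nat.add_sub_assoc hi, ip_hA_hA_self']
    refine Finset.sum_congr rfl fun j _ => ?_
    rw [Nat.sub_sub]
    exact if_congr (by omega) rfl rfl
  · rw [Finset.sum_eq_zero fun j _ => if_neg (by omega)]
    split_ifs with h
    · rw [ip_congr (f' := 0) (g' := 0), ip_zero_right] <;>
      · intro ν hν
        exact hA_eq_zero_of_lt _ _ (by omega)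
    · rfl

theorem ip_hA_hA_hA_hA_comm (a b d : ℕ) (f g : EndClass k → ℂ) :
    ip (a + (b + d)) (hA θ a (hA θ' b f)) (hA θ' b (hA θ a g)) =
      ∑ i ∈ Finset.range (a + 1), ∑ j ∈ Finset.range (b + 1),
        if i + j ≤ d then ip (d - (i + j)) (hB θ i (hB θ' j f)) (hB θ' j (hB θ i g)) else 0 := by
  rw [ip_hA, hB_hA_of_ne hθ, hB_hA_self', ip_hA_hA_self', Finset.sum_comm]
  refine Finset.sum_congr rfl fun j _ => ?_
  have h1 : hB θ' j (∑ i ∈ Finset.range (a + 1), hA θ i (hB θ i g)) =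
      ∑ i ∈ Finset.range (a + 1), hA θ i (hB θ' j (hB θ i g)) := by
    rw [← hBL_apply, map_sum]
    refine Finset.sum_congr rfl fun i _ => ?_
    rw [hBL_apply, hB_hA_of_ne hθ.symm]
  rw [h1]
  split_ifs with hj
  · rw [ip_sum_right]
    refine Finset.sum_congr rfl fun i _ => ?_
    rw [ip_hA_right_eq_ite, Nat.sub_sub, add_comm j i]
    exact if_congr (by omega) rfl rfl
  · rw [Finset.sum_eq_zero fun j _ => if_neg (by omega)]

omit hθ in
theorem hB_comm_of_hA_comm {a b d : ℕ} (h : ∀ f : EndClass k → ℂ, ∀ ν : EndClass k,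
      ν.dim = a + (b + d) → hA θ a (hA θ' b f) ν = hA θ' b (hA θ a f) ν)
    (f : EndClass k → ℂ) {ν : EndClass k} (hν : ν.dim = d) :
    hB θ a (hB θ' b f) ν = hB θ' b (hB θ a f) ν := by
  refine eq_of_ip_right (fun u => ?_) hν
  rw [← ip_hA, ← ip_hA, ← ip_hA, ← ip_hA, Nat.add_left_comm b a d]
  exact ip_congr (fun ν hν => (h u ν hν).symm) (fun _ _ => rfl)

theorem hA_comm_aux (d : ℕ) : ∀ (a b : ℕ) (f : EndClass k → ℂ) (ν : EndClass k),
    ν.dim = a + (b + d) → hA θ a (hA θ' b f) ν = hA θ' b (hA θ a f) ν := by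
  induction d using Nat.strong_induction_on with
  | _ d ih =>
  intro a b f ν hν
  have hc : ∀ i j : ℕ, i + j ≤ d → ∀ ν : EndClass k, ν.dim = d - (i + j) →
      hB θ i (hB θ' j f) ν = hB θ' j (hB θ i f) ν := by
    intro i j hij ν hν
    rcases Nat.eq_zero_or_pos (i + j) with h0 | h0
    · obtain ⟨rfl, rfl⟩ : i = 0 ∧ j = 0 := by omega
      simp only [hB_zero_left]
    · exact hB_comm_of_hA_comm (ih (d - (i + j)) (by omega) i j) f hν
  have h1 := ip_hA_hA_hA_hA hθ a b d f f
  have h2 := ip_hA_hA_hA_hA_comm hθ a b d f f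
  have h3 := ip_hA_hA_hA_hA hθ.symm b a d f f
  rw [Nat.add_left_comm, Finset.sum_comm] at h3
  have e2 : ip (a + (b + d)) (hA θ a (hA θ' b f)) (hA θ' b (hA θ a f)) =
      ip (a + (b + d)) (hA θ a (hA θ' b f)) (hA θ a (hA θ' b f)) := by
    rw [h1, h2]
    refine Finset.sum_congr rfl fun i _ => Finset.sum_congr rfl fun j _ => ?_
    split_ifs with hij
    · exact ip_congr (hc i j hij) fun _ _ => rfl
    · rfl
  have e3 : ip (a + (b + d)) (hA θ' b (hA θ a f)) (hA θ' b (hA θ a f)) =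
      ip (a + (b + d)) (hA θ a (hA θ' b f)) (hA θ a (hA θ' b f)) := by
    rw [h1, h3]
    refine Finset.sum_congr rfl fun i _ => Finset.sum_congr rfl fun j _ => ?_
    rw [add_comm j i]
    split_ifs with hij
    · exact ip_congr (hc i j hij) (hc i j hij)
    · rfl
  have e4 := congrArg conj e2
  rw [ip_conj, ip_conj] at e4
  have := eq_zero_of_ip_self (f := hA θ a (hA θ' b f) - hA θ' b (hA θ a f))
    (n := a + (b + d)) (by rw [ip_sub_left, ip_sub_right, ip_sub_right, e2, e3, e4]; ring) hν
  rwa [Pi.sub_apply, sub_eq_zero] at this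

theorem hB_comm (a b : ℕ) (f : EndClass k → ℂ) : hB θ a (hB θ' b f) = hB θ' b (hB θ a f) :=
  funext fun _ => hB_comm_of_hA_comm (hA_comm_aux hθ _ a b) f rfl

end

end Commutation

section Characters

open Module
open scoped ComplexConjugate

theorem exists_trace_pow_eq {V : Type*} [AddCommGroup V] [Module ℂ V] [FiniteDimensional ℂ V]
    {N : ℕ} (hN : N ≠ 0) (A : End ℂ V) (hA : A ^ N = 1) {ζ : ℂ} (hζ : IsPrimitiveRoot ζ N) :
    ∃ d : ℕ → ℕ, ∀ t < N, LinearMap.trace ℂ V (A ^ t) =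
      ∑ i ∈ Finset.range N, (ζ ^ i) ^ t * (d i : ℂ) := by
  have hN' : (N : ℂ) ≠ 0 := Nat.cast_ne_zero.2 hN
  have hζ0 : ζ ≠ 0 := hζ.ne_zero hN
  let B : ℕ → End ℂ V := fun i => (ζ ^ i)⁻¹ • A
  have hB : ∀ i, B i ^ N = 1 := by
    intro i
    rw [smul_pow, hA, inv_pow, ← pow_mul, mul_comm, pow_mul, hζ.pow_eq_one, one_pow, inv_one,
      one_smul]
  let S : ℕ → End ℂ V := fun i => ∑ j ∈ Finset.range N, B i ^ j
  have hBS : ∀ i, B i * S i = S i := by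
    intro i
    have := mul_geom_sum (B i) N
    rw [hB, sub_self, sub_mul, one_mul, sub_eq_zero] at this
    exact this
  have hBS' : ∀ i j, B i ^ j * S i = S i := by
    intro i j
    induction j with
    | zero => rw [pow_zero, one_mul]
    | succ j ih => rw [pow_succ, mul_assoc, hBS, ih]
  have hE : ∀ i, IsIdempotentElem ((N : ℂ)⁻¹ • S i) := by
    intro i
    have : S i * S i = (N : ℂ) • S i := by
      change (∑ j ∈ Finset.range N, B i ^ j) * S i = _
      rw [Finset.sum_mul, Finset.sum_congr rfl fun j _ => hBS' i j, Finset.sum_const,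
        Finset.card_range, Nat.cast_smul_eq_nsmul]
    rw [IsIdempotentElem, smul_mul_smul_comm, this, smul_smul]
    congr 1
    field_simp
  have htr : ∀ i, ∃ d : ℕ, LinearMap.trace ℂ V ((N : ℂ)⁻¹ • S i) = d := fun i =>
    ⟨_, LinearMap.IsProj.trace (LinearMap.isProj_range_iff_isIdempotentElem _ |>.2 (hE i))⟩
  choose d hd using htr
  refine ⟨d, fun t ht => ?_⟩
  simp only [← hd, ← smul_eq_mul, ← map_smul, ← map_sum]
  congr 1
  have h1 : ∀ i, (ζ ^ i) ^ t • (N : ℂ)⁻¹ • S i =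
      ∑ j ∈ Finset.range N, ((N : ℂ)⁻¹ * (ζ ^ t * (ζ ^ j)⁻¹) ^ i) • A ^ j := by
    intro i
    change (ζ ^ i) ^ t • (N : ℂ)⁻¹ • (∑ j ∈ Finset.range N, B i ^ j) = _
    rw [Finset.smul_sum, Finset.smul_sum]
    refine Finset.sum_congr rfl fun j _ => ?_
    rw [smul_pow, smul_smul, smul_smul]
    congr 1
    rw [mul_pow, inv_pow, inv_pow, ← pow_mul, ← pow_mul, ← pow_mul, ← pow_mul, mul_comm i t,
      mul_comm i j]
    ring
  simp only [h1]
  rw [Finset.sum_comm, Finset.sum_eq_single t]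
  · rw [← Finset.sum_smul, ← Finset.mul_sum, mul_inv_cancel₀ (pow_ne_zero _ hζ0)]
    simp [hN']
  · intro j hj hjt
    rw [← Finset.sum_smul, ← Finset.mul_sum]
    have hx : ζ ^ t * (ζ ^ j)⁻¹ ≠ 1 := by
      intro h
      rw [mul_inv_eq_one₀ (pow_ne_zero _ hζ0)] at h
      exact hjt (hζ.pow_inj (Finset.mem_range.1 hj) ht h.symm)
    have hx' : (ζ ^ t * (ζ ^ j)⁻¹) ^ N = 1 := by
      rw [mul_pow, inv_pow, ← pow_mul, ← pow_mul, mul_comm t, mul_comm j, pow_mul, pow_mul,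
        hζ.pow_eq_one, one_pow, one_pow, inv_one, mul_one]
    have := mul_geom_sum (ζ ^ t * (ζ ^ j)⁻¹) N
    rw [hx', sub_self, mul_eq_zero] at this
    rw [this.resolve_left (sub_ne_zero.2 hx), mul_zero, zero_smul]
  · intro h
    exact absurd (Finset.mem_range.2 ht) h

variable {G : Type} [Group G] [Finite G]

theorem FDRep.char_inv_eq_conj (V : FDRep ℂ G) (g : G) :
    V.character g⁻¹ = conj (V.character g) := by
  have hN : Nat.card G ≠ 0 := Nat.card_pos.ne'
  rcases (show Nat.card G = 1 ∨ 1 < Nat.card G by omega) with h1 | h1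
  · have : Subsingleton G := (Nat.card_eq_one_iff_unique.1 h1).1
    rw [Subsingleton.elim g⁻¹ 1, Subsingleton.elim g 1, FDRep.char_one, Complex.conj_natCast]
  obtain ⟨d, hd⟩ := exists_trace_pow_eq hN (V.ρ g) (by rw [← map_pow, pow_card_eq_one', map_one])
    (Complex.isPrimitiveRoot_exp _ hN)
  set ζ := Complex.exp (2 * Real.pi * Complex.I / (Nat.card G : ℕ))
  have hζ : ζ ^ Nat.card G = 1 := (Complex.isPrimitiveRoot_exp _ hN).pow_eq_one
  have e1 := hd 1 h1
  have e2 := hd (Nat.card G - 1) (by omega)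
  have hg : g ^ (Nat.card G - 1) = g⁻¹ := by
    rw [eq_inv_iff_mul_eq_one, ← pow_succ, Nat.sub_add_cancel h1.le, pow_card_eq_one']
  rw [← map_pow, hg] at e2
  rw [pow_one] at e1
  change LinearMap.trace ℂ V (V.ρ g⁻¹) = conj (LinearMap.trace ℂ V (V.ρ g))
  rw [e1, e2, map_sum]
  refine Finset.sum_congr rfl fun i _ => ?_
  rw [map_mul, Complex.conj_natCast, pow_one]
  congr 1
  have h2 : (ζ ^ i) ^ (Nat.card G - 1) * ζ ^ i = 1 := by
    rw [← pow_succ, Nat.sub_add_cancel h1.le, ← pow_mul, mul_comm, pow_mul, hζ, one_pow]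
  have h3 : ‖ζ ^ i‖ = 1 := by
    rw [norm_pow, Complex.norm_eq_one_of_pow_eq_one hζ hN, one_pow]
  rw [← Complex.inv_eq_conj h3]
  exact eq_inv_of_mul_eq_one_left h2

theorem FDRep.isIntegral_char (V : FDRep ℂ G) (g : G) : IsIntegral ℤ (V.character g) := by
  have hN : Nat.card G ≠ 0 := Nat.card_pos.ne'
  rcases (show Nat.card G = 1 ∨ 1 < Nat.card G by omega) with h1 | h1
  · have : Subsingleton G := (Nat.card_eq_one_iff_unique.1 h1).1
    rw [Subsingleton.elim g 1, FDRep.char_one]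
    exact isIntegral_algebraMap (R := ℤ) (x := (finrank ℂ V : ℤ))
  obtain ⟨d, hd⟩ := exists_trace_pow_eq hN (V.ρ g) (by rw [← map_pow, pow_card_eq_one', map_one])
    (Complex.isPrimitiveRoot_exp _ hN)
  have e1 := hd 1 h1
  rw [pow_one] at e1
  change IsIntegral ℤ (LinearMap.trace ℂ V (V.ρ g))
  rw [e1]
  refine IsIntegral.sum _ fun i _ => ?_
  refine IsIntegral.mul ?_ (isIntegral_algebraMap (R := ℤ) (x := (d i : ℤ)))
  exact (((Complex.isPrimitiveRoot_exp _ hN).isIntegral (Nat.pos_of_ne_zero hN)).pow i).pow 1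

/-- The set of irreducible characters. -/
def irrChars (G : Type) [Group G] : Set (G → ℂ) :=
  {χ | ∃ V : FDRep ℂ G, CategoryTheory.Simple V ∧ V.character = χ}

theorem exists_nat_avg {V : Type} [AddCommGroup V] [Module ℂ V] [FiniteDimensional ℂ V]
    [Fintype G] (ρ : Representation ℂ G V) :
    ∃ n : ℕ, (Nat.card G : ℂ)⁻¹ * ∑ g : G, ρ.character g = n := by
  have : Invertible (Nat.card G : ℂ) := invertibleOfNonzero (Nat.cast_ne_zero.2 Nat.card_pos.ne')
  exact ⟨_, ρ.card_inv_mul_sum_char_eq_finrank⟩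

theorem irrChars_orth [Fintype G] {χ ψ : G → ℂ} (hχ : χ ∈ irrChars G) (hψ : ψ ∈ irrChars G)
    [Decidable (χ = ψ)] :
    (Nat.card G : ℂ)⁻¹ * ∑ g : G, χ g * conj (ψ g) = if χ = ψ then 1 else 0 := by
  obtain ⟨V, hV, rfl⟩ := hχ
  obtain ⟨W, hW, rfl⟩ := hψ
  have : Invertible (Nat.card G : ℂ) := invertibleOfNonzero (Nat.cast_ne_zero.2 Nat.card_pos.ne')
  have h := FDRep.char_orthonormal V W
  simp only [FDRep.char_inv_eq_conj] at h
  rw [h]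
  by_cases h1 : V.character = W.character
  · rw [if_pos h1]
    have h2 := FDRep.char_orthonormal W W
    simp only [FDRep.char_inv_eq_conj] at h2
    rw [h1] at h
    rw [← h, h2, if_pos ⟨CategoryTheory.Iso.refl _⟩]
  · rw [if_neg h1, if_neg]
    rintro ⟨e⟩
    exact h1 (FDRep.char_iso e)

theorem mem_irrChars_of_irreducible {V : Type} [AddCommGroup V] [Module ℂ V]
    [FiniteDimensional ℂ V] (ρ : Representation ℂ G V) [ρ.IsIrreducible] :
    ρ.character ∈ irrChars G := by
  refine ⟨FDRep.of ρ, ?_, rfl⟩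
  have := Fintype.ofFinite G
  have : Invertible (Nat.card G : ℂ) := invertibleOfNonzero (Nat.cast_ne_zero.2 Nat.card_pos.ne')
  have h := Representation.char_orthonormal ρ ρ
  rw [if_pos ⟨Representation.Equiv.refl _⟩, inv_mul_eq_one₀
    (Nat.cast_ne_zero.2 Nat.card_pos.ne')] at h
  rw [FDRep.simple_iff_char_is_norm_one]
  exact h.symm

end Characters

section Completeness

open Module
open scoped ComplexConjugate MonoidAlgebra

theorem isIrreducible_ofModule' {G M : Type} [Group G] [AddCommGroup M] [Module ℂ M]
    [Module ℂ[G] M] [IsScalarTower ℂ ℂ[G] M] [IsSimpleModule ℂ[G] M] :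
    (Representation.ofModule' (k := ℂ) (G := G) M).IsIrreducible := by
  rw [Representation.irreducible_iff_isSimpleModule_asModule]
  let e : (Representation.ofModule' (k := ℂ) (G := G) M).asModule ≃ₗ[ℂ[G]] M :=
    { (Representation.ofModule' (k := ℂ) (G := G) M).asModuleEquiv.toAddEquiv with
      map_smul' := fun r m => by
        change (Representation.ofModule' (k := ℂ) (G := G) M).asModuleEquiv (r • m) = _
        rw [Representation.asModuleEquiv_map_smul, Representation.ofModule',
          Representation.asAlgebraHom, Equiv.apply_symm_apply]
        rfl }
  exact IsSimpleModule.congr e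

variable {G : Type} [Group G]

theorem eq_zero_of_forall_irrChars [Fintype G] (f : G → ℂ) (hf : ∀ g h, f (h * g * h⁻¹) = f g)
    (h : ∀ χ ∈ irrChars G, ∑ g, f g * conj (χ g) = 0) : f = 0 := by
  have : NeZero (Nat.card G : ℂ) := ⟨Nat.cast_ne_zero.2 Nat.card_pos.ne'⟩
  let z : ℂ[G] := ∑ g, MonoidAlgebra.single g⁻¹ (f g)
  have hz : ∀ x : ℂ[G], z * x = x * z := by
    intro x
    induction x using MonoidAlgebra.induction_on with
    | of g =>
      simp only [z, Finset.sum_mul, Finset.mul_sum, MonoidAlgebra.of_apply,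
        MonoidAlgebra.single_mul_single, mul_one, one_mul]
      refine Fintype.sum_equiv (MulAut.conj g⁻¹).toEquiv _ _ fun a => ?_
      have := hf a g⁻¹
      simp only [MulEquiv.toEquiv_eq_coe, EquivLike.coe_coe, MulAut.conj_apply, inv_inv] at this ⊢
      rw [this]
      congr 1
      group
    | add x y hx hy => rw [mul_add, add_mul, hx, hy]
    | smul r x hx => rw [mul_smul_comm, smul_mul_assoc, hx]
  have key : ∀ m : Submodule ℂ[G] ℂ[G], IsSimpleModule ℂ[G] m → ∀ v ∈ m, z * v = 0 := by
    intro m hm v hv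
    have : FiniteDimensional ℂ m :=
      FiniteDimensional.finiteDimensional_submodule (m.restrictScalars ℂ)
    let T : End ℂ[G] m :=
      { toFun := fun v => z • v
        map_add' := fun a b => smul_add _ _ _
        map_smul' := fun r a => by
          rw [smul_smul, hz, mul_smul]; rfl }
    obtain ⟨c, hc⟩ := (IsSimpleModule.algebraMap_end_bijective_of_isAlgClosed (A := ℂ[G]) (V := m)
      ℂ).2 T
    have hc' : ∀ v : m, z • v = c • v := fun v => (LinearMap.congr_fun hc v).symm
    let ρ := Representation.ofModule' (k := ℂ) (G := G) m
    have hρ : ρ.IsIrreducible := isIrreducible_ofModule'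
    obtain ⟨W, hW, hWρ⟩ := mem_irrChars_of_irreducible ρ
    have h1 := h _ ⟨W, hW, rfl⟩
    simp only [← FDRep.char_inv_eq_conj] at h1
    rw [hWρ] at h1
    have h2 : ∑ g, f g • ρ g⁻¹ = c • (1 : End ℂ m) := by
      ext1 v
      rw [LinearMap.smul_apply, End.one_apply, ← hc', Finset.sum_smul, LinearMap.sum_apply]
      refine Finset.sum_congr rfl fun g _ => ?_
      rw [LinearMap.smul_apply]
      change f g • (MonoidAlgebra.single g⁻¹ (1 : ℂ) : ℂ[G]) • v = _
      rw [← smul_assoc, MonoidAlgebra.smul_single, smul_eq_mul, mul_one]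
    have h3 := congrArg (LinearMap.trace ℂ m) h2
    rw [map_sum, map_smul, LinearMap.trace_one, smul_eq_mul] at h3
    simp only [map_smul, smul_eq_mul] at h3
    change ∑ g, f g * ρ.character g⁻¹ = _ at h3
    rw [h1] at h3
    have hm0 : (finrank ℂ m : ℂ) ≠ 0 := by
      have : Nontrivial m := IsSimpleModule.nontrivial ℂ[G] m
      exact Nat.cast_ne_zero.2 (finrank_pos (R := ℂ) (M := m)).ne'
    have hc0 : c = 0 := (mul_eq_zero.1 h3.symm).resolve_right hm0
    have := hc' ⟨v, hv⟩
    rw [hc0, zero_smul] at this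
    exact congrArg Subtype.val this
  have htop : (⊤ : Submodule ℂ[G] ℂ[G]) ≤ LinearMap.ker (LinearMap.toSpanSingleton ℂ[G] ℂ[G] z) := by
    rw [← IsSemisimpleModule.sSup_simples_eq_top ℂ[G] ℂ[G]]
    refine sSup_le fun m hm v hv => ?_
    rw [LinearMap.mem_ker, LinearMap.toSpanSingleton_apply, smul_eq_mul, ← hz]
    exact key m hm v hv
  have hz0 : z = 0 := by
    have := htop (Submodule.mem_top (x := 1))
    rwa [LinearMap.mem_ker, LinearMap.toSpanSingleton_apply, one_smul] at this
  funext g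
  have := congrArg (fun x : ℂ[G] => x.coeff g⁻¹) hz0
  simp only [z, MonoidAlgebra.coeff_sum, MonoidAlgebra.coeff_single, Finset.sum_apply', MonoidAlgebra.coeff_zero, Finsupp.zero_apply] at this
  rw [Finset.sum_eq_single g] at this
  · rwa [Finsupp.single_eq_same] at this
  · intro b _ hb
    exact Finsupp.single_eq_of_ne fun h => hb (inv_injective h.symm)
  · simp

end Completeness

section IrrClasses

open Module
open scoped ComplexConjugate

section Generic

variable {G H : Type} [Group G] [Finite G] [Group H] [Finite H]

theorem mem_irrChars_of_norm {V : Type} [AddCommGroup V] [Module ℂ V] [FiniteDimensional ℂ V]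
    [Fintype G] (ρ : Representation ℂ G V)
    (h : (Nat.card G : ℂ)⁻¹ * ∑ g : G, ρ.character g * conj (ρ.character g) = 1) :
    ρ.character ∈ irrChars G := by
  refine ⟨FDRep.of ρ, ?_, rfl⟩
  rw [FDRep.simple_iff_char_is_norm_one]
  simp only [FDRep.char_inv_eq_conj]
  rw [inv_mul_eq_one₀ (Nat.cast_ne_zero.2 Nat.card_pos.ne')] at h
  exact h.symm

theorem irrChars_comp_mulEquiv (e : G ≃* H) {χ : H → ℂ} (hχ : χ ∈ irrChars H) :
    χ ∘ e ∈ irrChars G := by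
  classical
  have := Fintype.ofFinite G
  have := Fintype.ofFinite H
  have h1 := irrChars_orth hχ hχ
  rw [if_pos rfl] at h1
  obtain ⟨V, hV, rfl⟩ := hχ
  refine mem_irrChars_of_norm (V.ρ.comp e.toMonoidHom) ?_
  rw [← h1, Nat.card_congr e.toEquiv]
  congr 1
  exact Fintype.sum_equiv e.toEquiv _ _ fun g => rfl

theorem irrChars_conj_mul {χ : G → ℂ} (hχ : χ ∈ irrChars G) (g h : G) :
    χ (h * g * h⁻¹) = χ g := by
  obtain ⟨V, hV, rfl⟩ := hχ
  exact FDRep.char_conj V g h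

theorem irrChars_isIntegral {χ : G → ℂ} (hχ : χ ∈ irrChars G) (g : G) : IsIntegral ℤ (χ g) := by
  obtain ⟨V, hV, rfl⟩ := hχ
  exact FDRep.isIntegral_char V g

theorem irrChars_one_pos {χ : G → ℂ} (hχ : χ ∈ irrChars G) : ∃ d : ℕ, 0 < d ∧ χ 1 = d := by
  classical
  have := Fintype.ofFinite G
  have h1 := irrChars_orth hχ hχ
  rw [if_pos rfl] at h1
  obtain ⟨V, hV, rfl⟩ := hχ
  refine ⟨finrank ℂ V, ?_, FDRep.char_one V⟩
  by_contra h0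
  have h0 : finrank ℂ V = 0 := by omega
  have : Subsingleton V := finrank_zero_iff.1 h0
  have h2 : ∀ g, V.character g = 0 := fun g => by
    change LinearMap.trace ℂ V (V.ρ g) = 0
    rw [Subsingleton.elim (V.ρ g) 0, map_zero]
  simp [h2] at h1

theorem mem_irrChars_of_hom (θ : G →* ℂ) : (θ : G → ℂ) ∈ irrChars G := by
  have := Fintype.ofFinite G
  let ρ : Representation ℂ G ℂ := (algebraMap ℂ (End ℂ ℂ)).toMonoidHom.comp θ
  have hρ : ∀ g, ρ.character g = θ g := fun g => by
    change LinearMap.trace ℂ ℂ (algebraMap ℂ (End ℂ ℂ) (θ g)) = _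
    rw [Algebra.algebraMap_eq_smul_one, map_smul, LinearMap.trace_one]
    simp
  have h1 : ρ.character = θ := funext hρ
  rw [← h1]
  refine mem_irrChars_of_norm ρ ?_
  simp only [hρ]
  have h2 : ∀ g, θ g * conj (θ g) = 1 := fun g => by
    rw [Complex.mul_conj, Complex.normSq_eq_norm_sq]
    have : ‖θ g‖ = 1 := Complex.norm_eq_one_of_pow_eq_one (n := Nat.card G)
      (by rw [← map_pow, pow_card_eq_one', map_one]) Nat.card_pos.ne'
    rw [this]; simp
  simp only [h2, Finset.sum_const, Finset.card_univ, ← Nat.card_eq_fintype_card]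
  rw [nsmul_eq_mul, mul_one, inv_mul_cancel₀ (Nat.cast_ne_zero.2 Nat.card_pos.ne')]

end Generic

variable {k : Type} [Field k] [Finite k]
variable {V W Q U : Type} [AddCommGroup V] [Module k V] [AddCommGroup W] [Module k W]
  [AddCommGroup Q] [Module k Q] [Finite V] [Finite W] [Finite Q]

/-- Restriction of a function on classes to the general linear group. -/
noncomputable def res (V : Type) [AddCommGroup V] [Module k V] [Finite V] (f : EndClass k → ℂ) :
    (V ≃ₗ[k] V) → ℂ :=
  fun g => f (cls (g : V →ₗ[k] V))

/-- Irreducible characters of `GL_n(k)`, extended by zero. -/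
def Irr (k : Type) [Field k] [Finite k] (n : ℕ) : Set (EndClass k → ℂ) :=
  {f | (∀ ν, f ν ≠ 0 → ν.dim = n ∧ ν.det ≠ 0) ∧
    res (Fin n → k) f ∈ irrChars ((Fin n → k) ≃ₗ[k] (Fin n → k))}

theorem Irr.dim_eq {n : ℕ} {f : EndClass k → ℂ} (hf : f ∈ Irr k n) {ν : EndClass k}
    (h : f ν ≠ 0) : ν.dim = n := (hf.1 ν h).1

theorem Irr.det_ne {n : ℕ} {f : EndClass k → ℂ} (hf : f ∈ Irr k n) {ν : EndClass k}
    (h : f ν ≠ 0) : ν.det ≠ 0 := (hf.1 ν h).2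

theorem sum_end_eq_sum_equiv (F : EndClass k → ℂ) (hF : ∀ ν, F ν ≠ 0 → ν.det ≠ 0) :
    ∑ x : End k V, F (cls x) = ∑ g : V ≃ₗ[k] V, F (cls (g : V →ₗ[k] V)) := by
  symm
  refine Finset.sum_of_injOn (fun g : V ≃ₗ[k] V => (g : V →ₗ[k] V))
    (fun a _ b _ h => LinearEquiv.toLinearMap_injective h) (fun _ _ => Finset.mem_coe.2 (Finset.mem_univ _)) ?_ (fun _ _ => rfl)
  intro x _ hx
  by_contra h0
  have h1 := hF _ h0
  rw [det_cls] at h1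
  exact hx ⟨LinearEquiv.ofIsUnitDet (f := x) (v := finBasis k V) (v' := finBasis k V) (by
    rw [LinearMap.det_toMatrix]; exact isUnit_iff_ne_zero.2 h1), by simp, by ext; rfl⟩

theorem ip_eq_avg {n : ℕ} (hV : finrank k V = n) (f g : EndClass k → ℂ)
    (hf : ∀ ν, f ν ≠ 0 → ν.det ≠ 0) :
    ip n f g = (Nat.card (V ≃ₗ[k] V) : ℂ)⁻¹ * ∑ x : V ≃ₗ[k] V, res V f x * conj (res V g x) := by
  rw [ip, card_linearEquiv hV]
  congr 1
  rw [sum_end_eq (fun ν => f ν * conj (g ν)) (show finrank k (Fin n → k) = finrank k V by simp [hV]),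
    sum_end_eq_sum_equiv (fun ν => f ν * conj (g ν)) fun ν h => hf ν (left_ne_zero_of_mul h)]
  rfl

/-- Conjugation by a linear equivalence. -/
def linearEquivConj (e : V ≃ₗ[k] W) : (V ≃ₗ[k] V) ≃* (W ≃ₗ[k] W) where
  toFun g := (e.symm.trans g).trans e
  invFun g := (e.trans g).trans e.symm
  left_inv g := by ext; simp
  right_inv g := by ext; simp
  map_mul' g h := by ext; simp

theorem cls_linearEquivConj (e : V ≃ₗ[k] W) (g : V ≃ₗ[k] V) :
    cls (linearEquivConj e g : W →ₗ[k] W) = cls (g : V →ₗ[k] V) :=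
  cls_conj (g : V →ₗ[k] V) e

theorem res_mem_irrChars {n : ℕ} {f : EndClass k → ℂ} (hf : f ∈ Irr k n) (hV : finrank k V = n) :
    res V f ∈ irrChars (V ≃ₗ[k] V) := by
  have e : V ≃ₗ[k] (Fin n → k) := LinearEquiv.ofFinrankEq _ _ (by rw [hV, finrank_fin_fun])
  have := irrChars_comp_mulEquiv (linearEquivConj e) hf.2
  convert this using 1
  funext g
  exact congrArg f (cls_linearEquivConj e g).symm

theorem exists_equiv_of_det_ne {ν : EndClass k} (hd : ν.dim = finrank k V) (h : ν.det ≠ 0) :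
    ∃ g : V ≃ₗ[k] V, cls (g : V →ₗ[k] V) = ν := by
  obtain ⟨x, rfl⟩ := EndClass.exists_fin hd
  have e : (Fin (finrank k V) → k) ≃ₗ[k] V := LinearEquiv.ofFinrankEq _ _ (by simp)
  rw [← cls_conj x e] at h ⊢
  rw [det_cls] at h
  exact ⟨LinearEquiv.ofIsUnitDet (f := e.conj x) (v := finBasis k V) (v' := finBasis k V) (by
    rw [LinearMap.det_toMatrix]; exact isUnit_iff_ne_zero.2 h), congrArg cls (by ext; rfl)⟩

theorem det_cls_equiv_ne (g : V ≃ₗ[k] V) : (cls (g : V →ₗ[k] V)).det ≠ 0 := by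
  rw [det_cls]
  exact (LinearEquiv.isUnit_det' g).ne_zero

/-- A function supported on invertible classes of dimension `n` is determined by its restriction. -/
theorem eq_of_res_eq {n : ℕ} (hV : finrank k V = n) {f g : EndClass k → ℂ}
    (hf : ∀ ν, f ν ≠ 0 → ν.dim = n ∧ ν.det ≠ 0) (hg : ∀ ν, g ν ≠ 0 → ν.dim = n ∧ ν.det ≠ 0)
    (h : res V f = res V g) : f = g := by
  funext ν
  by_cases hν : ν.dim = n ∧ ν.det ≠ 0
  · obtain ⟨x, rfl⟩ := exists_equiv_of_det_ne (V := V) (hν.1.trans hV.symm) hν.2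
    exact congrFun h x
  · rw [not_not.1 (mt (hf ν) hν), not_not.1 (mt (hg ν) hν)]

theorem exists_supported {n : ℕ} (hV : finrank k V = n) (χ : (V ≃ₗ[k] V) → ℂ)
    (hχ : ∀ g h, χ (h * g * h⁻¹) = χ g) :
    ∃ f : EndClass k → ℂ, (∀ ν, f ν ≠ 0 → ν.dim = n ∧ ν.det ≠ 0) ∧ res V f = χ := by
  classical
  refine ⟨fun ν => if h : ∃ g : V ≃ₗ[k] V, cls (g : V →ₗ[k] V) = ν then χ h.choose else 0, ?_, ?_⟩
  · intro ν hν
    by_cases h : ∃ g : V ≃ₗ[k] V, cls (g : V →ₗ[k] V) = ν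
    · obtain ⟨g, rfl⟩ := h
      exact ⟨by simp [hV], det_cls_equiv_ne g⟩
    · simp only [dif_neg h, ne_eq, not_true_eq_false] at hν
  · funext g
    have h : ∃ g' : V ≃ₗ[k] V, cls (g' : V →ₗ[k] V) = cls (g : V →ₗ[k] V) := ⟨g, rfl⟩
    change (if h : _ then _ else _) = _
    rw [dif_pos h]
    obtain ⟨e, he⟩ := cls_eq_iff.1 h.choose_spec
    rw [← hχ _ e]
    congr 1
    rw [mul_inv_eq_iff_eq_mul]
    ext v
    exact he v

theorem exists_mem_Irr {n : ℕ} (hV : finrank k V = n) {χ : (V ≃ₗ[k] V) → ℂ}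
    (hχ : χ ∈ irrChars (V ≃ₗ[k] V)) : ∃ f ∈ Irr k n, res V f = χ := by
  obtain ⟨f, hf, rfl⟩ := exists_supported hV χ fun g h => irrChars_conj_mul hχ g h
  refine ⟨f, ⟨hf, ?_⟩, rfl⟩
  have e : (Fin n → k) ≃ₗ[k] V := LinearEquiv.ofFinrankEq _ _ (by rw [hV, finrank_fin_fun])
  have := irrChars_comp_mulEquiv (linearEquivConj e) hχ
  convert this using 1
  funext g
  exact congrArg f (cls_linearEquivConj e g).symm

theorem ip_Irr {n : ℕ} {χ ψ : EndClass k → ℂ} (hχ : χ ∈ Irr k n) (hψ : ψ ∈ Irr k n)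
    [Decidable (χ = ψ)] : ip n χ ψ = if χ = ψ then 1 else 0 := by
  classical
  rw [ip_eq_avg (V := Fin n → k) (by simp) χ ψ fun ν h => Irr.det_ne hχ h, irrChars_orth hχ.2 hψ.2]
  refine if_congr ⟨fun h => ?_, fun h => h ▸ rfl⟩ rfl rfl
  exact eq_of_res_eq (V := Fin n → k) (by simp) hχ.1 hψ.1 h

theorem eq_zero_of_forall_Irr {n : ℕ} {f : EndClass k → ℂ}
    (hf : ∀ ν, f ν ≠ 0 → ν.dim = n ∧ ν.det ≠ 0) (h : ∀ χ ∈ Irr k n, ip n f χ = 0) : f = 0 := by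
  refine eq_of_res_eq (V := Fin n → k) (n := n) (by simp) hf (fun ν h => absurd rfl h) ?_
  have h0 : res (Fin n → k) (0 : EndClass k → ℂ) = 0 := rfl
  rw [h0]
  refine eq_zero_of_forall_irrChars _ (fun g h => ?_) fun χ hχ => ?_
  · exact congrArg f (cls_linearEquivConj h g)
  · obtain ⟨ψ, hψ, rfl⟩ := exists_mem_Irr (n := n) (by simp) hχ
    have := h ψ hψ
    rw [ip_eq_avg (V := Fin n → k) (by simp) f ψ fun ν h => (hf ν h).2, mul_eq_zero] at this
    exact this.resolve_left (inv_ne_zero (Nat.cast_ne_zero.2 Nat.card_pos.ne'))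

theorem Irr.isIntegral {n : ℕ} {χ : EndClass k → ℂ} (hχ : χ ∈ Irr k n) (ν : EndClass k) :
    IsIntegral ℤ (χ ν) := by
  by_cases h : χ ν = 0
  · rw [h]; exact isIntegral_zero
  · obtain ⟨g, rfl⟩ := exists_equiv_of_det_ne (V := Fin n → k) (by simpa using Irr.dim_eq hχ h) (Irr.det_ne hχ h)
    exact irrChars_isIntegral hχ.2 g

theorem Irr.one_pos {n : ℕ} {χ : EndClass k → ℂ} (hχ : χ ∈ Irr k n) (hV : finrank k V = n) :
    ∃ d : ℕ, 0 < d ∧ χ (cls (1 : End k V)) = d :=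
  irrChars_one_pos (res_mem_irrChars hχ hV)

theorem mulChar_mem_Irr (θ : MulChar k ℂ) (n : ℕ) [∀ ν : EndClass k, Decidable (ν.dim = n)] :
    (fun ν : EndClass k => if ν.dim = n then θ ν.det else 0) ∈ Irr k n := by
  constructor
  · intro ν h
    beta_reduce at h
    split_ifs at h with h1
    · refine ⟨h1, fun h2 => h ?_⟩
      rw [h2]; exact θ.map_nonunit not_isUnit_zero
    · exact absurd rfl h
  · let φ : ((Fin n → k) ≃ₗ[k] (Fin n → k)) →* ℂ :=
      { toFun := fun g => θ (LinearMap.det (g : (Fin n → k) →ₗ[k] (Fin n → k)))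
        map_one' := by
          change θ (LinearMap.det LinearMap.id) = 1
          rw [LinearMap.det_id, map_one]
        map_mul' := fun g h => by
          rw [← map_mul, ← map_mul]; rfl }
    convert mem_irrChars_of_hom φ using 1
    funext g
    change (if _ then _ else _) = _
    rw [if_pos (by simp), det_cls]
    rfl

end IrrClasses

section Expansion

open Module
open scoped ComplexConjugate

variable {k : Type} [Field k] [Finite k]
variable {V W Q U : Type} [AddCommGroup V] [Module k V] [AddCommGroup W] [Module k W]
  [AddCommGroup Q] [Module k Q] [Finite V] [Finite W] [Finite Q]

theorem ip_sum_smul_Irr {n : ℕ} (s : Finset (Irr k n)) (g : Irr k n → ℂ) {ψ : Irr k n}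
    [Decidable (ψ ∈ s)] :
    ip n (∑ χ ∈ s, g χ • χ.1) ψ.1 = if ψ ∈ s then g ψ else 0 := by
  classical
  rw [ip_sum_left]
  simp only [ip_smul_left, ip_Irr (Subtype.property _) ψ.2, Subtype.coe_inj]
  simp

theorem linearIndependent_res (n : ℕ) :
    LinearIndependent ℂ fun χ : Irr k n => res (Fin n → k) χ.1 := by
  classical
  rw [linearIndependent_iff']
  intro s g h i hi
  have h1 := ip_sum_smul_Irr s g (ψ := i)
  rw [if_pos hi] at h1
  rw [← h1, ip_eq_avg (V := Fin n → k) (by simp)]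
  · have h2 : res (Fin n → k) (∑ χ ∈ s, g χ • χ.1) = ∑ χ ∈ s, g χ • res (Fin n → k) χ.1 := by
      funext x
      simp [res, Finset.sum_apply]
    rw [h2, h]
    simp
  · intro ν h0
    simp only [Finset.sum_apply, Pi.smul_apply] at h0
    obtain ⟨χ, _, hχ⟩ := Finset.exists_ne_zero_of_sum_ne_zero h0
    exact Irr.det_ne χ.2 (right_ne_zero_of_mul hχ)

instance finite_Irr (n : ℕ) : Finite (Irr k n) :=
  (linearIndependent_res n).finite

noncomputable instance fintype_Irr (n : ℕ) : Fintype (Irr k n) := Fintype.ofFinite _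

theorem eq_sum_Irr {n : ℕ} {f : EndClass k → ℂ} (hf : ∀ ν, f ν ≠ 0 → ν.dim = n ∧ ν.det ≠ 0) :
    f = ∑ χ : Irr k n, ip n f χ.1 • χ.1 := by
  classical
  rw [← sub_eq_zero]
  refine eq_zero_of_forall_Irr (n := n) (fun ν h => ?_) fun ψ hψ => ?_
  · by_contra h1
    apply h
    rw [Pi.sub_apply, Finset.sum_apply, not_not.1 (mt (hf ν) h1), zero_sub, neg_eq_zero]
    refine Finset.sum_eq_zero fun χ _ => ?_
    rw [Pi.smul_apply, not_not.1 (mt (χ.2.1 ν) h1), smul_zero]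
  · rw [ip_sub_left, ip_sum_smul_Irr _ _ (ψ := ⟨ψ, hψ⟩), if_pos (Finset.mem_univ _), sub_self]

/-- The order of the automorphism group of a class. -/
noncomputable def cent (ν : EndClass k) : ℕ :=
  Nat.card {e : (Fin ν.rep.1 → k) ≃ₗ[k] (Fin ν.rep.1 → k) // ∀ v, e (ν.rep.2 v) = ν.rep.2 (e v)}

theorem cent_cls (x : End k V) : cent (cls x) = Nat.card {e : V ≃ₗ[k] V // ∀ v, e (x v) = x (e v)} := by
  obtain ⟨f, hf⟩ := EndClass.exists_rep x
  refine (Nat.card_congr ((linearEquivConj f).toEquiv.subtypeEquiv fun e => ?_)).symm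
  change _ ↔ ∀ v, f (e (f.symm ((cls x).rep.2 v))) = (cls x).rep.2 (f (e (f.symm v)))
  constructor
  · intro h v
    rw [← hf, ← h]
    congr 2
    rw [f.symm_apply_eq, hf, f.apply_symm_apply]
  · intro h v
    have := h (f v)
    rw [← hf, ← hf, f.symm_apply_apply, f.symm_apply_apply] at this
    exact f.injective this

theorem cent_ne_zero (ν : EndClass k) : cent ν ≠ 0 := by
  have : Nonempty {e : (Fin ν.rep.1 → k) ≃ₗ[k] (Fin ν.rep.1 → k) //
    ∀ v, e (ν.rep.2 v) = ν.rep.2 (e v)} := ⟨⟨LinearEquiv.refl _ _, fun _ => rfl⟩⟩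
  exact Nat.card_pos.ne'

theorem card_class_mul_cent (x : End k V) :
    Nat.card {y : End k V // cls y = cls x} * cent (cls x) = Nat.card (V ≃ₗ[k] V) := by
  have h1 : Nat.card (V ≃ₗ[k] V) = Nat.card (Σ y : {y : End k V // cls y = cls x},
      {e : V ≃ₗ[k] V // ∀ v, e (x v) = y.1 (e v)}) := by
    refine Nat.card_congr ⟨fun e => ⟨⟨e.conj x, cls_conj x e⟩, e, fun v => by
      rw [LinearEquiv.conj_apply_apply, e.symm_apply_apply]⟩, fun p => p.2.1, fun e => rfl, ?_⟩
    rintro ⟨⟨y, hy⟩, e, he⟩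
    have : e.conj x = y := LinearMap.ext fun v => by
      rw [LinearEquiv.conj_apply_apply, he, e.apply_symm_apply]
    subst this
    rfl
  have h2 : ∀ y : {y : End k V // cls y = cls x},
      Nat.card {e : V ≃ₗ[k] V // ∀ v, e (x v) = y.1 (e v)} = cent (cls x) := by
    rintro ⟨y, hy⟩
    rw [cent_cls]
    obtain ⟨f, hf⟩ := cls_eq_iff.1 hy
    refine Nat.card_congr ⟨fun e => ⟨e.1.trans f, fun v => ?_⟩,
      fun e => ⟨e.1.trans f.symm, fun v => ?_⟩, fun e => ?_, fun e => ?_⟩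
    · simp only [LinearEquiv.trans_apply]
      rw [e.2, hf]
    · simp only [LinearEquiv.trans_apply]
      rw [e.2, f.symm_apply_eq, hf, f.apply_symm_apply]
    · ext; simp
    · ext; simp
  have := Fintype.ofFinite {y : End k V // cls y = cls x}
  rw [h1, Nat.card_sigma]
  simp only [h2]
  rw [Finset.sum_const, Finset.card_univ, smul_eq_mul, Nat.card_eq_fintype_card]

instance finite_dimClass (n : ℕ) : Finite {ν : EndClass k // ν.dim = n} :=
  Finite.of_surjective (fun x : End k (Fin n → k) => ⟨cls x, by simp⟩) fun ν => by
    obtain ⟨x, hx⟩ := EndClass.exists_fin ν.2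
    exact ⟨x, Subtype.ext hx⟩

noncomputable instance fintype_dimClass (n : ℕ) : Fintype {ν : EndClass k // ν.dim = n} :=
  Fintype.ofFinite _

instance finite_invClass (n : ℕ) : Finite {ν : EndClass k // ν.dim = n ∧ ν.det ≠ 0} :=
  Finite.of_injective (β := {ν : EndClass k // ν.dim = n}) (fun ν => ⟨ν.1, ν.2.1⟩)
    fun _ _ h => Subtype.ext (congrArg Subtype.val h :)

noncomputable instance fintype_invClass (n : ℕ) : Fintype {ν : EndClass k // ν.dim = n ∧ ν.det ≠ 0} :=
  Fintype.ofFinite _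

theorem ip_eq_sum_dimClass (n : ℕ) (f g : EndClass k → ℂ) :
    ip n f g = ∑ ν : {ν : EndClass k // ν.dim = n}, (cent ν.1 : ℂ)⁻¹ * (f ν.1 * conj (g ν.1)) := by
  classical
  rw [ip, Finset.mul_sum, ← Finset.sum_fiberwise (g := fun x : End k (Fin n → k) =>
    (⟨cls x, by simp⟩ : {ν : EndClass k // ν.dim = n}))]
  refine Finset.sum_congr rfl fun ν _ => ?_
  obtain ⟨x, hx⟩ := EndClass.exists_fin ν.2
  have h1 := card_class_mul_cent x
  rw [hx] at h1
  rw [Finset.sum_congr rfl (g := fun _ => (glCard k n : ℂ)⁻¹ * (f ν.1 * conj (g ν.1)))]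
  · rw [Finset.sum_const, nsmul_eq_mul, ← mul_assoc]
    congr 1
    have h2 : (Finset.univ.filter fun y : End k (Fin n → k) =>
        (⟨cls y, by simp⟩ : {ν : EndClass k // ν.dim = n}) = ν).card =
        Nat.card {y : End k (Fin n → k) // cls y = ν.1} := by
      rw [Nat.card_eq_fintype_card, Fintype.card_subtype]
      congr 1
      ext y
      simp [Subtype.ext_iff]
    rw [h2, glCard, ← h1, Nat.cast_mul]
    have h3 : (cent ν.1 : ℂ) ≠ 0 := Nat.cast_ne_zero.2 (cent_ne_zero _)
    have h4 : (Nat.card {y : End k (Fin n → k) // cls y = ν.1} : ℂ) ≠ 0 := by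
      have : Nonempty {y : End k (Fin n → k) // cls y = ν.1} := ⟨⟨x, hx⟩⟩
      exact Nat.cast_ne_zero.2 Nat.card_pos.ne'
    field_simp
  · intro y hy
    have := congrArg Subtype.val (Finset.mem_filter.1 hy).2
    simp only at this
    rw [this]

theorem ip_eq_sum_invClass (n : ℕ) (f g : EndClass k → ℂ) (hf : ∀ ν, f ν ≠ 0 → ν.det ≠ 0) :
    ip n f g = ∑ ν : {ν : EndClass k // ν.dim = n ∧ ν.det ≠ 0},
      (cent ν.1 : ℂ)⁻¹ * (f ν.1 * conj (g ν.1)) := by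
  rw [ip_eq_sum_dimClass]
  symm
  refine Finset.sum_of_injOn (fun ν => ⟨ν.1, ν.2.1⟩)
    (fun a _ b _ h => Subtype.ext (congrArg Subtype.val h :))
    (fun _ _ => Finset.mem_coe.2 (Finset.mem_univ _)) (fun ν _ h => ?_) fun _ _ => rfl
  by_contra h0
  exact h ⟨⟨ν.1, ν.2, hf _ (left_ne_zero_of_mul (right_ne_zero_of_mul h0))⟩, by simp, rfl⟩

theorem sum_Irr_mul_conj {n : ℕ} {ν : EndClass k} (hν : ν.dim = n) (hd : ν.det ≠ 0) :
    ∑ χ : Irr k n, χ.1 ν * conj (χ.1 ν) = cent ν := by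
  classical
  let f : EndClass k → ℂ := fun μ => if μ = ν then 1 else 0
  have hf : ∀ μ, f μ ≠ 0 → μ.dim = n ∧ μ.det ≠ 0 := by
    intro μ h
    by_cases h1 : μ = ν
    · exact h1 ▸ ⟨hν, hd⟩
    · simp [f, h1] at h
  have h1 : ∀ χ : Irr k n, ip n f χ.1 = (cent ν : ℂ)⁻¹ * conj (χ.1 ν) := by
    intro χ
    rw [ip_eq_sum_dimClass, Fintype.sum_eq_single ⟨ν, hν⟩]
    · simp [f]
    · intro μ hμ
      have : μ.1 ≠ ν := fun h => hμ (Subtype.ext h)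
      simp [f, this]
  have h2 := congrFun (eq_sum_Irr hf) ν
  simp only [h1, Finset.sum_apply, Pi.smul_apply, smul_eq_mul] at h2
  have h3 : f ν = 1 := if_pos rfl
  have h4 : (cent ν : ℂ) ≠ 0 := Nat.cast_ne_zero.2 (cent_ne_zero _)
  rw [h3] at h2
  simp only [mul_assoc, ← Finset.mul_sum] at h2
  field_simp at h2
  rw [h2]
  exact Finset.sum_congr rfl fun χ _ => mul_comm _ _

theorem card_Irr (n : ℕ) : Nat.card (Irr k n) = Nat.card {ν : EndClass k // ν.dim = n ∧ ν.det ≠ 0} := by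
  classical
  have h1 : ∑ χ : Irr k n, ip n χ.1 χ.1 = (Nat.card (Irr k n) : ℂ) := by
    simp only [ip_Irr (Subtype.property _) (Subtype.property _), if_true, Finset.sum_const,
      Finset.card_univ, nsmul_eq_mul, mul_one, Nat.card_eq_fintype_card]
  have h2 : ∀ χ : Irr k n, ip n χ.1 χ.1 = ∑ ν : {ν : EndClass k // ν.dim = n ∧ ν.det ≠ 0},
      (cent ν.1 : ℂ)⁻¹ * (χ.1 ν.1 * conj (χ.1 ν.1)) := fun χ =>
    ip_eq_sum_invClass n _ _ fun ν h => Irr.det_ne χ.2 h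
  simp only [h2] at h1
  rw [Finset.sum_comm] at h1
  simp only [← Finset.mul_sum] at h1
  rw [Finset.sum_congr rfl (g := fun _ => 1)] at h1
  · rw [Finset.sum_const, Finset.card_univ, nsmul_eq_mul, mul_one, Nat.cast_inj] at h1
    rw [← h1, Nat.card_eq_fintype_card]
  · intro ν _
    rw [sum_Irr_mul_conj ν.2.1 ν.2.2, inv_mul_cancel₀ (Nat.cast_ne_zero.2 (cent_ne_zero _))]

end Expansion

section Nonneg

open Module
open scoped ComplexConjugate

variable {k : Type} [Field k] {W Q : Type} [AddCommGroup W] [Module k W]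
  [AddCommGroup Q] [Module k Q]

/-- Block upper triangular automorphisms. -/
def blkEquiv (a : W ≃ₗ[k] W) (c : Q →ₗ[k] W) (y : Q ≃ₗ[k] Q) : (W × Q) ≃ₗ[k] (W × Q) :=
  { blk (a : W →ₗ[k] W) c (y : Q →ₗ[k] Q) with
    invFun := fun v => (a.symm (v.1 - c (y.symm v.2)), y.symm v.2)
    left_inv := fun v => by simp
    right_inv := fun v => by simp }

@[simp] theorem blkEquiv_apply (a : W ≃ₗ[k] W) (c : Q →ₗ[k] W) (y : Q ≃ₗ[k] Q) (v : W × Q) :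
    blkEquiv a c y v = (a v.1 + c v.2, y v.2) := rfl

/-- The parabolic subgroup together with its two projections. -/
def parabolic (k W Q : Type) [Field k] [AddCommGroup W] [Module k W] [AddCommGroup Q] [Module k Q] :
    Subgroup ((W ≃ₗ[k] W) × (Q ≃ₗ[k] Q) × ((W × Q) ≃ₗ[k] (W × Q))) where
  carrier := {t | (∀ w, t.2.2 (w, 0) = (t.1 w, 0)) ∧ ∀ v, (t.2.2 v).2 = t.2.1 v.2}
  mul_mem' := by
    rintro ⟨a, y, g⟩ ⟨a', y', g'⟩ ⟨h1, h2⟩ ⟨h1', h2'⟩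
    simp only [Set.mem_ofPred_eq, Prod.mk_mul_mk, LinearEquiv.mul_apply] at *
    exact ⟨fun w => by rw [h1', h1], fun v => by rw [h2, h2']⟩
  one_mem' := ⟨fun w => rfl, fun v => rfl⟩
  inv_mem' := by
    rintro ⟨a, y, g⟩ ⟨h1, h2⟩
    refine ⟨fun w => ?_, fun v => ?_⟩
    · change g.symm (w, 0) = (a.symm w, 0)
      rw [g.symm_apply_eq]
      exact (by rw [h1]; simp)
    · change (g.symm v).2 = y.symm v.2
      rw [LinearEquiv.eq_symm_apply]
      rw [← h2]
      simp

/-- Coordinates on the parabolic subgroup. -/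
def parabolicEquiv (k W Q : Type) [Field k] [AddCommGroup W] [Module k W] [AddCommGroup Q]
    [Module k Q] : (W ≃ₗ[k] W) × (Q ≃ₗ[k] Q) × (Q →ₗ[k] W) ≃ parabolic k W Q where
  toFun t := ⟨(t.1, t.2.1, blkEquiv t.1 t.2.2 t.2.1), fun w => by simp, fun v => by simp⟩
  invFun p := (p.1.1, p.1.2.1, LinearMap.fst k W Q ∘ₗ (p.1.2.2 : (W × Q) →ₗ[k] (W × Q)) ∘ₗ
    LinearMap.inr k W Q)
  left_inv t := by
    refine Prod.ext rfl (Prod.ext rfl ?_)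
    ext v
    simp
  right_inv p := by
    obtain ⟨⟨a, y, g⟩, h1, h2⟩ := p
    simp only at h1 h2
    refine Subtype.ext (Prod.ext rfl (Prod.ext rfl ?_))
    refine LinearEquiv.ext fun v => ?_
    have hv : v = (v.1, 0) + (0, v.2) := by simp
    refine Prod.ext ?_ ?_
    · conv_rhs => rw [hv, map_add, h1]
      simp
    · simp [h2]

variable [Finite k] [Finite W] [Finite Q]

theorem exists_nat_avg_parabolic {ρ : (W ≃ₗ[k] W) → ℂ} {ρ' : (Q ≃ₗ[k] Q) → ℂ}
    {χ : ((W × Q) ≃ₗ[k] (W × Q)) → ℂ} (hρ : ρ ∈ irrChars _) (hρ' : ρ' ∈ irrChars _)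
    (hχ : χ ∈ irrChars _) :
    ∃ n : ℕ, ((Nat.card (W ≃ₗ[k] W) : ℂ) * Nat.card (Q ≃ₗ[k] Q) * Nat.card (Q →ₗ[k] W))⁻¹ *
      ∑ a, ∑ y, ∑ c, ρ a * ρ' y * conj (χ (blkEquiv a c y)) = n := by
  obtain ⟨X, -, rfl⟩ := hρ
  obtain ⟨Y, -, rfl⟩ := hρ'
  obtain ⟨Z, -, rfl⟩ := hχ
  let P := parabolic k W Q
  have : Fintype P := Fintype.ofFinite _
  let r1 : Representation ℂ P X := X.ρ.comp ((MonoidHom.fst _ _).comp P.subtype)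
  let r2 : Representation ℂ P Y := Y.ρ.comp (((MonoidHom.fst _ _).comp (MonoidHom.snd _ _)).comp P.subtype)
  let r3 : Representation ℂ P Z := Z.ρ.comp (((MonoidHom.snd _ _).comp (MonoidHom.snd _ _)).comp P.subtype)
  obtain ⟨n, hn⟩ := exists_nat_avg ((r1.tprod r2).tprod r3.dual)
  refine ⟨n, ?_⟩
  rw [← hn]
  congr 1
  · rw [← Nat.card_congr (parabolicEquiv k W Q), Nat.card_prod, Nat.card_prod]
    push_cast
    rw [mul_assoc]
  · rw [← (parabolicEquiv k W Q).sum_comp, Fintype.sum_prod_type]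
    refine Finset.sum_congr rfl fun a _ => ?_
    rw [Fintype.sum_prod_type]
    refine Finset.sum_congr rfl fun y _ => Finset.sum_congr rfl fun c _ => ?_
    rw [Representation.char_tensor, Representation.char_tensor, Pi.mul_apply, Pi.mul_apply,
      Representation.char_dual]
    rw [← FDRep.char_inv_eq_conj]
    rfl

theorem ip_hmul_Irr {m d : ℕ} {ρ ρ' χ : EndClass k → ℂ} (hρ : ρ ∈ Irr k m) (hρ' : ρ' ∈ Irr k d)
    (hχ : χ ∈ Irr k (m + d)) :
    ∃ N : ℕ, ip (m + d) (hmul m fun α ν => ρ α * ρ' ν) χ = N := by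
  obtain ⟨N, hN⟩ := exists_nat_avg_parabolic (k := k) hρ.2 hρ'.2
    (res_mem_irrChars (V := (Fin m → k) × (Fin d → k)) hχ (by simp))
  refine ⟨N, ?_⟩
  rw [← hN, ip_hmul]
  simp only [mul_inv, mul_assoc, ← Finset.mul_sum]
  rw [← card_linearEquiv (k := k) (V := Fin m → k) (by simp),
    ← card_linearEquiv (k := k) (V := Fin d → k) (by simp)]
  congr 2
  have h1 : ∀ (x : End k (Fin m → k)), ∑ y : End k (Fin d → k),
      ρ' (cls y) * conj (jac χ (cls x) (cls y)) = ∑ y : (Fin d → k) ≃ₗ[k] (Fin d → k),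
        ρ' (cls (y : (Fin d → k) →ₗ[k] _)) * conj (jac χ (cls x) (cls (y : (Fin d → k) →ₗ[k] _))) :=
    fun x => sum_end_eq_sum_equiv (fun ν => ρ' ν * conj (jac χ (cls x) ν)) fun ν h =>
      Irr.det_ne hρ' (left_ne_zero_of_mul h)
  simp only [h1]
  rw [sum_end_eq_sum_equiv (V := Fin m → k) (fun α => ρ α * ∑ y : (Fin d → k) ≃ₗ[k] (Fin d → k),
    (ρ' (cls (y : (Fin d → k) →ₗ[k] _)) * conj (jac χ α (cls (y : (Fin d → k) →ₗ[k] _))))) fun ν h =>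
      Irr.det_ne hρ (left_ne_zero_of_mul h), Finset.mul_sum]
  refine Finset.sum_congr rfl fun a _ => ?_
  rw [mul_left_comm]
  change ρ _ * _ = ρ _ * _
  congr 1
  rw [Finset.mul_sum]
  refine Finset.sum_congr rfl fun y _ => ?_
  rw [jac_cls, map_mul, map_inv₀, Complex.conj_natCast, map_sum, mul_left_comm]
  rfl

end Nonneg

section VirtualCharacters

open Module
open scoped ComplexConjugate

variable {k : Type} [Field k] [Finite k] {n m d : ℕ}

/-- Functions supported on the invertible classes of dimension `n`. -/
def Supp (n : ℕ) (f : EndClass k → ℂ) : Prop := ∀ ν, f ν ≠ 0 → ν.dim = n ∧ ν.det ≠ 0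

/-- Integral combinations of irreducible characters. -/
def IsVirt (n : ℕ) (f : EndClass k → ℂ) : Prop :=
  Supp n f ∧ ∀ χ ∈ Irr k n, ∃ z : ℤ, ip n f χ = z

/-- Nonnegative integral combinations of irreducible characters. -/
def IsChar (n : ℕ) (f : EndClass k → ℂ) : Prop :=
  Supp n f ∧ ∀ χ ∈ Irr k n, ∃ z : ℕ, ip n f χ = z

theorem Supp.sum {ι : Type*} (s : Finset ι) {f : ι → EndClass k → ℂ} (c : ι → ℂ)
    (h : ∀ i ∈ s, Supp n (f i)) : Supp n (∑ i ∈ s, c i • f i) := by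
  intro ν hν
  simp only [Finset.sum_apply, Pi.smul_apply] at hν
  obtain ⟨i, hi, h1⟩ := Finset.exists_ne_zero_of_sum_ne_zero hν
  exact h i hi ν (right_ne_zero_of_mul h1)

theorem IsChar.isVirt {f : EndClass k → ℂ} (h : IsChar n f) : IsVirt n f :=
  ⟨h.1, fun χ hχ => by
    obtain ⟨z, hz⟩ := h.2 χ hχ
    exact ⟨z, by rw [hz]; rfl⟩⟩

theorem isChar_of_mem_Irr {χ : EndClass k → ℂ} (h : χ ∈ Irr k n) : IsChar n χ := by
  classical
  refine ⟨h.1, fun ψ hψ => ?_⟩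
  rw [ip_Irr h hψ]
  split_ifs
  · exact ⟨1, by simp⟩
  · exact ⟨0, by simp⟩

theorem IsVirt.sum {ι : Type*} (s : Finset ι) {f : ι → EndClass k → ℂ} (c : ι → ℤ)
    (h : ∀ i ∈ s, IsVirt n (f i)) : IsVirt n (∑ i ∈ s, (c i : ℂ) • f i) := by
  refine ⟨Supp.sum s _ fun i hi => (h i hi).1, fun χ hχ => ?_⟩
  have h1 : ∀ i, ∃ z : ℤ, i ∈ s → ip n (f i) χ = z := fun i => by
    by_cases hi : i ∈ s
    · obtain ⟨z, hz⟩ := (h i hi).2 χ hχ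
      exact ⟨z, fun _ => hz⟩
    · exact ⟨0, fun h => absurd h hi⟩
  choose z hz using h1
  refine ⟨∑ i ∈ s, c i * z i, ?_⟩
  rw [ip_sum_left]
  push_cast
  exact Finset.sum_congr rfl fun i hi => by rw [ip_smul_left, hz i hi]

theorem ip_eq_sum_Irr {f : EndClass k → ℂ} (hf : Supp n f) (g : EndClass k → ℂ) :
    ip n f g = ∑ χ : Irr k n, ip n f χ.1 * ip n χ.1 g := by
  conv_lhs => rw [eq_sum_Irr hf]
  rw [ip_sum_left]
  exact Finset.sum_congr rfl fun χ _ => ip_smul_left _ _ _ _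

theorem IsChar.ip_nat {f g : EndClass k → ℂ} (hf : IsChar n f) (hg : IsChar n g) :
    ∃ z : ℕ, ip n f g = z := by
  choose a ha using hf.2
  choose b hb using hg.2
  refine ⟨∑ χ : Irr k n, a χ.1 χ.2 * b χ.1 χ.2, ?_⟩
  rw [ip_eq_sum_Irr hf.1]
  push_cast
  refine Finset.sum_congr rfl fun χ _ => ?_
  rw [ha _ χ.2, ← ip_conj, hb _ χ.2, Complex.conj_natCast]

theorem mem_Irr_of_ip_self {f : EndClass k → ℂ} (hf : IsVirt n f) (h1 : ip n f f = 1)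
    (hpos : 0 < (f (cls (1 : End k (Fin n → k)))).re) : f ∈ Irr k n := by
  classical
  choose a ha using hf.2
  have h2 : ∑ χ : Irr k n, a χ.1 χ.2 ^ 2 = 1 := by
    rw [ip_eq_sum_Irr hf.1] at h1
    have h3 : ((∑ χ : Irr k n, a χ.1 χ.2 ^ 2 : ℤ) : ℂ) = ((1 : ℤ) : ℂ) := by
      push_cast
      rw [← h1]
      refine Finset.sum_congr rfl fun χ _ => ?_
      rw [← ip_conj n f, ha _ χ.2, map_intCast, sq]
    exact_mod_cast h3
  obtain ⟨χ, _, hχ⟩ := Finset.exists_ne_zero_of_sum_ne_zero (h2.trans_ne one_ne_zero)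
  have h4 : a χ.1 χ.2 ^ 2 = 1 ∧ ∀ ψ : Irr k n, ψ ≠ χ → a ψ.1 ψ.2 = 0 := by
    rw [Fintype.sum_eq_add_sum_compl χ] at h2
    have h5 : 0 < a χ.1 χ.2 ^ 2 := lt_of_le_of_ne (sq_nonneg _) (Ne.symm hχ)
    have h6 : 0 ≤ ∑ ψ ∈ {χ}ᶜ, a ψ.1 ψ.2 ^ 2 := Finset.sum_nonneg fun _ _ => sq_nonneg _
    refine ⟨by omega, fun ψ hψ => ?_⟩
    have h7 : ∑ ψ ∈ {χ}ᶜ, a ψ.1 ψ.2 ^ 2 = 0 := by omega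
    have := (Finset.sum_eq_zero_iff_of_nonneg fun _ _ => sq_nonneg _).1 h7 ψ (by simpa using hψ)
    exact pow_eq_zero_iff two_ne_zero |>.1 this
  have h5 : f = (a χ.1 χ.2 : ℂ) • χ.1 := by
    conv_lhs => rw [eq_sum_Irr hf.1]
    rw [Fintype.sum_eq_single χ]
    · rw [ha _ χ.2]
    · intro ψ hψ
      rw [ha _ ψ.2, h4.2 ψ hψ, Int.cast_zero, zero_smul]
  rcases (by simpa using h4.1 : a χ.1 χ.2 = 1 ∨ a χ.1 χ.2 = -1) with h6 | h6
  · rw [h5, h6, Int.cast_one, one_smul]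
    exact χ.2
  · exfalso
    obtain ⟨D, hD, hD'⟩ := Irr.one_pos χ.2 (V := Fin n → k) (by simp)
    rw [h5, h6, Pi.smul_apply, hD'] at hpos
    simp at hpos
    linarith [hD, (Nat.cast_nonneg D : (0:ℝ) ≤ D)]

theorem dim_subCls {V : Type} [AddCommGroup V] [Module k V] [Finite V] {x : End k V}
    {S : Submodule k V} (h : S ≤ S.comap x) : (subCls x S).dim = finrank k S := by
  rw [subCls, dif_pos h, dim_cls]

theorem supp_hmul {F : EndClass k → EndClass k → ℂ}
    (hF : ∀ α ν, F α ν ≠ 0 → α.det ≠ 0 ∧ ν.dim = d ∧ ν.det ≠ 0) : Supp (m + d) (hmul m F) := by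
  classical
  intro ν hν
  rw [hmul] at hν
  obtain ⟨S, _, hS⟩ := Finset.exists_ne_zero_of_sum_ne_zero hν
  rw [ite_ne_right_iff] at hS
  obtain ⟨⟨h1, h2⟩, h3⟩ := hS
  obtain ⟨h4, h5, h6⟩ := hF _ _ h3
  rw [subCls, dif_pos h1, det_cls] at h4
  rw [quoCls, dif_pos h1, dim_cls] at h5
  rw [quoCls, dif_pos h1, det_cls] at h6
  rw [← ν.cls_rep, dim_cls, det_cls]
  refine ⟨?_, ?_⟩
  · rw [← S.finrank_quotient_add_finrank, h5, h2, add_comm]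
  · rw [LinearMap.det_eq_det_mul_det S _ h1]
    exact mul_ne_zero h4 h6

theorem MulChar.ne_zero_of_apply_ne {θ : MulChar k ℂ} {a : k} (h : θ a ≠ 0) : a ≠ 0 := by
  rintro rfl
  exact h (θ.map_nonunit not_isUnit_zero)

theorem Supp.hA {f : EndClass k → ℂ} (hf : Supp n f) (θ : MulChar k ℂ) (m : ℕ) :
    Supp (m + n) (hA θ m f) :=
  supp_hmul fun α ν h => ⟨MulChar.ne_zero_of_apply_ne (left_ne_zero_of_mul h),
    hf ν (right_ne_zero_of_mul h)⟩

theorem jac_ne_zero_imp {h : EndClass k → ℂ} {α ν : EndClass k} (hj : jac h α ν ≠ 0) :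
    ∃ c : (Fin ν.rep.1 → k) →ₗ[k] (Fin α.rep.1 → k), h (cls (blk α.rep.2 c ν.rep.2)) ≠ 0 := by
  rw [jac] at hj
  obtain ⟨c, _, hc⟩ := Finset.exists_ne_zero_of_sum_ne_zero (right_ne_zero_of_mul hj)
  exact ⟨c, hc⟩

theorem Supp.jac {f : EndClass k → ℂ} (hf : Supp n f) {α ν : EndClass k} (h : jac f α ν ≠ 0) :
    α.dim + ν.dim = n ∧ α.det ≠ 0 ∧ ν.det ≠ 0 := by
  obtain ⟨c, hc⟩ := jac_ne_zero_imp h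
  have := hf _ hc
  rw [dim_cls, det_cls, det_blk] at this
  conv in α.dim => rw [← α.cls_rep]
  conv in ν.dim => rw [← ν.cls_rep]
  conv in α.det => rw [← α.cls_rep]
  conv in ν.det => rw [← ν.cls_rep]
  rw [dim_cls, dim_cls, det_cls, det_cls]
  exact ⟨by simpa using this.1, left_ne_zero_of_mul this.2, right_ne_zero_of_mul this.2⟩

theorem Supp.hB {f : EndClass k → ℂ} (hf : Supp (m + d) f) (θ : MulChar k ℂ) :
    Supp d (hB θ m f) := by
  intro ν hν
  obtain ⟨a, _, ha⟩ := Finset.exists_ne_zero_of_sum_ne_zero (right_ne_zero_of_mul hν)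
  have := hf.jac (right_ne_zero_of_mul ha)
  rw [dim_cls, finrank_fin_fun] at this
  exact ⟨by omega, this.2.2⟩

theorem hA_eq_hmul (θ : MulChar k ℂ) (m : ℕ) (f : EndClass k → ℂ)
    [∀ ν : EndClass k, Decidable (ν.dim = m)] :
    hA θ m f = hmul m fun α ν => (if α.dim = m then θ α.det else 0) * f ν := by
  funext ν
  rw [hA, hmul, hmul]
  refine Finset.sum_congr rfl fun S _ => ?_
  split_ifs with h h1
  · rfl
  · exact absurd ((dim_subCls h.1).trans h.2) h1
  · rfl

theorem IsChar.hA {f : EndClass k → ℂ} (hf : IsChar n f) (θ : MulChar k ℂ) (m : ℕ) :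
    IsChar (m + n) (hA θ m f) := by
  classical
  refine ⟨hf.1.hA θ m, fun ψ hψ => ?_⟩
  have h1 : ∀ χ : Irr k n, ∃ z : ℕ, ip (m + n) (_root_.hA θ m χ.1) ψ = z := fun χ => by
    rw [hA_eq_hmul]
    exact ip_hmul_Irr (mulChar_mem_Irr θ m) χ.2 hψ
  choose z hz using h1
  choose a ha using hf.2
  refine ⟨∑ χ : Irr k n, a χ.1 χ.2 * z χ, ?_⟩
  rw [eq_sum_Irr hf.1, ← hAL_apply, map_sum, ip_sum_left]
  push_cast
  refine Finset.sum_congr rfl fun χ _ => ?_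
  rw [map_smul, ip_smul_left, ha _ χ.2, hAL_apply, hz]

theorem IsChar.hB {f : EndClass k → ℂ} (hf : IsChar (m + d) f) (θ : MulChar k ℂ) :
    IsChar d (hB θ m f) := by
  refine ⟨hf.1.hB θ, fun ψ hψ => ?_⟩
  obtain ⟨z, hz⟩ := ((isChar_of_mem_Irr hψ).hA θ m).ip_nat hf
  exact ⟨z, by rw [← ip_conj, ← ip_hA, hz, Complex.conj_natCast]⟩

theorem IsChar.exists_constituent {f : EndClass k → ℂ} (hf : IsChar n f) (h : f ≠ 0) :
    ∃ χ ∈ Irr k n, ip n f χ ≠ 0 := by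
  by_contra! h1
  exact h (eq_zero_of_forall_Irr hf.1 h1)

theorem IsChar.hB_constituent {f τ : EndClass k → ℂ} {θ : MulChar k ℂ} (hf : IsChar (m + d) f)
    (h : _root_.hB θ m f = 0) (hτ : τ ∈ Irr k (m + d)) (h1 : ip (m + d) f τ ≠ 0) :
    _root_.hB θ m τ = 0 := by
  refine eq_zero_of_forall_Irr ((isChar_of_mem_Irr hτ).hB θ).1 fun ψ hψ => ?_
  choose a ha using hf.2
  have h2 : ∀ χ : Irr k (m + d), ∃ z : ℕ, ip d (_root_.hB θ m χ.1) ψ = z := fun χ =>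
    ((isChar_of_mem_Irr χ.2).hB θ).2 ψ hψ
  choose z hz using h2
  have h3 : ∑ χ : Irr k (m + d), a χ.1 χ.2 * z χ = 0 := by
    have : ip d (_root_.hB θ m f) ψ = 0 := by rw [h, ip_zero_left]
    rw [eq_sum_Irr hf.1, ← hBL_apply, map_sum, ip_sum_left] at this
    rw [← Nat.cast_inj (R := ℂ), Nat.cast_zero, ← this]
    push_cast
    refine Finset.sum_congr rfl fun χ _ => ?_
    rw [map_smul, ip_smul_left, ha _ χ.2, hBL_apply, hz]
  rw [Finset.sum_eq_zero_iff] at h3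
  have h4 := h3 ⟨τ, hτ⟩ (Finset.mem_univ _)
  rw [hz ⟨τ, hτ⟩, Nat.cast_eq_zero]
  refine (Nat.mul_eq_zero.1 h4).resolve_left fun h5 => h1 ?_
  rw [ha _ hτ, h5, Nat.cast_zero]

end VirtualCharacters

section SymmetricFunctions

/-- All ways to remove a total of `a` from the entries of a list. -/
def subs : ℕ → List ℕ → List (List ℕ)
  | a, [] => if a = 0 then [[]] else []
  | a, b :: β => (List.range (min a b + 1)).flatMap fun j => (subs (a - j) β).map ((b - j) :: ·)

/-- The number of matrices with natural entries and given row and column sums. -/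
def matCount : List ℕ → List ℕ → ℕ
  | [], β => if β.sum = 0 then 1 else 0
  | a :: α, β => ((subs a β).map (matCount α)).sum

/-- The pairing of two formal combinations of products of complete symmetric functions. -/
def formPair (L L' : List (ℤ × List ℕ)) : ℤ :=
  (L.map fun x => (L'.map fun y => x.1 * y.1 * (matCount x.2 y.2 : ℤ)).sum).sum

/-- Multiplication of a formal combination by a complete symmetric function. -/
def formMul (m : ℕ) (L : List (ℤ × List ℕ)) : List (ℤ × List ℕ) :=
  L.map fun x => (x.1, m :: x.2)

/-- Partitions of size at most five. -/
def smallParts : List (List ℕ) :=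
  [[], [1], [2], [1, 1], [3], [2, 1], [1, 1, 1], [4], [3, 1], [2, 2], [2, 1, 1], [1, 1, 1, 1],
    [5], [4, 1], [3, 2], [3, 1, 1], [2, 2, 1], [2, 1, 1, 1], [1, 1, 1, 1, 1]]

/-- The Schur functions of size at most five in terms of complete symmetric functions. -/
def schurExp : List ℕ → List (ℤ × List ℕ)
  | [] => [(1, [])]
  | [1] => [(1, [1])]
  | [2] => [(1, [2])]
  | [1, 1] => [(1, [1, 1]), (-1, [2])]
  | [3] => [(1, [3])]
  | [2, 1] => [(1, [2, 1]), (-1, [3])]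
  | [1, 1, 1] => [(1, [1, 1, 1]), (-2, [2, 1]), (1, [3])]
  | [4] => [(1, [4])]
  | [3, 1] => [(1, [3, 1]), (-1, [4])]
  | [2, 2] => [(1, [2, 2]), (-1, [3, 1])]
  | [2, 1, 1] => [(1, [2, 1, 1]), (-1, [2, 2]), (-1, [3, 1]), (1, [4])]
  | [1, 1, 1, 1] => [(1, [1, 1, 1, 1]), (-3, [2, 1, 1]), (1, [2, 2]), (2, [3, 1]), (-1, [4])]
  | [5] => [(1, [5])]
  | [4, 1] => [(1, [4, 1]), (-1, [5])]
  | [3, 2] => [(1, [3, 2]), (-1, [4, 1])]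
  | [3, 1, 1] => [(1, [3, 1, 1]), (-1, [3, 2]), (-1, [4, 1]), (1, [5])]
  | [2, 2, 1] => [(1, [2, 2, 1]), (-1, [3, 2]), (-1, [3, 1, 1]), (1, [4, 1])]
  | [2, 1, 1, 1] => [(1, [2, 1, 1, 1]), (-2, [2, 2, 1]), (-1, [3, 1, 1]), (2, [3, 2]),
      (1, [4, 1]), (-1, [5])]
  | [1, 1, 1, 1, 1] => [(1, [1, 1, 1, 1, 1]), (-4, [2, 1, 1, 1]), (3, [2, 2, 1]),
      (3, [3, 1, 1]), (-2, [3, 2]), (-2, [4, 1]), (1, [5])]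
  | _ => []

theorem schurExp_sum : ∀ l ∈ smallParts, ∀ x ∈ schurExp l, x.2.sum = l.sum := by decide +kernel

theorem formPair_schurExp : ∀ l ∈ smallParts, ∀ l' ∈ smallParts,
    formPair (schurExp l) (schurExp l') = if l = l' then 1 else 0 := by decide +kernel

theorem formPair_pieri : ∀ l ∈ smallParts, ∀ m ∈ List.range 6, l.sum + m ≤ 5 →
    formPair (formMul m (schurExp l)) (formMul m (schurExp l)) =
      (smallParts.map fun l' => formPair (formMul m (schurExp l)) (schurExp l') ^ 2).sum := by
  decide +kernel

end SymmetricFunctions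

section SchurCharacters

open Module
open scoped ComplexConjugate

variable {k : Type} [Field k] [Finite k] {n m d d' : ℕ} {θ : MulChar k ℂ}

/-- Iterated products with the powers of the linear character `θ`. -/
noncomputable def hw (θ : MulChar k ℂ) : List ℕ → (EndClass k → ℂ) → EndClass k → ℂ
  | [], τ => τ
  | a :: α, τ => hA θ a (hw θ α τ)

/-- `τ` is annihilated by the adjoints of all products with `θ`. -/
def IsVac (θ : MulChar k ℂ) (τ : EndClass k → ℂ) : Prop := ∀ m, 0 < m → hB θ m τ = 0

theorem sum_of_mem_subs : ∀ {β : List ℕ} {a : ℕ} {γ : List ℕ}, γ ∈ subs a β → γ.sum + a = β.sum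
  | [], a, γ, h => by
    rw [subs] at h
    split_ifs at h with ha
    · rw [List.mem_singleton] at h
      rw [h, ha]
      rfl
    · simp at h
  | b :: β, a, γ, h => by
    simp only [subs, List.mem_flatMap, List.mem_range, List.mem_map] at h
    obtain ⟨j, hj, δ, hδ, rfl⟩ := h
    have := sum_of_mem_subs hδ
    simp only [List.sum_cons]
    omega

theorem list_sum_flatMap {ι M : Type*} [AddCommMonoid M] (l : List ι) {κ : Type*}
    (f : ι → List κ) (g : κ → M) :
    ((l.flatMap f).map g).sum = (l.map fun i => ((f i).map g).sum).sum := by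
  induction l with
  | nil => rfl
  | cons a l ih => simp [ih]

theorem list_sum_range {M : Type*} [AddCommMonoid M] (f : ℕ → M) (n : ℕ) :
    ∑ i ∈ Finset.range n, f i = ((List.range n).map f).sum := rfl

theorem hB_hw (hτ : IsVac θ τ) : ∀ (β : List ℕ) (a : ℕ),
    hB θ a (hw θ β τ) = ((subs a β).map fun γ => hw θ γ τ).sum
  | [], a => by
    rw [subs]
    split_ifs with ha
    · rw [ha, hB_zero_left]
      simp [hw]
    · rw [hw, hτ a (Nat.pos_of_ne_zero ha)]
      rfl
  | b :: β, a => by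
    rw [hw, hB_hA_self, subs, list_sum_flatMap, list_sum_range]
    refine congrArg List.sum (List.map_congr_left fun j _ => ?_)
    rw [hB_hw hτ β, List.map_map, ← hAL_apply, map_list_sum, List.map_map]
    rfl

theorem ip_list_sum_right {ι : Type*} (n : ℕ) (f : EndClass k → ℂ) (g : ι → EndClass k → ℂ)
    (l : List ι) : ip n f (l.map g).sum = (l.map fun i => ip n f (g i)).sum := by
  induction l with
  | nil => simp [ip_zero_right]
  | cons a l ih => simp [ip_add_right, ih]

theorem ip_vac_hw {τ τ' : EndClass k → ℂ} (hτ : IsVac θ τ) : ∀ (β : List ℕ), d = β.sum + d' →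
    ip d τ (hw θ β τ') = if β.sum = 0 then ip d τ τ' else 0
  | [], _ => by simp [hw]
  | 0 :: β, h => by
    rw [hw, hA_zero_left, List.sum_cons, zero_add]
    exact ip_vac_hw hτ β (by simpa using h)
  | (b + 1) :: β, h => by
    rw [hw, if_neg (by simp)]
    obtain ⟨c, rfl⟩ : ∃ c, d = (b + 1) + c := ⟨β.sum + d', by rw [h, List.sum_cons, add_assoc]⟩
    rw [ip_hA_right, hτ _ (Nat.succ_pos b), ip_zero_left]

theorem ip_hw {τ τ' : EndClass k → ℂ} (hτ : IsVac θ τ) (hτ' : IsVac θ τ') :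
    ∀ α β : List ℕ, α.sum + d = β.sum + d' →
      ip (α.sum + d) (hw θ α τ) (hw θ β τ') = matCount α β * ip d τ τ'
  | [], β, h => by
    rw [List.sum_nil, zero_add] at h ⊢
    rw [hw, ip_vac_hw hτ β h, matCount]
    split_ifs <;> simp
  | a :: α, β, h => by
    rw [List.sum_cons, add_assoc] at h ⊢
    rw [hw, ip_hA, hB_hw hτ', ip_list_sum_right, matCount, Nat.cast_list_sum, List.map_map,
      ← List.sum_map_mul_right]
    refine congrArg List.sum (List.map_congr_left fun γ hγ => ?_)
    have := sum_of_mem_subs hγ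
    exact ip_hw hτ hτ' α γ (by omega)

/-- Evaluation of a formal combination. -/
noncomputable def evForm (θ : MulChar k ℂ) (L : List (ℤ × List ℕ)) (τ : EndClass k → ℂ) :
    EndClass k → ℂ := (L.map fun x => (x.1 : ℂ) • hw θ x.2 τ).sum

theorem ip_list_sum_left {ι : Type*} (n : ℕ) (f : EndClass k → ℂ) (g : ι → EndClass k → ℂ)
    (l : List ι) : ip n (l.map g).sum f = (l.map fun i => ip n (g i) f).sum := by
  induction l with
  | nil => simp [ip_zero_left]
  | cons a l ih => simp [ip_add_left, ih]

theorem ip_evForm {τ τ' : EndClass k → ℂ} (hτ : IsVac θ τ) (hτ' : IsVac θ τ')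
    {L L' : List (ℤ × List ℕ)} {s s' : ℕ} (hL : ∀ x ∈ L, x.2.sum = s)
    (hL' : ∀ x ∈ L', x.2.sum = s') (h : s + d = s' + d') :
    ip (s + d) (evForm θ L τ) (evForm θ L' τ') = formPair L L' * ip d τ τ' := by
  rw [evForm, evForm, ip_list_sum_left, formPair, Int.cast_list_sum, List.map_map,
    ← List.sum_map_mul_right]
  refine congrArg List.sum (List.map_congr_left fun x hx => ?_)
  rw [ip_list_sum_right, Function.comp_apply, Int.cast_list_sum, List.map_map,
    ← List.sum_map_mul_right]
  refine congrArg List.sum (List.map_congr_left fun y hy => ?_)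
  have h1 := hL x hx
  have h2 := hL' y hy
  have h3 := ip_hw hτ hτ' (d := d) (d' := d') x.2 y.2 (by omega)
  rw [h1] at h3
  rw [ip_smul_left, ip_smul_right, h3]
  simp only [Function.comp_apply, Int.cast_mul, Int.cast_natCast, map_intCast]
  ring

/-- The Schur function of `l` evaluated at `θ`, times `τ`. -/
noncomputable def schurChar (θ : MulChar k ℂ) (l : List ℕ) (τ : EndClass k → ℂ) :
    EndClass k → ℂ := evForm θ (schurExp l) τ

theorem ip_schurChar {τ τ' : EndClass k → ℂ} (hτ : IsVac θ τ) (hτ' : IsVac θ τ')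
    {l l' : List ℕ} (hl : l ∈ smallParts) (hl' : l' ∈ smallParts)
    (h : l.sum + d = l'.sum + d') :
    ip (l.sum + d) (schurChar θ l τ) (schurChar θ l' τ') = if l = l' then ip d τ τ' else 0 := by
  rw [schurChar, schurChar, ip_evForm hτ hτ' (schurExp_sum l hl) (schurExp_sum l' hl') h,
    formPair_schurExp l hl l' hl']
  split_ifs <;> simp

theorem IsChar.hw {τ : EndClass k → ℂ} (hτ : IsChar d τ) :
    ∀ α : List ℕ, IsChar (α.sum + d) (_root_.hw θ α τ)
  | [] => by simpa [_root_.hw] using hτ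
  | a :: α => by
    rw [List.sum_cons, add_assoc]
    exact (IsChar.hw hτ α).hA θ a

theorem IsVirt.list_sum {ι : Type*} {f : ι → EndClass k → ℂ} (c : ι → ℤ) (l : List ι)
    (h : ∀ i ∈ l, IsVirt n (f i)) : IsVirt n (l.map fun i => (c i : ℂ) • f i).sum := by
  have := IsVirt.sum (n := n) (f := fun j : Fin l.length => f l[j]) Finset.univ
    (fun j => c l[j]) fun i _ => h _ (List.getElem_mem _)
  convert this using 1
  rw [← Fin.sum_univ_fun_getElem]
  rfl

theorem IsVirt.schurChar {τ : EndClass k → ℂ} (hτ : IsChar d τ) {l : List ℕ}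
    (hl : l ∈ smallParts) : IsVirt (l.sum + d) (_root_.schurChar θ l τ) :=
  IsVirt.list_sum _ _ fun x hx => by
    rw [← schurExp_sum l hl x hx]
    exact (hτ.hw x.2).isVirt

theorem hA_evForm (m : ℕ) (L : List (ℤ × List ℕ)) (τ : EndClass k → ℂ) :
    hA θ m (evForm θ L τ) = evForm θ (formMul m L) τ := by
  rw [evForm, evForm, formMul, ← hAL_apply, map_list_sum, List.map_map, List.map_map]
  refine congrArg List.sum (List.map_congr_left fun x _ => ?_)
  simp [hw, hAL_apply]

end SchurCharacters

section Degrees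

open Module
open scoped ComplexConjugate

variable {k : Type} [Field k] [Finite k] {n m d d' : ℕ} {θ : MulChar k ℂ}

/-- `∏_{i ≤ n} (q ^ i - 1)`. -/
def qfac (q n : ℕ) : ℕ := ∏ i ∈ Finset.range n, (q ^ (i + 1) - 1)

theorem qfac_ne_zero {q : ℕ} (hq : 2 ≤ q) (n : ℕ) : qfac q n ≠ 0 := by
  refine Finset.prod_ne_zero_iff.2 fun i _ => ?_
  have : 1 < q ^ (i + 1) := Nat.one_lt_pow (Nat.succ_ne_zero i) hq
  omega

theorem two_le_card (k : Type) [Field k] [Finite k] : 2 ≤ Nat.card k :=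
  Finite.one_lt_card

theorem glCard_eq (n : ℕ) : glCard k n = Nat.card k ^ n.choose 2 * qfac (Nat.card k) n := by
  classical
  have := Fintype.ofFinite k
  have h1 : glCard k n = Nat.card (GL (Fin n) k) :=
    Nat.card_congr ((Matrix.GeneralLinearGroup.toLin (n := Fin n) (R := k)).trans
      (LinearMap.GeneralLinearGroup.generalLinearEquiv k (Fin n → k))).toEquiv.symm
  rw [h1, Matrix.card_GL_field, ← Nat.card_eq_fintype_card]
  have h2 : ∀ i : ℕ, i < n → Nat.card k ^ n - Nat.card k ^ i =
      Nat.card k ^ i * (Nat.card k ^ (n - 1 - i + 1) - 1) := fun i hi => by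
    rw [Nat.mul_sub, ← pow_add, mul_one]
    congr 2
    omega
  rw [Finset.prod_congr rfl fun (i : Fin n) _ => h2 i i.2, Finset.prod_mul_distrib,
    Fin.prod_univ_eq_prod_range (fun i => Nat.card k ^ i) n,
    Fin.prod_univ_eq_prod_range (fun i => Nat.card k ^ (n - 1 - i + 1) - 1) n,
    Finset.prod_pow_eq_pow_sum, Finset.sum_range_id, ← Nat.choose_two_right,
    Finset.prod_range_reflect (fun i => Nat.card k ^ (i + 1) - 1) n]
  rfl

theorem choose_two_add (m d : ℕ) : (m + d).choose 2 = m.choose 2 + d.choose 2 + m * d := by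
  induction d with
  | zero => simp
  | succ d ih =>
    rw [← add_assoc, Nat.choose_succ_succ' (m + d) 1, Nat.choose_succ_succ' d 1, ih]
    simp only [Nat.reduceAdd, Nat.choose_one_right]
    ring

/-- The class of the identity. -/
noncomputable def oneCls (k : Type) [Field k] (n : ℕ) : EndClass k := cls (1 : End k (Fin n → k))

theorem cls_one {V : Type} [AddCommGroup V] [Module k V] [Finite V] (h : finrank k V = n) :
    cls (1 : End k V) = oneCls k n :=
  cls_eq_iff.2 ⟨LinearEquiv.ofFinrankEq _ _ (by simp [h]), fun _ => rfl⟩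

theorem eq_one_of_cls_eq {V W : Type} [AddCommGroup V] [Module k V] [Finite V]
    [AddCommGroup W] [Module k W] [Finite W] {x : End k V}
    (h : cls x = cls (1 : End k W)) : x = 1 := by
  obtain ⟨e, he⟩ := cls_eq_iff.1 h
  exact LinearMap.ext fun v => e.injective (he v)

theorem blk_one {W Q : Type} [AddCommGroup W] [Module k W] [AddCommGroup Q] [Module k Q]
    (a : End k W) (c : Q →ₗ[k] W) (y : End k Q) : blk a c y = 1 ↔ a = 1 ∧ c = 0 ∧ y = 1 := by
  constructor
  · intro h
    have h1 : ∀ w v, (a w + c v, y v) = ((w, v) : W × Q) := fun w v => by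
      have := LinearMap.congr_fun h (w, v)
      rwa [blk_apply] at this
    refine ⟨LinearMap.ext fun w => ?_, LinearMap.ext fun v => ?_, LinearMap.ext fun v => ?_⟩
    · simpa using (Prod.ext_iff.1 (h1 w 0)).1
    · simpa using (Prod.ext_iff.1 (h1 0 v)).1
    · exact (Prod.ext_iff.1 (h1 0 v)).2
  · rintro ⟨rfl, rfl, rfl⟩
    ext x <;> simp [blk_apply]

theorem hmul_oneCls (m d : ℕ) (F : EndClass k → EndClass k → ℂ) :
    hmul m F (oneCls k (m + d)) * (qfac (Nat.card k) m * qfac (Nat.card k) d) =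
      qfac (Nat.card k) (m + d) * F (oneCls k m) (oneCls k d) := by
  classical
  have h := ip_hmul m d F (fun ν => if ν = oneCls k (m + d) then 1 else 0)
  have hone : ∀ x : End k (Fin (m + d) → k), cls x = oneCls k (m + d) → x = 1 :=
    fun x hx => eq_one_of_cls_eq hx
  rw [ip, Fintype.sum_eq_single 1, Fintype.sum_eq_single 1, Fintype.sum_eq_single 1, jac_cls,
    Fintype.sum_eq_single 0] at h
  · have h1 : cls (blk (1 : End k (Fin m → k)) 0 (1 : End k (Fin d → k))) = oneCls k (m + d) := by
      rw [(blk_one _ _ _).2 ⟨rfl, rfl, rfl⟩]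
      exact cls_one (by simp)
    have hq : (Nat.card k : ℂ) ≠ 0 := by
      have := two_le_card k
      exact_mod_cast (by omega : Nat.card k ≠ 0)
    rw [h1] at h
    change (_ : ℂ) * (hmul m F (oneCls k (m + d)) * conj (if oneCls k (m + d) = _ then 1 else 0)) =
      _ * (F (oneCls k m) (oneCls k d) * _) at h
    rw [if_pos rfl, card_linearMap, glCard_eq, glCard_eq, glCard_eq, choose_two_add] at h
    simp only [finrank_fin_fun] at h
    push_cast at h
    have h2 : ∀ i, (qfac (Nat.card k) i : ℂ) ≠ 0 := fun i =>
      Nat.cast_ne_zero.2 (qfac_ne_zero (two_le_card k) i)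
    have h3 := h2 m
    have h4 := h2 d
    have h5 := h2 (m + d)
    simp only [map_one, mul_one, map_inv₀, map_pow, map_natCast] at h
    rw [pow_add, pow_add, mul_comm m d] at h
    field_simp at h
    linear_combination h
  · intro c hc
    exact if_neg fun h => hc ((blk_one _ _ _).1 (eq_one_of_cls_eq h)).2.1
  · intro y hy
    rw [jac_cls, Finset.sum_eq_zero, mul_zero, map_zero, mul_zero]
    intro c _
    exact if_neg fun h => hy ((blk_one _ _ _).1 (eq_one_of_cls_eq h)).2.2
  · intro a ha
    refine Finset.sum_eq_zero fun y _ => ?_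
    rw [jac_cls, Finset.sum_eq_zero, mul_zero, map_zero, mul_zero]
    intro c _
    exact if_neg fun h => ha ((blk_one _ _ _).1 (eq_one_of_cls_eq h)).1
  · intro x hx
    rw [if_neg fun h => hx (hone x h), map_zero, mul_zero]

theorem det_oneCls (n : ℕ) : (oneCls k n).det = 1 := by
  rw [oneCls, det_cls, map_one]

theorem hA_oneCls (f : EndClass k → ℂ) :
    hA θ m f (oneCls k (m + d)) * (qfac (Nat.card k) m * qfac (Nat.card k) d) =
      qfac (Nat.card k) (m + d) * f (oneCls k d) := by
  rw [hA, hmul_oneCls, det_oneCls, map_one, one_mul]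

theorem hw_oneCls (τ : EndClass k → ℂ) : ∀ α : List ℕ,
    hw θ α τ (oneCls k (α.sum + d)) =
      qfac (Nat.card k) (α.sum + d) * (α.map fun a => (qfac (Nat.card k) a : ℂ)⁻¹).prod *
        ((qfac (Nat.card k) d : ℂ)⁻¹ * τ (oneCls k d))
  | [] => by
    have h2 : (qfac (Nat.card k) d : ℂ) ≠ 0 :=
      Nat.cast_ne_zero.2 (qfac_ne_zero (two_le_card k) d)
    simp [hw, h2]
  | a :: α => by
    have h2 : ∀ i, (qfac (Nat.card k) i : ℂ) ≠ 0 := fun i =>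
      Nat.cast_ne_zero.2 (qfac_ne_zero (two_le_card k) i)
    have h := hA_oneCls (θ := θ) (m := a) (d := α.sum + d) (hw θ α τ)
    rw [hw_oneCls τ α] at h
    rw [List.sum_cons, List.map_cons, List.prod_cons, add_assoc, hw]
    have h3 := h2 a
    have h4 := h2 (α.sum + d)
    rw [← mul_left_inj' (mul_ne_zero h3 h4), h]
    field_simp

/-- `n(λ) = ∑ (i - 1) λ_i`. -/
def partN : List ℕ → ℕ
  | [] => 0
  | _ :: l => l.sum + partN l

/-- The product of `q ^ h - 1` over the hooks. -/
def hookProd (q : ℕ) (l : List ℕ) : ℕ := ((match l with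
  | [] => []
  | [1] => [1]
  | [2] => [1, 2]
  | [1, 1] => [1, 2]
  | [3] => [1, 2, 3]
  | [2, 1] => [1, 1, 3]
  | [1, 1, 1] => [1, 2, 3]
  | [4] => [1, 2, 3, 4]
  | [3, 1] => [1, 1, 2, 4]
  | [2, 2] => [1, 2, 2, 3]
  | [2, 1, 1] => [1, 1, 2, 4]
  | [1, 1, 1, 1] => [1, 2, 3, 4]
  | [5] => [1, 2, 3, 4, 5]
  | [4, 1] => [1, 1, 2, 3, 5]
  | [3, 2] => [1, 1, 2, 3, 4]
  | [3, 1, 1] => [1, 1, 2, 2, 5]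
  | [2, 2, 1] => [1, 1, 2, 3, 4]
  | [2, 1, 1, 1] => [1, 1, 2, 3, 5]
  | [1, 1, 1, 1, 1] => [1, 2, 3, 4, 5]
  | _ => [] : List ℕ).map fun h => q ^ h - 1).prod

theorem hookProd_ne_zero {q : ℕ} (hq : 2 ≤ q) {l : List ℕ} (hl : l ∈ smallParts) :
    hookProd q l ≠ 0 := by
  have h : ∀ i, q ^ (i + 1) - 1 ≠ 0 := fun i => by
    have : 1 < q ^ (i + 1) := Nat.one_lt_pow (Nat.succ_ne_zero i) hq
    omega
  have h1 := h 0
  have h2 := h 1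
  have h3 := h 2
  have h4 := h 3
  have h5 := h 4
  norm_num only at h1 h2 h3 h4 h5
  simp only [smallParts, List.mem_cons, List.not_mem_nil, or_false] at hl
  rcases hl with rfl | rfl | rfl | rfl | rfl | rfl | rfl | rfl | rfl | rfl | rfl | rfl | rfl | rfl |
    rfl | rfl | rfl | rfl | rfl <;>
  simp only [hookProd, List.map_cons, List.map_nil, List.prod_cons, List.prod_nil, ne_eq,
    mul_eq_zero, h1, h2, h3, h4, h5, or_self, not_false_eq_true, one_ne_zero]

theorem schurExp_qfac {q : ℕ} (hq : 2 ≤ q) {l : List ℕ} (hl : l ∈ smallParts) :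
    ((schurExp l).map fun x => (x.1 : ℂ) * (x.2.map fun a => (qfac q a : ℂ)⁻¹).prod).sum =
      q ^ partN l * (hookProd q l : ℂ)⁻¹ := by
  have h : ∀ i, ∃ a : ℂ, ((q ^ (i + 1) - 1 : ℕ) : ℂ) = a ∧ a = (q : ℂ) ^ (i + 1) - 1 ∧ a ≠ 0 :=
    fun i => ⟨_, rfl, by
      rw [Nat.cast_sub (Nat.one_le_pow _ _ (by omega))]
      push_cast
      rfl, by
      have : 1 < q ^ (i + 1) := Nat.one_lt_pow (Nat.succ_ne_zero i) hq
      exact Nat.cast_ne_zero.2 (by omega)⟩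
  obtain ⟨a1, c1, e1, h1⟩ := h 0
  obtain ⟨a2, c2, e2, h2⟩ := h 1
  obtain ⟨a3, c3, e3, h3⟩ := h 2
  obtain ⟨a4, c4, e4, h4⟩ := h 3
  obtain ⟨a5, c5, e5, h5⟩ := h 4
  simp only [zero_add, Nat.reduceAdd] at c1 c2 c3 c4 c5
  simp only [smallParts, List.mem_cons, List.not_mem_nil, or_false] at hl
  rcases hl with rfl | rfl | rfl | rfl | rfl | rfl | rfl | rfl | rfl | rfl | rfl | rfl | rfl | rfl |
    rfl | rfl | rfl | rfl | rfl <;>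
  simp only [hookProd, schurExp, partN, List.map_cons, List.map_nil, List.prod_cons, List.prod_nil,
    List.sum_cons, List.sum_nil, qfac, Finset.prod_range_succ, Finset.prod_range_zero, zero_add,
    Nat.reduceAdd, add_zero, Nat.cast_mul, Nat.cast_one, one_mul, mul_one, c1, c2, c3, c4, c5,
    Int.cast_one, Int.cast_neg, Int.cast_ofNat, pow_zero, inv_one] <;>
  field_simp <;> subst e1 e2 e3 e4 e5 <;> ring

theorem schurChar_oneCls (τ : EndClass k → ℂ) {l : List ℕ} (hl : l ∈ smallParts) :
    schurChar θ l τ (oneCls k (l.sum + d)) * (qfac (Nat.card k) d * hookProd (Nat.card k) l) =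
      qfac (Nat.card k) (l.sum + d) * (Nat.card k : ℂ) ^ partN l * τ (oneCls k d) := by
  have h1 : schurChar θ l τ (oneCls k (l.sum + d)) =
      ((schurExp l).map fun x => (x.1 : ℂ) *
        (x.2.map fun a => (qfac (Nat.card k) a : ℂ)⁻¹).prod).sum *
      (qfac (Nat.card k) (l.sum + d) * ((qfac (Nat.card k) d : ℂ)⁻¹ * τ (oneCls k d))) := by
    have h2 : ∀ L : List (ℤ × List ℕ), evForm θ L τ (oneCls k (l.sum + d)) =
        (L.map fun x => (x.1 : ℂ) * hw θ x.2 τ (oneCls k (l.sum + d))).sum := fun L => by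
      rw [evForm]
      induction L with
      | nil => rfl
      | cons a L ih => simp [ih]
    rw [schurChar, h2, ← List.sum_map_mul_right]
    refine congrArg List.sum (List.map_congr_left fun x hx => ?_)
    rw [← schurExp_sum l hl x hx, hw_oneCls]
    ring
  rw [h1, schurExp_qfac (two_le_card k) hl]
  have h2 : (qfac (Nat.card k) d : ℂ) ≠ 0 :=
    Nat.cast_ne_zero.2 (qfac_ne_zero (two_le_card k) d)
  have h3 : (hookProd (Nat.card k) l : ℂ) ≠ 0 :=
    Nat.cast_ne_zero.2 (hookProd_ne_zero (two_le_card k) hl)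
  field_simp

end Degrees

section SchurClassification

open Module
open scoped ComplexConjugate

variable {k : Type} [Field k] [Finite k] {n m d d' : ℕ} {θ : MulChar k ℂ}

theorem schurChar_mem_Irr {τ : EndClass k → ℂ} (hτ : τ ∈ Irr k d) (hv : IsVac θ τ) {l : List ℕ}
    (hl : l ∈ smallParts) : schurChar θ l τ ∈ Irr k (l.sum + d) := by
  classical
  refine mem_Irr_of_ip_self (IsVirt.schurChar (isChar_of_mem_Irr hτ) hl) ?_ ?_
  · rw [ip_schurChar hv hv hl hl rfl, if_pos rfl, ip_Irr hτ hτ, if_pos rfl]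
  · have h := schurChar_oneCls (θ := θ) (d := d) τ hl
    obtain ⟨D, hD, hD'⟩ := Irr.one_pos hτ (V := Fin d → k) (by simp)
    have h2 := two_le_card k
    have h3 := qfac_ne_zero h2 d
    have h4 := hookProd_ne_zero h2 hl
    have h5 := qfac_ne_zero h2 (l.sum + d)
    rw [show τ (oneCls k d) = D from hD'] at h
    have h6 : schurChar θ l τ (oneCls k (l.sum + d)) =
        ((qfac (Nat.card k) (l.sum + d) * Nat.card k ^ partN l * D /
          (qfac (Nat.card k) d * hookProd (Nat.card k) l) : ℝ) : ℂ) := by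
      push_cast
      rw [eq_div_iff (mul_ne_zero (Nat.cast_ne_zero.2 h3) (Nat.cast_ne_zero.2 h4)), h]
    change 0 < (schurChar θ l τ (oneCls k (l.sum + d))).re
    rw [h6, Complex.ofReal_re]
    have h7 : Nat.card k ≠ 0 := by omega
    positivity

theorem hB_evForm {θ' : MulChar k ℂ} (h : θ' ≠ θ) (m : ℕ) (L : List (ℤ × List ℕ))
    (τ : EndClass k → ℂ) : hB θ' m (evForm θ L τ) = evForm θ L (hB θ' m τ) := by
  have h1 : ∀ α : List ℕ, hB θ' m (hw θ α τ) = hw θ α (hB θ' m τ) := fun α => by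
    induction α with
    | nil => rfl
    | cons a α ih => rw [hw, hB_hA_of_ne h, ih, hw]
  rw [evForm, evForm, ← hBL_apply, map_list_sum, List.map_map]
  refine congrArg List.sum (List.map_congr_left fun x _ => ?_)
  rw [Function.comp_apply, map_smul, hBL_apply, h1]

theorem evForm_zero (L : List (ℤ × List ℕ)) : evForm θ L (0 : EndClass k → ℂ) = 0 := by
  have h1 : ∀ α : List ℕ, hw θ α (0 : EndClass k → ℂ) = 0 := fun α => by
    induction α with
    | nil => rfl
    | cons a α ih => rw [hw, ih, hA_zero_right]
  rw [evForm, List.sum_eq_zero]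
  simp [h1]

theorem IsVac.schurChar {θ' : MulChar k ℂ} (h : θ' ≠ θ) {τ : EndClass k → ℂ} (hv : IsVac θ' τ)
    (l : List ℕ) : IsVac θ' (_root_.schurChar θ l τ) := fun m hm => by
  rw [_root_.schurChar, hB_evForm h, hv m hm, evForm_zero]

theorem eq_of_ip_ne_zero {χ ψ : EndClass k → ℂ} (hχ : χ ∈ Irr k n) (hψ : ψ ∈ Irr k n)
    (h : ip n χ ψ ≠ 0) : χ = ψ := by
  classical
  by_contra h1
  rw [ip_Irr hχ hψ, if_neg h1] at h
  exact h rfl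

theorem pieri_constituent {τ χ : EndClass k → ℂ} (hτ : τ ∈ Irr k d) (hv : IsVac θ τ)
    {l : List ℕ} (hl : l ∈ smallParts) (hm : l.sum + m ≤ 5) (hχ : χ ∈ Irr k (m + (l.sum + d)))
    (h : ip (m + (l.sum + d)) (hA θ m (schurChar θ l τ)) χ ≠ 0) :
    ∃ l' ∈ smallParts, l'.sum = m + l.sum ∧ χ = schurChar θ l' τ := by
  classical
  set n := m + (l.sum + d) with hn
  have hn' : n = m + l.sum + d := (add_assoc _ _ _).symm
  set f := hA θ m (schurChar θ l τ) with hf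
  have hL : ∀ x ∈ formMul m (schurExp l), x.2.sum = m + l.sum := by
    intro x hx
    rw [formMul, List.mem_map] at hx
    obtain ⟨y, hy, rfl⟩ := hx
    rw [List.sum_cons, schurExp_sum l hl y hy]
  have hττ : ip d τ τ = 1 := by rw [ip_Irr hτ hτ, if_pos rfl]
  have hff : ip n f f = (formPair (formMul m (schurExp l)) (formMul m (schurExp l)) : ℂ) := by
    rw [hf, schurChar, hA_evForm, hn', ip_evForm hv hv hL hL rfl, hττ, mul_one]
  have hfchar : IsVirt n f := by
    have h1 : hA θ m (schurChar θ l τ) = (List.map (fun x => (x.1 : ℂ) • hw θ x.2 τ)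
      (formMul m (schurExp l))).sum := by rw [schurChar, hA_evForm, evForm]
    rw [hf, h1]
    refine IsVirt.list_sum _ _ fun x hx => ?_
    rw [hn', ← hL x hx]
    exact ((isChar_of_mem_Irr hτ).hw x.2).isVirt
  by_contra! hne
  have hfs : ∀ l' ∈ smallParts, l'.sum = m + l.sum →
      ip n f (schurChar θ l' τ) = (formPair (formMul m (schurExp l)) (schurExp l') : ℂ) := by
    intro l' hl' hs
    rw [hf, schurChar, hA_evForm, schurChar, hn',
      ip_evForm hv hv hL (schurExp_sum l' hl') (by rw [hs]), hττ, mul_one]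
  have hzero : ∀ l' ∈ smallParts, l'.sum ≠ m + l.sum →
      formPair (formMul m (schurExp l)) (schurExp l') = 0 := by
    intro l' hl' hs
    have h0 : ∀ α β : List ℕ, α.sum ≠ β.sum → matCount α β = 0 := by
      intro α
      induction α with
      | nil =>
        intro β hβ
        rw [matCount, if_neg fun h => hβ h.symm]
      | cons a α ih =>
        intro β hβ
        rw [matCount, List.sum_eq_zero]
        intro x hx
        rw [List.mem_map] at hx
        obtain ⟨γ, hγ, rfl⟩ := hx
        have := sum_of_mem_subs hγ
        rw [List.sum_cons] at hβ
        exact ih _ (by omega)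
    rw [formPair, List.sum_eq_zero]
    intro x hx
    rw [List.mem_map] at hx
    obtain ⟨y, hy, rfl⟩ := hx
    rw [List.sum_eq_zero]
    intro x hx
    rw [List.mem_map] at hx
    obtain ⟨z, hz, rfl⟩ := hx
    rw [h0 _ _ (by rw [hL y hy, schurExp_sum l' hl' z hz]; exact hs.symm)]
    simp
  have hmem : ∀ l' ∈ smallParts, l'.sum = m + l.sum → schurChar θ l' τ ∈ Irr k n := by
    intro l' hl' hs
    rw [hn', ← hs]
    exact schurChar_mem_Irr hτ hv hl'
  set P := smallParts.toFinset.filter fun l' => l'.sum = m + l.sum with hP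
  have hPm : ∀ {l'}, l' ∈ P ↔ l' ∈ smallParts ∧ l'.sum = m + l.sum := by simp [hP]
  set c : List ℕ → ℤ := fun l' => formPair (formMul m (schurExp l)) (schurExp l') with hc
  have hinj : ∀ l₁ ∈ P, ∀ l₂ ∈ P, ip n (schurChar θ l₁ τ) (schurChar θ l₂ τ) =
      if l₁ = l₂ then 1 else 0 := by
    intro l₁ h₁ l₂ h₂
    rw [hPm] at h₁ h₂
    have := ip_schurChar (d := d) (d' := d) hv hv h₁.1 h₂.1 (by rw [h₁.2, h₂.2])
    rw [h₁.2, ← hn'] at this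
    rw [this, hττ]
  have hsq : (formPair (formMul m (schurExp l)) (formMul m (schurExp l)) : ℤ) =
      ∑ l' ∈ P, c l' ^ 2 := by
    rw [formPair_pieri l hl m (by rw [List.mem_range]; omega) hm]
    have hnd : smallParts.Nodup := by decide
    rw [← List.sum_toFinset _ hnd, hP, Finset.sum_filter]
    refine Finset.sum_congr rfl fun l' hl' => ?_
    split_ifs with h
    · rfl
    · rw [hzero l' (by simpa using hl') h]
      rfl
  set g := ∑ l' ∈ P, (c l' : ℂ) • schurChar θ l' τ with hg
  have hgs : ∀ l' ∈ P, ip n g (schurChar θ l' τ) = c l' := by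
    intro l' hl'
    rw [hg, ip_sum_left, Finset.sum_eq_single_of_mem l' hl']
    · rw [ip_smul_left, hinj l' hl' l' hl', if_pos rfl, mul_one]
    · intro b hb hbl
      rw [ip_smul_left, hinj b hb l' hl', if_neg hbl, mul_zero]
  have hfg : ip n (f - g) (f - g) = 0 := by
    have h1 : ∀ u, ip n u g = ∑ l' ∈ P, (c l' : ℂ) * ip n u (schurChar θ l' τ) := fun u => by
      rw [hg, ip_sum_right]
      refine Finset.sum_congr rfl fun l' _ => ?_
      rw [ip_smul_right, map_intCast]
    have h2 : ip n f g = ∑ l' ∈ P, (c l' : ℂ) ^ 2 := by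
      rw [h1]
      refine Finset.sum_congr rfl fun l' hl' => ?_
      rw [hfs l' (hPm.1 hl').1 (hPm.1 hl').2, sq]
    have h3 : ip n g g = ∑ l' ∈ P, (c l' : ℂ) ^ 2 := by
      rw [h1]
      refine Finset.sum_congr rfl fun l' hl' => ?_
      rw [hgs l' hl', sq]
    have h4 : ip n g f = ∑ l' ∈ P, (c l' : ℂ) ^ 2 := by
      rw [← ip_conj, h2, map_sum]
      exact Finset.sum_congr rfl fun l' _ => by rw [map_pow, map_intCast]
    rw [ip_sub_left, ip_sub_right, ip_sub_right, h2, h3, h4, hff, hsq]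
    push_cast
    ring
  have hfg0 : f = g := by
    have hsupp : Supp n g := Supp.sum _ _ fun l' hl' => (hmem l' (hPm.1 hl').1 (hPm.1 hl').2).1
    funext ν
    by_cases hν : ν.dim = n
    · exact sub_eq_zero.1 (eq_zero_of_ip_self hfg hν)
    · rw [not_not.1 fun h => hν (hfchar.1 ν h).1, not_not.1 fun h => hν (hsupp ν h).1]
  rw [hfg0, hg, ip_sum_left] at h
  obtain ⟨l', hl', h1⟩ := Finset.exists_ne_zero_of_sum_ne_zero h
  rw [ip_smul_left] at h1
  have h2 := hPm.1 hl'
  exact hne l' h2.1 h2.2 (eq_of_ip_ne_zero (hmem l' h2.1 h2.2) hχ (right_ne_zero_of_mul h1)).symm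

theorem hB_eq_zero_of_gt {f : EndClass k → ℂ} (hf : Supp n f) (h : n < m) : hB θ m f = 0 := by
  funext ν
  rw [hB, Finset.sum_eq_zero, mul_zero]
  · rfl
  intro a _
  by_cases ha : jac f (cls a) ν = 0
  · rw [ha, mul_zero]
  · have := (hf.jac ha).1
    rw [dim_cls, finrank_fin_fun] at this
    omega

theorem exists_eq_schurChar (θ : MulChar k ℂ) : ∀ n ≤ 5, ∀ χ ∈ Irr k n,
    ∃ l ∈ smallParts, ∃ d, l.sum + d = n ∧ ∃ τ ∈ Irr k d, IsVac θ τ ∧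
      (∀ θ', θ' ≠ θ → IsVac θ' χ → IsVac θ' τ) ∧ χ = schurChar θ l τ := by
  intro n
  induction n using Nat.strong_induction_on with
  | _ n ih =>
  intro hn χ hχ
  by_cases hv : IsVac θ χ
  · refine ⟨[], by decide, n, by simp, χ, hχ, hv, fun _ _ h => h, ?_⟩
    simp [schurChar, schurExp, evForm, hw]
  · rw [IsVac] at hv
    push Not at hv
    obtain ⟨m, hm, hB0⟩ := hv
    have hmn : m ≤ n := by
      by_contra h
      exact hB0 (hB_eq_zero_of_gt hχ.1 (by omega))
    obtain ⟨c, rfl⟩ := Nat.exists_eq_add_of_le hmn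
    have hch := (isChar_of_mem_Irr hχ).hB θ
    obtain ⟨ψ, hψ, hne⟩ := hch.exists_constituent hB0
    obtain ⟨l, hl, d, rfl, τ, hτ, hvτ, hΘ, rfl⟩ := ih c (by omega) (by omega) ψ hψ
    obtain ⟨l', hl', hs, rfl⟩ := pieri_constituent hτ hvτ hl (by omega) hχ (by
      rw [ip_hA, ← ip_conj]
      exact (map_ne_zero _).2 hne)
    refine ⟨l', hl', d, by omega, τ, hτ, hvτ, fun θ' hθ' h => hΘ θ' hθ' fun b hb => ?_, rfl⟩
    have hsub : hB θ' b (hB θ m (schurChar θ l' τ)) = 0 := by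
      rw [hB_comm hθ', h b hb, hB_zero_right]
    by_cases hbd : l.sum + d < b
    · exact hB_eq_zero_of_gt hψ.1 hbd
    · obtain ⟨r, hr⟩ := Nat.exists_eq_add_of_le (not_lt.1 hbd)
      rw [hr] at hch hψ hne
      exact hch.hB_constituent hsub hψ hne

/-- The irreducible characters annihilated by the adjoints attached to `Θ`. -/
def vIrr (Θ : Set (MulChar k ℂ)) (n : ℕ) : Set (EndClass k → ℂ) :=
  {χ | χ ∈ Irr k n ∧ ∀ θ ∈ Θ, IsVac θ χ}

instance (Θ : Set (MulChar k ℂ)) (n : ℕ) : Finite (vIrr Θ n) :=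
  Finite.Set.subset (Irr k n) fun _ h => h.1

noncomputable instance (Θ : Set (MulChar k ℂ)) (n : ℕ) : Fintype (vIrr Θ n) :=
  Fintype.ofFinite _

/-- Partitions of size at most `n`. -/
abbrev PartLe (n : ℕ) : Type := {l : List ℕ // l ∈ smallParts.toFinset.filter fun l => l.sum ≤ n}

theorem sum_vIrr {M : Type*} [AddCommMonoid M] {Θ : Set (MulChar k ℂ)} (hθ : θ ∉ Θ) (hn : n ≤ 5)
    (F : (EndClass k → ℂ) → M) :
    ∑ χ : vIrr Θ n, F χ.1 = ∑ l ∈ smallParts.toFinset.filter fun l => l.sum ≤ n,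
      ∑ τ : vIrr (insert θ Θ) (n - l.sum), F (schurChar θ l τ.1) := by
  classical
  rw [← Finset.sum_coe_sort _ fun l => ∑ τ : vIrr (insert θ Θ) (n - l.sum), F (schurChar θ l τ.1),
    ← Fintype.sum_sigma' fun (l : PartLe n) (τ : vIrr (insert θ Θ) (n - l.1.sum)) =>
      F (schurChar θ l.1 τ.1)]
  symm
  have hpl : ∀ l : PartLe n, l.1 ∈ smallParts ∧ l.1.sum ≤ n := fun l =>
    (Finset.mem_filter.1 l.2).imp List.mem_toFinset.1 id
  have hmem : ∀ x : Σ l : PartLe n, vIrr (insert θ Θ) (n - l.1.sum),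
      schurChar θ x.1.1 x.2.1 ∈ vIrr Θ n := by
    rintro ⟨l, τ, hτ, hv⟩
    refine ⟨?_, fun θ' hθ' =>
      (hv θ' (Or.inr hθ')).schurChar (ne_of_mem_of_not_mem hθ' hθ) _⟩
    have := schurChar_mem_Irr hτ (hv θ (Or.inl rfl)) (hpl l).1
    rwa [Nat.add_sub_of_le (hpl l).2] at this
  refine Fintype.sum_bijective (fun x => ⟨schurChar θ x.1.1 x.2.1, hmem x⟩) ⟨?_, ?_⟩ _ _
    fun _ => rfl
  · rintro ⟨l, τ, hτ, hv⟩ ⟨l', τ', hτ', hv'⟩ h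
    have h1 : schurChar θ l.1 τ = schurChar θ l'.1 τ' := congrArg Subtype.val h
    have h2 : l.1.sum + (n - l.1.sum) = l'.1.sum + (n - l'.1.sum) := by
      have := (hpl l).2
      have := (hpl l').2
      omega
    have h3 := ip_schurChar (hv θ (Or.inl rfl)) (hv' θ (Or.inl rfl)) (hpl l).1 (hpl l').1 h2
    have h4 := schurChar_mem_Irr hτ (hv θ (Or.inl rfl)) (hpl l).1
    rw [← h1, ip_Irr h4 h4, if_pos rfl] at h3
    have h5 : l.1 = l'.1 := by
      by_contra h
      rw [if_neg h] at h3
      exact one_ne_zero h3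
    rw [if_pos h5] at h3
    obtain ⟨l, hl⟩ := l
    obtain ⟨l', hl'⟩ := l'
    cases h5
    have h6 : τ = τ' := eq_of_ip_ne_zero hτ hτ' (by rw [← h3]; exact one_ne_zero)
    cases h6
    rfl
  · rintro ⟨χ, hχ, hv⟩
    obtain ⟨l, hl, d, rfl, τ, hτ, hvτ, hΘ, rfl⟩ := exists_eq_schurChar θ n hn χ hχ
    have h1 : l.sum + d - l.sum = d := by omega
    refine ⟨⟨⟨l, by simp [hl]⟩, τ, by rw [h1]; exact hτ, ?_⟩, rfl⟩
    rintro θ' (rfl | hθ')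
    · exact hvτ
    · exact hΘ θ' (ne_of_mem_of_not_mem hθ' hθ) (hv θ' hθ')

end SchurClassification

section Nilpotent

open Module

variable {k : Type} [Field k] [Finite k]
variable {V W : Type} [AddCommGroup V] [Module k V] [AddCommGroup W] [Module k W]
variable [Finite V] [Finite W]

theorem pow_eq_zero_of_finrank_le {N : End k V} (hN : IsNilpotent N) {r : ℕ}
    (hr : finrank k V ≤ r) : N ^ r = 0 := by
  have h := LinearMap.aeval_self_charpoly N
  rw [hN.charpoly_eq_X_pow_finrank, map_pow, Polynomial.aeval_X] at h
  exact pow_eq_zero_of_le hr h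

theorem pow_restrict_apply {N : End k V} {S : Submodule k V} (h : S ≤ S.comap N) (r : ℕ) (s : S) :
    ((N.restrict h ^ r) s : V) = (N ^ r) s := by
  induction r generalizing s with
  | zero => rfl
  | succ r ih =>
    rw [pow_succ, pow_succ, Module.End.mul_apply, Module.End.mul_apply, ih]
    rfl

theorem isNilpotent_restrict {N : End k V} (hN : IsNilpotent N) {S : Submodule k V}
    (h : S ≤ S.comap N) : IsNilpotent (N.restrict h) := by
  obtain ⟨r, hr⟩ := hN
  refine ⟨r, LinearMap.ext fun s => Subtype.ext ?_⟩
  rw [pow_restrict_apply, hr]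
  rfl

theorem pow_mapQ_mk {N : End k V} {S : Submodule k V} (h : S ≤ S.comap N) (r : ℕ) (v : V) :
    ((S.mapQ S N h) ^ r) (S.mkQ v) = S.mkQ ((N ^ r) v) := by
  induction r generalizing v with
  | zero => rfl
  | succ r ih =>
    rw [pow_succ, pow_succ, Module.End.mul_apply, Module.End.mul_apply, ← ih]
    rfl

theorem isNilpotent_mapQ {N : End k V} (hN : IsNilpotent N) {S : Submodule k V}
    (h : S ≤ S.comap N) : IsNilpotent (S.mapQ S N h) := by
  obtain ⟨r, hr⟩ := hN
  refine ⟨r, LinearMap.ext fun s => ?_⟩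
  obtain ⟨v, rfl⟩ := S.mkQ_surjective s
  rw [pow_mapQ_mk, hr]
  simp

theorem lt_finrank_of_pow_ne_zero {N : End k V} (hN : IsNilpotent N) {S : Submodule k V}
    (h : S ≤ S.comap N) {r : ℕ} {v : V} (hv : v ∈ S) (hne : (N ^ r) v ≠ 0) :
    r < finrank k S := by
  by_contra hr
  have h1 := pow_eq_zero_of_finrank_le (isNilpotent_restrict hN h) (not_lt.1 hr)
  apply hne
  rw [← pow_restrict_apply h r ⟨v, hv⟩, h1]
  rfl

theorem range_pow_le_comap (N : End k V) (r : ℕ) :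
    LinearMap.range (N ^ r) ≤ (LinearMap.range (N ^ r)).comap N := by
  rintro _ ⟨v, rfl⟩
  exact ⟨N v, by rw [← Module.End.mul_apply, ← Module.End.mul_apply, ← pow_succ, ← pow_succ']⟩

theorem ker_pow_le_comap (N : End k V) (r : ℕ) :
    LinearMap.ker (N ^ r) ≤ (LinearMap.ker (N ^ r)).comap N := by
  intro v hv
  rw [Submodule.mem_comap, LinearMap.mem_ker, ← Module.End.mul_apply, ← pow_succ, pow_succ',
    Module.End.mul_apply, LinearMap.mem_ker.1 hv, map_zero]

theorem injective_of_injOn_ker {N : End k V} (hN : IsNilpotent N) {M : End k W}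
    {f : V →ₗ[k] W} (hf : ∀ v, f (N v) = M (f v)) (h : ∀ v, N v = 0 → f v = 0 → v = 0) :
    Function.Injective f := by
  rw [injective_iff_map_eq_zero]
  intro v hv
  obtain ⟨r, hr⟩ := hN
  have h1 : ∀ j, f ((N ^ j) v) = 0 := fun j => by
    induction j with
    | zero => exact hv
    | succ j ih => rw [pow_succ', Module.End.mul_apply, hf, ih, map_zero]
  have h2 : ∀ j ≤ r, (N ^ (r - j)) v = 0 := fun j => by
    induction j with
    | zero => intro _; rw [Nat.sub_zero, hr]; rfl
    | succ j ih =>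
      intro hj
      refine h _ ?_ (h1 _)
      rw [← Module.End.mul_apply, ← pow_succ', show r - (j + 1) + 1 = r - j by omega]
      exact ih (by omega)
  have := h2 r le_rfl
  rwa [Nat.sub_self] at this

theorem ker_le_comap_of_comm {x : End k V} {w : End k W} {Φ : V →ₗ[k] W}
    (hΦ : ∀ v, Φ (x v) = w (Φ v)) : LinearMap.ker Φ ≤ (LinearMap.ker Φ).comap x := by
  intro v hv
  rw [Submodule.mem_comap, LinearMap.mem_ker, hΦ, LinearMap.mem_ker.1 hv, map_zero]

theorem exists_equiv_blk_of_section {x : End k V} {w : End k W} {Φ : V →ₗ[k] W} {σ : W →ₗ[k] V}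
    (hΦ : ∀ v, Φ (x v) = w (Φ v)) (hσ : ∀ c, σ (w c) = x (σ c))
    (h : Function.Injective (Φ ∘ₗ σ)) :
    ∃ e : (W × LinearMap.ker Φ) ≃ₗ[k] V,
      (∀ v, e (blk w 0 (x.restrict (ker_le_comap_of_comm hΦ)) v) = x (e v)) ∧
        ∀ c, e (c, 0) = σ c := by
  let f : W × LinearMap.ker Φ →ₗ[k] V := σ.coprod (LinearMap.ker Φ).subtype
  have hf : Function.Bijective f := by
    refine ⟨(injective_iff_map_eq_zero f).2 ?_, fun v => ?_⟩
    · rintro ⟨c, κ⟩ hc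
      rw [LinearMap.coprod_apply, Submodule.subtype_apply] at hc
      have h1 : (Φ ∘ₗ σ) c = 0 := by
        have := congrArg Φ hc
        rwa [map_add, LinearMap.mem_ker.1 κ.2, add_zero, map_zero] at this
      have h2 : c = 0 := h (h1.trans (map_zero _).symm)
      rw [h2, map_zero, zero_add] at hc
      exact Prod.ext h2 (Subtype.ext hc)
    · obtain ⟨c, hc⟩ := (LinearMap.injective_iff_surjective.1 h) (Φ v)
      refine ⟨(c, ⟨v - σ c, ?_⟩), by simp [f]⟩
      rw [LinearMap.mem_ker, map_sub, ← hc]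
      exact sub_self _
  refine ⟨LinearEquiv.ofBijective f hf, fun v => ?_, fun c => by simp [f]⟩
  simp only [LinearEquiv.ofBijective_apply, f, LinearMap.coprod_apply, blk_apply,
    LinearMap.zero_apply, add_zero, Submodule.subtype_apply, map_add, hσ]
  rfl

/-- The nilpotent shift `c ↦ (i ↦ c (i + 1))`. -/
def shiftEnd (k : Type) [Field k] (l : ℕ) : End k (Fin l → k) where
  toFun c i := if h : i.1 + 1 < l then c ⟨i.1 + 1, h⟩ else 0
  map_add' c c' := by
    funext i
    simp only [Pi.add_apply]
    split_ifs <;> simp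
  map_smul' a c := by
    funext i
    simp only [Pi.smul_apply, RingHom.id_apply]
    split_ifs <;> simp

theorem shiftEnd_pow_apply (l r : ℕ) (c : Fin l → k) (i : Fin l) :
    ((shiftEnd k l ^ r) c) i = if h : i.1 + r < l then c ⟨i.1 + r, h⟩ else 0 := by
  induction r generalizing i with
  | zero => simp
  | succ r ih =>
    rw [pow_succ', Module.End.mul_apply]
    simp only [shiftEnd, LinearMap.coe_mk, AddHom.coe_mk]
    by_cases h1 : i.1 + 1 < l
    · rw [dif_pos h1, ← shiftEnd, ih]
      simp only [add_assoc, add_comm 1 r]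
    · rw [dif_neg h1, dif_neg (by omega)]

theorem shiftEnd_pow_self (l : ℕ) : shiftEnd k l ^ l = 0 := by
  refine LinearMap.ext fun c => funext fun i => ?_
  rw [shiftEnd_pow_apply, dif_neg (by omega)]
  rfl

theorem shiftEnd_pow_ne_zero {l r : ℕ} (h : r < l) : shiftEnd k l ^ r ≠ 0 := by
  intro h0
  have := congrFun (LinearMap.congr_fun h0 (fun _ => 1)) ⟨0, by omega⟩
  rw [shiftEnd_pow_apply, dif_pos (by simpa using h)] at this
  exact one_ne_zero this

theorem exists_equiv_blk_shift {N : End k V} {l : ℕ} (h0 : N ^ (l + 1) = 0) {y : V}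
    (hy : (N ^ l) y ≠ 0) :
    ∃ (K : Submodule k V) (h : K ≤ K.comap N) (e : ((Fin (l + 1) → k) × K) ≃ₗ[k] V),
      (∀ v, e (blk (shiftEnd k (l + 1)) 0 (N.restrict h) v) = N (e v)) ∧
        e (Pi.single (Fin.last l) 1, 0) = y := by
  obtain ⟨ξ, hξ⟩ : ∃ ξ : Module.Dual k V, ξ ((N ^ l) y) ≠ 0 := by
    by_contra! h
    exact hy ((Module.forall_dual_apply_eq_zero_iff k _).1 h)
  let Φ : V →ₗ[k] Fin (l + 1) → k := LinearMap.pi fun i => ξ ∘ₗ (N ^ i.1)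
  let σ : (Fin (l + 1) → k) →ₗ[k] V := Fintype.linearCombination k fun i => (N ^ (l - i.1)) y
  have hΦ : ∀ v, Φ (N v) = shiftEnd k (l + 1) (Φ v) := fun v => by
    funext i
    simp only [Φ, LinearMap.pi_apply, LinearMap.comp_apply, shiftEnd, LinearMap.coe_mk,
      AddHom.coe_mk, ← Module.End.mul_apply, ← pow_succ]
    split_ifs with h
    · rfl
    · rw [show i.1 + 1 = l + 1 by omega, h0, LinearMap.zero_apply, map_zero]
  have hσ : ∀ c, σ (shiftEnd k (l + 1) c) = N (σ c) := fun c => by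
    simp only [σ, Fintype.linearCombination_apply, map_sum, map_smul]
    rw [Fin.sum_univ_castSucc, Fin.sum_univ_succ]
    have hz : shiftEnd k (l + 1) c (Fin.last l) = 0 := by
      have := shiftEnd_pow_apply (l + 1) 1 c (Fin.last l)
      rwa [pow_one, dif_neg (by simp)] at this
    have hz' : N ((N ^ (l - (0 : Fin (l + 1)).1)) y) = 0 := by
      rw [← Module.End.mul_apply, ← pow_succ', Fin.val_zero, Nat.sub_zero, h0]
      rfl
    rw [hz, zero_smul, add_zero, hz', smul_zero, zero_add]
    refine Finset.sum_congr rfl fun i _ => ?_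
    have hc : shiftEnd k (l + 1) c i.castSucc = c i.succ := by
      have := shiftEnd_pow_apply (l + 1) 1 c i.castSucc
      rwa [pow_one, dif_pos (by simp)] at this
    rw [hc, ← Module.End.mul_apply, ← pow_succ', Fin.val_castSucc, Fin.val_succ]
    congr 4
    omega
  have hσy : σ (Pi.single (Fin.last l) 1) = y := by
    simp [σ]
  suffices hinj : Function.Injective (Φ ∘ₗ σ) by
    obtain ⟨e, he, heσ⟩ := exists_equiv_blk_of_section hΦ hσ hinj
    exact ⟨_, ker_le_comap_of_comm hΦ, e, he, (heσ _).trans hσy⟩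
  refine injective_of_injOn_ker ⟨_, shiftEnd_pow_self (l + 1)⟩
    (M := shiftEnd k (l + 1)) (fun v => ?_) fun c hc hΦc => ?_
  · rw [LinearMap.comp_apply, hσ, hΦ]
    rfl
  · have h2 : ∀ i : Fin l, c i.succ = 0 := fun i => by
      have := shiftEnd_pow_apply (l + 1) 1 c i.castSucc
      rw [pow_one, dif_pos (by simp), hc] at this
      exact this.symm
    have h3 := congrFun hΦc 0
    simp only [LinearMap.comp_apply, Φ, σ, Fintype.linearCombination_apply, Fin.sum_univ_succ, h2,
      zero_smul, Finset.sum_const_zero, add_zero, LinearMap.pi_apply, Fin.val_zero, pow_zero,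
      Module.End.one_apply, Nat.sub_zero, map_smul, smul_eq_mul, Pi.zero_apply] at h3
    funext i
    refine Fin.cases ?_ (fun i => h2 i) i
    exact (mul_eq_zero.1 h3).resolve_right hξ

theorem exists_split_shift {N : End k V} {l : ℕ} (h0 : N ^ (l + 1) = 0) (h1 : N ^ l ≠ 0) :
    ∃ (K : Submodule k V) (h : K ≤ K.comap N),
      cls N = cls (blk (shiftEnd k (l + 1)) 0 (N.restrict h)) := by
  obtain ⟨y, hy⟩ : ∃ y, (N ^ l) y ≠ 0 := by
    by_contra! h
    exact h1 (LinearMap.ext h)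
  obtain ⟨K, h, e, he, -⟩ := exists_equiv_blk_shift h0 hy
  exact ⟨K, h, (cls_congr e he).symm⟩

theorem cls_one_add {N : End k V} {M : End k W} (h : cls N = cls M) :
    cls (1 + N) = cls (1 + M) := by
  obtain ⟨e, he⟩ := cls_eq_iff.1 h
  exact cls_eq_iff.2 ⟨e, fun v => by simp [he]⟩

/-- The regular unipotent class. -/
noncomputable def regUni (k : Type) [Field k] (n : ℕ) : EndClass k := cls (1 + shiftEnd k n)

theorem one_add_blk (a : End k V) (c : W →ₗ[k] V) (y : End k W) :
    1 + blk a c y = blk (1 + a) c (1 + y) := by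
  refine LinearMap.ext fun v => ?_
  simp [blk_apply, Prod.ext_iff, add_assoc]

theorem cls_eq_regUni {N : End k V} (hN : IsNilpotent N) {n : ℕ} (hn : finrank k V = n)
    (h : n = 0 ∨ N ^ (n - 1) ≠ 0) : cls (1 + N) = regUni k n := by
  refine cls_one_add ?_
  rcases n with _ | n
  · have := Module.finrank_zero_iff.1 hn
    exact cls_congr (LinearEquiv.ofFinrankEq V (Fin 0 → k) (by simpa using hn))
      fun v => Subsingleton.elim _ _
  · obtain ⟨K, hK, h1⟩ := exists_split_shift (pow_eq_zero_of_finrank_le hN hn.le)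
      (h.resolve_left (Nat.succ_ne_zero n))
    have h2 := congrArg EndClass.dim h1
    rw [dim_cls, dim_cls, finrank_prod, finrank_fin_fun, hn] at h2
    have := Module.finrank_zero_iff.1 (by omega : finrank k K = 0)
    rw [h1, cls_blk_of_subsingleton_right]

/-- The unipotent class with one Jordan block of size `l` and `m` blocks of size one. -/
noncomputable def hookCls (k : Type) [Field k] (l m : ℕ) : EndClass k :=
  cls (blk (1 + shiftEnd k l) 0 (1 : End k (Fin m → k)))

theorem le_finrank_range_of_pow_ne_zero {N : End k V} (hN : IsNilpotent N) {r : ℕ}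
    (h : N ^ r ≠ 0) : r ≤ finrank k (LinearMap.range N) := by
  rcases r with _ | r
  · exact Nat.zero_le _
  obtain ⟨y, hy⟩ : ∃ y, (N ^ (r + 1)) y ≠ 0 := by
    by_contra! h1
    exact h (LinearMap.ext h1)
  rw [pow_succ, Module.End.mul_apply] at hy
  refine lt_finrank_of_pow_ne_zero hN (v := N y) ?_ ⟨y, rfl⟩ hy
  have := range_pow_le_comap N 1
  rwa [pow_one] at this

theorem finrank_submodule_prod (S : Submodule k V) (T : Submodule k W) :
    finrank k (S.prod T) = finrank k S + finrank k T := by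
  have h1 : S.prod T = LinearMap.range (S.subtype.prodMap T.subtype) := by
    rw [LinearMap.range_prodMap, Submodule.range_subtype, Submodule.range_subtype]
  rw [h1, LinearMap.finrank_range_of_inj, finrank_prod]
  exact Prod.map_injective.2 ⟨Subtype.val_injective, Subtype.val_injective⟩

theorem cls_eq_hookCls {N : End k V} {l m : ℕ} (h0 : N ^ (l + 1) = 0) (h1 : N ^ l ≠ 0)
    (hr : finrank k (LinearMap.range N) ≤ l) (hn : finrank k V = l + 1 + m) :
    cls (1 + N) = hookCls k (l + 1) m := by
  obtain ⟨K, hK, h2⟩ := exists_split_shift h0 h1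
  have h3 := congrArg EndClass.dim h2
  rw [dim_cls, dim_cls, finrank_prod, finrank_fin_fun, hn] at h3
  have hKm : finrank k K = m := by omega
  obtain ⟨e, he⟩ := cls_eq_iff.1 h2
  set B := blk (shiftEnd k (l + 1)) 0 (N.restrict hK)
  have h4 : LinearMap.range B = (LinearMap.range N).map (e : V →ₗ[k] _) := by
    ext v
    constructor
    · rintro ⟨w, rfl⟩
      exact ⟨N (e.symm w), ⟨_, rfl⟩, by rw [LinearEquiv.coe_coe, he, e.apply_symm_apply]⟩
    · rintro ⟨_, ⟨w, rfl⟩, rfl⟩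
      exact ⟨e w, (he w).symm⟩
  have h5 : finrank k (LinearMap.range B) ≤ l := by
    rw [h4]
    exact (Submodule.finrank_map_le _ _).trans hr
  have h6 : LinearMap.range B = (LinearMap.range (shiftEnd k (l + 1))).prod
      (LinearMap.range (N.restrict hK)) := by
    ext ⟨a, b⟩
    constructor
    · rintro ⟨w, hw⟩
      rw [blk_apply, LinearMap.zero_apply, add_zero] at hw
      exact ⟨⟨w.1, congrArg Prod.fst hw⟩, ⟨w.2, congrArg Prod.snd hw⟩⟩
    · rintro ⟨⟨u, hu⟩, ⟨v, hv⟩⟩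
      exact ⟨(u, v), by rw [blk_apply, LinearMap.zero_apply, add_zero]; exact Prod.ext hu hv⟩
  have h7 := le_finrank_range_of_pow_ne_zero (N := shiftEnd k (l + 1)) ⟨_, shiftEnd_pow_self _⟩
    (shiftEnd_pow_ne_zero (Nat.lt_succ_self l))
  rw [h6, finrank_submodule_prod] at h5
  have h8 : N.restrict hK = 0 := by
    rw [← LinearMap.range_eq_bot, ← Submodule.finrank_eq_zero]
    omega
  rw [show B = blk (shiftEnd k (l + 1)) 0 0 from congrArg (blk (shiftEnd k (l + 1)) 0) h8] at h2
  rw [cls_one_add h2, one_add_blk, add_zero, hookCls]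
  refine cls_eq_iff.2 ⟨(LinearEquiv.refl k _).prodCongr (LinearEquiv.ofFinrankEq K (Fin m → k)
    (by simpa using hKm)), fun v => ?_⟩
  simp [blk_apply]

end Nilpotent

section RegularUnipotent

open Module

variable {k : Type} [Field k] [Finite k]
variable {V W : Type} [AddCommGroup V] [Module k V] [AddCommGroup W] [Module k W]
variable [Finite V] [Finite W]

theorem le_comap_one_add {N : End k V} {S : Submodule k V} :
    S ≤ S.comap (1 + N) ↔ S ≤ S.comap N := by
  refine forall₂_congr fun v hv => ?_
  rw [Submodule.mem_comap, LinearMap.add_apply, Module.End.one_apply, Submodule.mem_comap]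
  exact S.add_mem_iff_right hv

theorem subCls_one_add {N : End k V} {S : Submodule k V} (h : S ≤ S.comap N) :
    subCls (1 + N) S = cls (1 + N.restrict h) :=
  subCls_eq _ S.subtype S.injective_subtype S.range_subtype fun w => by simp

theorem quoCls_one_add {N : End k V} {S : Submodule k V} (h : S ≤ S.comap N) :
    quoCls (1 + N) S = cls (1 + S.mapQ S N h) :=
  quoCls_eq _ S.mkQ S.mkQ_surjective S.ker_mkQ fun w => by simp

theorem isNilpotent_shiftEnd (n : ℕ) : IsNilpotent (shiftEnd k n) := ⟨n, shiftEnd_pow_self n⟩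

theorem hmul_regUni (m d : ℕ) (F : EndClass k → EndClass k → ℂ) :
    hmul m F (regUni k (m + d)) = F (regUni k m) (regUni k d) := by
  classical
  set N := shiftEnd k (m + d) with hN
  have hnil : IsNilpotent N := isNilpotent_shiftEnd _
  obtain ⟨v, hv⟩ : ∃ v, ∀ i j, i + j < m + d → (N ^ i) ((N ^ j) v) ≠ 0 := by
    refine ⟨fun _ => 1, fun i j hij h0 => ?_⟩
    have := congrFun h0 ⟨0, by omega⟩
    rw [← Module.End.mul_apply, ← pow_add, shiftEnd_pow_apply, dif_pos (by simpa using hij)] at this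
    exact one_ne_zero this
  have hV : finrank k (Fin (m + d) → k) = m + d := finrank_fin_fun k
  set T := LinearMap.range (N ^ d) with hT
  have hTi : T ≤ T.comap N := range_pow_le_comap N d
  have hTm : m ≤ finrank k T := by
    rcases m with _ | m
    · exact Nat.zero_le _
    · exact lt_finrank_of_pow_ne_zero hnil hTi ⟨v, rfl⟩ (hv m d (by omega))
  have hKd : d ≤ finrank k (LinearMap.ker (N ^ d)) := by
    rcases d with _ | d
    · exact Nat.zero_le _
    · refine lt_finrank_of_pow_ne_zero hnil (ker_pow_le_comap N _) (v := (N ^ m) v) ?_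
        (hv d m (by omega))
      rw [LinearMap.mem_ker, ← Module.End.mul_apply, ← pow_add,
        pow_eq_zero_of_le (by omega) (shiftEnd_pow_self (m + (d + 1)))]
      rfl
  have hrn := LinearMap.finrank_range_add_finrank_ker (N ^ d)
  rw [hV, ← hT] at hrn
  have hTf : finrank k T = m := by omega
  have hQf : finrank k (_ ⧸ T) = d := by
    have := T.finrank_quotient_add_finrank
    omega
  rw [regUni, hmul_cls, Finset.sum_eq_single T]
  · rw [if_pos ⟨le_comap_one_add.2 hTi, hTf⟩, subCls_one_add hTi, quoCls_one_add hTi,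
      cls_eq_regUni (isNilpotent_restrict hnil hTi) hTf,
      cls_eq_regUni (isNilpotent_mapQ hnil hTi) hQf]
    · rcases d with _ | d
      · exact Or.inl rfl
      · refine Or.inr fun h0 => ?_
        have h1 := LinearMap.congr_fun h0 (T.mkQ v)
        rw [pow_mapQ_mk, LinearMap.zero_apply, Submodule.mkQ_apply,
          Submodule.Quotient.mk_eq_zero] at h1
        have := lt_finrank_of_pow_ne_zero hnil hTi h1 (hv m d (by omega))
        omega
    · rcases m with _ | m
      · exact Or.inl rfl
      · refine Or.inr fun h0 => hv m d (by omega) ?_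
        rw [← pow_restrict_apply hTi m ⟨(N ^ d) v, v, rfl⟩]
        exact congrArg Subtype.val (LinearMap.congr_fun h0 _)
  · intro S _ hS
    refine if_neg fun h => hS ?_
    have hSi := le_comap_one_add.1 h.1
    refine (Submodule.eq_of_le_of_finrank_eq ?_ (hTf.trans h.2.symm)).symm
    rintro _ ⟨w, rfl⟩
    have h1 : (S.mapQ S N hSi) ^ d = 0 := by
      refine pow_eq_zero_of_finrank_le (isNilpotent_mapQ hnil hSi) ?_
      have := S.finrank_quotient_add_finrank
      omega
    rw [← Submodule.Quotient.mk_eq_zero, ← Submodule.mkQ_apply, ← pow_mapQ_mk hSi, h1]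
    rfl
  · simp

theorem det_one_add {N : End k V} (hN : IsNilpotent N) : LinearMap.det (1 + N) = 1 := by
  have h1 : (-N).charpoly = Polynomial.X ^ finrank k V := hN.neg.charpoly_eq_X_pow_finrank
  have h2 := LinearMap.eval_charpoly (-N) 1
  rw [h1, Polynomial.eval_pow, Polynomial.eval_X, one_pow, map_one, sub_neg_eq_add] at h2
  exact h2.symm

theorem det_regUni (n : ℕ) : (regUni k n).det = 1 := by
  rw [regUni, det_cls, det_one_add (isNilpotent_shiftEnd n)]

theorem dim_regUni (n : ℕ) : (regUni k n).dim = n := by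
  rw [regUni, dim_cls, finrank_fin_fun]

variable {θ : MulChar k ℂ}

theorem hA_regUni (m d : ℕ) (f : EndClass k → ℂ) :
    hA θ m f (regUni k (m + d)) = f (regUni k d) := by
  rw [hA, hmul_regUni, det_regUni, map_one, one_mul]

theorem hw_regUni (d : ℕ) (τ : EndClass k → ℂ) : ∀ α : List ℕ,
    hw θ α τ (regUni k (α.sum + d)) = τ (regUni k d)
  | [] => by simp [hw]
  | a :: α => by rw [hw, List.sum_cons, add_assoc, hA_regUni, hw_regUni d τ α]

/-- Partitions with at most one part. -/
def rowParts : List (List ℕ) := [[], [1], [2], [3], [4], [5]]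

theorem schurExp_coeff_sum : ∀ l ∈ smallParts,
    ((schurExp l).map Prod.fst).sum = if l ∈ rowParts then 1 else 0 := by decide +kernel

theorem schurChar_regUni (d : ℕ) (τ : EndClass k → ℂ) {l : List ℕ} (hl : l ∈ smallParts) :
    schurChar θ l τ (regUni k (l.sum + d)) = if l ∈ rowParts then τ (regUni k d) else 0 := by
  have h2 : ∀ L : List (ℤ × List ℕ), evForm θ L τ (regUni k (l.sum + d)) =
      (L.map fun x => (x.1 : ℂ) * hw θ x.2 τ (regUni k (l.sum + d))).sum := fun L => by
    rw [evForm]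
    induction L with
    | nil => rfl
    | cons a L ih => simp [ih]
  have h3 : schurChar θ l τ (regUni k (l.sum + d)) =
      (((schurExp l).map Prod.fst).sum : ℤ) * τ (regUni k d) := by
    rw [schurChar, h2, Int.cast_list_sum, List.map_map, ← List.sum_map_mul_right]
    refine congrArg List.sum (List.map_congr_left fun x hx => ?_)
    rw [← schurExp_sum l hl x hx, hw_regUni]
    rfl
  rw [h3, schurExp_coeff_sum l hl]
  split_ifs <;> simp

end RegularUnipotent

section HookChain

open Module

variable {k : Type} [Field k] [Finite k]
variable {V W : Type} [AddCommGroup V] [Module k V] [AddCommGroup W] [Module k W]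
variable [Finite V] [Finite W]

theorem hookCls_zero (l : ℕ) : hookCls k l 0 = regUni k l :=
  cls_blk_of_subsingleton_right _ _ _

theorem hookCls_one (m : ℕ) : hookCls k 1 m = oneCls k (1 + m) := by
  have h := cls_eq_hookCls (k := k) (V := Fin (1 + m) → k) (N := 0) (l := 0) (m := m) (by simp)
    (by
      intro h0
      have := congrFun (LinearMap.congr_fun h0 fun _ => 1) ⟨0, by omega⟩
      simp at this)
    (by rw [LinearMap.range_zero, finrank_bot]) (by simp)
  rw [← h, add_zero, cls_one (finrank_fin_fun k)]

theorem pow_succ_blk_apply (s : End k W) (c : V →ₗ[k] W) (r : ℕ) (w : W) (v : V) :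
    (blk s c 0 ^ (r + 1)) (w, v) = ((s ^ r) (s w + c v), 0) := by
  induction r generalizing w v with
  | zero => simp [blk_apply]
  | succ r ih =>
    rw [pow_succ, Module.End.mul_apply, blk_apply, LinearMap.zero_apply, ih, map_zero, add_zero,
      ← Module.End.mul_apply, ← pow_succ]

theorem card_comp_eq_zero {f : Dual k W} (hf : f ≠ 0) :
    Nat.card {c : V →ₗ[k] W // f ∘ₗ c = 0} * Nat.card k ^ finrank k V =
      Nat.card k ^ (finrank k V * finrank k W) := by
  have h1 : {c : V →ₗ[k] W // f ∘ₗ c = 0} ≃ (V →ₗ[k] LinearMap.ker f) :=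
    { toFun := fun c => LinearMap.codRestrict _ c.1 fun v => LinearMap.congr_fun c.2 v
      invFun := fun c => ⟨(LinearMap.ker f).subtype ∘ₗ c, LinearMap.ext fun v => (c v).2⟩
      left_inv := fun c => rfl
      right_inv := fun c => rfl }
  have h2 := LinearMap.finrank_range_add_finrank_ker f
  rw [LinearMap.range_eq_top.2 (LinearMap.surjective hf), finrank_top, finrank_self] at h2
  rw [Nat.card_congr h1, card_linearMap, ← h2, ← pow_add]
  ring_nf

theorem cls_blk_regUni {l m : ℕ} (c : (Fin (m + 1) → k) →ₗ[k] (Fin (l + 1) → k)) :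
    cls (blk (1 + shiftEnd k (l + 1)) c 1) =
      open Classical in if LinearMap.proj (Fin.last l) ∘ₗ c = 0 then hookCls k (l + 1) (m + 1)
        else hookCls k (l + 2) m := by
  set s := shiftEnd k (l + 1) with hs
  have hB : blk (1 + s) c 1 = 1 + blk s c 0 := by rw [one_add_blk, add_zero]
  have hsl : ∀ w : Fin (l + 1) → k, s w (Fin.last l) = 0 := fun w => by
    have := shiftEnd_pow_apply (k := k) (l + 1) 1 w (Fin.last l)
    rwa [pow_one, dif_neg (by simp)] at this
  have hs0 : ∀ w : Fin (l + 1) → k, (s ^ l) w 0 = w (Fin.last l) := fun w => by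
    rw [hs, shiftEnd_pow_apply, dif_pos (by simp)]
    congr 1
    exact Fin.ext (by simp)
  have hsw : ∀ w : Fin (l + 1) → k, w (Fin.last l) = 0 → (s ^ l) w = 0 := fun w hw => by
    funext i
    by_cases hi : i = 0
    · rw [hi, hs0, hw]
      rfl
    · rw [hs, shiftEnd_pow_apply, dif_neg]
      · rfl
      · have := Fin.val_ne_zero_iff.2 hi
        omega
  rw [hB]
  split_ifs with hc
  · refine cls_eq_hookCls ?_ ?_ ?_ (by simp)
    · refine LinearMap.ext fun x => ?_
      obtain ⟨w, v⟩ := x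
      rw [pow_succ_blk_apply, hsw]
      · rfl
      · rw [Pi.add_apply, hsl, zero_add]
        exact LinearMap.congr_fun hc v
    · intro h0
      rcases l with _ | l
      · have := LinearMap.congr_fun h0 ((fun _ => 1), 0)
        simpa using congrFun (congrArg Prod.fst this) 0
      · have := LinearMap.congr_fun h0 ((fun _ => 1), 0)
        rw [pow_succ_blk_apply, map_zero, add_zero, ← Module.End.mul_apply, ← pow_succ] at this
        exact one_ne_zero ((hs0 fun _ => 1).symm.trans (congrFun (congrArg Prod.fst this) 0))
    · have hp : (LinearMap.proj (Fin.last l) : Dual k (Fin (l + 1) → k)) ≠ 0 := fun h =>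
        one_ne_zero (α := k) (LinearMap.congr_fun h fun _ => 1)
      have h2 := LinearMap.finrank_range_add_finrank_ker
        (LinearMap.proj (Fin.last l) : Dual k (Fin (l + 1) → k))
      rw [LinearMap.range_eq_top.2 (LinearMap.surjective hp), finrank_top, finrank_self,
        finrank_fin_fun] at h2
      have h3 : LinearMap.range (blk s c 0) ≤
          (LinearMap.ker (LinearMap.proj (Fin.last l) : Dual k (Fin (l + 1) → k))).prod ⊥ := by
        rintro _ ⟨⟨w, v⟩, rfl⟩
        refine ⟨?_, rfl⟩
        change (s w + c v) (Fin.last l) = 0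
        rw [Pi.add_apply, hsl, zero_add]
        exact LinearMap.congr_fun hc v
      have h4 := Submodule.finrank_mono h3
      rw [finrank_submodule_prod, finrank_bot] at h4
      omega
  · refine cls_eq_hookCls (l := l + 1) ?_ ?_ ?_ (by simp; ring)
    · refine LinearMap.ext fun x => ?_
      obtain ⟨w, v⟩ := x
      rw [pow_succ_blk_apply, hs, shiftEnd_pow_self]
      rfl
    · intro h0
      refine hc (LinearMap.ext fun v => ?_)
      have := LinearMap.congr_fun h0 (0, v)
      rw [pow_succ_blk_apply, map_zero, zero_add] at this
      exact (hs0 (c v)).symm.trans (congrFun (congrArg Prod.fst this) 0)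
    · have h3 : LinearMap.range (blk s c 0) ≤ (⊤ : Submodule k (Fin (l + 1) → k)).prod ⊥ := by
        rintro _ ⟨⟨w, v⟩, rfl⟩
        exact ⟨trivial, rfl⟩
      have h4 := Submodule.finrank_mono h3
      rwa [finrank_submodule_prod, finrank_bot, finrank_top, finrank_fin_fun] at h4

theorem jac_regUni_oneCls (χ : EndClass k → ℂ) (l m : ℕ) :
    (Nat.card k : ℂ) ^ (m + 1) * jac χ (regUni k (l + 1)) (oneCls k (m + 1)) =
      χ (hookCls k (l + 1) (m + 1)) + ((Nat.card k : ℂ) ^ (m + 1) - 1) * χ (hookCls k (l + 2) m) := by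
  classical
  have hp : (LinearMap.proj (Fin.last l) : Dual k (Fin (l + 1) → k)) ≠ 0 := fun h =>
    one_ne_zero (α := k) (LinearMap.congr_fun h fun _ => 1)
  have h1 := card_comp_eq_zero (V := Fin (m + 1) → k) hp
  have hq : (Nat.card k : ℂ) ≠ 0 := Nat.cast_ne_zero.2 Nat.card_pos.ne'
  rw [regUni, oneCls, jac_cls]
  simp only [cls_blk_regUni, apply_ite χ]
  rw [Finset.sum_ite, Finset.sum_const, Finset.sum_const, nsmul_eq_mul, nsmul_eq_mul]
  have h2 : (Finset.univ.filter fun c : (Fin (m + 1) → k) →ₗ[k] (Fin (l + 1) → k) =>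
      LinearMap.proj (Fin.last l) ∘ₗ c = 0).card =
      Nat.card {c : (Fin (m + 1) → k) →ₗ[k] (Fin (l + 1) → k) //
        LinearMap.proj (Fin.last l) ∘ₗ c = 0} := by
    rw [Nat.card_eq_fintype_card, Fintype.card_subtype]
  have h3 := Finset.card_filter_add_card_filter_not (s := Finset.univ)
    fun c : (Fin (m + 1) → k) →ₗ[k] (Fin (l + 1) → k) => LinearMap.proj (Fin.last l) ∘ₗ c = 0
  rw [Finset.card_univ, ← Nat.card_eq_fintype_card, card_linearMap, h2] at h3
  rw [h2, card_linearMap]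
  simp only [finrank_fin_fun] at h1 h3 ⊢
  generalize Nat.card {c : (Fin (m + 1) → k) →ₗ[k] (Fin (l + 1) → k) //
    LinearMap.proj (Fin.last l) ∘ₗ c = 0} = A at *
  have h1' := congrArg (Nat.cast (R := ℂ)) h1
  have h3' := congrArg (Nat.cast (R := ℂ)) h3
  push_cast at h1' h3' ⊢
  rw [eq_sub_of_add_eq' h3']
  have hz : (Nat.card k : ℂ) ^ ((m + 1) * (l + 1)) ≠ 0 := pow_ne_zero _ hq
  rw [← mul_right_inj' hz]
  generalize (Nat.card k : ℂ) ^ ((m + 1) * (l + 1)) = B at *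
  subst h1'
  field_simp

end HookChain

section Recursion

open Module

variable {k : Type} [Field k] [Finite k] {θ : MulChar k ℂ} {Θ : Set (MulChar k ℂ)} {n : ℕ}

theorem sum_smallParts {M : Type*} [AddCommMonoid M] (n : ℕ) (f : List ℕ → M) :
    ∑ l ∈ smallParts.toFinset.filter (fun l => l.sum ≤ n), f l =
      ((smallParts.filter fun l => l.sum ≤ n).map f).sum := by
  rw [← List.sum_toFinset, List.toFinset_filter]
  · congr 1
    ext
    simp
  · exact List.Nodup.filter _ (by decide)

/-- The exponent of `p` in the degree of `χ`. -/
noncomputable def degVal (p n : ℕ) (χ : EndClass k → ℂ) : ℕ :=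
  padicValNat p ⌊‖χ (oneCls k n)‖⌋₊

theorem degVal_eq {p d : ℕ} {χ : EndClass k → ℂ} (h : χ (oneCls k n) = d) :
    degVal p n χ = padicValNat p d := by
  rw [degVal, h, Complex.norm_natCast, Nat.floor_natCast]

theorem exists_degree {χ : EndClass k → ℂ} (hχ : χ ∈ Irr k n) :
    ∃ d : ℕ, 0 < d ∧ χ (oneCls k n) = d :=
  Irr.one_pos hχ (finrank_fin_fun k)

theorem padicValNat_pow_sub_one {p e : ℕ} (hp : p.Prime) (he : 0 < e) (i : ℕ) :
    ¬ p ∣ (p ^ e) ^ (i + 1) - 1 := by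
  intro h
  have h1 : 1 ≤ (p ^ e) ^ (i + 1) := Nat.one_le_pow _ _ (pow_pos hp.pos _)
  have h2 : p ∣ (p ^ e) ^ (i + 1) :=
    dvd_pow (dvd_pow_self p he.ne') (Nat.succ_ne_zero i)
  have := (Nat.dvd_sub_iff_right h1 h2).1 h
  exact hp.one_lt.ne' (Nat.dvd_one.1 this)

theorem not_dvd_qfac {p e : ℕ} (hp : p.Prime) (he : 0 < e) (n : ℕ) : ¬ p ∣ qfac (p ^ e) n := by
  rw [qfac, hp.prime.dvd_finset_prod_iff]
  rintro ⟨i, -, hi⟩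
  exact padicValNat_pow_sub_one hp he i hi

theorem not_dvd_hookProd {p e : ℕ} (hp : p.Prime) (he : 0 < e) {l : List ℕ}
    (hl : l ∈ smallParts) : ¬ p ∣ hookProd (p ^ e) l := by
  unfold hookProd
  rw [hp.prime.dvd_prod_iff]
  rintro ⟨a, ha, hd⟩
  obtain ⟨h, hh, rfl⟩ := List.mem_map.1 ha
  rcases h with _ | h
  · clear ha hd
    revert hh
    revert l
    decide
  · exact padicValNat_pow_sub_one hp he h hd

theorem degVal_schurChar {p e d : ℕ} (hp : p.Prime) (he : 0 < e) (hk : Nat.card k = p ^ e)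
    {τ : EndClass k → ℂ} {l : List ℕ} (hl : l ∈ smallParts) (hτ : τ ∈ Irr k d)
    (hS : schurChar θ l τ ∈ Irr k (l.sum + d)) :
    degVal p (l.sum + d) (schurChar θ l τ) = e * partN l + degVal p d τ := by
  have := Fact.mk hp
  obtain ⟨a, ha, h1⟩ := exists_degree hτ
  obtain ⟨b, hb, h2⟩ := exists_degree hS
  have h3 := schurChar_oneCls (θ := θ) (d := d) τ hl
  rw [h1, h2, hk] at h3
  rw [degVal_eq h1, degVal_eq h2]
  have h4 : b * (qfac (p ^ e) d * hookProd (p ^ e) l) =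
      qfac (p ^ e) (l.sum + d) * (p ^ e) ^ partN l * a := by exact_mod_cast h3
  have h5 := congrArg (padicValNat p) h4
  have hq : ∀ n, qfac (p ^ e) n ≠ 0 := fun n h => not_dvd_qfac hp he n (h ▸ dvd_zero p)
  have hh : hookProd (p ^ e) l ≠ 0 := fun h => not_dvd_hookProd hp he hl (h ▸ dvd_zero p)
  rw [padicValNat.mul hb.ne' (mul_ne_zero (hq d) hh), padicValNat.mul (hq d) hh,
    padicValNat.mul (mul_ne_zero (hq _) (pow_ne_zero _ (pow_ne_zero _ hp.ne_zero))) ha.ne',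
    padicValNat.mul (hq _) (pow_ne_zero _ (pow_ne_zero _ hp.ne_zero)), ← pow_mul,
    padicValNat.prime_pow, padicValNat.eq_zero_of_not_dvd (not_dvd_qfac hp he _),
    padicValNat.eq_zero_of_not_dvd (not_dvd_qfac hp he _),
    padicValNat.eq_zero_of_not_dvd (not_dvd_hookProd hp he hl)] at h5
  omega

/-- The number of irreducible characters without constituents from `Θ`. -/
noncomputable def chNum (Θ : Set (MulChar k ℂ)) (n : ℕ) : ℕ := Nat.card (vIrr Θ n)

/-- The total exponent of `p` in the degrees of these characters. -/
noncomputable def chVal (p : ℕ) (Θ : Set (MulChar k ℂ)) (n : ℕ) : ℕ :=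
  ∑ χ : vIrr Θ n, degVal p n χ.1

/-- The sum of the squared absolute values at the regular unipotent class. -/
noncomputable def chUni (Θ : Set (MulChar k ℂ)) (n : ℕ) : ℝ :=
  ∑ χ : vIrr Θ n, ‖χ.1 (regUni k n)‖ ^ 2

theorem mem_filter_smallParts {l : List ℕ}
    (h : l ∈ smallParts.toFinset.filter fun l => l.sum ≤ n) : l ∈ smallParts ∧ l.sum ≤ n := by
  simpa using h

theorem chNum_rec (hθ : θ ∉ Θ) (hn : n ≤ 5) : chNum Θ n =
    ((smallParts.filter fun l => l.sum ≤ n).map fun l => chNum (insert θ Θ) (n - l.sum)).sum := by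
  have h := sum_vIrr hθ hn fun _ => 1
  rw [Finset.sum_const, Finset.card_univ, ← Nat.card_eq_fintype_card, smul_eq_mul, mul_one] at h
  rw [chNum, h, sum_smallParts]
  refine congrArg List.sum (List.map_congr_left fun l _ => ?_)
  rw [Finset.sum_const, Finset.card_univ, ← Nat.card_eq_fintype_card, smul_eq_mul, mul_one, chNum]

theorem chUni_rec (hθ : θ ∉ Θ) (hn : n ≤ 5) : chUni Θ n =
    ((smallParts.filter fun l => l.sum ≤ n).map fun l =>
      if l ∈ rowParts then chUni (insert θ Θ) (n - l.sum) else 0).sum := by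
  rw [chUni, sum_vIrr hθ hn fun χ => ‖χ (regUni k n)‖ ^ 2, ← sum_smallParts]
  refine Finset.sum_congr rfl fun l hl => ?_
  obtain ⟨h1, h2⟩ := mem_filter_smallParts hl
  obtain ⟨d, rfl⟩ := Nat.exists_eq_add_of_le h2
  rw [Nat.add_sub_cancel_left]
  simp only [schurChar_regUni d _ h1]
  split_ifs
  · rfl
  · simp

theorem chVal_rec {p e : ℕ} (hp : p.Prime) (he : 0 < e) (hk : Nat.card k = p ^ e)
    (hθ : θ ∉ Θ) (hn : n ≤ 5) : chVal p Θ n =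
    ((smallParts.filter fun l => l.sum ≤ n).map fun l =>
      e * partN l * chNum (insert θ Θ) (n - l.sum) + chVal p (insert θ Θ) (n - l.sum)).sum := by
  rw [chVal, sum_vIrr hθ hn fun χ => degVal p n χ, ← sum_smallParts]
  refine Finset.sum_congr rfl fun l hl => ?_
  obtain ⟨h1, h2⟩ := mem_filter_smallParts hl
  obtain ⟨d, rfl⟩ := Nat.exists_eq_add_of_le h2
  rw [Nat.add_sub_cancel_left, chNum, Nat.card_eq_fintype_card, ← Finset.card_univ, mul_comm,
    ← smul_eq_mul, ← Finset.sum_const, chVal, ← Finset.sum_add_distrib]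
  refine Finset.sum_congr rfl fun τ _ => ?_
  exact degVal_schurChar hp he hk h1 τ.2.1
    (schurChar_mem_Irr τ.2.1 (τ.2.2 θ (Set.mem_insert _ _)) h1)

end Recursion

section Transpose

open Module Polynomial

variable {k : Type} [Field k] [Finite k]
variable {V W Q : Type} [AddCommGroup V] [Module k V] [AddCommGroup W] [Module k W]
variable [AddCommGroup Q] [Module k Q] [Finite V] [Finite W] [Finite Q]

theorem exists_cyclic_decomposition (x : End k V) :
    ∃ (ι : Type) (_ : Fintype ι) (f : ι → k[X]) (E : V ≃ₗ[k] ∀ i, AdjoinRoot (f i)),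
      (∀ i, ∃ (p : k[X]) (e : ℕ), p.Monic ∧ Irreducible p ∧ f i = p ^ e) ∧
      ∀ v i, E (x v) i = AdjoinRoot.root (f i) * E v i := by
  classical
  obtain ⟨ι, hι, p, hp, e, ⟨E⟩⟩ := Module.equiv_directSum_of_isTorsion
    (AEval.isTorsion_of_finiteDimensional k V x)
  let E1 := E.trans (DirectSum.linearEquivFunOnFintype k[X] ι _)
  have hs : ∀ i, Submodule.span k[X] {p i ^ e i} = Ideal.span {normalize (p i) ^ e i} := fun i => by
    rw [← Ideal.submodule_span_eq]
    exact Ideal.span_singleton_eq_span_singleton.2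
      (Associated.pow_pow (associated_normalize (p i)))
  let E2 : AEval k V x ≃ₗ[k[X]] ∀ i, k[X] ⧸ Ideal.span {normalize (p i) ^ e i} :=
    E1.trans (LinearEquiv.piCongrRight fun i => Submodule.quotEquivOfEq _ _ (hs i))
  let E3 : V ≃ₗ[k] ∀ i, AdjoinRoot (normalize (p i) ^ e i) :=
    { toFun := fun v => E2 (AEval.of k V x v)
      invFun := fun u => (AEval.of k V x).symm (E2.symm u)
      left_inv := fun v => by simp
      right_inv := fun u => by
        change E2 (AEval.of k V x ((AEval.of k V x).symm (E2.symm _))) = _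
        rw [LinearEquiv.apply_symm_apply]
        exact E2.apply_symm_apply u
      map_add' := fun v w => by rw [map_add, map_add]; rfl
      map_smul' := fun a v => by
        rw [map_smul, ← AEval.C_smul, map_smul]
        funext i
        change (C a : k[X]) • E2 (AEval.of k V x v) i = a • E2 (AEval.of k V x v) i
        obtain ⟨r, hr⟩ := Ideal.Quotient.mk_surjective (E2 (AEval.of k V x v) i)
        rw [← hr]
        change Ideal.Quotient.mk _ (C a * r) = Ideal.Quotient.mk _ (a • r)
        rw [smul_eq_C_mul] }
  refine ⟨ι, hι, fun i => normalize (p i) ^ e i, E3, fun i => ⟨normalize (p i), e i,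
    Polynomial.monic_normalize (hp i).ne_zero, (associated_normalize (p i)).irreducible (hp i),
    rfl⟩, fun v i => ?_⟩
  have h1 : E2 (AEval.of k V x (x v)) = (X : k[X]) • E2 (AEval.of k V x v) := by
    rw [← map_smul, AEval.X_smul_of]
    rfl
  exact congrFun h1 i

theorem exists_functional {f : k[X]} (hf : f.Monic) : ∃ t : AdjoinRoot f →ₗ[k] k,
    ∀ a, (∀ u, t (a * u) = 0) → a = 0 := by
  refine ⟨lcoeff k (f.natDegree - 1) ∘ₗ AdjoinRoot.modByMonicHom hf, fun a ha => ?_⟩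
  by_contra h0
  obtain ⟨r, rfl⟩ := AdjoinRoot.mk_surjective a
  set s := r %ₘ f with hs
  have hrs : AdjoinRoot.mk f r = AdjoinRoot.mk f s := by
    rw [hs, ← AdjoinRoot.modByMonicHom_mk hf, AdjoinRoot.mk_leftInverse hf]
  rw [hrs] at ha h0
  have hs0 : s ≠ 0 := fun h => h0 (by rw [h, map_zero])
  have hf1 : f ≠ 1 := fun h => hs0 (by rw [hs, h, modByMonic_one])
  have hd := natDegree_modByMonic_lt r hf hf1
  rw [← hs] at hd
  have := ha (AdjoinRoot.mk f (X ^ (f.natDegree - 1 - s.natDegree)))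
  rw [← map_mul, LinearMap.comp_apply, AdjoinRoot.modByMonicHom_mk,
    (modByMonic_eq_self_iff hf).2, lcoeff_apply,
    show f.natDegree - 1 = s.natDegree + (f.natDegree - 1 - s.natDegree) by omega,
    Nat.add_sub_cancel_left, coeff_mul_X_pow, coeff_natDegree] at this
  · exact hs0 (leadingCoeff_eq_zero.1 this)
  · refine degree_lt_degree ?_
    rw [natDegree_mul_X_pow _ hs0]
    omega

theorem exists_dual_equiv (x : End k V) :
    ∃ φ : V ≃ₗ[k] Dual k V, ∀ v w, φ (x v) w = φ v (x w) := by
  classical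
  obtain ⟨ι, hι, f, E, hf, hE⟩ := exists_cyclic_decomposition x
  have hm : ∀ i, (f i).Monic := fun i => by
    obtain ⟨p, e, hp, -, h⟩ := hf i
    rw [h]
    exact hp.pow e
  choose t ht using fun i => exists_functional (hm i)
  let φ : V →ₗ[k] Dual k V := LinearMap.mk₂ k (fun v w => ∑ i, t i (E v i * E w i))
    (fun v v' w => by simp [add_mul, Finset.sum_add_distrib])
    (fun a v w => by simp [Finset.mul_sum])
    (fun v w w' => by simp [mul_add, Finset.sum_add_distrib])
    (fun a v w => by simp [Finset.mul_sum])
  have hφ : Function.Injective φ := by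
    rw [injective_iff_map_eq_zero]
    intro v hv
    refine (map_eq_zero_iff E E.injective).1 (funext fun i => ht i _ fun u => ?_)
    have := LinearMap.congr_fun hv (E.symm (Pi.single i u))
    simp only [φ, LinearMap.mk₂_apply, E.apply_symm_apply] at this
    rw [Finset.sum_eq_single i] at this
    · simpa using this
    · intro j _ hj
      rw [Pi.single_eq_of_ne hj, mul_zero, map_zero]
    · simp
  refine ⟨LinearEquiv.ofInjectiveOfFinrankEq φ hφ Subspace.dual_finrank_eq.symm, fun v w => ?_⟩
  change φ (x v) w = φ v (x w)
  simp only [φ, LinearMap.mk₂_apply, hE]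
  refine Finset.sum_congr rfl fun i _ => ?_
  ring_nf

theorem cls_blk_transpose (a : End k W) (y : End k Q) {φ : W ≃ₗ[k] Dual k W}
    (hφ : ∀ v w, φ (a v) w = φ v (a w)) {ψ : Q ≃ₗ[k] Dual k Q}
    (hψ : ∀ v w, ψ (y v) w = ψ v (y w)) (c : Q →ₗ[k] W) (c' : W →ₗ[k] Q)
    (hc : ∀ w v, ψ (c' w) v = φ w (c v)) : cls (blk a c y) = cls (blk y c' a) := by
  obtain ⟨D, hD⟩ := exists_dual_equiv (blk a c y)
  let Φ : (Q × W) →ₗ[k] Dual k (W × Q) := LinearMap.mk₂ k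
    (fun u v => φ u.2 v.1 + ψ u.1 v.2)
    (fun u u' v => by simp; ring) (fun r u v => by simp; ring)
    (fun u v v' => by simp; ring) (fun r u v => by simp; ring)
  have hΦ : ∀ u v, Φ u v = φ u.2 v.1 + ψ u.1 v.2 := fun _ _ => rfl
  have hinj : Function.Injective Φ := by
    rw [injective_iff_map_eq_zero]
    rintro ⟨v, w⟩ hv
    refine Prod.ext ((map_eq_zero_iff ψ ψ.injective).1 (LinearMap.ext fun v' => ?_))
      ((map_eq_zero_iff φ φ.injective).1 (LinearMap.ext fun w' => ?_))
    · simpa [hΦ] using LinearMap.congr_fun hv (0, v')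
    · simpa [hΦ] using LinearMap.congr_fun hv (w', 0)
  have hfin : finrank k (Q × W) = finrank k (Dual k (W × Q)) := by
    rw [Subspace.dual_finrank_eq, finrank_prod, finrank_prod, add_comm]
  let Ψ := LinearEquiv.ofInjectiveOfFinrankEq Φ hinj hfin
  have hΨ : ∀ u, Ψ u = Φ u := fun _ => rfl
  refine cls_eq_iff.2 ⟨D.trans Ψ.symm, fun v => Ψ.injective ?_⟩
  obtain ⟨u, hu⟩ : ∃ u, D v = Ψ u := ⟨Ψ.symm (D v), (Ψ.apply_symm_apply _).symm⟩
  rw [LinearEquiv.trans_apply, LinearEquiv.trans_apply, Ψ.apply_symm_apply, hu,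
    Ψ.symm_apply_apply]
  refine LinearMap.ext fun w => ?_
  rw [hD, hu, hΨ, hΨ, hΦ, hΦ]
  simp only [blk_apply, map_add, LinearMap.add_apply, hφ, hψ, hc]
  ring

theorem jac_comm_cls (h : EndClass k → ℂ) (a : End k W) (y : End k Q) :
    jac h (cls a) (cls y) = jac h (cls y) (cls a) := by
  obtain ⟨φ, hφ⟩ := exists_dual_equiv a
  obtain ⟨ψ, hψ⟩ := exists_dual_equiv y
  let T : (Q →ₗ[k] W) → (W →ₗ[k] Q) := fun c =>
    ψ.symm.toLinearMap ∘ₗ Dual.transpose (R := k) c ∘ₗ φ.toLinearMap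
  have hT : ∀ c w v, ψ (T c w) v = φ w (c v) := fun c w v => by
    simp [T, Dual.transpose_apply]
  have hcard : Nat.card (Q →ₗ[k] W) = Nat.card (W →ₗ[k] Q) := by
    rw [card_linearMap, card_linearMap, mul_comm]
  have hTi : Function.Injective T := fun c c' h => LinearMap.ext fun v => by
    rw [← sub_eq_zero, ← forall_dual_apply_eq_zero_iff k]
    intro f
    obtain ⟨w, rfl⟩ := φ.surjective f
    rw [map_sub, ← hT, ← hT, h, sub_self]
  have hTb : Function.Bijective T := hTi.bijective_of_nat_card_le hcard.ge
  rw [jac_cls, jac_cls, hcard]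
  congr 1
  exact Fintype.sum_bijective T hTb _ _ fun c => by
    rw [cls_blk_transpose a y hφ hψ c (T c) (hT c)]

theorem jac_comm (h : EndClass k → ℂ) (α ν : EndClass k) : jac h α ν = jac h ν α := by
  rw [← α.cls_rep, ← ν.cls_rep]
  exact jac_comm_cls h _ _

end Transpose

section JacAssoc

open Module
open scoped ComplexConjugate

variable {k : Type} [Field k] [Finite k] {n m d : ℕ}

theorem jac_assoc_cls {A B C : Type} [AddCommGroup A] [Module k A] [Finite A] [AddCommGroup B]
    [Module k B] [Finite B] [AddCommGroup C] [Module k C] [Finite C] (χ : EndClass k → ℂ)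
    (x : End k A) (y : End k B) (z : End k C) :
    jac (fun α => jac χ α (cls z)) (cls x) (cls y) =
      jac (fun ν => jac χ (cls x) ν) (cls y) (cls z) := by
  simp only [jac_cls]
  have h1 : ∀ (b : B →ₗ[k] A) (c : C →ₗ[k] A) (c' : C →ₗ[k] B),
      cls (blk (blk x b y) (c.prod c') z) = cls (blk x (b.coprod c) (blk y c' z)) :=
    fun b c c' => cls_congr (LinearEquiv.prodAssoc k A B C) fun v => by
      simp [blk_apply, add_assoc]
  have h2 : ∀ b : B →ₗ[k] A, ∑ c : C →ₗ[k] A × B, χ (cls (blk (blk x b y) c z)) =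
      ∑ c : C →ₗ[k] A, ∑ c' : C →ₗ[k] B, χ (cls (blk x (b.coprod c) (blk y c' z))) := fun b => by
    rw [← Fintype.sum_prod_type']
    symm
    exact Fintype.sum_equiv (LinearMap.prodEquiv k).toEquiv _ _ fun p => by
      rw [← h1]; rfl
  have h3 : ∀ c' : C →ₗ[k] B, ∑ c : B × C →ₗ[k] A, χ (cls (blk x c (blk y c' z))) =
      ∑ b : B →ₗ[k] A, ∑ c : C →ₗ[k] A, χ (cls (blk x (b.coprod c) (blk y c' z))) := fun c' => by
    rw [← Fintype.sum_prod_type']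
    symm
    exact Fintype.sum_equiv (LinearMap.coprodEquiv k).toEquiv _ _ fun p => rfl
  simp only [h2, h3, ← Finset.mul_sum, ← mul_assoc]
  congr 1
  · simp only [card_linearMap, finrank_prod]
    push_cast
    rw [← mul_inv, ← mul_inv, ← pow_add, ← pow_add]
    congr 2
    ring
  · rw [eq_comm, Finset.sum_comm]
    exact Finset.sum_congr rfl fun b _ => Finset.sum_comm

theorem jac_assoc (χ : EndClass k → ℂ) (α β ν : EndClass k) :
    jac (fun α => jac χ α ν) α β = jac (fun ν => jac χ α ν) β ν := by
  rw [← α.cls_rep, ← β.cls_rep, ← ν.cls_rep]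
  exact jac_assoc_cls χ _ _ _

theorem jac_mul_sum {ι : Type*} [Fintype ι] (c : ℂ) (w : ι → ℂ) (g : ι → EndClass k → ℂ)
    (α ν : EndClass k) :
    jac (fun μ => c * ∑ i, w i * g i μ) α ν = c * ∑ i, w i * jac (g i) α ν := by
  simp only [jac, Finset.mul_sum]
  rw [Finset.sum_comm]
  refine Finset.sum_congr rfl fun i _ => Finset.sum_congr rfl fun a _ => ?_
  ring

theorem hB_jac (θ : MulChar k ℂ) (m : ℕ) (χ : EndClass k → ℂ) (ν : EndClass k) :
    hB θ m (fun α => jac χ α ν) = fun μ => jac (hB θ m χ) μ ν := by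
  funext μ
  simp only [hB, jac_assoc]
  exact (jac_mul_sum _ _ (fun a : End k (Fin m → k) => fun ν => jac χ (cls a) ν) μ ν).symm

theorem jac_zero (α ν : EndClass k) : jac (0 : EndClass k → ℂ) α ν = 0 := by
  simp [jac]

/-- The coefficient of `α ↦ ρ α`, `ν ↦ ρ' ν` in the restriction `jac χ`. -/
noncomputable def jacCoef (m d : ℕ) (χ ρ ρ' : EndClass k → ℂ) : ℂ :=
  ip m (fun α => ip d (fun ν => jac χ α ν) ρ') ρ

theorem jacCoef_eq (m d : ℕ) (χ ρ ρ' : EndClass k → ℂ) :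
    jacCoef m d χ ρ ρ' = conj (ip (m + d) (hmul m fun α ν => ρ α * ρ' ν) χ) := by
  rw [ip_hmul, jacCoef]
  simp only [ip, map_mul, map_inv₀, Complex.conj_natCast, map_sum, Complex.conj_conj,
    Finset.mul_sum, Finset.sum_mul]
  refine Finset.sum_congr rfl fun a _ => Finset.sum_congr rfl fun y _ => ?_
  ring

theorem jacCoef_comm (m d : ℕ) (χ ρ ρ' : EndClass k → ℂ) :
    jacCoef m d χ ρ ρ' = jacCoef d m χ ρ' ρ := by
  simp only [jacCoef, ip, Finset.mul_sum, Finset.sum_mul]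
  rw [Finset.sum_comm]
  refine Finset.sum_congr rfl fun a _ => Finset.sum_congr rfl fun y _ => ?_
  rw [jac_comm]
  ring

/-- The multiplicity of the irreducible character `χ` in the product of `ρ` and `ρ'`. -/
noncomputable def jacNum (m d : ℕ) (χ ρ ρ' : EndClass k → ℂ) : ℕ := ⌊‖jacCoef m d χ ρ ρ'‖⌋₊

theorem jacNum_comm (m d : ℕ) (χ ρ ρ' : EndClass k → ℂ) :
    jacNum m d χ ρ ρ' = jacNum d m χ ρ' ρ := by
  rw [jacNum, jacCoef_comm, jacNum]

variable {χ ρ ρ' : EndClass k → ℂ}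

theorem ip_hmul_eq_jacNum (hχ : χ ∈ Irr k (m + d)) (hρ : ρ ∈ Irr k m) (hρ' : ρ' ∈ Irr k d) :
    ip (m + d) (hmul m fun α ν => ρ α * ρ' ν) χ = jacNum m d χ ρ ρ' := by
  obtain ⟨N, hN⟩ := ip_hmul_Irr hρ hρ' hχ
  rw [jacNum, jacCoef_eq, hN, Complex.conj_natCast, Complex.norm_natCast, Nat.floor_natCast]

theorem jacCoef_eq_jacNum (hχ : χ ∈ Irr k (m + d)) (hρ : ρ ∈ Irr k m) (hρ' : ρ' ∈ Irr k d) :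
    jacCoef m d χ ρ ρ' = jacNum m d χ ρ ρ' := by
  rw [jacCoef_eq, ip_hmul_eq_jacNum hχ hρ hρ', Complex.conj_natCast]

theorem isChar_ip_jac (hχ : χ ∈ Irr k (m + d)) (hρ' : ρ' ∈ Irr k d) :
    IsChar m fun α => ip d (fun ν => jac χ α ν) ρ' := by
  refine ⟨fun α hα => ?_, fun ρ hρ => ⟨_, jacCoef_eq_jacNum hχ hρ hρ'⟩⟩
  obtain ⟨y, _, hy⟩ := Finset.exists_ne_zero_of_sum_ne_zero (right_ne_zero_of_mul hα)
  have := Supp.jac hχ.1 (left_ne_zero_of_mul hy)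
  rw [dim_cls, finrank_fin_fun] at this
  exact ⟨by omega, this.2.1⟩

theorem hB_ip_jac {θ : MulChar k ℂ} {b : ℕ} (h : hB θ b χ = 0) (ρ' : EndClass k → ℂ) :
    hB θ b (fun α => ip d (fun ν => jac χ α ν) ρ') = 0 := by
  have h1 : (fun α => ip d (fun ν => jac χ α ν) ρ') = ((glCard k d : ℂ)⁻¹ •
      ∑ y : End k (Fin d → k), conj (ρ' (cls y)) • fun α => jac χ α (cls y)) := by
    funext α
    simp only [ip, Pi.smul_apply, Finset.sum_apply, smul_eq_mul, mul_comm]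
  rw [h1, ← hBL_apply, map_smul, map_sum, Finset.sum_eq_zero, smul_zero]
  intro y _
  rw [map_smul, hBL_apply, hB_jac, h]
  simp only [jac_zero]
  exact smul_zero _

theorem mem_vIrr_left_of_jacNum_ne_zero {Θ : Set (MulChar k ℂ)} (hχ : χ ∈ vIrr Θ (m + d))
    (hρ : ρ ∈ Irr k m) (hρ' : ρ' ∈ Irr k d) (h : jacNum m d χ ρ ρ' ≠ 0) : ρ ∈ vIrr Θ m := by
  refine ⟨hρ, fun θ hθ b hb => ?_⟩
  have hc := isChar_ip_jac hχ.1 hρ'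
  have hv := hB_ip_jac (d := d) (hχ.2 θ hθ b hb) ρ'
  have hne : ip m (fun α => ip d (fun ν => jac χ α ν) ρ') ρ ≠ 0 := by
    rw [← jacCoef, jacCoef_eq_jacNum hχ.1 hρ hρ']
    exact_mod_cast h
  by_cases hbm : m < b
  · exact hB_eq_zero_of_gt hρ.1 hbm
  · obtain ⟨r, rfl⟩ := Nat.exists_eq_add_of_le (not_lt.1 hbm)
    exact hc.hB_constituent hv hρ hne

theorem mem_vIrr_right_of_jacNum_ne_zero {Θ : Set (MulChar k ℂ)} (hχ : χ ∈ vIrr Θ (m + d))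
    (hρ : ρ ∈ Irr k m) (hρ' : ρ' ∈ Irr k d) (h : jacNum m d χ ρ ρ' ≠ 0) : ρ' ∈ vIrr Θ d := by
  rw [add_comm] at hχ
  rw [jacNum_comm] at h
  exact mem_vIrr_left_of_jacNum_ne_zero hχ hρ' hρ h

theorem jac_eq_sum (hχ : χ ∈ Irr k (m + d)) {α ν : EndClass k} (hα : α.dim = m) :
    jac χ α ν = ∑ ρ : Irr k m, ∑ ρ' : Irr k d, jacNum m d χ ρ.1 ρ'.1 * (ρ.1 α * ρ'.1 ν) := by
  have h1 : Supp d (fun ν => jac χ α ν) := fun ν hν => by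
    have := Supp.jac hχ.1 hν
    exact ⟨by omega, this.2.2⟩
  have h2 := congrFun (eq_sum_Irr h1) ν
  simp only [Finset.sum_apply, Pi.smul_apply, smul_eq_mul] at h2
  rw [h2, Finset.sum_comm]
  refine Finset.sum_congr rfl fun ρ' _ => ?_
  have h3 := congrFun (eq_sum_Irr (isChar_ip_jac hχ ρ'.2).1) α
  simp only [Finset.sum_apply, Pi.smul_apply, smul_eq_mul] at h3
  rw [h3, Finset.sum_mul]
  refine Finset.sum_congr rfl fun ρ _ => ?_
  rw [← jacCoef, jacCoef_eq_jacNum hχ ρ.2 ρ'.2]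
  ring

theorem isChar_hmul_Irr (hρ : ρ ∈ Irr k m) (hτ : ρ' ∈ Irr k d) :
    IsChar (m + d) (hmul m fun α ν => ρ α * ρ' ν) :=
  ⟨supp_hmul fun α ν h => ⟨(hρ.1 α (left_ne_zero_of_mul h)).2,
    hτ.1 ν (right_ne_zero_of_mul h)⟩, fun _ hχ => ip_hmul_Irr hρ hτ hχ⟩

/-- The degree of a character. -/
noncomputable def chDeg (n : ℕ) (χ : EndClass k → ℂ) : ℕ := ⌊‖χ (oneCls k n)‖⌋₊

theorem chDeg_eq (hχ : χ ∈ Irr k n) : χ (oneCls k n) = chDeg n χ := by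
  obtain ⟨d, -, h⟩ := exists_degree hχ
  rw [chDeg, h, Complex.norm_natCast, Nat.floor_natCast]

theorem chDeg_pos (hχ : χ ∈ Irr k n) : 0 < chDeg n χ := by
  obtain ⟨d, h0, h⟩ := exists_degree hχ
  rwa [chDeg, h, Complex.norm_natCast, Nat.floor_natCast]

theorem sum_jacNum_mul_chDeg (hρ : ρ ∈ Irr k m) (hρ' : ρ' ∈ Irr k d) :
    (∑ χ : Irr k (m + d), jacNum m d χ.1 ρ ρ' * chDeg (m + d) χ.1) *
      (qfac (Nat.card k) m * qfac (Nat.card k) d) =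
      qfac (Nat.card k) (m + d) * (chDeg m ρ * chDeg d ρ') := by
  have h := hmul_oneCls m d fun α ν : EndClass k => ρ α * ρ' ν
  have h2 := congrFun (eq_sum_Irr (isChar_hmul_Irr hρ hρ').1) (oneCls k (m + d))
  simp only [Finset.sum_apply, Pi.smul_apply, smul_eq_mul] at h2
  rw [h2, chDeg_eq hρ, chDeg_eq hρ'] at h
  rw [← Nat.cast_inj (R := ℂ)]
  push_cast
  rw [← h]
  congr 1
  exact Finset.sum_congr rfl fun χ _ => by rw [ip_hmul_eq_jacNum χ.2 hρ hρ', chDeg_eq χ.2]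

end JacAssoc

section Vacuum

open Module

variable {k : Type} [Field k] [Finite k] {n m d : ℕ} {χ ρ ρ' : EndClass k → ℂ}

theorem regUni_one_eq : regUni k 1 = oneCls k 1 := by
  rw [← hookCls_zero, hookCls_one]

theorem not_mem_vIrr_one {Θ : Set (MulChar k ℂ)} (h1 : chUni Θ 1 = 0) : χ ∉ vIrr Θ 1 := by
  intro hχ
  rw [chUni, Finset.sum_eq_zero_iff_of_nonneg fun _ _ => sq_nonneg _] at h1
  have := h1 ⟨χ, hχ⟩ (Finset.mem_univ _)
  dsimp only at this
  rw [regUni_one_eq, chDeg_eq hχ.1, Complex.norm_natCast] at this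
  have h2 := chDeg_pos hχ.1
  have h3 : ((chDeg 1 χ : ℕ) : ℝ) = 0 := by simpa using this
  rw [Nat.cast_eq_zero] at h3
  omega

theorem jac_eq_zero_of_one {Θ : Set (MulChar k ℂ)} (h1 : chUni Θ 1 = 0) (hχ : χ ∈ vIrr Θ (m + d))
    (h : m = 1 ∨ d = 1) {α ν : EndClass k} (hα : α.dim = m) : jac χ α ν = 0 := by
  rw [jac_eq_sum hχ.1 hα]
  refine Finset.sum_eq_zero fun ρ _ => Finset.sum_eq_zero fun ρ' _ => ?_
  by_cases h0 : jacNum m d χ ρ.1 ρ'.1 = 0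
  · rw [h0, Nat.cast_zero, zero_mul]
  · rcases h with rfl | rfl
    · exact absurd (mem_vIrr_left_of_jacNum_ne_zero hχ ρ.2 ρ'.2 h0) (not_mem_vIrr_one h1)
    · exact absurd (mem_vIrr_right_of_jacNum_ne_zero hχ ρ.2 ρ'.2 h0) (not_mem_vIrr_one h1)

theorem hook_rel {Θ : Set (MulChar k ℂ)} (h1 : chUni Θ 1 = 0) {l m : ℕ}
    (hχ : χ ∈ vIrr Θ (l + 1 + (m + 1))) (h : l = 0 ∨ m = 0) :
    χ (hookCls k (l + 1) (m + 1)) + ((Nat.card k : ℂ) ^ (m + 1) - 1) * χ (hookCls k (l + 2) m) = 0 := by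
  rw [← jac_regUni_oneCls, jac_eq_zero_of_one h1 hχ (by omega) (dim_regUni _), mul_zero]

theorem exists_int_of_mul_eq (hχ : χ ∈ Irr k n) {ν : EndClass k} {a b : ℤ} (ha : a ≠ 0)
    (h : a * χ ν = b) : ∃ z : ℤ, χ ν = z ∧ a * z = b := by
  have h1 : χ ν = ((b / a : ℚ) : ℂ) := by
    push_cast
    rw [eq_div_iff (by exact_mod_cast ha), mul_comm, h]
  have h2 := Irr.isIntegral hχ ν
  rw [h1] at h2
  have h3 : IsIntegral ℤ (b / a : ℚ) :=
    (isIntegral_algebraMap_iff (algebraMap ℚ ℂ).injective).1 h2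
  obtain ⟨z, hz⟩ := IsIntegrallyClosed.isIntegral_iff.1 h3
  have hz' : χ ν = z := by
    rw [h1, ← hz]
    simp
  refine ⟨z, hz', ?_⟩
  rw [hz'] at h
  exact_mod_cast h

theorem eq_one_of_sum_eq_card {ι : Type*} [Fintype ι] {f : ι → ℝ} (h1 : ∀ i, 1 ≤ f i)
    (h : ∑ i, f i = Nat.card ι) (i : ι) : f i = 1 := by
  have h2 : ∑ i, (f i - 1) = 0 := by
    rw [Finset.sum_sub_distrib, h]
    simp
  rw [Finset.sum_eq_zero_iff_of_nonneg fun i _ => sub_nonneg.2 (h1 i)] at h2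
  exact sub_eq_zero.1 (h2 i (Finset.mem_univ i))

theorem one_le_sq_of_ne_zero {z : ℤ} (h : z ≠ 0) : (1 : ℝ) ≤ ‖(z : ℂ)‖ ^ 2 := by
  rw [Complex.norm_intCast, ← Int.cast_abs]
  exact_mod_cast one_le_pow₀ (Int.one_le_abs h)

theorem sq_eq_one_of_norm {z : ℤ} (h : ‖(z : ℂ)‖ ^ 2 = 1) : z ^ 2 = 1 := by
  rw [Complex.norm_intCast, sq_abs] at h
  exact_mod_cast h

theorem vac_two {Θ : Set (MulChar k ℂ)} (h1 : chUni Θ 1 = 0) (h2 : chUni Θ 2 = chNum Θ 2)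
    (hχ : χ ∈ vIrr Θ 2) : χ (regUni k 2) = -1 ∧ (chDeg 2 χ : ℤ) = Nat.card k - 1 := by
  have hq : 2 ≤ Nat.card k := two_le_card k
  have key : ∀ ψ ∈ vIrr Θ 2, ∃ z : ℤ, ψ (regUni k 2) = z ∧ -((Nat.card k : ℤ) - 1) * z = chDeg 2 ψ ∧
      z ≠ 0 := by
    intro ψ hψ
    have h := hook_rel h1 (l := 0) (m := 0) hψ (Or.inl rfl)
    rw [hookCls_one, hookCls_zero, chDeg_eq hψ.1] at h
    obtain ⟨z, hz, hz'⟩ := exists_int_of_mul_eq hψ.1 (ν := regUni k 2) (a := -((Nat.card k : ℤ) - 1))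
      (b := chDeg 2 ψ) (by omega) (by push_cast; linear_combination -h)
    refine ⟨z, hz, hz', ?_⟩
    rintro rfl
    have := chDeg_pos hψ.1
    omega
  obtain ⟨z, hz, hz', h0⟩ := key χ hχ
  have h3 := eq_one_of_sum_eq_card (f := fun ψ : vIrr Θ 2 => ‖ψ.1 (regUni k 2)‖ ^ 2) (fun ψ => by
    obtain ⟨w, hw, -, hw0⟩ := key ψ.1 ψ.2
    rw [hw]
    exact one_le_sq_of_ne_zero hw0) h2 ⟨χ, hχ⟩
  simp only [hz] at h3
  have h4 := sq_eq_one_of_norm h3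
  have h5 : z = -1 := by
    have h6 : (z - 1) * (z + 1) = 0 := by linear_combination h4
    rcases mul_eq_zero.1 h6 with h | h
    · have := chDeg_pos hχ.1
      rw [show z = 1 by omega] at hz'
      omega
    · omega
  rw [h5] at hz hz'
  exact ⟨by rw [hz]; simp, by linarith⟩

theorem vac_three {Θ : Set (MulChar k ℂ)} (h1 : chUni Θ 1 = 0) (h3 : chUni Θ 3 = chNum Θ 3)
    (hχ : χ ∈ vIrr Θ 3) : χ (regUni k 3) = 1 ∧
      (chDeg 3 χ : ℤ) = ((Nat.card k : ℤ) ^ 2 - 1) * (Nat.card k - 1) := by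
  have hq : 2 ≤ Nat.card k := two_le_card k
  have hq1 : 0 < (Nat.card k : ℤ) - 1 := by omega
  have hq2 : 0 < (Nat.card k : ℤ) ^ 2 - 1 := by nlinarith
  have key : ∀ ψ ∈ vIrr Θ 3, ∃ z : ℤ, ψ (regUni k 3) = z ∧
      (((Nat.card k : ℤ) ^ 2 - 1) * ((Nat.card k : ℤ) - 1)) * z = chDeg 3 ψ ∧ z ≠ 0 := by
    intro ψ hψ
    have h := hook_rel h1 (l := 0) (m := 1) hψ (Or.inl rfl)
    have h' := hook_rel h1 (l := 1) (m := 0) hψ (Or.inr rfl)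
    rw [hookCls_one, chDeg_eq hψ.1] at h
    rw [hookCls_zero] at h'
    norm_num at h h'
    obtain ⟨z, hz, hz'⟩ := exists_int_of_mul_eq hψ.1 (ν := regUni k 3)
      (a := ((Nat.card k : ℤ) ^ 2 - 1) * ((Nat.card k : ℤ) - 1))
      (b := chDeg 3 ψ) (by positivity)
      (by push_cast; linear_combination -h + ((Nat.card k : ℂ) ^ 2 - 1) * h')
    refine ⟨z, hz, hz', ?_⟩
    rintro rfl
    have := chDeg_pos hψ.1
    omega
  obtain ⟨z, hz, hz', h0⟩ := key χ hχ
  have h4 := eq_one_of_sum_eq_card (f := fun ψ : vIrr Θ 3 => ‖ψ.1 (regUni k 3)‖ ^ 2) (fun ψ => by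
    obtain ⟨w, hw, -, hw0⟩ := key ψ.1 ψ.2
    rw [hw]
    exact one_le_sq_of_ne_zero hw0) h3 ⟨χ, hχ⟩
  simp only [hz] at h4
  have h4 := sq_eq_one_of_norm h4
  have h5 : z = 1 := by
    have h6 : (z - 1) * (z + 1) = 0 := by linear_combination h4
    rcases mul_eq_zero.1 h6 with h | h
    · omega
    · have := chDeg_pos hχ.1
      rw [show z = -1 by omega] at hz'
      have := mul_pos hq2 hq1
      omega
  rw [h5] at hz hz'
  exact ⟨by rw [hz]; simp, by linarith⟩

/-- The number of constituents of the restriction of `χ`. -/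
noncomputable def jacTot (m d : ℕ) (χ : EndClass k → ℂ) : ℕ :=
  ∑ ρ : Irr k m, ∑ ρ' : Irr k d, jacNum m d χ ρ.1 ρ'.1

theorem jacTot_comm (m d : ℕ) (χ : EndClass k → ℂ) : jacTot m d χ = jacTot d m χ := by
  rw [jacTot, jacTot, Finset.sum_comm]
  exact Finset.sum_congr rfl fun _ _ => Finset.sum_congr rfl fun _ _ => jacNum_comm _ _ _ _ _

theorem jac_eq_mul_jacTot {Θ : Set (MulChar k ℂ)} (hχ : χ ∈ vIrr Θ (m + d)) {α ν : EndClass k}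
    (hα : α.dim = m) {a b : ℂ} (ha : ∀ ρ ∈ vIrr Θ m, ρ α = a) (hb : ∀ ρ ∈ vIrr Θ d, ρ ν = b) :
    jac χ α ν = jacTot m d χ * (a * b) := by
  rw [jac_eq_sum hχ.1 hα, jacTot]
  push_cast
  rw [Finset.sum_mul]
  refine Finset.sum_congr rfl fun ρ _ => ?_
  rw [Finset.sum_mul]
  refine Finset.sum_congr rfl fun ρ' _ => ?_
  by_cases h0 : jacNum m d χ ρ.1 ρ'.1 = 0
  · rw [h0, Nat.cast_zero, zero_mul, zero_mul]
  · rw [ha _ (mem_vIrr_left_of_jacNum_ne_zero hχ ρ.2 ρ'.2 h0),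
      hb _ (mem_vIrr_right_of_jacNum_ne_zero hχ ρ.2 ρ'.2 h0)]

theorem chDeg_eq_of_int (hχ : χ ∈ Irr k n) {z : ℤ} (h : (chDeg n χ : ℤ) = z) :
    χ (oneCls k n) = z := by
  rw [chDeg_eq hχ]
  exact_mod_cast congrArg (Int.cast : ℤ → ℂ) h

variable {Θ : Set (MulChar k ℂ)} (h1 : chUni Θ 1 = 0) (h2 : chUni Θ 2 = chNum Θ 2)
include h1 h2

theorem vac_four (hχ : χ ∈ vIrr Θ 4) : ∃ A : ℤ, χ (regUni k 4) = A ∧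
    (chDeg 4 χ : ℤ) = ((Nat.card k : ℤ) ^ 3 - 1) * (Nat.card k - 1) *
      ((Nat.card k : ℤ) ^ 2 * jacTot 2 2 χ - ((Nat.card k : ℤ) ^ 2 - 1) * A) := by
  have hq : 2 ≤ (Nat.card k : ℤ) := by exact_mod_cast two_le_card k
  have hq1 : 0 < (Nat.card k : ℤ) - 1 := by linarith
  have hq2 : 0 < (Nat.card k : ℤ) ^ 2 - 1 := by nlinarith
  have hq3 : 0 < (Nat.card k : ℤ) ^ 3 - 1 := by nlinarith
  have ha := hook_rel h1 (l := 0) (m := 2) hχ (Or.inl rfl)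
  have hb := jac_regUni_oneCls χ 1 1
  have hc := hook_rel h1 (l := 2) (m := 0) hχ (Or.inr rfl)
  rw [hookCls_one, chDeg_eq hχ.1] at ha
  rw [hookCls_zero] at hc
  rw [jac_eq_mul_jacTot (m := 2) (d := 2) hχ (dim_regUni _) (fun ρ h => (vac_two h1 h2 h).1)
    fun ρ h => chDeg_eq_of_int h.1 (vac_two h1 h2 h).2] at hb
  norm_num at ha hb hc
  obtain ⟨z, hz, hz'⟩ := exists_int_of_mul_eq hχ.1 (ν := regUni k 4)
    (a := ((Nat.card k : ℤ) ^ 3 - 1) * (Nat.card k - 1) * ((Nat.card k : ℤ) ^ 2 - 1))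
    (b := ((Nat.card k : ℤ) ^ 3 - 1) * (Nat.card k - 1) * (Nat.card k : ℤ) ^ 2 * jacTot 2 2 χ
      - chDeg 4 χ) (by positivity) (by
        push_cast
        linear_combination ha + ((Nat.card k : ℂ) ^ 3 - 1) * hb +
          ((Nat.card k : ℂ) ^ 3 - 1) * ((Nat.card k : ℂ) ^ 2 - 1) * hc)
  exact ⟨z, hz, by linear_combination hz'⟩

theorem vac_five (h3 : chUni Θ 3 = chNum Θ 3) (hχ : χ ∈ vIrr Θ 5) :
    ∃ A : ℤ, χ (regUni k 5) = A ∧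
    (chDeg 5 χ : ℤ) = ((Nat.card k : ℤ) ^ 4 - 1) * (Nat.card k - 1) *
      ((Nat.card k : ℤ) ^ 3 * ((Nat.card k : ℤ) ^ 2 - 1) * jacTot 2 3 χ +
       ((Nat.card k : ℤ) ^ 3 - 1) * (Nat.card k : ℤ) ^ 2 * jacTot 2 3 χ +
       ((Nat.card k : ℤ) ^ 3 - 1) * ((Nat.card k : ℤ) ^ 2 - 1) * A) := by
  have hq : 2 ≤ (Nat.card k : ℤ) := by exact_mod_cast two_le_card k
  have hq1 : 0 < (Nat.card k : ℤ) - 1 := by linarith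
  have hq2 : 0 < (Nat.card k : ℤ) ^ 2 - 1 := by nlinarith
  have hq3 : 0 < (Nat.card k : ℤ) ^ 3 - 1 := by nlinarith
  have hq4 : 0 < (Nat.card k : ℤ) ^ 4 - 1 := by nlinarith
  have ha := hook_rel h1 (l := 0) (m := 3) hχ (Or.inl rfl)
  have hb := jac_regUni_oneCls χ 1 2
  have hc := jac_regUni_oneCls χ 2 1
  have hd := hook_rel h1 (l := 3) (m := 0) hχ (Or.inr rfl)
  rw [hookCls_one, chDeg_eq hχ.1] at ha
  rw [hookCls_zero] at hd
  rw [jac_eq_mul_jacTot (m := 2) (d := 3) hχ (dim_regUni _) (fun ρ h => (vac_two h1 h2 h).1)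
    fun ρ h => chDeg_eq_of_int h.1 (vac_three h1 h3 h).2] at hb
  rw [jac_eq_mul_jacTot (m := 3) (d := 2) hχ (dim_regUni _) (fun ρ h => (vac_three h1 h3 h).1)
    fun ρ h => chDeg_eq_of_int h.1 (vac_two h1 h2 h).2, jacTot_comm] at hc
  norm_num at ha hb hc hd
  obtain ⟨z, hz, hz'⟩ := exists_int_of_mul_eq hχ.1 (ν := regUni k 5)
    (a := ((Nat.card k : ℤ) ^ 4 - 1) * (Nat.card k - 1) *
      (((Nat.card k : ℤ) ^ 3 - 1) * ((Nat.card k : ℤ) ^ 2 - 1)))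
    (b := chDeg 5 χ - ((Nat.card k : ℤ) ^ 4 - 1) * (Nat.card k - 1) *
      ((Nat.card k : ℤ) ^ 3 * ((Nat.card k : ℤ) ^ 2 - 1) * jacTot 2 3 χ +
       ((Nat.card k : ℤ) ^ 3 - 1) * (Nat.card k : ℤ) ^ 2 * jacTot 2 3 χ)) (by positivity) (by
        push_cast
        linear_combination -ha - ((Nat.card k : ℂ) ^ 4 - 1) * hb +
          ((Nat.card k : ℂ) ^ 4 - 1) * ((Nat.card k : ℂ) ^ 3 - 1) * hc +
          ((Nat.card k : ℂ) ^ 4 - 1) * ((Nat.card k : ℂ) ^ 3 - 1) *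
          ((Nat.card k : ℂ) ^ 2 - 1) * hd)
  exact ⟨z, hz, by linear_combination -hz'⟩

end Vacuum

section VacuumValuations

open Module
open scoped ComplexConjugate

variable {k : Type} [Field k] [Finite k] {n m d : ℕ} {χ ρ ρ' : EndClass k → ℂ}
variable {Θ : Set (MulChar k ℂ)} {p e : ℕ}

theorem chDeg_zero (hχ : χ ∈ Irr k 0) : chDeg 0 χ = 1 := by
  classical
  have h := ip_Irr hχ hχ
  rw [if_pos rfl, ip, Fintype.sum_unique] at h
  have h1 : cls (default : End k (Fin 0 → k)) = oneCls k 0 :=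
    congrArg cls (Subsingleton.elim (α := End k (Fin 0 → k)) _ _)
  rw [h1, chDeg_eq hχ, glCard_eq] at h
  simp only [Nat.choose_zero_succ, pow_zero, qfac, Finset.range_zero, Finset.prod_empty, mul_one,
    Nat.cast_one, inv_one, one_mul, Complex.conj_natCast] at h
  have h2 : chDeg 0 χ * chDeg 0 χ = 1 := by exact_mod_cast h
  exact Nat.eq_one_of_mul_eq_one_left h2

theorem chVal_eq_zero (h : ∀ χ ∈ vIrr Θ n, ¬ p ∣ chDeg n χ) : chVal p Θ n = 0 :=
  Finset.sum_eq_zero fun χ _ => padicValNat.eq_zero_of_not_dvd (h χ.1 χ.2)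

theorem chVal_zero (hp : p.Prime) : chVal p Θ 0 = 0 :=
  chVal_eq_zero fun χ hχ h => by
    rw [chDeg_zero hχ.1] at h
    exact hp.one_lt.ne' (Nat.dvd_one.1 h)

theorem chVal_one (h1 : chUni Θ 1 = 0) : chVal p Θ 1 = 0 :=
  chVal_eq_zero fun _ hχ => absurd hχ (not_mem_vIrr_one h1)

theorem not_dvd_of_cast {D : ℕ} (hp : p.Prime) (he : 0 < e) (hk : Nat.card k = p ^ e) {z : ℤ}
    (f : ℤ → ℤ) (h : (D : ℤ) = f (Nat.card k)) (hf : (f (Nat.card k) : ZMod p) = z)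
    (hz : z ^ 2 = 1) : ¬ p ∣ D := by
  intro hd
  have : Fact p.Prime := ⟨hp⟩
  have h2 := congrArg (Int.cast : ℤ → ZMod p) h
  rw [hf, Int.cast_natCast, (ZMod.natCast_eq_zero_iff _ _).2 hd] at h2
  have h3 := congrArg (Int.cast : ℤ → ZMod p) hz
  rw [Int.cast_pow, ← h2] at h3
  simp at h3

theorem cast_card_eq_zero (he : 0 < e) (hk : Nat.card k = p ^ e) : ((Nat.card k : ℕ) : ZMod p) = 0 := by
  rw [hk, Nat.cast_pow, CharP.cast_eq_zero, zero_pow he.ne']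

theorem chVal_two (hp : p.Prime) (he : 0 < e) (hk : Nat.card k = p ^ e) (h1 : chUni Θ 1 = 0)
    (h2 : chUni Θ 2 = chNum Θ 2) : chVal p Θ 2 = 0 :=
  chVal_eq_zero fun χ hχ => not_dvd_of_cast (z := -1) hp he hk (fun q => q - 1)
    (vac_two h1 h2 hχ).2 (by simp [cast_card_eq_zero he hk]) (by norm_num)

theorem chVal_three (hp : p.Prime) (he : 0 < e) (hk : Nat.card k = p ^ e) (h1 : chUni Θ 1 = 0)
    (h3 : chUni Θ 3 = chNum Θ 3) : chVal p Θ 3 = 0 :=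
  chVal_eq_zero fun χ hχ => not_dvd_of_cast (z := 1) hp he hk (fun q => (q ^ 2 - 1) * (q - 1))
    (vac_three h1 h3 hχ).2 (by simp [cast_card_eq_zero he hk]) (by norm_num)

theorem jacNum_mul_chDeg_le (hχ : χ ∈ Irr k (m + d)) (hρ : ρ ∈ Irr k m) (hρ' : ρ' ∈ Irr k d) :
    jacNum m d χ ρ ρ' * chDeg (m + d) χ * (qfac (Nat.card k) m * qfac (Nat.card k) d) ≤
      qfac (Nat.card k) (m + d) * (chDeg m ρ * chDeg d ρ') := by
  have key : ∀ f : Irr k (m + d) → ℕ, f ⟨χ, hχ⟩ ≤ ∑ ψ, f ψ := fun f =>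
    Finset.single_le_sum (fun _ _ => Nat.zero_le _) (Finset.mem_univ _)
  rw [← sum_jacNum_mul_chDeg hρ hρ']
  exact Nat.mul_le_mul_right _ (key fun ψ => jacNum m d ψ.1 ρ ρ' * chDeg (m + d) ψ.1)

theorem jacNum_mul_chDeg_add_le {χ' : EndClass k → ℂ} (hχ : χ ∈ Irr k (m + d))
    (hχ' : χ' ∈ Irr k (m + d)) (hne : χ ≠ χ') (hρ : ρ ∈ Irr k m) (hρ' : ρ' ∈ Irr k d) :
    (jacNum m d χ ρ ρ' * chDeg (m + d) χ + jacNum m d χ' ρ ρ' * chDeg (m + d) χ') *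
      (qfac (Nat.card k) m * qfac (Nat.card k) d) ≤
      qfac (Nat.card k) (m + d) * (chDeg m ρ * chDeg d ρ') := by
  have key : ∀ f : Irr k (m + d) → ℕ, f ⟨χ, hχ⟩ + f ⟨χ', hχ'⟩ ≤ ∑ ψ, f ψ := fun f =>
    Finset.add_le_sum (fun _ _ => Nat.zero_le _) (Finset.mem_univ _) (Finset.mem_univ _)
      fun h => hne (congrArg Subtype.val h)
  rw [← sum_jacNum_mul_chDeg hρ hρ']
  exact Nat.mul_le_mul_right _ (key fun ψ => jacNum m d ψ.1 ρ ρ' * chDeg (m + d) ψ.1)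

theorem exists_jacNum_ne_zero (h : jacTot m d χ ≠ 0) :
    ∃ ρ ∈ Irr k m, ∃ ρ' ∈ Irr k d, jacNum m d χ ρ ρ' ≠ 0 := by
  obtain ⟨ρ, _, h⟩ := Finset.exists_ne_zero_of_sum_ne_zero h
  obtain ⟨ρ', _, h⟩ := Finset.exists_ne_zero_of_sum_ne_zero h
  exact ⟨ρ.1, ρ.2, ρ'.1, ρ'.2, h⟩

theorem qfac_cast (q : ℕ) (hq : 1 ≤ q) (n : ℕ) :
    (qfac q n : ℤ) = ∏ i ∈ Finset.range n, ((q : ℤ) ^ (i + 1) - 1) := by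
  rw [qfac, Nat.cast_prod]
  refine Finset.prod_congr rfl fun i _ => ?_
  rw [Nat.cast_sub (Nat.one_le_pow _ _ hq)]
  simp

theorem degree_bound_five {q T N : ℤ} (hq : 2 ≤ q) (hT : 1 ≤ T) (hN : 1 ≤ N)
    (h : (q - 1) ^ 3 * (q ^ 2 - 1) ^ 2 * (q ^ 3 - 1) * (q ^ 4 - 1) *
      (N * T * (q ^ 3 * (q ^ 2 - 1) + (q ^ 3 - 1) * q ^ 2)) ≤
      (q - 1) ^ 3 * (q ^ 2 - 1) ^ 2 * (q ^ 3 - 1) * (q ^ 4 - 1) * (q ^ 5 - 1)) : False := by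
  have h1 : 0 < q - 1 := by linarith
  have hp : ∀ n : ℕ, n ≠ 0 → 0 < q ^ n - 1 := fun n hn => by
    have := one_lt_pow₀ (show 1 < q by linarith) hn
    linarith
  have h2 := hp 2 (by norm_num)
  have h3 := hp 3 (by norm_num)
  have h4 := hp 4 (by norm_num)
  have h5 := le_of_mul_le_mul_left h (by positivity)
  have h6 : 1 ≤ N * T := one_le_mul_of_one_le_of_one_le hN hT
  have h7 : 0 < q ^ 3 * (q ^ 2 - 1) + (q ^ 3 - 1) * q ^ 2 := by positivity
  have h8 := (le_mul_of_one_le_left h7.le h6).trans h5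
  have h9 : 0 < (q ^ 2 - 1) * (q ^ 3 - 1) := mul_pos h2 h3
  linarith [show q ^ 3 * (q ^ 2 - 1) + (q ^ 3 - 1) * q ^ 2 - (q ^ 5 - 1) =
    (q ^ 2 - 1) * (q ^ 3 - 1) by ring]

variable (h1 : chUni Θ 1 = 0) (h2 : chUni Θ 2 = chNum Θ 2)
include h1 h2

theorem vac_five_ne_zero (h3 : chUni Θ 3 = chNum Θ 3) (hχ : χ ∈ vIrr Θ 5) {A : ℤ}
    (hA : (chDeg 5 χ : ℤ) = ((Nat.card k : ℤ) ^ 4 - 1) * (Nat.card k - 1) *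
      ((Nat.card k : ℤ) ^ 3 * ((Nat.card k : ℤ) ^ 2 - 1) * jacTot 2 3 χ +
       ((Nat.card k : ℤ) ^ 3 - 1) * (Nat.card k : ℤ) ^ 2 * jacTot 2 3 χ +
       ((Nat.card k : ℤ) ^ 3 - 1) * ((Nat.card k : ℤ) ^ 2 - 1) * A)) : A ≠ 0 := by
  rintro rfl
  have hT : jacTot 2 3 χ ≠ 0 := by
    intro h
    rw [h] at hA
    have := chDeg_pos hχ.1
    simp at hA
    omega
  obtain ⟨ρ, hρ, ρ', hρ', h0⟩ := exists_jacNum_ne_zero hT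
  have hle := jacNum_mul_chDeg_le (m := 2) (d := 3) hχ.1 hρ hρ'
  have hr := (vac_two h1 h2 (mem_vIrr_left_of_jacNum_ne_zero (m := 2) (d := 3) hχ hρ hρ' h0)).2
  have hr' := (vac_three h1 h3 (mem_vIrr_right_of_jacNum_ne_zero (m := 2) (d := 3) hχ hρ hρ' h0)).2
  have hq := two_le_card k
  zify at hle
  rw [hr, hr', qfac_cast _ (by omega), qfac_cast _ (by omega), qfac_cast _ (by omega), hA] at hle
  simp only [Finset.prod_range_succ, Finset.prod_range_zero] at hle
  have hq' : 2 ≤ (Nat.card k : ℤ) := by exact_mod_cast hq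
  have hT' : 1 ≤ (jacTot 2 3 χ : ℤ) := by exact_mod_cast Nat.one_le_iff_ne_zero.2 hT
  have hn : 1 ≤ (jacNum 2 3 χ ρ ρ' : ℤ) := by exact_mod_cast Nat.one_le_iff_ne_zero.2 h0
  generalize (Nat.card k : ℤ) = q at *
  generalize (jacTot 2 3 χ : ℤ) = T at *
  generalize (jacNum 2 3 χ ρ ρ' : ℤ) = N at *
  exact degree_bound_five hq' hT' hn (by linear_combination hle)

theorem chVal_five (hp : p.Prime) (he : 0 < e) (hk : Nat.card k = p ^ e)
    (h3 : chUni Θ 3 = chNum Θ 3) (h5 : chUni Θ 5 = chNum Θ 5) : chVal p Θ 5 = 0 := by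
  refine chVal_eq_zero fun χ hχ => ?_
  obtain ⟨A, hA, hd⟩ := vac_five h1 h2 h3 hχ
  have h6 := eq_one_of_sum_eq_card (f := fun ψ : vIrr Θ 5 => ‖ψ.1 (regUni k 5)‖ ^ 2) (fun ψ => by
    obtain ⟨w, hw, hw'⟩ := vac_five h1 h2 h3 ψ.2
    rw [hw]
    exact one_le_sq_of_ne_zero (vac_five_ne_zero h1 h2 h3 ψ.2 hw')) h5 ⟨χ, hχ⟩
  simp only [hA] at h6
  refine not_dvd_of_cast hp he hk (fun q => (q ^ 4 - 1) * (q - 1) *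
    (q ^ 3 * (q ^ 2 - 1) * jacTot 2 3 χ + (q ^ 3 - 1) * q ^ 2 * jacTot 2 3 χ +
      (q ^ 3 - 1) * (q ^ 2 - 1) * A)) hd ?_ (sq_eq_one_of_norm h6)
  simp [cast_card_eq_zero he hk]

omit h2 in
theorem exceptional_four (h2 : chUni Θ 2 = chNum Θ 2) (hχ : χ ∈ vIrr Θ 4)
    (h0 : χ (regUni k 4) = 0) : (∃ ρ ∈ vIrr Θ 2, jacNum 2 2 χ ρ ρ = 1) ∧
      (chDeg 4 χ : ℤ) = ((Nat.card k : ℤ) ^ 3 - 1) * (Nat.card k - 1) * (Nat.card k : ℤ) ^ 2 := by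
  obtain ⟨A, hA, hd⟩ := vac_four h1 h2 hχ
  rw [h0] at hA
  have hA0 : A = 0 := by exact_mod_cast hA.symm
  subst hA0
  have hT : jacTot 2 2 χ ≠ 0 := by
    intro h
    rw [h] at hd
    have := chDeg_pos hχ.1
    simp at hd
    omega
  have hbd : ∀ ρ ∈ Irr k 2, ∀ ρ' ∈ Irr k 2, jacNum 2 2 χ ρ ρ' ≠ 0 →
      jacNum 2 2 χ ρ ρ' * jacTot 2 2 χ ≤ 1 := by
    intro ρ hρ ρ' hρ' h0
    have hle := jacNum_mul_chDeg_le (m := 2) (d := 2) hχ.1 hρ hρ'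
    have hr := (vac_two h1 h2 (mem_vIrr_left_of_jacNum_ne_zero (m := 2) (d := 2) hχ hρ hρ' h0)).2
    have hr' := (vac_two h1 h2 (mem_vIrr_right_of_jacNum_ne_zero (m := 2) (d := 2) hχ hρ hρ' h0)).2
    have hq := two_le_card k
    zify at hle ⊢
    rw [hr, hr', qfac_cast _ (by omega), qfac_cast _ (by omega), hd] at hle
    simp only [Finset.prod_range_succ, Finset.prod_range_zero] at hle
    have hq' : 2 ≤ (Nat.card k : ℤ) := by exact_mod_cast hq
    generalize (Nat.card k : ℤ) = q at *
    generalize (jacTot 2 2 χ : ℤ) = T at *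
    generalize (jacNum 2 2 χ ρ ρ' : ℤ) = N at *
    have g1 : 0 < q - 1 := by linarith
    have g2 : 0 < q ^ 2 - 1 := by nlinarith
    have g3 : 0 < q ^ 3 - 1 := by nlinarith
    have hc : 0 < (q - 1) ^ 3 * (q ^ 2 - 1) ^ 2 * (q ^ 3 - 1) := by positivity
    have h5 : N * T * q ^ 2 ≤ q ^ 2 + 1 := by
      refine le_of_mul_le_mul_left ?_ hc
      linear_combination hle
    by_contra! h6
    nlinarith
  obtain ⟨ρ, hρ, ρ', hρ', hne⟩ := exists_jacNum_ne_zero hT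
  have h3 := hbd ρ hρ ρ' hρ' hne
  have hT1 : jacTot 2 2 χ = 1 := by
    have := Nat.le_mul_of_pos_left (jacTot 2 2 χ) (Nat.pos_of_ne_zero hne)
    omega
  have hN1 : jacNum 2 2 χ ρ ρ' = 1 := by
    rw [hT1] at h3
    omega
  refine ⟨⟨ρ, mem_vIrr_left_of_jacNum_ne_zero (m := 2) (d := 2) hχ hρ hρ' hne, ?_⟩, ?_⟩
  · by_cases heq : ρ = ρ'
    · rw [← heq] at hN1
      exact hN1
    · exfalso
      have h4 : ∑ x : Irr k 2 × Irr k 2, jacNum 2 2 χ x.1.1 x.2.1 = 1 := by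
        rw [← hT1, jacTot, Fintype.sum_prod_type]
      have h5 := Finset.add_le_sum
        (f := fun x : Irr k 2 × Irr k 2 => jacNum 2 2 χ x.1.1 x.2.1) (fun _ _ => Nat.zero_le _)
        (Finset.mem_univ (⟨ρ, hρ⟩, ⟨ρ', hρ'⟩)) (Finset.mem_univ (⟨ρ', hρ'⟩, ⟨ρ, hρ⟩))
        (fun h => heq (congrArg Subtype.val (congrArg Prod.fst h)))
      simp only [h4, hN1] at h5
      rw [jacNum_comm, hN1] at h5
      omega
  · rw [hd, hT1]
    simp

theorem exceptional_injective {χ' : EndClass k → ℂ} (hχ : χ ∈ vIrr Θ 4)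
    (h0 : χ (regUni k 4) = 0) (hχ' : χ' ∈ vIrr Θ 4) (h0' : χ' (regUni k 4) = 0)
    (hρ : ρ ∈ vIrr Θ 2) (hn : jacNum 2 2 χ ρ ρ = 1) (hn' : jacNum 2 2 χ' ρ ρ = 1) : χ = χ' := by
  by_contra hne
  have hle := jacNum_mul_chDeg_add_le (m := 2) (d := 2) hχ.1 hχ'.1 hne hρ.1 hρ.1
  have hd := (exceptional_four h1 h2 hχ h0).2
  have hd' := (exceptional_four h1 h2 hχ' h0').2
  have hr := (vac_two h1 h2 hρ).2
  have hq := two_le_card k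
  rw [hn, hn', one_mul, one_mul] at hle
  zify at hle
  rw [hr, qfac_cast _ (by omega), qfac_cast _ (by omega), hd, hd'] at hle
  simp only [Finset.prod_range_succ, Finset.prod_range_zero] at hle
  have hq' : 2 ≤ (Nat.card k : ℤ) := by exact_mod_cast hq
  generalize (Nat.card k : ℤ) = q at *
  have g1 : 0 < q - 1 := by linarith
  have g2 : 0 < q ^ 2 - 1 := by nlinarith
  have g3 : 0 < q ^ 3 - 1 := by nlinarith
  have hc : 0 < (q - 1) ^ 3 * (q ^ 2 - 1) ^ 2 * (q ^ 3 - 1) := by positivity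
  have h5 : 2 * q ^ 2 ≤ q ^ 2 + 1 := by
    refine le_of_mul_le_mul_left ?_ hc
    linear_combination hle
  nlinarith

theorem chVal_four (hp : p.Prime) (he : 0 < e) (hk : Nat.card k = p ^ e)
    (h4 : chUni Θ 4 + chNum Θ 2 = chNum Θ 4) : chVal p Θ 4 = 2 * e * chNum Θ 2 := by
  classical
  have : Fact p.Prime := ⟨hp⟩
  let Z := Finset.univ.filter fun χ : vIrr Θ 4 => χ.1 (regUni k 4) = 0
  have hZ : ∀ χ ∈ Z, χ.1 (regUni k 4) = 0 := fun χ hχ => (Finset.mem_filter.1 hχ).2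
  choose! g hg hg' using fun χ (hχ : χ ∈ Z) => (exceptional_four h1 h2 χ.2 (hZ χ hχ)).1
  have hgi : Set.InjOn (fun χ : vIrr Θ 4 => g χ) Z := fun χ hχ χ' hχ' h => Subtype.ext
    (exceptional_injective h1 h2 χ.2 (hZ χ hχ) χ'.2 (hZ χ' hχ') (hg χ hχ) (hg' χ hχ)
      (by rw [show g χ = g χ' from h]; exact hg' χ' hχ'))
  have hZle : Z.card ≤ chNum Θ 2 := by
    rw [← Finset.card_image_of_injOn hgi, chNum, Nat.card_coe_set_eq, ← Set.ncard_coe_finset]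
    refine Set.ncard_le_ncard (fun x hx => ?_) (Set.toFinite _)
    obtain ⟨χ, hχ, rfl⟩ := Finset.mem_image.1 hx
    exact hg χ hχ
  have hf1 : ∀ χ ∈ Zᶜ, 1 ≤ ‖χ.1 (regUni k 4)‖ ^ 2 := fun χ hχ => by
    obtain ⟨A, hA, -⟩ := vac_four h1 h2 χ.2
    rw [hA]
    refine one_le_sq_of_ne_zero ?_
    rintro rfl
    refine Finset.mem_compl.1 hχ (Finset.mem_filter.2 ⟨Finset.mem_univ _, ?_⟩)
    rw [hA, Int.cast_zero]
  have hs : ∑ χ ∈ Zᶜ, ‖χ.1 (regUni k 4)‖ ^ 2 = chUni Θ 4 := by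
    rw [chUni, ← Finset.sum_add_sum_compl Z, Finset.sum_eq_zero (s := Z), zero_add]
    intro χ hχ
    rw [hZ χ hχ]
    simp
  have hcard : Z.card + Zᶜ.card = chNum Θ 4 := by
    rw [Finset.card_add_card_compl, chNum, Nat.card_eq_fintype_card]
  have hcard' : (Z.card : ℝ) + Zᶜ.card = chNum Θ 4 := by exact_mod_cast hcard
  have hZle' : (Z.card : ℝ) ≤ chNum Θ 2 := by exact_mod_cast hZle
  have hs1 : ∑ χ ∈ Zᶜ, (‖χ.1 (regUni k 4)‖ ^ 2 - 1) = chUni Θ 4 - Zᶜ.card := by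
    rw [Finset.sum_sub_distrib, hs]
    simp
  have hnn : ∀ χ ∈ Zᶜ, 0 ≤ ‖χ.1 (regUni k 4)‖ ^ 2 - 1 := fun χ hχ => sub_nonneg.2 (hf1 χ hχ)
  have hs2 := Finset.sum_nonneg hnn
  have hs3 : ∑ χ ∈ Zᶜ, (‖χ.1 (regUni k 4)‖ ^ 2 - 1) = 0 := by linarith
  have hZc : Z.card = chNum Θ 2 := by
    have : (Z.card : ℝ) = chNum Θ 2 := by linarith
    exact_mod_cast this
  rw [Finset.sum_eq_zero_iff_of_nonneg hnn] at hs3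
  rw [chVal, ← Finset.sum_add_sum_compl Z, Finset.sum_const_nat (m := 2 * e), hZc,
    Finset.sum_eq_zero (s := Zᶜ), add_zero, mul_comm]
  · intro χ hχ
    obtain ⟨A, hA, hd⟩ := vac_four h1 h2 χ.2
    have h6 := sub_eq_zero.1 (hs3 χ hχ)
    rw [hA] at h6
    refine padicValNat.eq_zero_of_not_dvd (not_dvd_of_cast hp he hk (fun q => (q ^ 3 - 1) *
      (q - 1) * (q ^ 2 * jacTot 2 2 χ.1 - (q ^ 2 - 1) * A)) hd ?_ (sq_eq_one_of_norm h6))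
    simp [cast_card_eq_zero he hk]
  · intro χ hχ
    have hd := (exceptional_four h1 h2 χ.2 (hZ χ hχ)).2
    have hq := two_le_card k
    have hd' : chDeg 4 χ.1 = (Nat.card k ^ 3 - 1) * (Nat.card k ^ 1 - 1) * Nat.card k ^ 2 := by
      zify [Nat.one_le_pow 3 (Nat.card k) (by omega), Nat.one_le_pow 1 (Nat.card k) (by omega)]
      rw [hd, pow_one]
    have n3 := padicValNat_pow_sub_one hp he 2
    have n1 := padicValNat_pow_sub_one hp he 0
    rw [← hk] at n3 n1
    change padicValNat p (chDeg 4 χ.1) = _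
    rw [hd', padicValNat.mul, padicValNat.mul, padicValNat.eq_zero_of_not_dvd n3,
      padicValNat.eq_zero_of_not_dvd n1, hk, ← pow_mul, padicValNat.prime_pow]
    · ring
    · rintro h; rw [h] at n3; simp at n3
    · rintro h; rw [h] at n1; simp at n1
    · intro h
      rcases mul_eq_zero.1 h with h | h
      · rw [h] at n3; simp at n3
      · rw [h] at n1; simp at n1
    · positivity

end VacuumValuations

section Fitting

open Module

variable {k : Type} [Field k]
variable {V W Q V' W' Q' : Type} [AddCommGroup V] [Module k V] [AddCommGroup W] [Module k W]
  [AddCommGroup Q] [Module k Q] [AddCommGroup V'] [Module k V'] [AddCommGroup W'] [Module k W']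
  [AddCommGroup Q'] [Module k Q']

theorem cls_eq_blk_of_isCompl [Module.Finite k V] {x : End k V} {S T : Submodule k V}
    (h : IsCompl S T) (hS : S ≤ S.comap x) (hT : T ≤ T.comap x) :
    cls x = cls (blk (x.restrict hS) 0 (x.restrict hT)) := by
  refine (cls_congr (Submodule.prodEquivOfIsCompl S T h) fun v => ?_).symm
  simp [Submodule.coe_prodEquivOfIsCompl']

/-- `a` is not an eigenvalue of `x`. -/
def NoEig (a : k) (x : End k V) : Prop := ∀ v, x v = a • v → v = 0

theorem NoEig.congr {a : k} {x : End k V} {y : End k W} (e : V ≃ₗ[k] W)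
    (h : ∀ v, e (x v) = y (e v)) (hx : NoEig a x) : NoEig a y := by
  intro w hw
  have h1 : e.symm w = 0 := hx _ (e.injective (by
    rw [h, e.apply_symm_apply, hw, map_smul, e.apply_symm_apply]))
  rwa [e.symm_apply_eq, map_zero] at h1

theorem NoEig.injective {a : k} {x : End k V} (hx : NoEig a x) :
    Function.Injective (x - a • (1 : End k V)) :=
  (injective_iff_map_eq_zero _).2 fun v hv => hx v (sub_eq_zero.1 hv)

theorem noEig_blk {a : k} {x : End k V} {y : End k W} :
    NoEig a (blk x 0 y) ↔ NoEig a x ∧ NoEig a y := by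
  refine ⟨fun h => ⟨fun v hv => ?_, fun w hw => ?_⟩, fun h v hv => ?_⟩
  · exact congrArg Prod.fst (h (v, 0) (Prod.ext (by simpa using hv) (by simp)))
  · exact congrArg Prod.snd (h (0, w) (Prod.ext (by simp) (by simpa using hw)))
  · exact Prod.ext (h.1 _ (by simpa using congrArg Prod.fst hv))
      (h.2 _ (by simpa using congrArg Prod.snd hv))

theorem noEig_add_nilpotent {a b : k} (hab : a ≠ b) {N : End k V} (hN : IsNilpotent N) :
    NoEig b (a • 1 + N) := by
  intro v hv
  have h1 : N v = (b - a) • v := by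
    rw [sub_smul, ← hv]
    simp
  have h2 : ∀ r, (N ^ r) v = (b - a) ^ r • v := fun r => by
    induction r with
    | zero => simp
    | succ r ih => rw [pow_succ, Module.End.mul_apply, h1, map_smul, ih, smul_smul, pow_succ']
  obtain ⟨r, hr⟩ := hN
  have h3 := h2 r
  rw [hr, LinearMap.zero_apply, eq_comm, smul_eq_zero] at h3
  exact h3.resolve_left (pow_ne_zero _ (sub_ne_zero.2 hab.symm))

theorem noEig_zero_iff [Module.Finite k V] (x : End k V) : NoEig 0 x ↔ LinearMap.det x ≠ 0 := by
  rw [← isUnit_iff_ne_zero, ← LinearMap.isUnit_iff_isUnit_det, LinearMap.isUnit_iff_ker_eq_bot,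
    LinearMap.ker_eq_bot, injective_iff_map_eq_zero]
  simp [NoEig]

/-- Fitting decomposition with respect to the eigenvalue `a`. -/
theorem exists_fitting [Finite k] [Finite V] (x : End k V) (a : k) :
    ∃ (S T : Submodule k V) (N : End k S) (y : End k T), IsNilpotent N ∧ NoEig a y ∧
      cls x = cls (blk (a • 1 + N) 0 y) := by
  set M := x - a • (1 : End k V) with hM
  obtain ⟨n, hn⟩ := Filter.eventually_atTop.1 (LinearMap.eventually_isCompl_ker_pow_range_pow M)
  have hc := hn (n + 1) (Nat.le_succ n)
  have hx : ∀ v, x v = a • v + M v := fun v => by simp [hM]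
  have hS := ker_pow_le_comap M (n + 1)
  have hT := range_pow_le_comap M (n + 1)
  have hS' : LinearMap.ker (M ^ (n + 1)) ≤ (LinearMap.ker (M ^ (n + 1))).comap x := fun v hv => by
    rw [Submodule.mem_comap, hx]
    exact add_mem (Submodule.smul_mem _ _ hv) (hS hv)
  have hT' : LinearMap.range (M ^ (n + 1)) ≤ (LinearMap.range (M ^ (n + 1))).comap x :=
    fun v hv => by
    rw [Submodule.mem_comap, hx]
    exact add_mem (Submodule.smul_mem _ _ hv) (hT hv)
  refine ⟨_, _, M.restrict hS, x.restrict hT', ⟨n + 1, ?_⟩, ?_, ?_⟩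
  · refine LinearMap.ext fun v => Subtype.ext ?_
    rw [pow_restrict_apply]
    exact LinearMap.mem_ker.1 v.2
  · intro v hv
    have h1 : x v.1 = a • v.1 := congrArg Subtype.val hv
    have h2 : M v.1 = 0 := by simp [hM, h1]
    have h4 : ∀ u, M u = 0 → (M ^ (n + 1)) u = 0 := fun u hu => by
      rw [pow_succ, Module.End.mul_apply, hu, map_zero]
    have h3 : v.1 ∈ LinearMap.ker (M ^ (n + 1)) := LinearMap.mem_ker.2 (h4 _ h2)
    exact Subtype.ext (Submodule.disjoint_def.1 hc.disjoint _ h3 v.2)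
  · rw [cls_eq_blk_of_isCompl hc hS' hT']
    congr 2
    refine LinearMap.ext fun v => Subtype.ext ?_
    simp [hx]

/-- There is no nonzero map intertwining `x` and `y`. -/
def NoHom (x : End k W) (y : End k Q) : Prop := ∀ c : W →ₗ[k] Q, (∀ v, c (x v) = y (c v)) → c = 0

theorem NoEig.noHom {a : k} {N : End k W} (hN : IsNilpotent N) {y : End k Q} (hy : NoEig a y) :
    NoHom (a • 1 + N) y := by
  intro c hc
  have h1 : ∀ v, c (N v) = (y - a • (1 : End k Q)) (c v) := fun v => by
    have := hc v
    simp only [LinearMap.add_apply, LinearMap.smul_apply, Module.End.one_apply, map_add,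
      map_smul] at this
    simp [← this]
  have h2 : ∀ r v, c ((N ^ r) v) = ((y - a • (1 : End k Q)) ^ r) (c v) := fun r => by
    induction r with
    | zero => simp
    | succ r ih => intro v; rw [pow_succ, Module.End.mul_apply, ih, h1, pow_succ,
        Module.End.mul_apply]
  obtain ⟨r, hr⟩ := hN
  refine LinearMap.ext fun v => ?_
  have h3 := h2 r v
  rw [hr, LinearMap.zero_apply, map_zero, Module.End.coe_pow] at h3
  exact (hy.injective.iterate r) (h3.symm.trans (by
    rw [← Module.End.coe_pow, LinearMap.zero_apply, map_zero]))

theorem NoEig.noHom' [Module.Finite k Q] {a : k} {N : End k W} (hN : IsNilpotent N) {y : End k Q}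
    (hy : NoEig a y) : NoHom y (a • 1 + N) := by
  intro c hc
  have h1 : ∀ v, c ((y - a • (1 : End k Q)) v) = N (c v) := fun v => by
    simp [hc]
  have h2 : ∀ r v, c (((y - a • (1 : End k Q)) ^ r) v) = (N ^ r) (c v) := fun r => by
    induction r with
    | zero => simp
    | succ r ih => intro v; rw [pow_succ, Module.End.mul_apply, ih, h1, pow_succ,
        Module.End.mul_apply]
  obtain ⟨r, hr⟩ := hN
  refine LinearMap.ext fun v => ?_
  obtain ⟨w, rfl⟩ : ∃ w, ((y - a • (1 : End k Q)) ^ r) w = v := by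
    rw [Module.End.coe_pow]
    exact ((LinearMap.injective_iff_surjective.1 hy.injective).iterate r) v
  rw [h2, hr]
  rfl

theorem apply_of_noHom {x : End k W} {y : End k Q} {x' : End k W'} {y' : End k Q'}
    (h1 : NoHom x y') (h2 : NoHom y x') (e : (W × Q) →ₗ[k] W' × Q')
    (he : ∀ v, e (blk x 0 y v) = blk x' 0 y' (e v)) (w : W) (u : Q) :
    e (w, u) = ((e (w, 0)).1, (e (0, u)).2) := by
  have h3 : ∀ w, (e (w, 0)).2 = 0 := fun w =>
    LinearMap.congr_fun (h1 (LinearMap.snd k W' Q' ∘ₗ e ∘ₗ LinearMap.inl k W Q) fun v => by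
      have := congrArg Prod.snd (he (v, 0))
      simpa using this) w
  have h4 : ∀ u, (e (0, u)).1 = 0 := fun w =>
    LinearMap.congr_fun (h2 (LinearMap.fst k W' Q' ∘ₗ e ∘ₗ LinearMap.inr k W Q) fun v => by
      have := congrArg Prod.fst (he (0, v))
      simpa using this) w
  have h5 : (w, u) = (w, (0 : Q)) + ((0 : W), u) := by simp
  rw [h5, map_add]
  exact Prod.ext (by simp [h4]) (by simp [h3])

theorem exists_prodCongr {x : End k W} {y : End k Q} {x' : End k W'} {y' : End k Q'}
    (h1 : NoHom x y') (h2 : NoHom y x') (h1' : NoHom x' y) (h2' : NoHom y' x)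
    (e : (W × Q) ≃ₗ[k] W' × Q') (he : ∀ v, e (blk x 0 y v) = blk x' 0 y' (e v)) :
    ∃ (f : W ≃ₗ[k] W') (g : Q ≃ₗ[k] Q'), (∀ w, f (x w) = x' (f w)) ∧
      (∀ u, g (y u) = y' (g u)) ∧ e = f.prodCongr g := by
  have hs : ∀ v, e.symm (blk x' 0 y' v) = blk x 0 y (e.symm v) := fun v => by
    rw [e.symm_apply_eq, he, e.apply_symm_apply]
  have ha := apply_of_noHom h1 h2 e.toLinearMap he
  have hb := apply_of_noHom h1' h2' e.symm.toLinearMap hs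
  simp only [LinearEquiv.coe_coe] at ha hb
  have haw : ∀ w, e (w, 0) = ((e (w, 0)).1, 0) := fun w => (ha w 0).trans (by
    rw [show ((0 : W), (0 : Q)) = 0 from rfl, map_zero]; rfl)
  have hau : ∀ u, e (0, u) = (0, (e (0, u)).2) := fun w => (ha 0 w).trans (by
    rw [show ((0 : W), (0 : Q)) = 0 from rfl, map_zero]; rfl)
  have hbw : ∀ w, e.symm (w, 0) = ((e.symm (w, 0)).1, 0) := fun w => (hb w 0).trans (by
    rw [show ((0 : W'), (0 : Q')) = 0 from rfl, map_zero]; rfl)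
  have hbu : ∀ u, e.symm (0, u) = (0, (e.symm (0, u)).2) := fun w => (hb 0 w).trans (by
    rw [show ((0 : W'), (0 : Q')) = 0 from rfl, map_zero]; rfl)
  refine ⟨LinearEquiv.ofLinear
      (LinearMap.fst k W' Q' ∘ₗ e.toLinearMap ∘ₗ LinearMap.inl k W Q)
      (LinearMap.fst k W Q ∘ₗ e.symm.toLinearMap ∘ₗ LinearMap.inl k W' Q') ?_ ?_,
    LinearEquiv.ofLinear
      (LinearMap.snd k W' Q' ∘ₗ e.toLinearMap ∘ₗ LinearMap.inr k W Q)
      (LinearMap.snd k W Q ∘ₗ e.symm.toLinearMap ∘ₗ LinearMap.inr k W' Q') ?_ ?_,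
    fun w => ?_, fun u => ?_, LinearEquiv.ext fun v => ?_⟩
  · refine LinearMap.ext fun w => ?_
    simp [← hbw]
  · refine LinearMap.ext fun w => ?_
    simp [← haw]
  · refine LinearMap.ext fun w => ?_
    simp [← hbu]
  · refine LinearMap.ext fun w => ?_
    simp [← hau]
  · have := congrArg Prod.fst (he (w, 0))
    simpa using this
  · have := congrArg Prod.snd (he (0, u))
    simpa using this
  · obtain ⟨w, u⟩ := v
    simp [ha w u]

theorem cls_eq_of_cls_blk_eq [Module.Finite k W] [Module.Finite k Q] [Module.Finite k W']
    [Module.Finite k Q'] {a : k} {N : End k W} {N' : End k W'} {y : End k Q} {y' : End k Q'}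
    (hN : IsNilpotent N) (hN' : IsNilpotent N') (hy : NoEig a y) (hy' : NoEig a y')
    (h : cls (blk (a • 1 + N) 0 y) = cls (blk (a • 1 + N') 0 y')) :
    cls N = cls N' ∧ cls y = cls y' := by
  obtain ⟨e, he⟩ := cls_eq_iff.1 h
  obtain ⟨f, g, hf, hg, -⟩ := exists_prodCongr (NoEig.noHom hN hy') (NoEig.noHom' hN' hy)
    (NoEig.noHom hN' hy) (NoEig.noHom' hN hy') e he
  exact ⟨cls_congr f fun v => by simpa using hf v, cls_congr g hg⟩

end Fitting

section FittingCent

open Module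

variable {k : Type} [Field k] [Finite k]
variable {W Q : Type} [AddCommGroup W] [Module k W] [AddCommGroup Q] [Module k Q]
  [Finite W] [Finite Q]

theorem cent_blk_of_noHom {x : End k W} {y : End k Q} (h1 : NoHom x y) (h2 : NoHom y x) :
    cent (cls (blk x 0 y)) = cent (cls x) * cent (cls y) := by
  rw [cent_cls, cent_cls, cent_cls, ← Nat.card_prod]
  symm
  refine Nat.card_congr (Equiv.ofBijective (fun p => ⟨p.1.1.prodCongr p.2.1, fun v => ?_⟩)
    ⟨fun p p' h => ?_, fun e => ?_⟩)
  · simp [p.1.2, p.2.2]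
  · have h3 := fun v => LinearEquiv.congr_fun (congrArg Subtype.val h) v
    refine Prod.ext (Subtype.ext (LinearEquiv.ext fun w => ?_))
      (Subtype.ext (LinearEquiv.ext fun w => ?_))
    · exact congrArg Prod.fst (h3 (w, 0))
    · exact congrArg Prod.snd (h3 (0, w))
  · obtain ⟨f, g, hf, hg, h⟩ := exists_prodCongr h1 h2 h1 h2 e.1 e.2
    exact ⟨(⟨f, hf⟩, ⟨g, hg⟩), Subtype.ext h.symm⟩

end FittingCent

section NilpotentClasses

open Module

variable {k : Type} [Field k] [Finite k]
variable {V W : Type} [AddCommGroup V] [Module k V] [AddCommGroup W] [Module k W]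

theorem blk_zero_pow (a : End k V) (y : End k W) (i : ℕ) : blk a 0 y ^ i = blk (a ^ i) 0 (y ^ i) := by
  induction i with
  | zero => exact LinearMap.ext fun v => by simp
  | succ i ih =>
    refine LinearMap.ext fun v => ?_
    rw [pow_succ, ih, pow_succ, pow_succ]
    simp

/-- The rank of a power of the endomorphism. -/
noncomputable def EndClass.rk (ν : EndClass k) (i : ℕ) : ℕ :=
  finrank k (LinearMap.range (ν.rep.2 ^ i))

theorem rk_cls [Finite V] (x : End k V) (i : ℕ) :
    (cls x).rk i = finrank k (LinearMap.range (x ^ i)) := by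
  obtain ⟨e, he⟩ := EndClass.exists_rep x
  have h1 : ∀ v, e ((x ^ i) v) = ((cls x).rep.2 ^ i) (e v) := fun v => by
    induction i with
    | zero => simp
    | succ i ih => rw [pow_succ', Module.End.mul_apply, he, ih, ← Module.End.mul_apply, ← pow_succ']
  have h2 : LinearMap.range ((cls x).rep.2 ^ i) = (LinearMap.range (x ^ i)).map (e : V →ₗ[k] _) := by
    ext v
    constructor
    · rintro ⟨w, rfl⟩
      exact ⟨(x ^ i) (e.symm w), ⟨_, rfl⟩, by rw [LinearEquiv.coe_coe, h1, e.apply_symm_apply]⟩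
    · rintro ⟨_, ⟨w, rfl⟩, rfl⟩
      exact ⟨e w, (h1 w).symm⟩
  rw [EndClass.rk, h2]
  exact LinearEquiv.finrank_map_eq e _

theorem rk_blk [Finite V] [Finite W] (a : End k V) (y : End k W) (i : ℕ) :
    (cls (blk a 0 y)).rk i = (cls a).rk i + (cls y).rk i := by
  rw [rk_cls, rk_cls, rk_cls, blk_zero_pow, ← finrank_submodule_prod]
  suffices h : LinearMap.range (blk (a ^ i) 0 (y ^ i)) =
    (LinearMap.range (a ^ i)).prod (LinearMap.range (y ^ i)) by rw [h]
  ext ⟨u, v⟩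
  constructor
  · rintro ⟨w, hw⟩
    rw [blk_apply, LinearMap.zero_apply, add_zero] at hw
    exact ⟨⟨w.1, congrArg Prod.fst hw⟩, ⟨w.2, congrArg Prod.snd hw⟩⟩
  · rintro ⟨⟨u, hu⟩, ⟨v, hv⟩⟩
    exact ⟨(u, v), by rw [blk_apply, LinearMap.zero_apply, add_zero]; exact Prod.ext hu hv⟩

theorem rk_shiftEnd (l i : ℕ) : (cls (shiftEnd k l)).rk i = l - i := by
  rw [rk_cls]
  let g : (Fin (l - i) → k) →ₗ[k] (Fin l → k) :=
    { toFun := fun c j => if h : j.1 < l - i then c ⟨j.1, h⟩ else 0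
      map_add' := fun c c' => by
        funext j
        simp only [Pi.add_apply]
        split_ifs <;> simp
      map_smul' := fun a c => by
        funext j
        simp only [Pi.smul_apply, RingHom.id_apply]
        split_ifs <;> simp }
  have hg : Function.Injective g := fun c c' h => by
    funext j
    have := congrFun h ⟨j.1, by omega⟩
    simpa [g] using this
  have h1 : LinearMap.range (shiftEnd k l ^ i) = LinearMap.range g := by
    ext v
    constructor
    · rintro ⟨c, rfl⟩
      refine ⟨fun j => c ⟨j.1 + i, by omega⟩, funext fun j => ?_⟩
      rw [shiftEnd_pow_apply]
      simp only [g, LinearMap.coe_mk, AddHom.coe_mk]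
      by_cases h : j.1 + i < l
      · rw [dif_pos h, dif_pos (by omega)]
      · rw [dif_neg h, dif_neg (by omega)]
    · rintro ⟨c, rfl⟩
      refine ⟨fun j => if h : i ≤ j.1 then c ⟨j.1 - i, by omega⟩ else 0, funext fun j => ?_⟩
      rw [shiftEnd_pow_apply]
      simp only [g, LinearMap.coe_mk, AddHom.coe_mk]
      by_cases h : j.1 + i < l
      · rw [dif_pos h, dif_pos (by omega), dif_pos (by omega)]
        congr 2
        omega
      · rw [dif_neg h, dif_neg (by omega)]
  rw [h1, LinearMap.finrank_range_of_inj hg, finrank_fin_fun]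

theorem rk_eq_zero_iff [Finite V] (x : End k V) (i : ℕ) : (cls x).rk i = 0 ↔ x ^ i = 0 := by
  rw [rk_cls, Submodule.finrank_eq_zero, LinearMap.range_eq_bot]

theorem rk_zero [Finite V] (x : End k V) : (cls x).rk 0 = finrank k V := by
  rw [rk_cls, pow_zero, Module.End.one_eq_id, LinearMap.range_id, finrank_top]

theorem cls_blk_congr_right [Finite V] [Finite W] {U : Type} [AddCommGroup U]
    [Module k U] [Finite U] (a : End k V) {y : End k W} {z : End k U}
    (h : cls y = cls z) : cls (blk a 0 y) = cls (blk a 0 z) := by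
  obtain ⟨e, he⟩ := cls_eq_iff.1 h
  exact cls_congr ((LinearEquiv.refl k V).prodCongr e) fun v => by simp [he]

theorem exists_max_pow [Nontrivial V] {N : End k V} (hN : IsNilpotent N) :
    ∃ l, N ^ (l + 1) = 0 ∧ N ^ l ≠ 0 := by
  classical
  have h := Nat.find_spec hN
  have h0 : Nat.find hN ≠ 0 := fun h0 => by
    rw [h0, pow_zero] at h
    exact one_ne_zero h
  obtain ⟨l, hl⟩ := Nat.exists_eq_succ_of_ne_zero h0
  exact ⟨l, by rwa [hl] at h, Nat.find_min hN (by omega)⟩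

theorem cls_eq_of_rk_eq (n : ℕ) : ∀ {V W : Type} [AddCommGroup V] [Module k V]
    [AddCommGroup W] [Module k W] [Finite V] [Finite W] {N : End k V} {M : End k W},
    IsNilpotent N → IsNilpotent M → finrank k V = n → (∀ i, (cls N).rk i = (cls M).rk i) →
    cls N = cls M := by
  induction n using Nat.strong_induction_on with
  | _ n ih =>
  intro V W _ _ _ _ _ _ N M hN hM hn h
  have h0 := h 0
  rw [rk_zero, rk_zero, hn] at h0
  rcases n.eq_zero_or_pos with rfl | hpos
  · have := Module.finrank_zero_iff.1 hn
    have := Module.finrank_zero_iff.1 h0.symm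
    exact cls_congr (LinearEquiv.ofFinrankEq V W (by omega)) fun v => Subsingleton.elim _ _
  · have : Nontrivial V := Module.nontrivial_of_finrank_pos (R := k) (by omega)
    obtain ⟨l, h1, h2⟩ := exists_max_pow hN
    have h1' : M ^ (l + 1) = 0 := by
      rwa [← rk_eq_zero_iff, ← h, rk_eq_zero_iff]
    have h2' : M ^ l ≠ 0 := by
      rwa [Ne, ← rk_eq_zero_iff, ← h, rk_eq_zero_iff]
    obtain ⟨K, hK, e1⟩ := exists_split_shift h1 h2
    obtain ⟨K', hK', e2⟩ := exists_split_shift h1' h2'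
    have h3 := congrArg EndClass.dim e1
    rw [dim_cls, dim_cls, finrank_prod, finrank_fin_fun, hn] at h3
    rw [e1, e2]
    refine cls_blk_congr_right _ (ih (finrank k K) (by omega) (isNilpotent_restrict hN hK)
      (isNilpotent_restrict hM hK') rfl fun i => ?_)
    have h4 := h i
    rw [e1, e2, rk_blk, rk_blk] at h4
    exact Nat.add_left_cancel h4

/-- The class of the nilpotent endomorphism with given Jordan blocks. -/
noncomputable def nilCls (k : Type) [Field k] : List ℕ → EndClass k
  | [] => cls (0 : End k (Fin 0 → k))
  | l :: t => cls (blk (shiftEnd k l) 0 (nilCls k t).rep.2)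

theorem rk_nilCls (l : List ℕ) (i : ℕ) : (nilCls k l).rk i = (l.map (· - i)).sum := by
  induction l with
  | nil =>
    rw [nilCls, rk_cls, List.map_nil, List.sum_nil]
    exact finrank_zero_of_subsingleton
  | cons a t ih => rw [nilCls, rk_blk, EndClass.cls_rep, ih, rk_shiftEnd, List.map_cons, List.sum_cons]

theorem dim_nilCls (l : List ℕ) : (nilCls k l).dim = l.sum := by
  have h := rk_nilCls (k := k) l 0
  rw [← EndClass.cls_rep (nilCls k l), rk_zero, ← dim_cls (nilCls k l).rep.2, EndClass.cls_rep] at h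
  simpa using h

/-- The class consists of nilpotent endomorphisms. -/
def EndClass.IsNil (ν : EndClass k) : Prop := IsNilpotent ν.rep.2

theorem isNil_cls [Finite V] (x : End k V) : (cls x).IsNil ↔ IsNilpotent x := by
  constructor
  · rintro ⟨r, hr⟩
    exact ⟨r, by rw [← rk_eq_zero_iff, ← EndClass.cls_rep (cls x), rk_eq_zero_iff, hr]⟩
  · rintro ⟨r, hr⟩
    exact ⟨r, by rw [← rk_eq_zero_iff, EndClass.cls_rep, rk_eq_zero_iff, hr]⟩

theorem isNil_nilCls (l : List ℕ) : (nilCls k l).IsNil := by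
  refine ⟨l.sum, ?_⟩
  rw [← rk_eq_zero_iff, EndClass.cls_rep, rk_nilCls, List.sum_eq_zero_iff]
  intro x hx
  obtain ⟨a, ha, rfl⟩ := List.mem_map.1 hx
  exact Nat.sub_eq_zero_of_le (List.le_sum_of_mem ha)

theorem nilCls_injOn : ∀ l ∈ smallParts, ∀ l' ∈ smallParts, nilCls k l = nilCls k l' → l = l' := by
  have h : ∀ l ∈ smallParts, ∀ l' ∈ smallParts,
      (∀ i ∈ Finset.range 6, (l.map (· - i)).sum = (l'.map (· - i)).sum) → l = l' := by decide
  intro l hl l' hl' h1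
  refine h l hl l' hl' fun i _ => ?_
  rw [← rk_nilCls (k := k), h1, rk_nilCls]

theorem cons_mem_smallParts : ∀ t ∈ smallParts, ∀ a ∈ Finset.range 6, 0 < a → a + t.sum ≤ 5 →
    (∀ b ∈ t, b ≤ a) → a :: t ∈ smallParts := by decide

theorem exists_nilCls (n : ℕ) : ∀ {V : Type} [AddCommGroup V] [Module k V] [Finite V]
    {N : End k V} {b : ℕ}, N ^ b = 0 → finrank k V = n → n ≤ 5 →
    ∃ l ∈ smallParts, l.sum = n ∧ (∀ a ∈ l, a ≤ b) ∧ cls N = nilCls k l := by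
  induction n using Nat.strong_induction_on with
  | _ n ih =>
  intro V _ _ _ N b hN hn h5
  rcases n.eq_zero_or_pos with rfl | hpos
  · have := Module.finrank_zero_iff.1 hn
    refine ⟨[], by decide, rfl, by simp, ?_⟩
    exact cls_congr (LinearEquiv.ofFinrankEq V (Fin 0 → k) (by simpa using hn))
      fun v => Subsingleton.elim _ _
  · have : Nontrivial V := Module.nontrivial_of_finrank_pos (R := k) (by omega)
    obtain ⟨l, h1, h2⟩ := exists_max_pow ⟨b, hN⟩
    have hlb : l + 1 ≤ b := by
      by_contra hb
      exact h2 (pow_eq_zero_of_le (by omega) hN)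
    obtain ⟨K, hK, e1⟩ := exists_split_shift h1 h2
    have h3 := congrArg EndClass.dim e1
    rw [dim_cls, dim_cls, finrank_prod, finrank_fin_fun, hn] at h3
    have h4 : N.restrict hK ^ (l + 1) = 0 := LinearMap.ext fun v => Subtype.ext (by
      rw [pow_restrict_apply, h1]; rfl)
    obtain ⟨t, ht, hts, hta, hte⟩ := ih (finrank k K) (by omega) h4 rfl (by omega)
    refine ⟨(l + 1) :: t, cons_mem_smallParts t ht _ (Finset.mem_range.2 (by omega))
      (Nat.succ_pos l) (by omega) hta, by rw [List.sum_cons]; omega, ?_, ?_⟩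
    · intro a ha
      rcases List.mem_cons.1 ha with rfl | ha
      · exact hlb
      · exact (hta a ha).trans hlb
    · rw [e1, nilCls]
      exact cls_blk_congr_right _ (by rw [hte, EndClass.cls_rep])

theorem IsNil.exists_nilCls {ν : EndClass k} (h : ν.IsNil) (h5 : ν.dim ≤ 5) :
    ∃ l ∈ smallParts, l.sum = ν.dim ∧ ν = nilCls k l := by
  obtain ⟨b, hb⟩ := h
  obtain ⟨l, hl, h1, -, h2⟩ := _root_.exists_nilCls ν.dim hb (by
    rw [← dim_cls ν.rep.2, EndClass.cls_rep]) h5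
  exact ⟨l, hl, h1, by rw [← h2, EndClass.cls_rep]⟩

end NilpotentClasses

section NilpotentCentralizers

open Module

variable {k : Type} [Field k] [Finite k]
variable {V W : Type} [AddCommGroup V] [Module k V] [AddCommGroup W] [Module k W]
  [Finite V] [Finite W]

theorem exists_comm_apply_eq {N : End k V} {l : ℕ} (h0 : N ^ (l + 1) = 0) {y z : V}
    (hy : (N ^ l) y ≠ 0) (hz : (N ^ l) z ≠ 0) :
    ∃ e : V ≃ₗ[k] V, (∀ v, e (N v) = N (e v)) ∧ e y = z := by
  have hN : IsNilpotent N := ⟨_, h0⟩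
  obtain ⟨K, hK, e1, h1, h1'⟩ := exists_equiv_blk_shift h0 hy
  obtain ⟨L, hL, e2, h2, h2'⟩ := exists_equiv_blk_shift h0 hz
  have hKL : cls (N.restrict hK) = cls (N.restrict hL) := by
    refine cls_eq_of_rk_eq _ (isNilpotent_restrict hN hK) (isNilpotent_restrict hN hL) rfl
      fun i => ?_
    have h3 : cls (blk (shiftEnd k (l + 1)) 0 (N.restrict hK)) =
        cls (blk (shiftEnd k (l + 1)) 0 (N.restrict hL)) :=
      (cls_congr e1 h1).trans (cls_congr e2 h2).symm
    have h4 := congrArg (EndClass.rk · i) h3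
    simp only [rk_blk] at h4
    exact Nat.add_left_cancel h4
  obtain ⟨f, hf⟩ := cls_eq_iff.1 hKL
  have h1s : ∀ v, e1.symm (N v) = blk (shiftEnd k (l + 1)) 0 (N.restrict hK) (e1.symm v) :=
    fun v => by rw [e1.symm_apply_eq, h1, e1.apply_symm_apply]
  refine ⟨(e1.symm.trans ((LinearEquiv.refl k _).prodCongr f)).trans e2, fun v => ?_, ?_⟩
  · simp only [LinearEquiv.trans_apply, h1s, ← h2]
    congr 1
    simp [hf]
  · rw [LinearEquiv.trans_apply, LinearEquiv.trans_apply, ← h1', e1.symm_apply_apply, ← h2']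
    simp

theorem card_pow_apply_ne_zero (N : End k V) (l : ℕ) :
    Nat.card {v : V // (N ^ l) v ≠ 0} + Nat.card k ^ (finrank k V - (cls N).rk l) =
      Nat.card k ^ finrank k V := by
  classical
  have := Fintype.ofFinite V
  have h1 : Nat.card {v : V // (N ^ l) v = 0} = Nat.card k ^ (finrank k V - (cls N).rk l) := by
    rw [rk_cls, ← LinearMap.finrank_range_add_finrank_ker (N ^ l), Nat.add_sub_cancel_left,
      ← Module.natCard_eq_pow_finrank (K := k)]
    rfl
  rw [← h1, ← Module.natCard_eq_pow_finrank (K := k), Nat.card_eq_fintype_card,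
    Nat.card_eq_fintype_card, Nat.card_eq_fintype_card, add_comm]
  exact (Fintype.card_congr (Equiv.sumCompl fun v => (N ^ l) v = 0)).symm ▸ Fintype.card_sum.symm

theorem cent_eq_card_mul_card_fix {N : End k V} {l : ℕ} (h0 : N ^ (l + 1) = 0) {y : V}
    (hy : (N ^ l) y ≠ 0) :
    cent (cls N) = Nat.card {v : V // (N ^ l) v ≠ 0} *
      Nat.card {e : V ≃ₗ[k] V // (∀ v, e (N v) = N (e v)) ∧ e y = y} := by
  have hpow : ∀ e : V ≃ₗ[k] V, (∀ v, e (N v) = N (e v)) → ∀ r v, e ((N ^ r) v) = (N ^ r) (e v) := by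
    intro e he r
    induction r with
    | zero => simp
    | succ r ih => intro v; rw [pow_succ, Module.End.mul_apply, ih, he, Module.End.mul_apply]
  rw [cent_cls, ← Nat.card_prod]
  have h := fun v : {v : V // (N ^ l) v ≠ 0} => exists_comm_apply_eq h0 hy v.2
  choose E hE hEy using h
  have hsymm : ∀ a v, (E a).symm (N v) = N ((E a).symm v) := fun a v => by
    rw [LinearEquiv.symm_apply_eq, hE, LinearEquiv.apply_symm_apply]
  refine Nat.card_congr ⟨fun e => (⟨e.1 y, ?_⟩, ⟨e.1.trans (E ⟨e.1 y, ?_⟩).symm, ?_, ?_⟩),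
    fun p => ⟨p.2.1.trans (E p.1), ?_⟩, ?_, ?_⟩
  · rw [← hpow e.1 e.2]
    exact fun h => hy (e.1.injective (h.trans (map_zero _).symm))
  · rw [← hpow e.1 e.2]
    exact fun h => hy (e.1.injective (h.trans (map_zero _).symm))
  · intro v
    rw [LinearEquiv.trans_apply, LinearEquiv.trans_apply, e.2, hsymm]
  · rw [LinearEquiv.trans_apply, LinearEquiv.symm_apply_eq, hEy]
  · intro v
    rw [LinearEquiv.trans_apply, LinearEquiv.trans_apply, p.2.2.1, hE]
  · intro e
    refine Subtype.ext (LinearEquiv.ext fun v => ?_)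
    simp
  · rintro ⟨⟨v, hv⟩, ⟨e, he, hey⟩⟩
    have h1 : E ⟨v, hv⟩ (e y) = v := by rw [hey, hEy]
    refine Prod.ext (Subtype.ext ?_) (Subtype.ext (LinearEquiv.ext fun w => ?_))
    · simpa using h1
    · simp only [LinearEquiv.trans_apply]
      rw [LinearEquiv.symm_apply_eq]
      congr 2
      exact Subtype.ext h1.symm

/-- The map into the shift with given bottom coordinate. -/
def toShift (M : End k W) (l : ℕ) (ξ : Module.Dual k W) : W →ₗ[k] Fin l → k :=
  LinearMap.pi fun i => ξ ∘ₗ (M ^ i.1)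

theorem toShift_comm {M : End k W} {l : ℕ} (h0 : M ^ l = 0) (ξ : Module.Dual k W) (w : W) :
    toShift M l ξ (M w) = shiftEnd k l (toShift M l ξ w) := by
  funext i
  simp only [toShift, LinearMap.pi_apply, LinearMap.comp_apply, shiftEnd, LinearMap.coe_mk,
    AddHom.coe_mk, ← Module.End.mul_apply, ← pow_succ]
  split_ifs with h
  · rfl
  · rw [show i.1 + 1 = l by omega, h0, LinearMap.zero_apply, map_zero]

theorem eq_toShift {M : End k W} {l : ℕ} {c : W →ₗ[k] Fin (l + 1) → k}
    (hc : ∀ w, c (M w) = shiftEnd k (l + 1) (c w)) :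
    c = toShift M (l + 1) (LinearMap.proj 0 ∘ₗ c) := by
  have h1 : ∀ r w, c ((M ^ r) w) = (shiftEnd k (l + 1) ^ r) (c w) := fun r => by
    induction r with
    | zero => simp
    | succ r ih => intro w; rw [pow_succ, Module.End.mul_apply, ih, hc, pow_succ,
        Module.End.mul_apply]
  refine LinearMap.ext fun w => funext fun i => ?_
  simp only [toShift, LinearMap.pi_apply, LinearMap.comp_apply, LinearMap.proj_apply, h1]
  have h2 : (0 : Fin (l + 1)).1 + i.1 < l + 1 := by rw [Fin.val_zero, zero_add]; exact i.2
  rw [shiftEnd_pow_apply, dif_pos h2]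
  exact congrArg _ (Fin.ext (by simp))

theorem shiftEnd_hom_ext {l : ℕ} {N : End k V} {f g : (Fin (l + 1) → k) →ₗ[k] V}
    (hf : ∀ c, f (shiftEnd k (l + 1) c) = N (f c)) (hg : ∀ c, g (shiftEnd k (l + 1) c) = N (g c))
    (h : f (Pi.single (Fin.last l) 1) = g (Pi.single (Fin.last l) 1)) : f = g := by
  have hpow : ∀ {f : (Fin (l + 1) → k) →ₗ[k] V}, (∀ c, f (shiftEnd k (l + 1) c) = N (f c)) →
      ∀ r c, f ((shiftEnd k (l + 1) ^ r) c) = (N ^ r) (f c) := by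
    intro f hf r
    induction r with
    | zero => simp
    | succ r ih => intro c; rw [pow_succ, Module.End.mul_apply, ih, hf, pow_succ,
        Module.End.mul_apply]
  refine LinearMap.pi_ext' fun i => LinearMap.ext_ring ?_
  have h1 : (Pi.single i 1 : Fin (l + 1) → k) =
      (shiftEnd k (l + 1) ^ (l - i.1)) (Pi.single (Fin.last l) 1) := by
    funext j
    rw [shiftEnd_pow_apply]
    rcases eq_or_ne j i with rfl | hij
    · rw [dif_pos (by omega), Pi.single_eq_same]
      have : (⟨j.1 + (l - j.1), by omega⟩ : Fin (l + 1)) = Fin.last l := Fin.ext (by simp; omega)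
      rw [this, Pi.single_eq_same]
    · rw [Pi.single_eq_of_ne hij]
      split_ifs with h2
      · rw [Pi.single_eq_of_ne]
        intro h3
        have := congrArg Fin.val h3
        rw [Fin.val_last] at this
        exact hij (Fin.ext (by simp only at this; omega))
      · rfl
  simp only [LinearMap.comp_apply, LinearMap.single_apply]
  rw [h1, hpow hf, hpow hg, h]

theorem card_fix_blk_shift {M : End k W} {l : ℕ} (h0 : M ^ (l + 1) = 0) :
    Nat.card {e : ((Fin (l + 1) → k) × W) ≃ₗ[k] (Fin (l + 1) → k) × W //
      (∀ v, e (blk (shiftEnd k (l + 1)) 0 M v) = blk (shiftEnd k (l + 1)) 0 M (e v)) ∧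
        e (Pi.single (Fin.last l) 1, 0) = (Pi.single (Fin.last l) 1, 0)} =
      Nat.card k ^ finrank k W * cent (cls M) := by
  have hd : Nat.card k ^ finrank k W = Nat.card (Module.Dual k W) := by
    rw [Module.natCard_eq_pow_finrank (K := k) (V := Module.Dual k W), Subspace.dual_finrank_eq]
  rw [hd, cent_cls, ← Nat.card_prod]
  symm
  let F : (Module.Dual k W) × {e : W ≃ₗ[k] W // ∀ v, e (M v) = M (e v)} →
      ((Fin (l + 1) → k) × W) →ₗ[k] (Fin (l + 1) → k) × W := fun p =>
    blk 1 (toShift M (l + 1) p.1) p.2.1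
  have hF : ∀ p, Function.Bijective (F p) := fun p => by
    have h1 : Function.Injective (F p) := (injective_iff_map_eq_zero _).2 fun v hv => by
      have h2 : v.2 = 0 := p.2.1.injective ((congrArg Prod.snd hv).trans (map_zero _).symm)
      have h3 := congrArg Prod.fst hv
      simp only [F, blk_apply, h2, map_zero, add_zero, Module.End.one_apply] at h3
      exact Prod.ext h3 h2
    exact ⟨h1, LinearMap.injective_iff_surjective.1 h1⟩
  refine Nat.card_congr (Equiv.ofBijective (fun p => ⟨LinearEquiv.ofBijective (F p) (hF p),
    fun v => ?_, ?_⟩) ⟨fun p p' h => ?_, fun e => ?_⟩)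
  · simp only [F, LinearEquiv.ofBijective_apply, blk_apply, LinearMap.zero_apply, add_zero,
      Module.End.one_apply, toShift_comm h0, LinearEquiv.coe_coe, p.2.2, map_add]
  · simp [F, blk_apply]
  · have h1 := fun v => LinearEquiv.congr_fun (congrArg Subtype.val h) ((0 : Fin (l + 1) → k), v)
    simp only [F, LinearEquiv.ofBijective_apply, blk_apply, map_zero, zero_add, Prod.mk.injEq] at h1
    refine Prod.ext (LinearMap.ext fun w => ?_) (Subtype.ext (LinearEquiv.ext fun w => (h1 w).2))
    simpa [toShift] using congrFun (h1 w).1 0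
  · obtain ⟨e, he, hg⟩ := e
    have he1 : ∀ c, e (c, 0) = (c, 0) := LinearMap.congr_fun (shiftEnd_hom_ext (l := l)
      (N := blk (shiftEnd k (l + 1)) 0 M) (f := e.toLinearMap ∘ₗ LinearMap.inl k _ _)
      (g := LinearMap.inl k _ _) (fun c => by simp [← he]) (fun c => by simp) (by simpa using hg))
    have he2 : ∀ c w, e (c, w) = (c + (e (0, w)).1, (e (0, w)).2) := fun c w => by
      have : (c, w) = (c, (0 : W)) + (0, w) := by simp
      rw [this, map_add, he1]
      exact Prod.ext (by simp) (by simp)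
    have he3 : ∀ w, e (0, M w) = (shiftEnd k (l + 1) (e (0, w)).1, M (e (0, w)).2) := fun w => by
      simpa using he (0, w)
    let y : W →ₗ[k] W := LinearMap.snd k _ _ ∘ₗ e.toLinearMap ∘ₗ LinearMap.inr k _ _
    let c : W →ₗ[k] Fin (l + 1) → k := LinearMap.fst k _ _ ∘ₗ e.toLinearMap ∘ₗ LinearMap.inr k _ _
    have hy : Function.Injective y := (injective_iff_map_eq_zero _).2 fun w hw => by
      have h2 : e (0, w) = e ((e (0, w)).1, 0) := by
        rw [he1]
        exact Prod.ext rfl hw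
      exact congrArg Prod.snd (e.injective h2)
    refine ⟨(LinearMap.proj 0 ∘ₗ c, ⟨LinearEquiv.ofBijective y
      ⟨hy, LinearMap.injective_iff_surjective.1 hy⟩, fun w => congrArg Prod.snd (he3 w)⟩),
      Subtype.ext (LinearEquiv.ext fun v => ?_)⟩
    have hc : c = toShift M (l + 1) (LinearMap.proj 0 ∘ₗ c) :=
      eq_toShift fun w => congrArg Prod.fst (he3 w)
    simp only [LinearEquiv.ofBijective_apply, F, blk_apply, ← hc]
    rw [show v = (v.1, v.2) from rfl, he2]
    rfl

theorem pow_shiftEnd_single (l : ℕ) :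
    (shiftEnd k (l + 1) ^ l) (Pi.single (Fin.last l) 1) ≠ 0 := by
  intro h
  have h2 : (0 : Fin (l + 1)).1 + l < l + 1 := by simp
  have h1 := congrFun h 0
  rw [shiftEnd_pow_apply, dif_pos h2] at h1
  have h3 : (⟨_, h2⟩ : Fin (l + 1)) = Fin.last l := Fin.ext (by simp)
  rw [h3, Pi.single_eq_same] at h1
  exact one_ne_zero h1

theorem pow_rep_nilCls {t : List ℕ} {l : ℕ} (h : ∀ a ∈ t, a ≤ l) : (nilCls k t).rep.2 ^ l = 0 := by
  rw [← rk_eq_zero_iff, EndClass.cls_rep, rk_nilCls, List.sum_eq_zero_iff]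
  intro x hx
  obtain ⟨a, ha, rfl⟩ := List.mem_map.1 hx
  exact Nat.sub_eq_zero_of_le (h a ha)

theorem finrank_rep (ν : EndClass k) : finrank k (Fin ν.rep.1 → k) = ν.dim := by
  rw [← dim_cls ν.rep.2, EndClass.cls_rep]

theorem cent_nilCls_cons {l : ℕ} {t : List ℕ} (h : ∀ a ∈ t, a ≤ l + 1) :
    ∃ c, cent (nilCls k ((l + 1) :: t)) = c * (Nat.card k ^ t.sum * cent (nilCls k t)) ∧
      c + Nat.card k ^ (l + 1 + t.sum - (((l + 1) :: t).map (· - l)).sum) =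
        Nat.card k ^ (l + 1 + t.sum) := by
  have hM := pow_rep_nilCls (k := k) h
  have h0 : blk (shiftEnd k (l + 1)) 0 (nilCls k t).rep.2 ^ (l + 1) = 0 := by
    rw [blk_zero_pow, hM, shiftEnd_pow_self]
    exact LinearMap.ext fun v => by simp
  have hy : (blk (shiftEnd k (l + 1)) 0 (nilCls k t).rep.2 ^ l) (Pi.single (Fin.last l) 1, 0) ≠ 0 := by
    rw [blk_zero_pow]
    exact fun h => pow_shiftEnd_single l (by simpa using congrArg Prod.fst h)
  have h1 := card_pow_apply_ne_zero (blk (shiftEnd k (l + 1)) 0 (nilCls k t).rep.2) l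
  rw [finrank_prod, finrank_fin_fun, finrank_rep, dim_nilCls] at h1
  refine ⟨_, ?_, by rw [← rk_nilCls (k := k)]; exact h1⟩
  rw [nilCls, cent_eq_card_mul_card_fix h0 hy, card_fix_blk_shift hM, finrank_rep, dim_nilCls,
    EndClass.cls_rep]

/-- The exponent of `q` in the order of the centralizer of a nilpotent class. -/
def centVal : List ℕ → ℕ
  | [] => 0
  | l :: t => (l + t.sum - ((l :: t).map (· - (l - 1))).sum) + t.sum + centVal t

theorem padicValNat_cent_nilCls {p e : ℕ} (hp : p.Prime) (he : 0 < e) (hk : Nat.card k = p ^ e) :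
    ∀ t : List ℕ, t.Pairwise (· ≥ ·) → (∀ a ∈ t, 0 < a) →
      padicValNat p (cent (nilCls k t)) = e * centVal t := by
  have := Fact.mk hp
  intro t
  induction t with
  | nil =>
    intro _ _
    have : cent (nilCls k []) = 1 := by
      rw [nilCls, cent_cls, Nat.card_eq_one_iff_unique]
      refine ⟨⟨fun a b => Subtype.ext (LinearEquiv.ext fun v => Subsingleton.elim _ _)⟩,
        ⟨LinearEquiv.refl _ _, fun v => rfl⟩⟩
    simp [this, centVal]
  | cons a t ih =>
    intro h1 h2
    rw [List.pairwise_cons] at h1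
    obtain ⟨l, rfl⟩ := Nat.exists_eq_succ_of_ne_zero (h2 a (by simp)).ne'
    obtain ⟨c, hc, hcc⟩ := cent_nilCls_cons (k := k) (l := l) (t := t) h1.1
    rw [Nat.succ_eq_add_one, hc]
    set r := (((l + 1) :: t).map (· - l)).sum with hr
    have hr1 : 1 ≤ r := by
      rw [hr, List.map_cons, List.sum_cons]
      omega
    have hr2 : r ≤ l + 1 + t.sum := by
      have : ((t.map (· - l)).sum) ≤ t.sum := by
        conv_rhs => rw [← List.map_id t]
        exact List.sum_le_sum fun i _ => Nat.sub_le _ _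
      rw [hr, List.map_cons, List.sum_cons]
      omega
    obtain ⟨s, hs⟩ := Nat.exists_eq_add_of_le hr2
    obtain ⟨r', hr'⟩ := Nat.exists_eq_add_of_le' hr1
    have hcv : c = (p ^ e) ^ s * ((p ^ e) ^ (r' + 1) - 1) := by
      rw [hs, Nat.add_sub_cancel_left, hk, pow_add, hr'] at hcc
      rw [Nat.mul_sub, mul_one, mul_comm]
      omega
    have hpe : p ^ e ≠ 0 := pow_ne_zero _ hp.ne_zero
    have hnd := padicValNat_pow_sub_one hp he r'
    have h3 : (p ^ e) ^ (r' + 1) - 1 ≠ 0 := fun h => hnd (h ▸ dvd_zero p)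
    rw [hcv, hk, padicValNat.mul (mul_ne_zero (pow_ne_zero _ hpe) h3)
      (mul_ne_zero (pow_ne_zero _ hpe) (cent_ne_zero _)), padicValNat.mul (pow_ne_zero _ hpe) h3,
      padicValNat.mul (pow_ne_zero _ hpe) (cent_ne_zero _), ih h1.2 fun a ha => h2 a (by simp [ha]),
      padicValNat.eq_zero_of_not_dvd hnd, ← pow_mul, ← pow_mul, padicValNat.prime_pow,
      padicValNat.prime_pow]
    have h4 : centVal ((l + 1) :: t) = s + t.sum + centVal t := by
      rw [centVal, Nat.add_sub_cancel, ← hr, hs, Nat.add_sub_cancel_left]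
    rw [h4]
    ring

theorem smallParts_sorted : ∀ l ∈ smallParts, l.Pairwise (· ≥ ·) ∧ ∀ a ∈ l, 0 < a := by decide

end NilpotentCentralizers

section ClassRecursion

open Module

variable {k : Type} [Field k] [Finite k] {S : Set k} {a : k} {n : ℕ}

/-- The classes of dimension `n` without eigenvalues in `S`. -/
def clSet (S : Set k) (n : ℕ) : Set (EndClass k) := {ν | ν.dim = n ∧ ∀ a ∈ S, NoEig a ν.rep.2}

instance (S : Set k) (n : ℕ) : Finite (clSet S n) :=
  Finite.of_injective (β := {ν : EndClass k // ν.dim = n}) (fun ν => ⟨ν.1, ν.2.1⟩)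
    fun _ _ h => Subtype.ext (congrArg Subtype.val h :)

noncomputable instance (S : Set k) (n : ℕ) : Fintype (clSet S n) := Fintype.ofFinite _

theorem cls_mem_clSet {V : Type} [AddCommGroup V] [Module k V] [Finite V] {x : End k V} :
    cls x ∈ clSet S n ↔ finrank k V = n ∧ ∀ a ∈ S, NoEig a x := by
  obtain ⟨e, he⟩ := EndClass.exists_rep x
  rw [clSet, Set.mem_setOf_eq, dim_cls]
  exact and_congr_right fun _ => forall₂_congr fun a _ => ⟨fun h => h.congr e.symm fun v => by
    rw [e.symm_apply_eq, he, e.apply_symm_apply], fun h => h.congr e he⟩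

/-- The class with generalized eigenvalue `a` of Jordan type `l` and complement `ν`. -/
noncomputable def joinCls (a : k) (l : List ℕ) (ν : EndClass k) : EndClass k :=
  cls (blk (a • 1 + (nilCls k l).rep.2) 0 ν.rep.2)

theorem joinCls_mem (ha : a ∉ S) {l : List ℕ} (hl : l.sum ≤ n) {ν : EndClass k}
    (hν : ν ∈ clSet (insert a S) (n - l.sum)) : joinCls a l ν ∈ clSet S n := by
  refine cls_mem_clSet.2 ⟨?_, fun b hb => noEig_blk.2 ⟨noEig_add_nilpotent
    (ne_of_mem_of_not_mem hb ha).symm (isNil_nilCls l), hν.2 b (Or.inr hb)⟩⟩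
  rw [finrank_prod, finrank_rep, finrank_rep, dim_nilCls, hν.1]
  omega

theorem joinCls_inj {l l' : List ℕ} (hl : l ∈ smallParts) (hl' : l' ∈ smallParts)
    {ν ν' : EndClass k} (hν : NoEig a ν.rep.2) (hν' : NoEig a ν'.rep.2)
    (h : joinCls a l ν = joinCls a l' ν') : l = l' ∧ ν = ν' := by
  obtain ⟨h1, h2⟩ := cls_eq_of_cls_blk_eq (show IsNilpotent (nilCls k l).rep.2 from isNil_nilCls l)
    (show IsNilpotent (nilCls k l').rep.2 from isNil_nilCls l') hν hν' h
  rw [EndClass.cls_rep, EndClass.cls_rep] at h1 h2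
  exact ⟨nilCls_injOn l hl l' hl' h1, h2⟩

theorem exists_joinCls (hn : n ≤ 5) {ν : EndClass k} (hν : ν ∈ clSet S n) (a : k) :
    ∃ l ∈ smallParts, l.sum ≤ n ∧ ∃ τ ∈ clSet (insert a S) (n - l.sum), ν = joinCls a l τ := by
  obtain ⟨U, T, N, y, hN, hy, h⟩ := exists_fitting ν.rep.2 a
  rw [EndClass.cls_rep] at h
  rw [h, cls_mem_clSet, finrank_prod] at hν
  obtain ⟨l, hl, h1, h2⟩ := IsNil.exists_nilCls ((isNil_cls N).2 hN) (by rw [dim_cls]; omega)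
  rw [dim_cls] at h1
  refine ⟨l, hl, by omega, cls y, cls_mem_clSet.2 ⟨by omega, ?_⟩, ?_⟩
  · rintro b (rfl | hb)
    · exact hy
    · exact (noEig_blk.1 (hν.2 b hb)).2
  · obtain ⟨e, he⟩ := cls_eq_iff.1 (h2.trans (EndClass.cls_rep _).symm)
    obtain ⟨f, hf⟩ := EndClass.exists_rep y
    refine h.trans ?_
    exact cls_congr (e.prodCongr f) fun v => by simp [he, hf]

theorem sum_clSet {M : Type*} [AddCommMonoid M] (ha : a ∉ S) (hn : n ≤ 5) (F : EndClass k → M) :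
    ∑ ν : clSet S n, F ν.1 = ∑ l ∈ smallParts.toFinset.filter fun l => l.sum ≤ n,
      ∑ τ : clSet (insert a S) (n - l.sum), F (joinCls a l τ.1) := by
  classical
  rw [← Finset.sum_coe_sort _ fun l => ∑ τ : clSet (insert a S) (n - l.sum), F (joinCls a l τ.1),
    ← Fintype.sum_sigma' fun (l : PartLe n) (τ : clSet (insert a S) (n - l.1.sum)) =>
      F (joinCls a l.1 τ.1)]
  symm
  have hpl : ∀ l : PartLe n, l.1 ∈ smallParts ∧ l.1.sum ≤ n := fun l =>
    (Finset.mem_filter.1 l.2).imp List.mem_toFinset.1 id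
  refine Fintype.sum_bijective (fun x => ⟨joinCls a x.1.1 x.2.1,
    joinCls_mem ha (hpl x.1).2 x.2.2⟩) ⟨?_, ?_⟩ _ _ fun _ => rfl
  · rintro ⟨⟨l, hl⟩, τ, hτ⟩ ⟨⟨l', hl'⟩, τ', hτ'⟩ h
    have h1 : joinCls a l τ = joinCls a l' τ' := congrArg Subtype.val h
    obtain ⟨rfl, rfl⟩ := joinCls_inj (hpl ⟨l, hl⟩).1 (hpl ⟨l', hl'⟩).1 (hτ.2 a (Or.inl rfl))
      (hτ'.2 a (Or.inl rfl)) h1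
    rfl
  · rintro ⟨ν, hν⟩
    obtain ⟨l, hl, hl2, τ, hτ, h⟩ := exists_joinCls hn hν a
    exact ⟨⟨⟨l, by simp [hl, hl2]⟩, τ, hτ⟩, Subtype.ext h.symm⟩

/-- The number of classes of dimension `n` without eigenvalues in `S`. -/
noncomputable def clNum (S : Set k) (n : ℕ) : ℕ := Nat.card (clSet S n)

/-- The exponent of `p` in the product of the orders of centralizers. -/
noncomputable def clVal (p : ℕ) (S : Set k) (n : ℕ) : ℕ := ∑ ν : clSet S n, padicValNat p (cent ν.1)

theorem clNum_rec (ha : a ∉ S) (hn : n ≤ 5) : clNum S n =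
    ((smallParts.filter fun l => l.sum ≤ n).map fun l => clNum (insert a S) (n - l.sum)).sum := by
  have h := sum_clSet ha hn fun _ => 1
  rw [Finset.sum_const, Finset.card_univ, ← Nat.card_eq_fintype_card, smul_eq_mul, mul_one] at h
  rw [clNum, h, sum_smallParts]
  refine congrArg List.sum (List.map_congr_left fun l _ => ?_)
  rw [Finset.sum_const, Finset.card_univ, ← Nat.card_eq_fintype_card, smul_eq_mul, mul_one, clNum]

theorem cent_smul_one_add {V : Type} [AddCommGroup V] [Module k V] [Finite V] (a : k)
    (N : End k V) : cent (cls (a • 1 + N)) = cent (cls N) := by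
  rw [cent_cls, cent_cls]
  refine Nat.card_congr (Equiv.subtypeEquivRight fun e => forall_congr' fun v => ?_)
  simp

theorem cent_joinCls (l : List ℕ) {ν : EndClass k} (hν : NoEig a ν.rep.2) :
    cent (joinCls a l ν) = cent (nilCls k l) * cent ν := by
  have hN : IsNilpotent (nilCls k l).rep.2 := isNil_nilCls l
  rw [joinCls, cent_blk_of_noHom (NoEig.noHom hN hν) (NoEig.noHom' hN hν), cent_smul_one_add, EndClass.cls_rep, EndClass.cls_rep]

theorem clVal_rec {p e : ℕ} (hp : p.Prime) (he : 0 < e) (hk : Nat.card k = p ^ e)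
    (ha : a ∉ S) (hn : n ≤ 5) : clVal p S n =
    ((smallParts.filter fun l => l.sum ≤ n).map fun l =>
      e * centVal l * clNum (insert a S) (n - l.sum) + clVal p (insert a S) (n - l.sum)).sum := by
  have := Fact.mk hp
  rw [clVal, sum_clSet ha hn fun ν => padicValNat p (cent ν), ← sum_smallParts]
  refine Finset.sum_congr rfl fun l hl => ?_
  obtain ⟨h1, h2⟩ := mem_filter_smallParts hl
  rw [clNum, Nat.card_eq_fintype_card, ← Finset.card_univ, mul_comm,
    ← smul_eq_mul, ← Finset.sum_const, clVal, ← Finset.sum_add_distrib]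
  refine Finset.sum_congr rfl fun τ _ => ?_
  rw [cent_joinCls l (τ.2.2 a (Or.inl rfl)), padicValNat.mul (cent_ne_zero _) (cent_ne_zero _),
    padicValNat_cent_nilCls hp he hk l (smallParts_sorted l h1).1 (smallParts_sorted l h1).2]

theorem card_invClass_eq_clNum (n : ℕ) :
    Nat.card {ν : EndClass k // ν.dim = n ∧ ν.det ≠ 0} = clNum ({0} : Set k) n := by
  refine Nat.card_congr (Equiv.subtypeEquivRight fun ν => and_congr_right fun _ => ?_)
  simp [noEig_zero_iff, EndClass.det]

theorem cent_regUni (n : ℕ) : cent (regUni k (n + 1)) + Nat.card k ^ n = Nat.card k ^ (n + 1) := by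
  have h1 : nilCls k [n + 1] = cls (shiftEnd k (n + 1)) :=
    (cls_blk_congr_right _ (EndClass.cls_rep _)).trans (cls_blk_of_subsingleton_right _ _ _)
  have h2 : cent (regUni k (n + 1)) = cent (nilCls k [n + 1]) := by
    have := cent_smul_one_add (1 : k) (shiftEnd k (n + 1))
    rwa [one_smul, ← h1] at this
  have h3 : cent (nilCls k []) = 1 := by
    rw [nilCls, cent_cls, Nat.card_eq_one_iff_unique]
    refine ⟨⟨fun a b => Subtype.ext (LinearEquiv.ext fun v => Subsingleton.elim _ _)⟩,
      ⟨LinearEquiv.refl _ _, fun v => rfl⟩⟩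
  obtain ⟨c, h4, h5⟩ := cent_nilCls_cons (k := k) (l := n) (t := []) (by simp)
  rw [h2, h4, h3]
  simpa using h5

end ClassRecursion

section MulRoot

open Module Polynomial

variable {k : Type} [Field k] [Finite k] {n : ℕ} {f g : k[X]}
variable {V W : Type} [AddCommGroup V] [Module k V] [AddCommGroup W] [Module k W]

theorem aeval_intertwine (e : V →ₗ[k] W) {x : End k V} {y : End k W}
    (h : ∀ v, e (x v) = y (e v)) (r : k[X]) (v : V) : e (aeval x r v) = aeval y r (e v) := by
  induction r using Polynomial.induction_on generalizing v with
  | C a => simp [algebraMap_end_apply]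
  | add p q hp hq => simp [hp, hq]
  | monomial n a ih =>
    rw [pow_succ, ← mul_assoc, map_mul _ (C a * X ^ n), map_mul _ (C a * X ^ n), aeval_X, aeval_X, Module.End.mul_apply, ih, h]
    rfl

theorem aeval_blk_eq_zero (x : End k V) (y : End k W) (r : k[X]) :
    aeval (blk x 0 y) r = 0 ↔ aeval x r = 0 ∧ aeval y r = 0 := by
  have h1 := aeval_intertwine (LinearMap.fst k V W) (x := blk x 0 y) (y := x) (by simp) r
  have h2 := aeval_intertwine (LinearMap.snd k V W) (x := blk x 0 y) (y := y) (by simp) r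
  refine ⟨fun h => ⟨LinearMap.ext fun v => ?_, LinearMap.ext fun v => ?_⟩, fun h =>
    LinearMap.ext fun v => Prod.ext ?_ ?_⟩
  · simpa [h] using (h1 (v, 0)).symm
  · simpa [h] using (h2 (0, v)).symm
  · simpa [h.1] using h1 v
  · simpa [h.2] using h2 v

theorem aeval_eq_zero_of_cls_eq [Module.Finite k V] [Module.Finite k W] {x : End k V}
    {y : End k W} (h : cls x = cls y) {r : k[X]} (hr : aeval x r = 0) : aeval y r = 0 := by
  obtain ⟨e, he⟩ := cls_eq_iff.1 h
  refine LinearMap.ext fun w => ?_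
  have := aeval_intertwine e.toLinearMap he r (e.symm w)
  simpa [hr] using this.symm

theorem finite_adjoinRoot (hf : f.Monic) : Finite (AdjoinRoot f) := by
  have := hf.finite_adjoinRoot
  exact Module.finite_of_finite k

theorem finrank_adjoinRoot (hf : f.Monic) : finrank k (AdjoinRoot f) = f.natDegree :=
  (AdjoinRoot.powerBasis' hf).finrank

/-- Multiplication by the root. -/
noncomputable def mulRoot (f : k[X]) : End k (AdjoinRoot f) :=
  Algebra.lmul k (AdjoinRoot f) (AdjoinRoot.root f)

theorem mulRoot_apply (u : AdjoinRoot f) : mulRoot f u = AdjoinRoot.root f * u := rfl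

theorem aeval_mulRoot (r : k[X]) (u : AdjoinRoot f) :
    aeval (mulRoot f) r u = AdjoinRoot.mk f r * u := by
  rw [mulRoot, aeval_algHom_apply, AdjoinRoot.aeval_eq]
  rfl

theorem aeval_mulRoot_eq_zero {r : k[X]} : aeval (mulRoot f) r = 0 ↔ f ∣ r := by
  rw [← AdjoinRoot.mk_eq_zero]
  refine ⟨fun h => by simpa [h] using (aeval_mulRoot (f := f) r 1).symm, fun h =>
    LinearMap.ext fun u => by rw [aeval_mulRoot, h, zero_mul]; rfl⟩

theorem noEig_mulRoot {a : k} (h0 : f ≠ 0) : NoEig a (mulRoot f) ↔ ¬ f.IsRoot a := by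
  have h1 : ∀ r : k[X], mulRoot f (AdjoinRoot.mk f r) - a • AdjoinRoot.mk f r =
      AdjoinRoot.mk f ((X - C a) * r) := fun r => by
    rw [mulRoot_apply, map_mul, map_sub, AdjoinRoot.mk_X, AdjoinRoot.mk_C, sub_mul, Algebra.smul_def]
    rfl
  constructor
  · intro h ha
    obtain ⟨r, hr⟩ := dvd_iff_isRoot.2 ha
    have h2 := h (AdjoinRoot.mk f r) (sub_eq_zero.1 (by rw [h1, ← hr, AdjoinRoot.mk_self]))
    obtain ⟨c, hc⟩ := AdjoinRoot.mk_eq_zero.1 h2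
    have hr0 : r ≠ 0 := fun h => h0 (by rw [hr, h, mul_zero])
    refine not_isUnit_X_sub_C a (IsUnit.of_mul_eq_one c (mul_right_cancel₀ hr0 ?_))
    rw [one_mul]
    calc _ = f * c := by rw [hr]; ring
      _ = r := hc.symm
  · intro h v hv
    obtain ⟨r, rfl⟩ := AdjoinRoot.mk_surjective v
    have h2 : f ∣ (X - C a) * r := by rw [← AdjoinRoot.mk_eq_zero, ← h1, hv, sub_self]
    rw [AdjoinRoot.mk_eq_zero]
    refine (IsCoprime.symm ?_).dvd_of_dvd_mul_left h2
    exact ((irreducible_X_sub_C a).coprime_iff_not_dvd).2 fun h3 => h (dvd_iff_isRoot.1 h3)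

theorem cent_mulRoot [Finite (AdjoinRoot f)] :
    cent (cls (mulRoot f)) = Nat.card (AdjoinRoot f)ˣ := by
  rw [cent_cls]
  have hc : ∀ e : AdjoinRoot f ≃ₗ[k] AdjoinRoot f, (∀ v, e (mulRoot f v) = mulRoot f (e v)) →
      ∀ u v, e (u * v) = u * e v := fun e he u v => by
    obtain ⟨r, rfl⟩ := AdjoinRoot.mk_surjective u
    rw [← aeval_mulRoot, ← aeval_mulRoot]
    exact aeval_intertwine e.toLinearMap he r v
  symm
  refine Nat.card_eq_of_bijective (fun u => ⟨LinearEquiv.ofLinear (Algebra.lmul k _ u.1)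
    (Algebra.lmul k _ (u⁻¹).1) (LinearMap.ext fun v => by simp) (LinearMap.ext fun v => by simp),
    fun v => by simp [mulRoot_apply, mul_left_comm]⟩) ⟨fun u w h => ?_, fun ⟨e, he⟩ => ?_⟩
  · have := LinearEquiv.congr_fun (congrArg Subtype.val h) 1
    exact Units.ext (by simpa using this)
  · have h1 : e.symm 1 * e 1 = 1 := by rw [← hc e he, mul_one, e.apply_symm_apply]
    refine ⟨⟨e 1, e.symm 1, by rw [mul_comm, h1], h1⟩, Subtype.ext (LinearEquiv.ext fun v => ?_)⟩
    simp [mul_comm (e 1), ← hc e he]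

theorem cent_blk_mulRoot (hf : f.Monic) (hi : Irreducible f) [Finite (AdjoinRoot f)] :
    cent (cls (blk (mulRoot f) 0 (mulRoot f))) =
      Nat.card k ^ f.natDegree * qfac (Nat.card k ^ f.natDegree) 2 := by
  have := Fact.mk hi
  have hK : Nat.card (AdjoinRoot f) = Nat.card k ^ f.natDegree := by
    rw [Module.natCard_eq_pow_finrank (K := k), finrank_adjoinRoot hf]
  have h1 : Nat.card ((AdjoinRoot f × AdjoinRoot f) ≃ₗ[AdjoinRoot f] AdjoinRoot f × AdjoinRoot f) =
      glCard (AdjoinRoot f) 2 := card_linearEquiv (by simp)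
  rw [glCard_eq, hK, Nat.choose_self, pow_one] at h1
  rw [cent_cls, ← h1]
  symm
  refine Nat.card_eq_of_bijective (fun e => ⟨e.restrictScalars k, fun v => ?_⟩)
    ⟨fun u w h => ?_, fun ⟨e, he⟩ => ?_⟩
  · have h2 : ∀ v, blk (mulRoot f) 0 (mulRoot f) v = AdjoinRoot.root f • v := fun v =>
      Prod.ext (by simp [mulRoot_apply]) (by simp [mulRoot_apply])
    rw [h2, h2]
    exact map_smul e _ _
  · exact LinearEquiv.ext fun v => LinearEquiv.congr_fun (congrArg Subtype.val h) v
  · have hc : ∀ (u : AdjoinRoot f) v, e (u • v) = u • e v := fun u v => by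
      obtain ⟨r, rfl⟩ := AdjoinRoot.mk_surjective u
      have h2 : ∀ v, aeval (blk (mulRoot f) 0 (mulRoot f)) r v = AdjoinRoot.mk f r • v := fun v =>
        Prod.ext
          ((aeval_intertwine (LinearMap.fst k _ _) (y := mulRoot f) (by simp) r v).trans
            (aeval_mulRoot _ _))
          ((aeval_intertwine (LinearMap.snd k _ _) (y := mulRoot f) (by simp) r v).trans
            (aeval_mulRoot _ _))
      rw [← h2, ← h2]
      exact aeval_intertwine e.toLinearMap he r v
    exact ⟨{ e with map_smul' := hc }, rfl⟩

end MulRoot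

section Anisotropic

open Module Polynomial

variable {k : Type} [Field k] [Finite k] {n : ℕ} {f g : k[X]}
variable {V : Type} [AddCommGroup V] [Module k V] [Finite V]

theorem cls_mulRoot_mul [Finite (AdjoinRoot f)] [Finite (AdjoinRoot g)]
    [Finite (AdjoinRoot (f * g))] (hf : f.Monic) (hg : g.Monic) (h : IsCoprime f g) :
    cls (mulRoot (f * g)) = cls (blk (mulRoot f) 0 (mulRoot g)) := by
  let φ : AdjoinRoot (f * g) →ₗ[k] AdjoinRoot f × AdjoinRoot g :=
    (AdjoinRoot.algHomOfDvd k (f * g) f (dvd_mul_right f g)).toLinearMap.prod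
      (AdjoinRoot.algHomOfDvd k (f * g) g (dvd_mul_left g f)).toLinearMap
  have h1 : ∀ r, φ (AdjoinRoot.mk _ r) = (AdjoinRoot.mk f r, AdjoinRoot.mk g r) := fun r => Prod.ext
    (by simp only [φ, LinearMap.prod_apply, Pi.prod, AlgHom.toLinearMap_apply,
      AdjoinRoot.coe_algHomOfDvd, AdjoinRoot.liftAlgHom_mk]; exact AdjoinRoot.aeval_eq r)
    (by simp only [φ, LinearMap.prod_apply, Pi.prod, AlgHom.toLinearMap_apply,
      AdjoinRoot.coe_algHomOfDvd, AdjoinRoot.liftAlgHom_mk]; exact AdjoinRoot.aeval_eq r)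
  have h2 : Function.Injective φ := by
    rw [injective_iff_map_eq_zero]
    intro u hu
    obtain ⟨r, rfl⟩ := AdjoinRoot.mk_surjective u
    rw [h1, Prod.mk_eq_zero, AdjoinRoot.mk_eq_zero, AdjoinRoot.mk_eq_zero] at hu
    exact AdjoinRoot.mk_eq_zero.2 (h.mul_dvd hu.1 hu.2)
  refine cls_congr (LinearEquiv.ofInjectiveOfFinrankEq φ h2 ?_) fun u => ?_
  · rw [finrank_prod, finrank_adjoinRoot hf, finrank_adjoinRoot hg,
      finrank_adjoinRoot (hf.mul hg), hf.natDegree_mul hg]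
  · change φ _ = blk _ _ _ (φ u)
    obtain ⟨r, rfl⟩ := AdjoinRoot.mk_surjective u
    rw [mulRoot_apply, ← AdjoinRoot.mk_X, ← map_mul, h1, h1]
    simp [mulRoot_apply]

theorem two_le_natDegree (hf : f.Monic) (h : ∀ a, ¬ f.IsRoot a) : f = 1 ∨ 2 ≤ f.natDegree := by
  by_cases h1 : f.natDegree = 0
  · exact Or.inl (Monic.natDegree_eq_zero hf |>.1 h1)
  · refine Or.inr (by_contra fun h2 => ?_)
    obtain ⟨a, ha⟩ := exists_root_of_degree_eq_one
      ((degree_eq_iff_natDegree_eq_of_pos one_pos).2 (show f.natDegree = 1 by omega))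
    exact h a ha

theorem exists_mulRoot (x : End k V) (hx : ∀ a, NoEig a x) (h5 : finrank k V ≤ 5) :
    (∃ (f : k[X]) (_ : f.Monic) (_ : Finite (AdjoinRoot f)), cls x = cls (mulRoot f)) ∨
    ∃ (f : k[X]) (_ : f.Monic) (_ : Finite (AdjoinRoot f)), finrank k V = 4 ∧
      cls x = cls (blk (mulRoot f) 0 (mulRoot f)) := by
  classical
  obtain ⟨ι, hι, f, E, hf, hE⟩ := exists_cyclic_decomposition x
  have hm : ∀ i, (f i).Monic := fun i => by
    obtain ⟨p, e, hp, -, h⟩ := hf i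
    rw [h]
    exact hp.pow e
  have hfin : ∀ i, Finite (AdjoinRoot (f i)) := fun i => finite_adjoinRoot (hm i)
  have hroot : ∀ i a, ¬ (f i).IsRoot a := fun i a => by
    rw [← noEig_mulRoot (hm i).ne_zero]
    intro u hu
    have h1 := hx a (E.symm (Pi.single i u)) (E.injective (funext fun j => by
      rw [hE, map_smul, E.apply_symm_apply, Pi.smul_apply]
      by_cases hj : j = i
      · subst hj
        rw [Pi.single_eq_same]
        exact hu
      · rw [Pi.single_eq_of_ne hj, mul_zero, smul_zero]))
    rw [E.symm_apply_eq, map_zero] at h1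
    simpa using congrFun h1 i
  have hd := fun i => two_le_natDegree (hm i) (hroot i)
  have hsum : ∑ i, (f i).natDegree = finrank k V := by
    rw [E.finrank_eq, finrank_pi_fintype]
    exact Finset.sum_congr rfl fun i _ => (finrank_adjoinRoot (hm i)).symm
  have hsub : ∀ i, f i = 1 → Subsingleton (AdjoinRoot (f i)) := fun i h =>
    finrank_zero_iff.1 ((finrank_adjoinRoot (hm i)).trans (by rw [h, natDegree_one]))
  by_cases h0 : ∀ i, f i = 1
  · have h1 := finite_adjoinRoot (monic_one (R := k))
    refine Or.inl ⟨1, monic_one, h1, ?_⟩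
    have h2 : Subsingleton (AdjoinRoot (1 : k[X])) :=
      finrank_zero_iff.1 ((finrank_adjoinRoot monic_one).trans natDegree_one)
    have h3 : finrank k V = finrank k (AdjoinRoot (1 : k[X])) := by
      rw [finrank_adjoinRoot monic_one, natDegree_one, ← hsum]
      exact Finset.sum_eq_zero fun i _ => by rw [h0, natDegree_one]
    exact cls_congr (LinearEquiv.ofFinrankEq _ _ h3) fun v => Subsingleton.elim _ _
  push Not at h0
  obtain ⟨i, hi⟩ := h0
  by_cases h1 : ∀ j, j ≠ i → f j = 1
  · refine Or.inl ⟨f i, hm i, hfin i, ?_⟩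
    refine cls_congr (E.trans (LinearEquiv.ofBijective (LinearMap.proj i) ⟨fun u v h => ?_,
      fun u => ⟨Pi.single i u, by simp⟩⟩)) fun v => hE v i
    funext j
    by_cases hj : j = i
    · exact hj ▸ h
    · have := hsub j (h1 j hj)
      exact Subsingleton.elim _ _
  push Not at h1
  obtain ⟨j, hji, hj⟩ := h1
  have h2 : ∀ l, l ≠ i → l ≠ j → f l = 1 := fun l hli hlj => by
    by_contra hl
    have h3 : ∑ m ∈ {i, j, l}, (f m).natDegree ≤ ∑ m, (f m).natDegree :=
      Finset.sum_le_sum_of_subset (Finset.subset_univ _)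
    rw [Finset.sum_insert (by simp [hji.symm, hli.symm]), Finset.sum_insert (by simp [hlj.symm]),
      Finset.sum_singleton] at h3
    have := (hd i).resolve_left hi
    have := (hd j).resolve_left hj
    have := (hd l).resolve_left hl
    omega
  have hx2 : cls x = cls (blk (mulRoot (f i)) 0 (mulRoot (f j))) := by
    refine cls_congr (E.trans (LinearEquiv.ofBijective ((LinearMap.proj i).prod (LinearMap.proj j))
      ⟨fun u v h => ?_, fun u => ⟨Pi.single i u.1 + Pi.single j u.2, Prod.ext ?_ ?_⟩⟩)) fun v => ?_
    · have h3 := congrArg Prod.fst h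
      have h4 := congrArg Prod.snd h
      funext l
      by_cases hli : l = i
      · exact hli ▸ h3
      by_cases hlj : l = j
      · exact hlj ▸ h4
      have := hsub l (h2 l hli hlj)
      exact Subsingleton.elim _ _
    · simp [hji.symm]
    · simp [hji]
    · rw [blk_apply]
      exact Prod.ext ((hE v i).trans (add_zero _).symm) (hE v j)
  by_cases hco : IsCoprime (f i) (f j)
  · have := finite_adjoinRoot ((hm i).mul (hm j))
    exact Or.inl ⟨f i * f j, (hm i).mul (hm j), this,
      hx2.trans (cls_mulRoot_mul (hm i) (hm j) hco).symm⟩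
  obtain ⟨p, a, hp, hpi, hpa⟩ := hf i
  obtain ⟨r, b, hr, hri, hrb⟩ := hf j
  have hpr : p = r := by
    by_contra hne
    refine hco ?_
    rw [hpa, hrb]
    refine IsCoprime.pow (hpi.coprime_iff_not_dvd.2 fun h => hne ?_)
    exact eq_of_monic_of_associated hp hr (hpi.associated_of_dvd hri h)
  subst hpr
  have ha : a ≠ 0 := fun h => hi (by rw [hpa, h, pow_zero])
  have hb : b ≠ 0 := fun h => hj (by rw [hrb, h, pow_zero])
  have hp2 : 2 ≤ p.natDegree := (two_le_natDegree hp fun c hc => hroot i c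
    (hc.dvd (hpa ▸ dvd_pow_self p ha))).resolve_left fun h => hpi.not_isUnit (h ▸ isUnit_one)
  have hs : a * p.natDegree + b * p.natDegree = finrank k V := by
    rw [← hsum, ← natDegree_pow, ← natDegree_pow, ← hpa, ← hrb, ← Finset.sum_pair (f := fun l => (f l).natDegree) hji.symm]
    refine Finset.sum_subset (Finset.subset_univ _) fun l _ hl => ?_
    rw [h2 l (fun h => hl (by simp [h])) (fun h => hl (by simp [h])), natDegree_one]
  have hab : a = 1 ∧ b = 1 ∧ p.natDegree = 2 := by
    have h3 : 1 * p.natDegree ≤ a * p.natDegree := Nat.mul_le_mul_right _ (by omega)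
    have h4 : 1 * p.natDegree ≤ b * p.natDegree := Nat.mul_le_mul_right _ (by omega)
    have h5 : p.natDegree = 2 := by omega
    rw [h5] at hs
    omega
  obtain ⟨rfl, rfl, hp3⟩ := hab
  refine Or.inr ⟨f i, hm i, hfin i, by omega, hx2.trans (cls_blk_congr_right _ ?_)⟩
  have key : ∀ (g h : k[X]) (_ : g = h) [Finite (AdjoinRoot g)] [Finite (AdjoinRoot h)],
      cls (mulRoot g) = cls (mulRoot h) := by
    rintro g _ rfl _ _
    rfl
  exact key _ _ (hrb.trans hpa.symm)

end Anisotropic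

section Units

open Module Polynomial

variable {k : Type} [Field k] [Finite k] {n : ℕ} {f g : k[X]}

theorem charP_of_natCard {p e : ℕ} (hp : p.Prime) (hk : Nat.card k = p ^ e) : CharP k p := by
  have := Fact.mk hp
  have := Fintype.ofFinite k
  exact charP_of_card_eq_prime_pow (by rw [← hk, Nat.card_eq_fintype_card])

theorem not_dvd_card_units {p e : ℕ} (hp : p.Prime) (hk : Nat.card k = p ^ e) (hf : Squarefree f)
    [Finite (AdjoinRoot f)] : ¬ p ∣ Nat.card (AdjoinRoot f)ˣ := by
  intro h
  have := Fact.mk hp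
  have := charP_of_natCard hp hk
  obtain ⟨u, hu⟩ := exists_prime_orderOf_dvd_card' p h
  have hne : u ≠ 1 := fun h => hp.one_lt.ne (by rw [← hu, h, orderOf_one])
  have : Nontrivial (AdjoinRoot f) := ⟨u.1, 1, fun h => hne (Units.ext h)⟩
  have : CharP (AdjoinRoot f) p :=
    charP_of_injective_algebraMap (algebraMap k (AdjoinRoot f)).injective p
  have h1 : (u.1 - 1) ^ p = 0 := by
    rw [sub_pow_char, one_pow, ← Units.val_pow_eq_pow_val, ← hu, pow_orderOf_eq_one, Units.val_one,
      sub_self]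
  obtain ⟨r, hr⟩ := AdjoinRoot.mk_surjective (u.1 - 1)
  rw [← hr, ← map_pow, AdjoinRoot.mk_eq_zero, hf.dvd_pow_iff_dvd hp.ne_zero,
    ← AdjoinRoot.mk_eq_zero, hr] at h1
  exact hne (Units.ext (sub_eq_zero.1 h1))

theorem card_units_mul_self (hg : g.Monic) (hi : Irreducible g) [Finite (AdjoinRoot g)]
    [Finite (AdjoinRoot (g * g))] :
    Nat.card (AdjoinRoot (g * g))ˣ + Nat.card k ^ g.natDegree = Nat.card k ^ (2 * g.natDegree) := by
  have h1 : Nat.card (AdjoinRoot g) = Nat.card k ^ g.natDegree := by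
    rw [Module.natCard_eq_pow_finrank (K := k), finrank_adjoinRoot hg]
  have h2 : Nat.card (AdjoinRoot (g * g)) = Nat.card k ^ (2 * g.natDegree) := by
    rw [Module.natCard_eq_pow_finrank (K := k), finrank_adjoinRoot (hg.mul hg),
      hg.natDegree_mul hg, two_mul]
  rw [← h1, ← h2, ← Nat.card_sum]
  have hs := fun u : AdjoinRoot g => AdjoinRoot.mk_surjective u
  choose s hs using hs
  have h3 : ∀ a b : k[X], AdjoinRoot.mk (g * g) (g * a) = AdjoinRoot.mk (g * g) (g * b) ↔
      AdjoinRoot.mk g a = AdjoinRoot.mk g b := fun a b => by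
    rw [AdjoinRoot.mk_eq_mk, AdjoinRoot.mk_eq_mk, ← mul_sub, mul_dvd_mul_iff_left hg.ne_zero]
  have h4 : ∀ a : k[X], ¬ IsUnit (AdjoinRoot.mk (g * g) (g * a)) := fun a h => by
    have h5 : AdjoinRoot.mk (g * g) (g * a) ^ 2 = 0 := by
      rw [← map_pow, AdjoinRoot.mk_eq_zero]
      exact ⟨a * a, by ring⟩
    have h6 := h.pow 2
    rw [h5, isUnit_zero_iff, ← map_zero (AdjoinRoot.mk (g * g)),
      ← map_one (AdjoinRoot.mk (g * g)), AdjoinRoot.mk_eq_mk] at h6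
    have h7 : g * g ∣ 1 := by simpa using h6
    exact hi.not_isUnit (isUnit_of_dvd_one ((dvd_mul_right g g).trans h7))
  refine Nat.card_eq_of_bijective (Sum.elim (fun u => u.1) fun u => AdjoinRoot.mk (g * g) (g * s u))
    ⟨?_, fun w => ?_⟩
  · rintro (u | u) (v | v) h
    · exact congrArg Sum.inl (Units.ext h)
    · exact absurd ⟨u, h⟩ (h4 (s v))
    · exact absurd ⟨v, h.symm⟩ (h4 (s u))
    · have h5 := (h3 _ _).1 h
      rw [hs, hs] at h5
      rw [h5]
  · obtain ⟨r, rfl⟩ := AdjoinRoot.mk_surjective w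
    by_cases hr : g ∣ r
    · obtain ⟨a, rfl⟩ := hr
      exact ⟨Sum.inr (AdjoinRoot.mk g a), (h3 _ _).2 (hs _)⟩
    · have h5 : IsCoprime r (g * g) :=
        (IsCoprime.mul_left (hi.coprime_iff_not_dvd.2 hr) (hi.coprime_iff_not_dvd.2 hr)).symm
      obtain ⟨a, b, hab⟩ := h5
      have h6 : AdjoinRoot.mk (g * g) r * AdjoinRoot.mk (g * g) a = 1 := by
        rw [← map_mul, ← map_one (AdjoinRoot.mk (g * g)), ← hab, AdjoinRoot.mk_eq_mk]
        exact ⟨-b, by ring⟩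
      exact ⟨Sum.inl (Units.mkOfMulEqOne _ _ h6), rfl⟩

theorem eq_mul_self_of_not_squarefree (hf : f.Monic) (hr : ∀ a, ¬ f.IsRoot a)
    (h5 : f.natDegree ≤ 5) (h : ¬ Squarefree f) :
    ∃ g : k[X], g.Monic ∧ g.natDegree = 2 ∧ (∀ a, ¬ g.IsRoot a) ∧ f = g * g := by
  classical
  rw [squarefree_iff_irreducible_sq_not_dvd_of_ne_zero hf.ne_zero] at h
  push Not at h
  obtain ⟨g, hg, hgf⟩ := h
  have ha := associated_normalize g
  set r := normalize g with hrdef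
  have hri : Irreducible r := ha.irreducible hg
  have hrm : r.Monic := monic_normalize hg.ne_zero
  obtain ⟨c, hc⟩ : r * r ∣ f := ((ha.mul_mul ha).dvd_iff_dvd_left).1 hgf
  have hcm : c.Monic := (hrm.mul hrm).of_mul_monic_left (hc ▸ hf)
  have h1 : ∀ a, ¬ r.IsRoot a := fun a h => hr a (h.dvd ((dvd_mul_right r r).trans ⟨c, hc⟩))
  have h2 : ∀ a, ¬ c.IsRoot a := fun a h => hr a (h.dvd ⟨r * r, hc.trans (mul_comm _ _)⟩)
  have h3 := (two_le_natDegree hrm h1).resolve_left fun h => hri.not_isUnit (h ▸ isUnit_one)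
  have h4 : f.natDegree = r.natDegree + r.natDegree + c.natDegree := by
    rw [hc, (hrm.mul hrm).natDegree_mul hcm, hrm.natDegree_mul hrm]
  rcases two_le_natDegree hcm h2 with h6 | h6
  · exact ⟨r, hrm, by omega, h1, by rw [hc, h6, mul_one]⟩
  · omega

theorem irreducible_of_natDegree_eq_two (hf : f.Monic) (h2 : f.natDegree = 2)
    (hr : ∀ a, ¬ f.IsRoot a) : Irreducible f :=
  irreducible_of_degree_le_three_of_not_isRoot (Finset.mem_Icc.2 ⟨by omega, by omega⟩) hr

theorem padicValNat_cent_sq {p e : ℕ} (hp : p.Prime) (he : 0 < e) (hk : Nat.card k = p ^ e)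
    (hg : g.Monic) (h2 : g.natDegree = 2) (hr : ∀ a, ¬ g.IsRoot a) [Finite (AdjoinRoot (g * g))] :
    padicValNat p (cent (cls (mulRoot (g * g)))) = 2 * e := by
  have := Fact.mk hp
  have := finite_adjoinRoot hg
  have h := card_units_mul_self hg (irreducible_of_natDegree_eq_two hg h2 hr)
  rw [cent_mulRoot]
  rw [h2, hk] at h
  have h3 : Nat.card (AdjoinRoot (g * g))ˣ = p ^ (e * 2) * ((p ^ e) ^ (1 + 1) - 1) := by
    rw [Nat.mul_sub, mul_one, ← pow_mul, ← pow_add]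
    rw [← pow_mul, ← pow_mul] at h
    rw [show e * 2 + e * (1 + 1) = e * (2 * 2) by ring]
    omega
  have h4 := padicValNat_pow_sub_one hp he 1
  rw [h3, padicValNat.mul (pow_pos hp.pos _).ne' (fun h => h4 (by rw [h]; exact dvd_zero p)),
    padicValNat.prime_pow, padicValNat.eq_zero_of_not_dvd h4, add_zero, mul_comm]

theorem padicValNat_cent_dbl {p e : ℕ} (hp : p.Prime) (he : 0 < e) (hk : Nat.card k = p ^ e)
    (hg : g.Monic) (h2 : g.natDegree = 2) (hr : ∀ a, ¬ g.IsRoot a) [Finite (AdjoinRoot g)] :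
    padicValNat p (cent (cls (blk (mulRoot g) 0 (mulRoot g)))) = 2 * e := by
  have := Fact.mk hp
  have h4 := not_dvd_qfac hp (show 0 < e * 2 by omega) 2
  rw [cent_blk_mulRoot hg (irreducible_of_natDegree_eq_two hg h2 hr), h2, hk, ← pow_mul,
    padicValNat.mul (pow_pos hp.pos _).ne' (fun h => h4 (by rw [h]; exact dvd_zero p)),
    padicValNat.prime_pow, padicValNat.eq_zero_of_not_dvd h4, add_zero, mul_comm]

end Units

section PolyCount

open Module Polynomial

variable {k : Type} [Field k] [Finite k] {n : ℕ} {S : Set k} {a : k}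

/-- The monic polynomials of degree `n` without roots in `S`. -/
def polySet (S : Set k) (n : ℕ) : Set k[X] :=
  {f | f.Monic ∧ f.natDegree = n ∧ ∀ a ∈ S, ¬ f.IsRoot a}

theorem card_monic (n : ℕ) : Nat.card {f : k[X] // f.Monic ∧ f.natDegree = n} = Nat.card k ^ n := by
  rw [Nat.card_congr ((monicEquivDegreeLT n).trans (degreeLTEquiv k n).toEquiv), Nat.card_fun,
    Nat.card_fin]

instance (n : ℕ) : Finite {f : k[X] // f.Monic ∧ f.natDegree = n} :=
  Finite.of_equiv _ ((monicEquivDegreeLT n).trans (degreeLTEquiv k n).toEquiv).symm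

instance (S : Set k) (n : ℕ) : Finite (polySet S n) :=
  Finite.of_injective (β := {f : k[X] // f.Monic ∧ f.natDegree = n})
    (fun f => ⟨f.1, f.2.1, f.2.2.1⟩) fun a b h => Subtype.ext (congrArg Subtype.val h :)

noncomputable instance (S : Set k) (n : ℕ) : Fintype (polySet S n) := Fintype.ofFinite _

instance (f : polySet S n) : Finite (AdjoinRoot f.1) := finite_adjoinRoot f.2.1

/-- The number of monic polynomials of degree `n` without roots in `S`. -/
noncomputable def polyNum (S : Set k) (n : ℕ) : ℕ := Nat.card (polySet S n)

theorem polyNum_empty (n : ℕ) : polyNum (∅ : Set k) n = Nat.card k ^ n := by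
  rw [← card_monic]
  exact Nat.card_congr (Equiv.subtypeEquivRight fun f => by simp [polySet])

theorem polyNum_insert (ha : a ∉ S) (n : ℕ) :
    polyNum (insert a S) (n + 1) + polyNum S n = polyNum S (n + 1) := by
  rw [polyNum, polyNum, ← Nat.card_sum]
  refine Nat.card_eq_of_bijective (Sum.elim
    (fun f => ⟨f.1, f.2.1, f.2.2.1, fun b hb => f.2.2.2 b (Or.inr hb)⟩)
    fun g => ⟨(X - C a) * g.1, (monic_X_sub_C a).mul g.2.1, ?_, fun b hb h => ?_⟩) ⟨?_, ?_⟩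
  · rw [(monic_X_sub_C a).natDegree_mul g.2.1, natDegree_X_sub_C, g.2.2.1, add_comm]
  · rcases root_mul.1 h with h | h
    · rw [root_X_sub_C] at h
      exact ha (h ▸ hb)
    · exact g.2.2.2 b hb h
  · rintro (f | f) (g | g) h
    · exact congrArg Sum.inl (Subtype.ext (congrArg Subtype.val h :))
    · have h1 : f.1 = (X - C a) * g.1 := congrArg Subtype.val h
      exact absurd (dvd_iff_isRoot.1 ⟨_, h1⟩) (f.2.2.2 a (Or.inl rfl))
    · have h1 : (X - C a) * f.1 = g.1 := congrArg Subtype.val h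
      exact absurd (dvd_iff_isRoot.1 ⟨_, h1.symm⟩) (g.2.2.2 a (Or.inl rfl))
    · have h1 : (X - C a) * f.1 = (X - C a) * g.1 := congrArg Subtype.val h
      exact congrArg Sum.inr (Subtype.ext (mul_left_cancel₀ (X_sub_C_ne_zero a) h1))
  · rintro ⟨f, hf, hd, hr⟩
    by_cases h : f.IsRoot a
    · obtain ⟨g, rfl⟩ := dvd_iff_isRoot.2 h
      have hg : g.Monic := (monic_X_sub_C a).of_mul_monic_left hf
      rw [(monic_X_sub_C a).natDegree_mul hg, natDegree_X_sub_C] at hd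
      exact ⟨Sum.inr ⟨g, hg, by omega, fun b hb h => hr b hb (h.dvd (dvd_mul_left _ _))⟩, rfl⟩
    · refine ⟨Sum.inl ⟨f, hf, hd, ?_⟩, rfl⟩
      rintro b (rfl | hb)
      · exact h
      · exact hr b hb

theorem polyNum_zero (S : Set k) : polyNum S 0 = 1 := by
  rw [polyNum, Nat.card_eq_one_iff_unique]
  refine ⟨⟨fun f g => Subtype.ext ?_⟩, ⟨1, monic_one, natDegree_one, by simp⟩⟩
  rw [(Monic.natDegree_eq_zero f.2.1).1 f.2.2.1, (Monic.natDegree_eq_zero g.2.1).1 g.2.2.1]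

theorem polyNum_univ_one : polyNum (Set.univ : Set k) 1 = 0 := by
  have : IsEmpty (polySet (Set.univ : Set k) 1) := ⟨fun f => by
    rcases two_le_natDegree f.2.1 (fun a => f.2.2.2 a trivial) with h | h
    · have := f.2.2.1
      rw [h, natDegree_one] at this
      omega
    · have := f.2.2.1
      omega⟩
  exact Nat.card_of_isEmpty

/-- The cyclic class with the given characteristic polynomial. -/
noncomputable def rootCls (f : polySet S n) : EndClass k := cls (mulRoot f.1)

/-- The sum of two copies of a cyclic class. -/
noncomputable def dblCls (f : polySet S n) : EndClass k :=
  cls (blk (mulRoot f.1) 0 (mulRoot f.1))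

theorem rootCls_mem (f : polySet S n) : rootCls f ∈ clSet S n :=
  cls_mem_clSet.2 ⟨(finrank_adjoinRoot f.2.1).trans f.2.2.1,
    fun a ha => (noEig_mulRoot f.2.1.ne_zero).2 (f.2.2.2 a ha)⟩

theorem dblCls_mem (f : polySet S n) : dblCls f ∈ clSet S (n + n) :=
  cls_mem_clSet.2 ⟨by rw [finrank_prod, finrank_adjoinRoot f.2.1, f.2.2.1], fun a ha =>
    noEig_blk.2 ⟨(noEig_mulRoot f.2.1.ne_zero).2 (f.2.2.2 a ha),
      (noEig_mulRoot f.2.1.ne_zero).2 (f.2.2.2 a ha)⟩⟩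

theorem rootCls_injective : Function.Injective (rootCls : polySet S n → EndClass k) := by
  intro f g h
  have h1 := aeval_mulRoot_eq_zero.1 (aeval_eq_zero_of_cls_eq h (aeval_mulRoot_eq_zero.2 dvd_rfl))
  have h2 := aeval_mulRoot_eq_zero.1
    (aeval_eq_zero_of_cls_eq h.symm (aeval_mulRoot_eq_zero.2 dvd_rfl))
  exact Subtype.ext (eq_of_monic_of_associated f.2.1 g.2.1 (associated_of_dvd_dvd h2 h1))

theorem dblCls_injective : Function.Injective (dblCls : polySet S n → EndClass k) := by
  intro f g h
  have h1 := aeval_mulRoot_eq_zero.1 ((aeval_blk_eq_zero _ _ _).1 (aeval_eq_zero_of_cls_eq h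
    ((aeval_blk_eq_zero _ _ _).2 ⟨aeval_mulRoot_eq_zero.2 dvd_rfl,
      aeval_mulRoot_eq_zero.2 dvd_rfl⟩))).1
  have h2 := aeval_mulRoot_eq_zero.1 ((aeval_blk_eq_zero _ _ _).1 (aeval_eq_zero_of_cls_eq h.symm
    ((aeval_blk_eq_zero _ _ _).2 ⟨aeval_mulRoot_eq_zero.2 dvd_rfl,
      aeval_mulRoot_eq_zero.2 dvd_rfl⟩))).1
  exact Subtype.ext (eq_of_monic_of_associated f.2.1 g.2.1 (associated_of_dvd_dvd h2 h1))

theorem rootCls_ne_dblCls (f : polySet S 4) (g : polySet S 2) : rootCls f ≠ dblCls g := by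
  intro h
  have h1 := aeval_mulRoot_eq_zero.1 (aeval_eq_zero_of_cls_eq h.symm
    ((aeval_blk_eq_zero _ _ g.1).2 ⟨aeval_mulRoot_eq_zero.2 dvd_rfl,
      aeval_mulRoot_eq_zero.2 dvd_rfl⟩))
  have h2 := natDegree_le_of_dvd h1 g.2.1.ne_zero
  rw [f.2.2.1, g.2.2.1] at h2
  omega

theorem exists_rootCls (hn : n ≤ 5) {ν : EndClass k} (hν : ν ∈ clSet Set.univ n) :
    (∃ f : polySet (Set.univ : Set k) n, ν = rootCls f) ∨
      n = 4 ∧ ∃ f : polySet (Set.univ : Set k) 2, ν = dblCls f := by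
  rw [← EndClass.cls_rep ν] at hν ⊢
  rw [cls_mem_clSet] at hν
  have hx := fun a => hν.2 a trivial
  rcases exists_mulRoot ν.rep.2 hx (by omega) with ⟨f, hf, h1, h2⟩ | ⟨f, hf, h1, h4, h2⟩
  · have h3 := cls_mem_clSet.1 (h2 ▸ cls_mem_clSet.2 hν)
    refine Or.inl ⟨⟨f, hf, (finrank_adjoinRoot hf).symm.trans h3.1, fun a ha => ?_⟩, h2⟩
    exact (noEig_mulRoot hf.ne_zero).1 (h3.2 a ha)
  · have h3 := cls_mem_clSet.1 (h2 ▸ cls_mem_clSet.2 hν)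
    have h5 := h3.1
    rw [finrank_prod, finrank_adjoinRoot hf] at h5
    refine Or.inr ⟨by omega, ⟨f, hf, by omega, fun a ha => ?_⟩, h2⟩
    exact (noEig_mulRoot hf.ne_zero).1 (noEig_blk.1 (h3.2 a ha)).1

theorem sum_clSet_univ {M : Type*} [AddCommMonoid M] (hn : n ≤ 5) (F : EndClass k → M) :
    ∑ ν : clSet (Set.univ : Set k) n, F ν.1 =
      ∑ f : polySet (Set.univ : Set k) n, F (rootCls f) +
        if n = 4 then ∑ f : polySet (Set.univ : Set k) 2, F (dblCls f) else 0 := by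
  split_ifs with h
  · subst h
    refine Eq.trans ?_ (Fintype.sum_sum_type fun f => F (Sum.elim rootCls dblCls f))
    symm
    refine Fintype.sum_bijective (Sum.elim (fun f => ⟨rootCls f, rootCls_mem f⟩)
      fun f => ⟨dblCls f, dblCls_mem f⟩) ⟨?_, ?_⟩ _ _ ?_
    · rintro (f | f) (g | g) h
      · exact congrArg Sum.inl (rootCls_injective (congrArg Subtype.val h :))
      · exact absurd (congrArg Subtype.val h :) (rootCls_ne_dblCls f g)
      · exact absurd (congrArg Subtype.val h :).symm (rootCls_ne_dblCls g f)
      · exact congrArg Sum.inr (dblCls_injective (congrArg Subtype.val h :))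
    · rintro ⟨ν, hν⟩
      rcases exists_rootCls hn hν with ⟨f, rfl⟩ | ⟨-, f, rfl⟩
      · exact ⟨Sum.inl f, rfl⟩
      · exact ⟨Sum.inr f, rfl⟩
    · rintro (f | f) <;> rfl
  · rw [add_zero]
    symm
    refine Fintype.sum_bijective
      (fun f : polySet (Set.univ : Set k) n => (⟨rootCls f, rootCls_mem f⟩ : clSet Set.univ n))
      ⟨fun f g h => rootCls_injective (congrArg Subtype.val h :), fun ⟨ν, hν⟩ => ?_⟩ _ _
      fun _ => rfl
    rcases exists_rootCls hn hν with ⟨f, rfl⟩ | ⟨h4, -⟩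
    · exact ⟨f, rfl⟩
    · exact absurd h4 h

theorem clNum_univ (hn : n ≤ 5) : clNum (Set.univ : Set k) n =
    polyNum (Set.univ : Set k) n + if n = 4 then polyNum (Set.univ : Set k) 2 else 0 := by
  have h := sum_clSet_univ (k := k) hn fun _ => 1
  simpa [clNum, polyNum, Nat.card_eq_fintype_card] using h

theorem clVal_univ {p e : ℕ} (hp : p.Prime) (he : 0 < e) (hk : Nat.card k = p ^ e) (hn : n ≤ 5) :
    clVal p (Set.univ : Set k) n = if n = 4 then 4 * e * polyNum (Set.univ : Set k) 2 else 0 := by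
  have hsq : ∀ f : polySet (Set.univ : Set k) n, Squarefree f.1 →
      padicValNat p (cent (rootCls f)) = 0 := fun f hf => by
    rw [rootCls, cent_mulRoot]
    exact padicValNat.eq_zero_of_not_dvd (not_dvd_card_units hp hk hf)
  rw [clVal, sum_clSet_univ hn fun ν => padicValNat p (cent ν)]
  split_ifs with h
  · subst h
    have h1 : ∑ f : polySet (Set.univ : Set k) 2, padicValNat p (cent (dblCls f)) =
        ∑ f : polySet (Set.univ : Set k) 2, 2 * e := Finset.sum_congr rfl fun f _ =>
      padicValNat_cent_dbl hp he hk f.2.1 f.2.2.1 fun a => f.2.2.2 a trivial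
    let φ : polySet (Set.univ : Set k) 2 → polySet (Set.univ : Set k) 4 := fun g =>
      ⟨g.1 * g.1, g.2.1.mul g.2.1, by rw [g.2.1.natDegree_mul g.2.1, g.2.2.1], fun a ha h =>
        (root_mul.1 h).elim (g.2.2.2 a ha) (g.2.2.2 a ha)⟩
    have hφ : Function.Injective φ := fun f g h => by
      have h2 : f.1 * f.1 = g.1 * g.1 := congrArg Subtype.val h
      have h3 : f.1 ∣ g.1 := (UniqueFactorizationMonoid.pow_dvd_pow_iff_dvd two_ne_zero).1 (by rw [sq, sq, h2])
      have h4 : g.1 ∣ f.1 := (UniqueFactorizationMonoid.pow_dvd_pow_iff_dvd two_ne_zero).1 (by rw [sq, sq, h2])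
      exact Subtype.ext (eq_of_monic_of_associated f.2.1 g.2.1 (associated_of_dvd_dvd h3 h4))
    have h2 : ∑ f : polySet (Set.univ : Set k) 4, padicValNat p (cent (rootCls f)) =
        ∑ f : polySet (Set.univ : Set k) 2, 2 * e := by
      rw [Fintype.sum_of_injective φ hφ (fun _ => 2 * e)
        (fun f => padicValNat p (cent (rootCls f))) (fun f hf => ?_) fun g => ?_]
      · refine hsq f (by_contra fun h => hf ?_)
        obtain ⟨g, hg, h2, h3, h4⟩ := eq_mul_self_of_not_squarefree f.2.1
          (fun a => f.2.2.2 a trivial) (by rw [f.2.2.1]; omega) h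
        exact ⟨⟨g, hg, h2, fun a _ => h3 a⟩, Subtype.ext h4.symm⟩
      · have := finite_adjoinRoot (g.2.1.mul g.2.1)
        exact (padicValNat_cent_sq hp he hk g.2.1 g.2.2.1 fun a => g.2.2.2 a trivial).symm
    rw [h1, h2, Finset.sum_const, Finset.card_univ, smul_eq_mul, polyNum,
      Nat.card_eq_fintype_card]
    ring
  · rw [add_zero]
    refine Finset.sum_eq_zero fun f _ => hsq f (by_contra fun h2 => ?_)
    obtain ⟨g, hg, h3, -, h4⟩ := eq_mul_self_of_not_squarefree f.2.1
      (fun a => f.2.2.2 a trivial) (by rw [f.2.2.1]; omega) h2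
    have h5 := f.2.2.1
    rw [h4, hg.natDegree_mul hg] at h5
    omega

end PolyCount

section Assembly

open Module

/-- The relations between the numbers of classes and the numbers of regular classes. -/
def ClassRel (N E : ℕ → ℝ) : Prop :=
  E 0 = 1 ∧ N 0 = 1 ∧ N 1 = E 1 ∧ N 2 = E 2 + E 1 ∧ N 3 = E 3 + E 1 ^ 2 + E 1 ∧
    N 4 = E 4 + E 2 + E 2 * E 1 + E 1 ^ 2 + E 1 ∧
    N 5 = E 5 + E 3 * E 1 + 2 * E 1 * E 2 + 2 * E 1 ^ 2 + E 1

/-- The relations between the valuations and the numbers of classes. -/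
def ValRel (r e t₂ t₃ t₄ t₅ y : ℝ) (N V : ℕ → ℝ) : Prop :=
  V 0 = 0 ∧ V 1 = 0 ∧ V 2 = e * r * (t₂ * N 0) ∧ V 3 = e * r * (t₂ * N 1 + t₃ * N 0) ∧
    V 4 = e * r * (t₂ * N 2 + t₃ * N 1 + t₄ * N 0) + y ∧
    V 5 = e * r * (t₂ * N 3 + t₃ * N 2 + t₄ * N 1 + t₅ * N 0) + r * y

/-- The recursion for numbers of classes. -/
def NumStep (N N' : ℕ → ℝ) : Prop :=
  ∀ n ≤ 5, N n = ((smallParts.filter fun l => l.sum ≤ n).map fun l => N' (n - l.sum)).sum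

/-- The recursion for valuations. -/
def ValStep (e : ℝ) (w : List ℕ → ℕ) (N' V V' : ℕ → ℝ) : Prop :=
  ∀ n ≤ 5, V n = ((smallParts.filter fun l => l.sum ≤ n).map fun l =>
    e * w l * N' (n - l.sum) + V' (n - l.sum)).sum

theorem NumStep.expand {N N' : ℕ → ℝ} (h : NumStep N N') :
    N 0 = N' 0 ∧ N 1 = N' 1 + N' 0 ∧ N 2 = N' 2 + N' 1 + 2 * N' 0 ∧
    N 3 = N' 3 + N' 2 + 2 * N' 1 + 3 * N' 0 ∧
    N 4 = N' 4 + N' 3 + 2 * N' 2 + 3 * N' 1 + 5 * N' 0 ∧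
    N 5 = N' 5 + N' 4 + 2 * N' 3 + 3 * N' 2 + 5 * N' 1 + 7 * N' 0 := by
  refine ⟨?_, ?_, ?_, ?_, ?_, ?_⟩ <;> rw [h _ (by norm_num)] <;> simp [smallParts] <;> ring

/-- Adding one value to the excluded set divides the generating function of regular classes by
a geometric series. -/
def UniStep (E E' : ℕ → ℝ) : Prop := E' 0 = E 0 ∧ ∀ n < 5, E' (n + 1) + E n = E (n + 1)

theorem ClassRel.up {N N' E E' : ℕ → ℝ} (h : ClassRel N' E') (hN : NumStep N N')
    (hE : UniStep E E') : ClassRel N E := by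
  obtain ⟨a0, b0, b1, b2, b3, b4, b5⟩ := h
  obtain ⟨n0, n1, n2, n3, n4, n5⟩ := hN.expand
  obtain ⟨e0, he⟩ := hE
  have e1 := he 0 (by norm_num)
  have e2 := he 1 (by norm_num)
  have e3 := he 2 (by norm_num)
  have e4 := he 3 (by norm_num)
  have e5 := he 4 (by norm_num)
  clear he hN
  norm_num at e1 e2 e3 e4 e5
  rw [a0] at e0
  rw [← e0] at e1
  rw [← e1] at e2
  rw [← e2] at e3
  rw [← e3] at e4
  rw [← e4] at e5
  refine ⟨e0.symm, n0.trans b0, ?_, ?_, ?_, ?_, ?_⟩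
  · rw [n1, b0, b1, ← e1]
  · rw [n2, b0, b1, b2, ← e2, ← e1]; ring
  · rw [n3, b0, b1, b2, b3, ← e3, ← e1]; ring
  · rw [n4, b0, b1, b2, b3, b4, ← e4, ← e2, ← e1]; ring
  · rw [n5, b0, b1, b2, b3, b4, b5, ← e5, ← e3, ← e2, ← e1]; ring

theorem ClassRel.down {N N' E E' : ℕ → ℝ} (h : ClassRel N E) (hN : NumStep N N')
    (hE : UniStep E E') : ClassRel N' E' := by
  obtain ⟨a0, b0, b1, b2, b3, b4, b5⟩ := h
  obtain ⟨n0, n1, n2, n3, n4, n5⟩ := hN.expand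
  obtain ⟨e0, he⟩ := hE
  have e1 := he 0 (by norm_num)
  have e2 := he 1 (by norm_num)
  have e3 := he 2 (by norm_num)
  have e4 := he 3 (by norm_num)
  have e5 := he 4 (by norm_num)
  clear he hN
  norm_num at e1 e2 e3 e4 e5
  rw [a0] at e0 e1
  rw [← e1] at e2
  rw [← e2] at e3
  rw [← e3] at e4
  rw [← e4] at e5
  rw [← e1] at b1
  rw [← e1, ← e2] at b2
  rw [← e1, ← e3] at b3
  rw [← e1, ← e2, ← e4] at b4
  rw [← e1, ← e2, ← e3, ← e5] at b5
  have m0 : N' 0 = 1 := n0.symm.trans b0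
  rw [m0] at n1 n2 n3 n4 n5
  have m1 : N' 1 = E' 1 := by linarith
  rw [m1] at n2 n3 n4 n5
  have m2 : N' 2 = E' 2 + E' 1 := by linarith
  rw [m2] at n3 n4 n5
  have m3 : N' 3 = E' 3 + E' 1 ^ 2 + E' 1 := by linarith
  rw [m3] at n4 n5
  have m4 : N' 4 = E' 4 + E' 2 + E' 2 * E' 1 + E' 1 ^ 2 + E' 1 := by linarith
  rw [m4] at n5
  exact ⟨e0, m0, m1, m2, m3, m4, by linarith⟩

theorem ValRel.up_cent {N N' V V' : ℕ → ℝ} {r e y : ℝ} (h : ValRel r e 2 6 14 20 y N' V')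
    (hN : NumStep N N') (hV : ValStep e centVal N' V V') :
    ValRel (r + 1) e 2 6 14 20 y N V := by
  obtain ⟨a0, a1, a2, a3, a4, a5⟩ := h
  obtain ⟨n0, n1, n2, n3, n4, n5⟩ := hN.expand
  refine ⟨?_, ?_, ?_, ?_, ?_, ?_⟩ <;> rw [hV _ (by norm_num)] <;>
    simp [smallParts, centVal] <;> simp only [*] <;> ring

theorem ValRel.up_part {N N' V V' : ℕ → ℝ} {r e y : ℝ} (h : ValRel r e 1 3 7 10 y N' V')
    (hN : NumStep N N') (hV : ValStep e partN N' V V') :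
    ValRel (r + 1) e 1 3 7 10 y N V := by
  obtain ⟨a0, a1, a2, a3, a4, a5⟩ := h
  obtain ⟨n0, n1, n2, n3, n4, n5⟩ := hN.expand
  refine ⟨?_, ?_, ?_, ?_, ?_, ?_⟩ <;> rw [hV _ (by norm_num)] <;>
    simp [smallParts, partN] <;> simp only [*] <;> ring

theorem Set.induction_insert {α : Type*} [Finite α] {P : ℕ → Set α → Prop} (h0 : P 0 ∅)
    (h : ∀ r a S, a ∉ S → P r S → P (r + 1) (insert a S)) (S : Set α) : P S.ncard S := by
  induction S, Set.toFinite S using Set.Finite.induction_on with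
  | empty => simpa
  | insert ha _ ih =>
    rw [Set.ncard_insert_of_notMem ha]
    exact h _ _ _ ha ih

theorem Set.induction_erase {α : Type*} [Finite α] {P : ℕ → Set α → Prop} (h0 : P 0 Set.univ)
    (h : ∀ r a S, a ∉ S → P r (insert a S) → P (r + 1) S) (S : Set α) : P Sᶜ.ncard S := by
  have := Set.induction_insert (P := fun r T => P r Tᶜ) (by simpa) (fun r a T ha hT => by
    refine h r a _ (by simp) ?_
    convert hT using 1
    ext x
    by_cases hx : x = a <;> simp [hx, ha]) Sᶜ
  simpa using this

variable {k : Type} [Field k] [Finite k]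

theorem clNum_step {S : Set k} {a : k} (ha : a ∉ S) :
    NumStep (fun n => clNum S n) fun n => clNum (insert a S) n := fun n hn => by
  simp only [clNum_rec ha hn, Nat.cast_list_sum, List.map_map]
  rfl

theorem chNum_step {Θ : Set (MulChar k ℂ)} {θ : MulChar k ℂ} (hθ : θ ∉ Θ) :
    NumStep (fun n => chNum Θ n) fun n => chNum (insert θ Θ) n := fun n hn => by
  simp only [chNum_rec hθ hn, Nat.cast_list_sum, List.map_map]
  rfl

theorem clVal_step {p e : ℕ} (hp : p.Prime) (he : 0 < e) (hk : Nat.card k = p ^ e)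
    {S : Set k} {a : k} (ha : a ∉ S) :
    ValStep e centVal (fun n => clNum (insert a S) n) (fun n => clVal p S n)
      fun n => clVal p (insert a S) n := fun n hn => by
  simp only [clVal_rec hp he hk ha hn, Nat.cast_list_sum, List.map_map]
  refine congrArg List.sum (List.map_congr_left fun l _ => ?_)
  simp

theorem chVal_step {p e : ℕ} (hp : p.Prime) (he : 0 < e) (hk : Nat.card k = p ^ e)
    {Θ : Set (MulChar k ℂ)} {θ : MulChar k ℂ} (hθ : θ ∉ Θ) :
    ValStep e partN (fun n => chNum (insert θ Θ) n) (fun n => chVal p Θ n)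
      fun n => chVal p (insert θ Θ) n := fun n hn => by
  simp only [chVal_rec hp he hk hθ hn, Nat.cast_list_sum, List.map_map]
  refine congrArg List.sum (List.map_congr_left fun l _ => ?_)
  simp

theorem polyNum_step {S : Set k} {a : k} (ha : a ∉ S) :
    UniStep (fun n => polyNum S n) fun n => polyNum (insert a S) n :=
  ⟨by simp [polyNum_zero], fun n _ => by
    have := polyNum_insert ha n
    dsimp only
    exact_mod_cast this⟩

theorem chUni_step {Θ : Set (MulChar k ℂ)} {θ : MulChar k ℂ} (hθ : θ ∉ Θ) :
    UniStep (chUni Θ) (chUni (insert θ Θ)) := by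
  refine ⟨by rw [chUni_rec hθ (by norm_num)]; simp [smallParts, rowParts], fun n hn => ?_⟩
  rw [chUni_rec hθ hn.le, chUni_rec hθ hn]
  interval_cases n <;> simp [smallParts, rowParts]


end Assembly

section Totals

open Module

variable {k : Type} [Field k] [Finite k]

theorem UniStep.count {α : Type*} [Finite α] {E : Set α → ℕ → ℝ}
    (h : ∀ a S, a ∉ S → UniStep (E S) (E (insert a S))) (S : Set α) :
    E S 1 = E ∅ 1 - S.ncard * E ∅ 0 ∧ 2 * E S 2 =
      2 * E ∅ 2 - 2 * S.ncard * E ∅ 1 + S.ncard * (S.ncard - 1) * E ∅ 0 ∧ E S 0 = E ∅ 0 := by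
  refine Set.induction_insert (P := fun r S => E S 1 = E ∅ 1 - r * E ∅ 0 ∧ 2 * E S 2 =
      2 * E ∅ 2 - 2 * r * E ∅ 1 + r * (r - 1) * E ∅ 0 ∧ E S 0 = E ∅ 0) ?_ ?_ S
  · simp
  · rintro r a S ha ⟨h1, h2, h3⟩
    obtain ⟨e0, he⟩ := h a S ha
    have e1 := he 0 (by norm_num)
    have e2 := he 1 (by norm_num)
    norm_num at e1 e2
    push_cast
    exact ⟨by linarith, by linear_combination 2 * e2 + h2 - 2 * h1, e0.trans h3⟩

theorem polyNum_univ_two : 2 * (polyNum (Set.univ : Set k) 2 : ℝ) = Nat.card k * (Nat.card k - 1) := by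
  have := (UniStep.count (E := fun (S : Set k) n => (polyNum S n : ℝ))
    (fun a S ha => polyNum_step ha) Set.univ).2.1
  simp only [polyNum_empty, Set.ncard_univ] at this
  rw [this]
  push_cast
  ring

theorem polyNum_singleton (n : ℕ) :
    polyNum ({0} : Set k) (n + 1) + Nat.card k ^ n = Nat.card k ^ (n + 1) := by
  have := polyNum_insert (Set.notMem_empty (0 : k)) n
  simpa [polyNum_empty] using this

theorem classRel_clNum (S : Set k) : ClassRel (fun n => clNum S n) fun n => polyNum S n := by
  refine Set.induction_erase (P := fun _ S => ClassRel (fun n => clNum S n) fun n => polyNum S n)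
    ?_ (fun r a S ha h => h.up (clNum_step ha) (polyNum_step ha)) S
  simp [ClassRel, clNum_univ, polyNum_zero, polyNum_univ_one]

theorem vIrr_empty (n : ℕ) : vIrr (∅ : Set (MulChar k ℂ)) n = Irr k n := by
  simp [vIrr]

theorem chNum_empty (n : ℕ) : chNum (∅ : Set (MulChar k ℂ)) n = clNum ({0} : Set k) n := by
  rw [chNum, vIrr_empty, card_Irr, card_invClass_eq_clNum]

theorem chUni_empty (n : ℕ) : chUni (∅ : Set (MulChar k ℂ)) n = cent (regUni k n) := by
  have h := sum_Irr_mul_conj (dim_regUni (k := k) n) (by rw [det_regUni]; exact one_ne_zero)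
  simp only [Complex.mul_conj, Complex.normSq_eq_norm_sq] at h
  have h' : (∑ χ : Irr k n, ‖χ.1 (regUni k n)‖ ^ 2 : ℝ) = cent (regUni k n) := by
    exact_mod_cast h
  rw [← h', chUni]
  exact Fintype.sum_equiv (Equiv.setCongr (vIrr_empty n)) _ _ fun _ => rfl

theorem cent_regUni_zero : cent (regUni k 0) = 1 := by
  have h := card_class_mul_cent (1 + shiftEnd k 0)
  have h1 : Nat.card ((Fin 0 → k) ≃ₗ[k] (Fin 0 → k)) = 1 := by simp
  rw [h1] at h
  exact Nat.eq_one_of_mul_eq_one_left h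

theorem cent_regUni_eq (n : ℕ) : cent (regUni k n) = polyNum ({0} : Set k) n := by
  rcases n with _ | n
  · rw [cent_regUni_zero, polyNum_zero]
  · have h1 := cent_regUni (k := k) n
    have h2 := polyNum_singleton (k := k) n
    omega

theorem classRel_chNum (Θ : Set (MulChar k ℂ)) : ClassRel (fun n => chNum Θ n) (chUni Θ) := by
  refine Set.induction_insert (P := fun _ Θ => ClassRel (fun n => chNum Θ n) (chUni Θ))
    ?_ (fun r a S ha h => h.down (chNum_step ha) (chUni_step ha)) Θ
  have : chUni (∅ : Set (MulChar k ℂ)) = fun n => (polyNum ({0} : Set k) n : ℝ) := by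
    ext n
    rw [chUni_empty, cent_regUni_eq]
  rw [this]
  simp only [chNum_empty]
  exact classRel_clNum _

theorem natCard_mulChar : Nat.card (MulChar k ℂ) + 1 = Nat.card k := by
  have := Fintype.ofFinite k
  rw [MulChar.card_eq_card_units_of_hasEnoughRootsOfUnity, Nat.card_units]
  have := two_le_card k
  omega

theorem chUni_univ : chUni (Set.univ : Set (MulChar k ℂ)) 1 = 0 ∧
    chUni (Set.univ : Set (MulChar k ℂ)) 2 = polyNum (Set.univ : Set k) 2 := by
  obtain ⟨h1, h2, -⟩ := UniStep.count (E := fun Θ : Set (MulChar k ℂ) => chUni Θ)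
    (fun a S ha => chUni_step ha) Set.univ
  have hq : (Nat.card (MulChar k ℂ) : ℝ) = Nat.card k - 1 := by
    rw [← natCard_mulChar (k := k)]
    simp
  have p1 : (polyNum ({0} : Set k) 1 : ℝ) + 1 = Nat.card k := by
    have := polyNum_singleton (k := k) 0
    norm_num at this
    exact_mod_cast this
  have p2 : (polyNum ({0} : Set k) 2 : ℝ) + Nat.card k = Nat.card k ^ 2 := by
    have := polyNum_singleton (k := k) 1
    norm_num at this
    exact_mod_cast this
  have p3 := polyNum_univ_two (k := k)
  simp only [chUni_empty, cent_regUni_eq, polyNum_zero, Set.ncard_univ, hq] at h1 h2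
  refine ⟨by rw [h1]; push_cast; linarith, ?_⟩
  push_cast at h2
  linear_combination h2 / 2 - p3 / 2 + p2 - (Nat.card k - 1 : ℝ) * p1

theorem valRel_clVal {p e : ℕ} (hp : p.Prime) (he : 0 < e) (hk : Nat.card k = p ^ e) (S : Set k) :
    ValRel Sᶜ.ncard e 2 6 14 20 (4 * e * polyNum (Set.univ : Set k) 2)
      (fun n => clNum S n) fun n => clVal p S n := by
  refine Set.induction_erase (P := fun r S => ValRel r e 2 6 14 20
      (4 * e * polyNum (Set.univ : Set k) 2) (fun n => clNum S n) fun n => clVal p S n)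
    ?_ (fun r a S ha h => ?_) S
  · simp [ValRel, clVal_univ hp he hk]
  · rw [Nat.cast_succ]
    exact h.up_cent (clNum_step ha) (clVal_step hp he hk ha)

theorem valRel_chVal {p e : ℕ} (hp : p.Prime) (he : 0 < e) (hk : Nat.card k = p ^ e)
    (Θ : Set (MulChar k ℂ)) :
    ValRel Θᶜ.ncard e 1 3 7 10 (2 * e * polyNum (Set.univ : Set k) 2)
      (fun n => chNum Θ n) fun n => chVal p Θ n := by
  refine Set.induction_erase (P := fun r Θ => ValRel r e 1 3 7 10
      (2 * e * polyNum (Set.univ : Set k) 2) (fun n => chNum Θ n) fun n => chVal p Θ n)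
    ?_ (fun r a S ha h => ?_) Θ
  · obtain ⟨h1, h2⟩ := chUni_univ (k := k)
    obtain ⟨-, -, -, n2, n3, n4, n5⟩ := classRel_chNum (Set.univ : Set (MulChar k ℂ))
    simp only [h1] at n2 n3 n4 n5
    norm_num at n2 n3 n4 n5
    have h4 : chVal p (Set.univ : Set (MulChar k ℂ)) 4 =
        2 * e * chNum (Set.univ : Set (MulChar k ℂ)) 2 :=
      chVal_four h1 n2.symm hp he hk (by rw [n4, n2])
    simp [ValRel, chVal_zero hp, chVal_one h1, chVal_two hp he hk h1 n2.symm,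
      chVal_three hp he hk h1 n3.symm, chVal_five h1 n2.symm hp he hk n3.symm n5.symm, h4, n2, h2]
  · rw [Nat.cast_succ]
    exact h.up_part (chNum_step ha) (chVal_step hp he hk ha)

/-- The number of classes, the valuation of the product of the orders of centralizers and the
valuation of the product of the degrees for `GL_5`. -/
theorem totals_five {p e : ℕ} (hp : p.Prime) (he : 0 < e) (hk : Nat.card k = p ^ e) {q : ℤ}
    (hq : q = p ^ e) :
    (clNum ({0} : Set k) 5 : ℤ) = q ^ 5 - q ^ 2 - q + 1 ∧
    (chVal p (∅ : Set (MulChar k ℂ)) 5 : ℤ) = e * ((q - 1) * (q ^ 3 + 4 * q ^ 2 + 5 * q)) ∧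
    (clVal p ({0} : Set k) 5 : ℤ) = 2 * (e * ((q - 1) * (q ^ 3 + 4 * q ^ 2 + 5 * q))) := by
  obtain ⟨-, c0, c1, c2, c3, -, c5⟩ := classRel_clNum ({0} : Set k)
  obtain ⟨-, -, -, -, -, v5⟩ := valRel_clVal hp he hk ({0} : Set k)
  obtain ⟨-, -, -, -, -, w5⟩ := valRel_chVal hp he hk (∅ : Set (MulChar k ℂ))
  have p0 := polyNum_univ_two (k := k)
  have hr : ((({0} : Set k)ᶜ.ncard : ℕ) : ℝ) = Nat.card k - 1 := by
    rw [Set.ncard_compl, Set.ncard_singleton, Nat.cast_sub Nat.card_pos]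
    simp
  have hr' : (((∅ : Set (MulChar k ℂ))ᶜ.ncard : ℕ) : ℝ) = Nat.card k - 1 := by
    rw [Set.compl_empty, Set.ncard_univ, ← natCard_mulChar (k := k)]
    simp
  have hp' : ∀ n, (polyNum ({0} : Set k) (n + 1) : ℝ) = Nat.card k ^ (n + 1) - Nat.card k ^ n :=
    fun n => by
      rw [eq_sub_iff_add_eq]
      exact_mod_cast polyNum_singleton (k := k) n
  have hQ : ((q : ℤ) : ℝ) = Nat.card k := by rw [hk, hq]; norm_cast
  rw [hr] at v5
  rw [hr'] at w5
  simp only [chNum_empty] at w5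
  have p1 := hp' 0
  have p2 := hp' 1
  have p3 := hp' 2
  have p5 := hp' 4
  norm_num at p1 p2 p3 p5
  rw [← hQ] at v5 w5 p0 p1 p2 p3 p5
  dsimp only at c0 c1 c2 c3 c5 v5 w5
  rw [p1] at c1 c2 c3 c5
  rw [p2] at c2 c5
  rw [p3] at c3 c5
  rw [p5] at c5
  rw [c0, c1, c2, c3] at v5 w5
  refine ⟨?_, ?_, ?_⟩
  · have : (clNum ({0} : Set k) 5 : ℝ) = q ^ 5 - q ^ 2 - q + 1 := by rw [c5]; ring
    exact_mod_cast this
  · have : (chVal p (∅ : Set (MulChar k ℂ)) 5 : ℝ) =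
        e * ((q - 1) * (q ^ 3 + 4 * q ^ 2 + 5 * q)) := by
      rw [w5]
      linear_combination ((q : ℝ) - 1) * e * p0
    exact_mod_cast this
  · have : (clVal p ({0} : Set k) 5 : ℝ) =
        2 * (e * ((q - 1) * (q ^ 3 + 4 * q ^ 2 + 5 * q))) := by
      rw [v5]
      linear_combination ((q : ℝ) - 1) * e * 2 * p0
    exact_mod_cast this

end Totals

section Transfer

open Module

theorem padicValNat_prod {p : ℕ} [Fact p.Prime] {ι : Type*} (s : Finset ι) {f : ι → ℕ}
    (hf : ∀ i ∈ s, f i ≠ 0) : padicValNat p (∏ i ∈ s, f i) = ∑ i ∈ s, padicValNat p (f i) := by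
  classical
  induction s using Finset.induction_on with
  | empty => simp
  | insert a s ha ih =>
    rw [Finset.prod_insert ha, Finset.sum_insert ha,
      padicValNat.mul (hf _ (Finset.mem_insert_self _ _))
        (Finset.prod_ne_zero_iff.2 fun i hi => hf i (Finset.mem_insert_of_mem hi)),
      ih fun i hi => hf i (Finset.mem_insert_of_mem hi)]

variable {k : Type} [Field k] [Finite k] {n : ℕ}

theorem mem_clSet_zero {ν : EndClass k} :
    ν ∈ clSet ({0} : Set k) n ↔ ν.dim = n ∧ ν.det ≠ 0 :=
  and_congr_right fun _ => by simp [noEig_zero_iff, EndClass.det]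

/-- Invertible matrices as linear automorphisms. -/
noncomputable def glEquiv (k : Type) [Field k] (n : ℕ) :
    GL (Fin n) k ≃* ((Fin n → k) ≃ₗ[k] (Fin n → k)) :=
  (Matrix.GeneralLinearGroup.toLin (n := Fin n) (R := k)).trans
    (LinearMap.GeneralLinearGroup.generalLinearEquiv k (Fin n → k))

/-- The class of an invertible matrix. -/
noncomputable def glCls (g : GL (Fin n) k) : EndClass k :=
  cls (glEquiv k n g : (Fin n → k) →ₗ[k] (Fin n → k))

theorem glCls_eq_iff {g h : GL (Fin n) k} : glCls g = glCls h ↔ IsConj g h := by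
  rw [glCls, glCls, cls_eq_iff, isConj_iff]
  constructor
  · rintro ⟨e, he⟩
    refine ⟨(glEquiv k n).symm e, ?_⟩
    rw [mul_inv_eq_iff_eq_mul]
    apply (glEquiv k n).injective
    rw [map_mul, map_mul, MulEquiv.apply_symm_apply]
    exact LinearEquiv.ext he
  · rintro ⟨c, hc⟩
    refine ⟨glEquiv k n c, fun v => ?_⟩
    rw [mul_inv_eq_iff_eq_mul] at hc
    have := congrArg (glEquiv k n) hc
    rw [map_mul, map_mul] at this
    exact LinearEquiv.congr_fun this v

theorem exists_glCls_eq {ν : EndClass k} (h : ν ∈ clSet ({0} : Set k) n) :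
    ∃ g : GL (Fin n) k, glCls g = ν := by
  obtain ⟨h1, h2⟩ := mem_clSet_zero.1 h
  obtain ⟨g, hg⟩ := exists_equiv_of_det_ne (V := Fin n → k) (h1.trans (finrank_fin_fun k).symm) h2
  exact ⟨(glEquiv k n).symm g, by rw [glCls, MulEquiv.apply_symm_apply, hg]⟩

theorem glCls_mem (g : GL (Fin n) k) : glCls g ∈ clSet ({0} : Set k) n :=
  mem_clSet_zero.2 ⟨by rw [glCls, dim_cls, finrank_fin_fun], det_cls_equiv_ne _⟩

/-- Conjugacy classes of the general linear group as classes of endomorphisms. -/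
noncomputable def conjToCls : ConjClasses (GL (Fin n) k) → clSet ({0} : Set k) n :=
  Quotient.lift (fun g => ⟨glCls g, glCls_mem g⟩) fun _ _ h => Subtype.ext (glCls_eq_iff.2 h)

theorem conjToCls_bijective : Function.Bijective (conjToCls (k := k) (n := n)) := by
  constructor
  · intro c d
    induction c using Quotient.inductionOn
    induction d using Quotient.inductionOn
    exact fun h => Quotient.sound (glCls_eq_iff.1 (Subtype.ext_iff.1 h))
  · rintro ⟨ν, hν⟩
    obtain ⟨g, rfl⟩ := exists_glCls_eq hν
    exact ⟨ConjClasses.mk g, rfl⟩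

theorem ncard_carrier_mul_cent (c : ConjClasses (GL (Fin n) k)) :
    c.carrier.ncard * cent (conjToCls c).1 = glCard k n := by
  induction c using Quotient.inductionOn with
  | _ g =>
  rw [glCard, ← card_class_mul_cent (glEquiv k n g : (Fin n → k) →ₗ[k] (Fin n → k)),
    ← Nat.card_coe_set_eq]
  refine congrArg₂ _ (Nat.card_eq_of_bijective (fun h : (ConjClasses.mk g).carrier =>
    ⟨(glEquiv k n h.1 : (Fin n → k) →ₗ[k] (Fin n → k)),
      glCls_eq_iff.2 (ConjClasses.mk_eq_mk_iff_isConj.1 (ConjClasses.mem_carrier_iff_mk_eq.1 h.2))⟩)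
    ⟨fun a b hab => ?_, ?_⟩) rfl
  · exact Subtype.ext ((glEquiv k n).injective (LinearEquiv.toLinearMap_injective
      (Subtype.ext_iff.1 hab)))
  · rintro ⟨y, hy⟩
    obtain ⟨e, he⟩ := cls_eq_iff.1 hy
    have hc : glEquiv k n ((glEquiv k n).symm e⁻¹ * g * (glEquiv k n).symm e) =
        e⁻¹ * glEquiv k n g * e := by
      rw [map_mul, map_mul, MulEquiv.apply_symm_apply, MulEquiv.apply_symm_apply]
    refine ⟨⟨(glEquiv k n).symm e⁻¹ * g * (glEquiv k n).symm e, ?_⟩, Subtype.ext ?_⟩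
    · refine ConjClasses.mem_carrier_iff_mk_eq.2 (ConjClasses.mk_eq_mk_iff_isConj.2 ?_)
      exact (isConj_iff.2 ⟨(glEquiv k n).symm e, by
        rw [map_inv]; group⟩)
    · refine LinearMap.ext fun v => ?_
      change glEquiv k n _ v = y v
      rw [hc]
      exact (LinearEquiv.symm_apply_eq e).2 (he v).symm

theorem finprod_irrCharDegSet :
    ∏ᶠ x ∈ irrCharDegSet (GL (Fin n) k), (x.2 : ℚ) = ∏ χ : Irr k n, (chDeg n χ.1 : ℚ) := by
  rw [← finprod_eq_prod_of_fintype,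
    finprod_set_coe_eq_finprod_mem (Irr k n) (f := fun χ => (chDeg n χ : ℚ))]
  refine (finprod_mem_eq_of_bijOn (fun χ => (fun g => χ (glCls g), chDeg n χ)) ⟨?_, ?_, ?_⟩
    fun _ _ => rfl).symm
  · intro χ hχ
    obtain ⟨V, hV, h⟩ := irrChars_comp_mulEquiv (glEquiv k n) hχ.2
    refine ⟨V, hV, h.symm, ?_⟩
    have h1 := congrFun h 1
    rw [FDRep.char_one] at h1
    have h2 : (chDeg n χ : ℂ) = finrank ℂ V := by
      rw [h1, ← chDeg_eq hχ, oneCls, Function.comp_apply, map_one]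
      rfl
    exact_mod_cast h2
  · intro χ hχ ψ hψ h
    refine eq_of_res_eq (finrank_fin_fun k) hχ.1 hψ.1 (funext fun g => ?_)
    have := congrFun (congrArg Prod.fst h) ((glEquiv k n).symm g)
    simpa [glCls, res] using this
  · rintro ⟨χ, d⟩ ⟨V, hV, h1, h2⟩
    have h3 : V.character ∈ irrChars (GL (Fin n) k) := ⟨V, hV, rfl⟩
    obtain ⟨f, hf, h⟩ := exists_mem_Irr (finrank_fin_fun k)
      (irrChars_comp_mulEquiv (glEquiv k n).symm h3)
    have h4 : (fun g => f (glCls g)) = V.character := by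
      funext g
      have := congrFun h (glEquiv k n g)
      simpa [glCls, res] using this
    refine ⟨f, hf, Prod.ext (h4.trans h1.symm) ?_⟩
    have h5 := congrFun h4 1
    rw [FDRep.char_one] at h5
    have h6 : (chDeg n f : ℂ) = finrank ℂ V := by
      rw [← h5, ← chDeg_eq hf, oneCls, glCls, map_one]
      rfl
    dsimp only at h2 ⊢
    rw [h2]
    exact_mod_cast h6

theorem padicValNat_glCard_five {p e : ℕ} [Fact p.Prime] (he : 0 < e) (hk : Nat.card k = p ^ e) :
    padicValNat p (glCard k 5) = 10 * e := by
  have hp : p.Prime := Fact.out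
  have hq : qfac (p ^ e) 5 ≠ 0 := fun h => not_dvd_qfac hp he 5 (h ▸ dvd_zero p)
  rw [glCard_eq, hk, padicValNat.mul (pow_ne_zero _ (pow_ne_zero _ hp.ne_zero)) hq,
    padicValNat.eq_zero_of_not_dvd (not_dvd_qfac hp he 5), ← pow_mul, padicValNat.prime_pow]
  simp [Nat.choose, mul_comm]

theorem finprod_ncard_carrier :
    ∏ᶠ c : ConjClasses (GL (Fin n) k), (c.carrier.ncard : ℚ) =
      ((∏ ν : clSet ({0} : Set k) n, glCard k n / cent ν.1 : ℕ) : ℚ) := by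
  have := Fintype.ofFinite (ConjClasses (GL (Fin n) k))
  rw [finprod_eq_prod_of_fintype, Nat.cast_prod]
  refine Fintype.prod_bijective conjToCls conjToCls_bijective _ _ fun c => ?_
  rw [← ncard_carrier_mul_cent c, Nat.mul_div_cancel _ (Nat.pos_of_ne_zero (cent_ne_zero _))]

theorem cent_dvd_glCard (ν : clSet ({0} : Set k) n) : cent ν.1 ∣ glCard k n := by
  obtain ⟨c, rfl⟩ := conjToCls_bijective.2 ν
  exact Dvd.intro_left _ (ncard_carrier_mul_cent c)

end Transfer

/-- For `q = p ^ e`, the `p`-adic valuation of `h(GL_5(F_q))` is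
`e (q - 1)(10q⁴ + 7q³ - 2q² - 15q - 10)`. -/
theorem valuation_harada_GL5 (p e : ℕ) (hp : p.Prime) (he : 0 < e)
    (k : Type) [Field k] [Fintype k] (hk : Fintype.card k = p ^ e) :
    groupH (GL (Fin 5) k) ≠ 0 ∧
      padicValRat p (groupH (GL (Fin 5) k)) =
        (e : ℤ) * (((p : ℤ) ^ e - 1) *
          (10 * ((p : ℤ) ^ e) ^ 4 + 7 * ((p : ℤ) ^ e) ^ 3 - 2 * ((p : ℤ) ^ e) ^ 2 -
            15 * (p : ℤ) ^ e - 10)) := by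
  have := Fact.mk hp
  rw [← Nat.card_eq_fintype_card] at hk
  have hg : glCard k 5 ≠ 0 := by exact_mod_cast glCard_ne_zero (k := k) 5
  have hW : ∀ ν : clSet ({0} : Set k) 5, glCard k 5 / cent ν.1 ≠ 0 := fun ν h => by
    have := Nat.div_mul_cancel (cent_dvd_glCard ν)
    rw [h, zero_mul] at this
    exact hg this.symm
  have hD : ∀ χ : Irr k 5, chDeg 5 χ.1 ≠ 0 := fun χ => (chDeg_pos χ.2).ne'
  have hW0 := Finset.prod_ne_zero_iff.2 fun ν (_ : ν ∈ Finset.univ) => hW ν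
  have hD0 := Finset.prod_ne_zero_iff.2 fun χ (_ : χ ∈ Finset.univ) => hD χ
  rw [groupH, finprod_irrCharDegSet, finprod_ncard_carrier, ← Nat.cast_prod]
  refine ⟨div_ne_zero (Nat.cast_ne_zero.2 hW0) (Nat.cast_ne_zero.2 hD0), ?_⟩
  rw [padicValRat.div (Nat.cast_ne_zero.2 hW0) (Nat.cast_ne_zero.2 hD0), padicValRat.of_nat,
    padicValRat.of_nat, padicValNat_prod _ fun ν _ => hW ν, padicValNat_prod _ fun χ _ => hD χ]
  obtain ⟨h1, h2, h3⟩ := totals_five hp he hk rfl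
  have h4 : ∑ χ : Irr k 5, padicValNat p (chDeg 5 χ.1) =
      chVal p (∅ : Set (MulChar k ℂ)) 5 := by
    rw [chVal]
    refine (Fintype.sum_equiv (Equiv.setCongr (vIrr_empty 5)) _ _ fun χ => ?_).symm
    exact degVal_eq (chDeg_eq ((Equiv.setCongr (vIrr_empty 5)) χ).2)
  have h5 : ∑ ν : clSet ({0} : Set k) 5, padicValNat p (glCard k 5 / cent ν.1) +
      clVal p ({0} : Set k) 5 = clNum ({0} : Set k) 5 * (10 * e) := by
    rw [clVal, ← Finset.sum_add_distrib, clNum, Nat.card_eq_fintype_card, ← Finset.card_univ,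
      ← smul_eq_mul, ← Finset.sum_const]
    refine Finset.sum_congr rfl fun ν _ => ?_
    rw [← padicValNat_glCard_five he hk, ← padicValNat.mul (hW ν) (cent_ne_zero _),
      Nat.div_mul_cancel (cent_dvd_glCard ν)]
  rw [h4, h2]
  have h6 : ((∑ ν : clSet ({0} : Set k) 5, padicValNat p (glCard k 5 / cent ν.1) : ℕ) : ℤ) =
      clNum ({0} : Set k) 5 * (10 * e) - clVal p ({0} : Set k) 5 := by
    rw [eq_sub_iff_add_eq]
    exact_mod_cast h5
  rw [h6, h1, h3]
  ring
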